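/- Assume GRH. Let Φ: ℝ → ℝ be a fixed smooth compactly supported function with support contained in (0,∞), and fix δ > 0 and ε > 0. Then there exist constants C > 0 and x₀ such that for all x ≥ x₀, all y with (log x)^{2+δ} ≤ y ≤ exp((log x)^{1/2−δ}), every positive integer q₀ all of whose prime factors are at most y, and every real γ with |γ| ≤ 1/(q₀√x) and |γ| ≤ x^{δ−1}, the following holds, where c = c(x,y) is the unique positive real solution of Σ_{p ≤ y} (log p)/(p^c − 1) = log x and Φ̌(s,λ) = ∫₀^∞ Φ(w) e(λw) w^{s−1} dw: |M(x,y;q₀,γ) − q₀^{−c}·∏_{p | q₀}(1 − (p^c−1)/(p−1))·c·Φ̌(c, γx)·Ψ(x,y)| ≤ C·(x^{3/4+ε}·q₀^{−3/4+ε} + Ψ(x,y)·q₀^{−c+ε}/((log y)·(1+|γ|x)²)). -/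

import Mathlib

noncomputable section

/-- The Generalized Riemann Hypothesis. -/
def GRH : Prop :=
  (∀ s : ℂ, 0 < s.re → s.re < 1 → riemannZeta s = 0 → s.re = 1 / 2) ∧
  (∀ (N : ℕ) [NeZero N] (χ : DirichletCharacter ℂ N) (s : ℂ),
    0 < s.re → s.re < 1 → DirichletCharacter.LFunction χ s = 0 → s.re = 1 / 2)

/-- `Ψ(x,y)`: the number of positive integers `n ≤ x` all of whose prime factors are `≤ y`. -/
def Psi (x y : ℝ) : ℕ :=
  Nat.card {n : ℕ | 0 < n ∧ (n : ℝ) ≤ x ∧ ∀ p : ℕ, p.Prime → p ∣ n → (p : ℝ) ≤ y}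

/-- The local main term `M(x,y;q,γ)`. -/
def Mterm (x y : ℝ) (Φ : ℝ → ℝ) (q : ℕ) (γ : ℝ) : ℂ :=
  ∑' n : {n : ℕ // 0 < n ∧ ∀ p : ℕ, p.Prime → p ∣ n → (p : ℝ) ≤ y},
    (((ArithmeticFunction.moebius (q / Nat.gcd q (n : ℕ)) : ℝ) /
        (Nat.totient (q / Nat.gcd q (n : ℕ)) : ℝ) : ℝ) : ℂ) *
      Complex.exp (2 * (Real.pi : ℂ) * Complex.I * ((n : ℕ) : ℂ) * (γ : ℂ)) *
      ((Φ (((n : ℕ) : ℝ) / x) : ℝ) : ℂ)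

/-- The Mellin-type transform `Φ̌(s,λ) = ∫₀^∞ Φ(w) e(λw) w^{s−1} dw` for real `s`. -/
def PhiCheck (Φ : ℝ → ℝ) (s lam : ℝ) : ℂ :=
  ∫ w in Set.Ioi (0 : ℝ), ((Φ w : ℝ) : ℂ) *
    Complex.exp (2 * (Real.pi : ℂ) * Complex.I * ((lam * w : ℝ) : ℂ)) *
    ((w ^ (s - 1) : ℝ) : ℂ)

section
open Complex

lemma norm_cpow_sub_le_of_mem_Icc {s : ℂ} (hs : 0 ≤ s.re) {n u : ℝ} (hn : 0 < n) (hu : n ≤ u) :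
    ‖(u : ℂ) ^ (-s) - (n : ℂ) ^ (-s)‖ ≤ ‖s‖ * n ^ (-s.re - 1) * (u - n) := by
  have hd : ∀ v ∈ Set.Icc n u, HasDerivWithinAt (fun v : ℝ => (v : ℂ) ^ (-s))
      (-s * (v : ℂ) ^ (-s - 1)) (Set.Icc n u) v := by
    intro v hv
    have hv0 : (v : ℂ) ∈ slitPlane := by
      rw [ofReal_mem_slitPlane]; exact lt_of_lt_of_le hn hv.1
    have := ((hasDerivAt_id (v : ℂ)).cpow_const (c := -s) hv0).comp_ofReal
    simpa using this.hasDerivWithinAt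
  have hb : ∀ v ∈ Set.Icc n u, ‖-s * (v : ℂ) ^ (-s - 1)‖ ≤ ‖s‖ * n ^ (-s.re - 1) := by
    intro v hv
    have hv0 : 0 < v := lt_of_lt_of_le hn hv.1
    rw [norm_mul, norm_neg, norm_cpow_eq_rpow_re_of_pos hv0]
    simp only [sub_re, neg_re, one_re]
    gcongr ?_ * ?_
    apply Real.rpow_le_rpow_of_nonpos hn hv.1; linarith
  have := (convex_Icc n u).norm_image_sub_le_of_norm_hasDerivWithin_le hd hb
    (Set.left_mem_Icc.2 hu) (Set.right_mem_Icc.2 hu)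
  rwa [Real.norm_of_nonneg (sub_nonneg.2 hu)] at this

/-- The telescoping correction terms in the continuation of `(s - 1) ζ(s)`. -/
def zetaTerm (n : ℕ) (s : ℂ) : ℂ :=
  (s - 1) * (((n : ℝ) + 1 : ℝ) : ℂ) ^ (-s) -
    ((((n : ℝ) + 1 : ℝ) : ℂ) ^ (1 - s) - (((n : ℝ) + 2 : ℝ) : ℂ) ^ (1 - s))

lemma norm_zetaTerm_le {s : ℂ} (hs : 0 ≤ s.re) (n : ℕ) :
    ‖zetaTerm n s‖ ≤ ‖s - 1‖ * ‖s‖ * ((n : ℝ) + 1) ^ (-s.re - 1) := by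
  set m : ℝ := (n : ℝ) + 1 with hm
  have hm0 : 0 < m := by positivity
  have hd : ∀ v ∈ Set.Icc m (m + 1), HasDerivWithinAt
      (fun v : ℝ => (s - 1) * (m : ℂ) ^ (-s) * (v : ℂ) + (v : ℂ) ^ (1 - s))
      ((s - 1) * ((m : ℂ) ^ (-s) - (v : ℂ) ^ (-s))) (Set.Icc m (m + 1)) v := by
    intro v hv
    have hv0 : (v : ℂ) ∈ slitPlane := by
      rw [ofReal_mem_slitPlane]; exact lt_of_lt_of_le hm0 hv.1
    have h1 := ((hasDerivAt_id (v : ℂ)).cpow_const (c := 1 - s) hv0).comp_ofReal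
    have h2 := ((hasDerivAt_id (v : ℂ)).const_mul ((s - 1) * (m : ℂ) ^ (-s))).comp_ofReal
    have h3 := (h2.add h1).hasDerivWithinAt (s := Set.Icc m (m + 1))
    refine h3.congr_deriv ?_
    rw [show (1 : ℂ) - s - 1 = -s by ring]
    simp only [id_eq]
    ring
  have hb : ∀ v ∈ Set.Icc m (m + 1), ‖(s - 1) * ((m : ℂ) ^ (-s) - (v : ℂ) ^ (-s))‖
      ≤ ‖s - 1‖ * (‖s‖ * m ^ (-s.re - 1)) := by
    intro v hv
    rw [norm_mul, norm_sub_rev ((m : ℂ) ^ (-s))]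
    gcongr
    refine (norm_cpow_sub_le_of_mem_Icc hs hm0 hv.1).trans ?_
    have : v - m ≤ 1 := by linarith [hv.2]
    exact mul_le_of_le_one_right (by positivity) this
  have := (convex_Icc m (m + 1)).norm_image_sub_le_of_norm_hasDerivWithin_le hd hb
    (Set.left_mem_Icc.2 (by linarith)) (Set.right_mem_Icc.2 (by linarith))
  have h2 : m + 1 = (n : ℝ) + 2 := by rw [hm]; ring
  have e : zetaTerm n s = (s - 1) * (m : ℂ) ^ (-s) * ((m + 1 : ℝ) : ℂ) + ((m + 1 : ℝ) : ℂ) ^ (1 - s)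
    - ((s - 1) * (m : ℂ) ^ (-s) * (m : ℂ) + (m : ℂ) ^ (1 - s)) := by
    rw [zetaTerm, ← hm, h2]
    have : (((n : ℝ) + 2 : ℝ) : ℂ) = (m : ℂ) + 1 := by rw [← h2]; push_cast; ring
    rw [this]; ring
  rw [e]
  refine this.trans ?_
  simp [mul_assoc]

lemma summable_zetaBound : Summable (fun n : ℕ => ((n : ℝ) + 1) ^ (-(3 / 2) : ℝ)) := by
  have := (summable_nat_add_iff 1).2 (Real.summable_nat_rpow.2 (by norm_num : (-(3/2) : ℝ) < -1))
  simpa using this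

lemma norm_zetaTerm_le_half {s : ℂ} (hs : 1 / 2 ≤ s.re) (n : ℕ) :
    ‖zetaTerm n s‖ ≤ ‖s - 1‖ * ‖s‖ * ((n : ℝ) + 1) ^ (-(3 / 2) : ℝ) := by
  refine (norm_zetaTerm_le (by linarith) n).trans ?_
  gcongr
  · linarith [n.cast_nonneg (α := ℝ)]
  · linarith

lemma differentiable_zetaTerm (n : ℕ) : Differentiable ℂ (zetaTerm n) := by
  unfold zetaTerm
  have h1 : (((n : ℝ) + 1 : ℝ) : ℂ) ≠ 0 := by
    rw [Ne, ofReal_eq_zero]; positivity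
  have h2 : (((n : ℝ) + 2 : ℝ) : ℂ) ≠ 0 := by
    rw [Ne, ofReal_eq_zero]; positivity
  intro s
  refine ((differentiableAt_id.sub_const 1).mul ?_).sub (DifferentiableAt.sub ?_ ?_)
  · exact (differentiableAt_id.neg).const_cpow (Or.inl h1)
  · exact ((differentiableAt_const 1).sub differentiableAt_id).const_cpow (Or.inl h1)
  · exact ((differentiableAt_const 1).sub differentiableAt_id).const_cpow (Or.inl h2)

lemma riemannZeta₁_eq_tsum_of_one_lt {s : ℂ} (hs : 1 < s.re) :
    riemannZeta₁ s = 1 + ∑' n, zetaTerm n s := by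
  have hs1 : s ≠ 1 := by rintro rfl; simp at hs
  have hz : HasSum (fun n : ℕ => (((n : ℝ) + 1 : ℝ) : ℂ) ^ (-s)) (riemannZeta s) := by
    rw [zeta_eq_tsum_one_div_nat_add_one_cpow hs]
    have hsum : Summable (fun n : ℕ => 1 / ((n : ℂ) + 1) ^ s) := by
      have := (summable_nat_add_iff 1).2 (Complex.summable_one_div_nat_cpow.2 hs)
      simpa using this
    convert hsum.hasSum using 2 with n
    rw [cpow_neg]; push_cast; simp
  have ht : HasSum (fun n : ℕ => (((n : ℝ) + 1 : ℝ) : ℂ) ^ (1 - s)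
      - (((n : ℝ) + 2 : ℝ) : ℂ) ^ (1 - s)) 1 := by
    have hS : Summable (fun n : ℕ => (((n : ℝ) + 1 : ℝ) : ℂ) ^ (1 - s)
      - (((n : ℝ) + 2 : ℝ) : ℂ) ^ (1 - s)) := by
      have h1 : Summable (fun n => zetaTerm n s) :=
        Summable.of_norm_bounded (summable_zetaBound.mul_left (‖s - 1‖ * ‖s‖))
          (fun n => norm_zetaTerm_le_half (by linarith) n)
      have h2 := (hz.summable.mul_left (s - 1)).sub h1
      refine h2.congr fun n => ?_
      rw [zetaTerm]; ring
    rw [hS.hasSum_iff_tendsto_nat]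
    have hsum : ∀ N : ℕ, ∑ n ∈ Finset.range N, ((((n : ℝ) + 1 : ℝ) : ℂ) ^ (1 - s)
      - (((n : ℝ) + 2 : ℝ) : ℂ) ^ (1 - s)) = 1 - (((N : ℝ) + 1 : ℝ) : ℂ) ^ (1 - s) := by
      intro N
      have := Finset.sum_range_sub' (fun n : ℕ => (((n : ℝ) + 1 : ℝ) : ℂ) ^ (1 - s)) N
      simp only [Nat.cast_zero, zero_add, ofReal_one, one_cpow] at this
      rw [← this]
      refine Finset.sum_congr rfl fun n _ => ?_
      congr 3
      push_cast; ring
    simp_rw [hsum]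
    have : Filter.Tendsto (fun N : ℕ => (((N : ℝ) + 1 : ℝ) : ℂ) ^ (1 - s)) Filter.atTop (nhds 0) := by
      rw [tendsto_zero_iff_norm_tendsto_zero]
      have h3 : ∀ N : ℕ, ‖(((N : ℝ) + 1 : ℝ) : ℂ) ^ (1 - s)‖ = ((N : ℝ) + 1) ^ (-(s.re - 1)) := by
        intro N
        rw [norm_cpow_eq_rpow_re_of_pos (by positivity)]; simp
      simp_rw [h3]
      exact (tendsto_rpow_neg_atTop (by linarith : 0 < s.re - 1)).comp
        (Filter.tendsto_atTop_add_const_right _ _ tendsto_natCast_atTop_atTop)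
    simpa using this.const_sub 1
  have h4 := (hz.mul_left (s - 1)).sub ht
  have h5 : HasSum (fun n => zetaTerm n s) ((s - 1) * riemannZeta s - 1) := h4
  rw [h5.tsum_eq, riemannZeta_eq_inv_sub_mul hs1]
  have : s - 1 ≠ 0 := sub_ne_zero.2 hs1
  field_simp
  ring

lemma riemannZeta₁_eq_tsum {s : ℂ} (hs : 1 / 2 < s.re) :
    riemannZeta₁ s = 1 + ∑' n, zetaTerm n s := by
  set R : ℝ := ‖s‖ + 4 with hR
  set U : Set ℂ := {z | 1 / 2 < z.re} ∩ Metric.ball 0 R with hU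
  have hUo : IsOpen U := (isOpen_lt continuous_const continuous_re).inter Metric.isOpen_ball
  have hUc : Convex ℝ U := (convex_halfSpace_re_gt _).inter (convex_ball _ _)
  have hd : DifferentiableOn ℂ (fun z => ∑' n, zetaTerm n z) U := by
    refine differentiableOn_tsum_of_summable_norm
      (summable_zetaBound.mul_left ((R + 1) * R)) (fun n => (differentiable_zetaTerm n).differentiableOn)
      hUo fun n w hw => ?_
    refine (norm_zetaTerm_le_half (le_of_lt hw.1) n).trans ?_
    have : ‖w‖ ≤ R := by simpa using (mem_ball_zero_iff.1 hw.2).le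
    gcongr
    refine (norm_sub_le _ _).trans ?_
    simpa using this
  have hA : AnalyticOnNhd ℂ (fun z => 1 + ∑' n, zetaTerm n z) U :=
    (hd.const_add 1).analyticOnNhd hUo
  have hB : AnalyticOnNhd ℂ riemannZeta₁ U :=
    differentiable_riemannZeta₁.differentiableOn.analyticOnNhd hUo
  have h2 : (2 : ℂ) ∈ U := by
    refine ⟨by norm_num, ?_⟩
    rw [mem_ball_zero_iff]; simp; rw [hR]; linarith [norm_nonneg s]
  have hev : riemannZeta₁ =ᶠ[nhds 2] (fun z => 1 + ∑' n, zetaTerm n z) := by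
    have : {z : ℂ | 1 < z.re} ∈ nhds (2 : ℂ) :=
      (isOpen_lt continuous_const continuous_re).mem_nhds (by norm_num)
    filter_upwards [this] with z hz using riemannZeta₁_eq_tsum_of_one_lt hz
  exact hB.eqOn_of_preconnected_of_eventuallyEq hA hUc.isPreconnected h2 hev
    ⟨hs, by rw [mem_ball_zero_iff]; linarith⟩

lemma norm_riemannZeta₁_le : ∃ C > 0, ∀ s : ℂ, 1 / 2 < s.re →
    ‖riemannZeta₁ s‖ ≤ C * (‖s‖ + 1) ^ 2 := by
  refine ⟨1 + ∑' n : ℕ, ((n : ℝ) + 1) ^ (-(3 / 2) : ℝ), ?_, fun s hs => ?_⟩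
  · have : 0 ≤ ∑' n : ℕ, ((n : ℝ) + 1) ^ (-(3 / 2) : ℝ) := tsum_nonneg fun n => by positivity
    linarith
  rw [riemannZeta₁_eq_tsum hs]
  have h1 : ‖∑' n, zetaTerm n s‖ ≤ ‖s - 1‖ * ‖s‖ * ∑' n : ℕ, ((n : ℝ) + 1) ^ (-(3 / 2) : ℝ) := by
    rw [← tsum_mul_left]
    exact tsum_of_norm_bounded (summable_zetaBound.mul_left _).hasSum
      (fun n => norm_zetaTerm_le_half hs.le n)
  set S := ∑' n : ℕ, ((n : ℝ) + 1) ^ (-(3 / 2) : ℝ)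
  have hS : 0 ≤ S := tsum_nonneg fun n => by positivity
  have h2 : ‖s - 1‖ ≤ ‖s‖ + 1 := by simpa using norm_sub_le s 1
  have h3 : ‖s - 1‖ * ‖s‖ ≤ (‖s‖ + 1) ^ 2 := by
    rw [sq]; gcongr; linarith
  have h4 : 1 ≤ (‖s‖ + 1) ^ 2 := by nlinarith [norm_nonneg s]
  calc ‖1 + ∑' n, zetaTerm n s‖ ≤ ‖(1 : ℂ)‖ + ‖∑' n, zetaTerm n s‖ := norm_add_le _ _
    _ ≤ 1 + (‖s‖ + 1) ^ 2 * S := by rw [norm_one]; gcongr; exact h1.trans (by gcongr)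
    _ ≤ _ := by nlinarith

lemma norm_logDeriv_le_of_ball {Z : ℂ → ℂ} {c : ℂ} {R r M : ℝ} (hr : 0 < r) (hrR : r < R) (hM : 0 < M)
    (hZ : DifferentiableOn ℂ Z (Metric.ball c R)) (hne : ∀ z ∈ Metric.ball c R, Z z ≠ 0)
    (hb : ∀ z ∈ Metric.ball c R, ‖Z z‖ ≤ Real.exp M * ‖Z c‖) {z : ℂ} (hz : ‖z - c‖ ≤ r) :
    ‖deriv Z z / Z z‖ ≤ 8 * M * R / (R - r) ^ 2 := by
  have hR : 0 < R := hr.trans hrR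
  have hD : DifferentiableOn ℂ (fun z => deriv Z z / Z z) (Metric.ball c R) :=
    (hZ.deriv Metric.isOpen_ball).div hZ hne
  obtain ⟨g₀, hg₀⟩ := hD.isExactOn_ball
  set g : ℂ → ℂ := fun z => g₀ z - g₀ c with hg
  have hg' : ∀ z ∈ Metric.ball c R, HasDerivAt g (deriv Z z / Z z) z := fun z hz =>
    (hg₀ z hz).sub_const _
  have hc : c ∈ Metric.ball c R := Metric.mem_ball_self hR
  have hconst : ∀ z ∈ Metric.ball c R, Z z = Z c * exp (g z) := by
    intro z hz
    have hd : ∀ w ∈ Metric.ball c R, HasDerivAt (fun w => Z w * exp (-g w)) 0 w := by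
      intro w hw
      have h1 := (hZ.differentiableAt (Metric.isOpen_ball.mem_nhds hw)).hasDerivAt
      have h2 := h1.mul (hg' w hw).neg.cexp
      refine h2.congr_deriv ?_
      have := hne w hw
      field_simp
      ring
    have h3 : Z z * exp (-g z) = Z c * exp (-g c) := by
      refine IsOpen.is_const_of_deriv_eq_zero Metric.isOpen_ball (convex_ball c R).isPreconnected
        (fun w hw => (hd w hw).differentiableAt.differentiableWithinAt)
        (fun w hw => (hd w hw).deriv) hz hc
    have h4 : g c = 0 := by simp [hg]
    rw [h4, neg_zero, exp_zero, mul_one, exp_neg] at h3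
    rw [← h3]
    field_simp [exp_ne_zero]
  have hre : ∀ z ∈ Metric.ball c R, (g z).re ≤ M := by
    intro z hz
    have h1 := hb z hz
    rw [hconst z hz, norm_mul, norm_exp, mul_comm] at h1
    have h2 : 0 < ‖Z c‖ := norm_pos_iff.2 (hne c hc)
    have h3 := le_of_mul_le_mul_right h1 h2
    exact Real.exp_le_exp.1 h3
  set ρ : ℝ := (R - r) / 2 with hρ
  have hρ0 : 0 < ρ := by rw [hρ]; linarith
  have hbc : ∀ w : ℂ, ‖w - c‖ ≤ r + ρ → ‖g w‖ ≤ 2 * M * R / ρ := by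
    intro w hw
    have hwR : ‖w - c‖ < R := by rw [hρ] at hw; linarith
    have := borelCaratheodory_zero (f := fun u => g (c + u)) (z := w - c) hM ?_ ?_ hR
      (mem_ball_zero_iff.2 hwR) (by simp [hg])
    · rw [add_sub_cancel] at this
      refine this.trans ?_
      gcongr
      linarith
    · intro u hu
      have : c + u ∈ Metric.ball c R := by
        rw [mem_ball_iff_norm]; simpa using hu
      have h := (hg' _ this).differentiableAt
      exact (h.comp u (differentiableAt_id.const_add c)).differentiableWithinAt
    · intro u hu
      have : c + u ∈ Metric.ball c R := by
        rw [mem_ball_iff_norm]; simpa using hu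
      exact hre _ this
  have hzR : z ∈ Metric.ball c R := by rw [mem_ball_iff_norm]; linarith
  rw [← (hg' z hzR).deriv]
  have hsub : Metric.closedBall z ρ ⊆ Metric.ball c R := by
    intro w hw
    rw [mem_closedBall_iff_norm] at hw
    rw [mem_ball_iff_norm]
    have : ‖w - c‖ ≤ ‖w - z‖ + ‖z - c‖ := norm_sub_le_norm_sub_add_norm_sub w z c
    rw [hρ] at hw; linarith
  have hgd : DifferentiableOn ℂ g (Metric.ball c R) := fun w hw =>
    (hg' w hw).differentiableAt.differentiableWithinAt
  refine (norm_deriv_le_of_forall_mem_sphere_norm_le hρ0 ?_ (C := 2 * M * R / ρ) ?_).trans ?_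
  · exact (hgd.mono hsub).diffContOnCl_ball subset_rfl
  · intro w hw
    apply hbc
    have h1 : ‖w - z‖ = ρ := by simpa [mem_sphere_iff_norm] using hw
    have : ‖w - c‖ ≤ ‖w - z‖ + ‖z - c‖ := norm_sub_le_norm_sub_add_norm_sub w z c
    linarith
  · have : R - r = 2 * ρ := by rw [hρ]; ring
    rw [this]
    apply le_of_eq
    field_simp
    ring

/-- The Riemann hypothesis for `ζ`, as it appears in `GRH`. -/
def RHzeta : Prop := ∀ s : ℂ, 0 < s.re → s.re < 1 → riemannZeta s = 0 → s.re = 1 / 2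

lemma riemannZeta₁_ne_zero (h : RHzeta) {s : ℂ} (hs : 1 / 2 < s.re) : riemannZeta₁ s ≠ 0 := by
  rcases eq_or_ne s 1 with rfl | h1
  · simp
  intro h0
  have hz : riemannZeta s = 0 := by
    rw [riemannZeta_eq_inv_sub_mul h1, h0, mul_zero]
  rcases lt_or_ge s.re 1 with h2 | h2
  · have := h s (by linarith) h2 hz; linarith
  · exact riemannZeta_ne_zero_of_one_le_re h2 hz

lemma norm_riemannZeta₁_two_add (t : ℝ) : 1 / 4 ≤ ‖riemannZeta₁ (2 + t * I)‖ := by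
  set s : ℂ := 2 + t * I with hs
  have hre : s.re = 2 := by simp [hs]
  have h1 : s ≠ 1 := by intro h; rw [h] at hre; norm_num at hre
  have e : riemannZeta₁ s = (s - 1) * riemannZeta s := by
    rw [riemannZeta_eq_inv_sub_mul h1]
    have : s - 1 ≠ 0 := sub_ne_zero.2 h1
    field_simp
  have hn : 1 ≤ ‖s - 1‖ := by
    have := abs_re_le_norm (s - 1)
    rw [sub_re, hre, one_re] at this
    norm_num at this
    exact this
  have hz : 1 / 4 ≤ ‖riemannZeta s‖ := by
    have hsum : Summable (fun n : ℕ => 1 / (n : ℂ) ^ s) :=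
      Complex.summable_one_div_nat_cpow.2 (by rw [hre]; norm_num)
    have h2 : ∀ n : ℕ, ‖1 / ((n + 2 : ℕ) : ℂ) ^ s‖ = 1 / ((n + 2 : ℕ) : ℝ) ^ 2 := by
      intro n
      rw [norm_div, norm_one, norm_natCast_cpow_of_pos (by omega), hre]
      norm_cast
    have hz2 := hasSum_zeta_two
    have h3 : HasSum (fun n : ℕ => 1 / ((n + 2 : ℕ) : ℝ) ^ 2) (Real.pi ^ 2 / 6 - 1) := by
      have := (hasSum_nat_add_iff' 2).2 hz2
      simpa [Finset.sum_range_succ] using this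
    have h4 : ‖∑' n : ℕ, 1 / ((n + 2 : ℕ) : ℂ) ^ s‖ ≤ Real.pi ^ 2 / 6 - 1 :=
      tsum_of_norm_bounded h3 fun n => (h2 n).le
    have h5 : riemannZeta s = 1 + ∑' n : ℕ, 1 / ((n + 2 : ℕ) : ℂ) ^ s := by
      rw [zeta_eq_tsum_one_div_nat_cpow (by rw [hre]; norm_num), ← hsum.sum_add_tsum_nat_add 2]
      have : s ≠ 0 := by intro h; rw [h] at hre; norm_num at hre
      simp [Finset.sum_range_succ, zero_cpow this]
    have h6 : ‖(1 : ℂ)‖ ≤ ‖riemannZeta s‖ + ‖∑' n : ℕ, 1 / ((n + 2 : ℕ) : ℂ) ^ s‖ := by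
      have := norm_sub_le (riemannZeta s) (∑' n : ℕ, 1 / ((n + 2 : ℕ) : ℂ) ^ s)
      rwa [h5, add_sub_cancel_right, ← h5] at this
    rw [norm_one] at h6
    have hpi : Real.pi ^ 2 < 10 := by nlinarith [Real.pi_lt_d2, Real.pi_pos]
    linarith
  rw [e, norm_mul]
  nlinarith [norm_nonneg (riemannZeta s)]

/-- `-ζ'/ζ(s) - 1/(s-1)`, regular at `s = 1`. -/
def zetaReg (s : ℂ) : ℂ := -(deriv riemannZeta₁ s / riemannZeta₁ s)

lemma differentiableAt_zetaReg (h : RHzeta) {s : ℂ} (hs : 1 / 2 < s.re) :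
    DifferentiableAt ℂ zetaReg s := by
  have hd := differentiable_riemannZeta₁
  have h2 : Differentiable ℂ (deriv riemannZeta₁) := by
    have := (hd.differentiableOn (s := Set.univ)).deriv isOpen_univ
    exact differentiableOn_univ.1 this
  exact ((h2 s).div (hd s) (riemannZeta₁_ne_zero h hs)).neg

lemma norm_zetaReg_le (h : RHzeta) {ε : ℝ} (hε : 0 < ε) : ∃ C > 0, ∀ s : ℂ, 1 / 2 + ε ≤ s.re →
    s.re ≤ 2 → ‖zetaReg s‖ ≤ C * Real.log (2 + |s.im|) := by
  wlog hε1 : ε ≤ 1 generalizing ε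
  · obtain ⟨C, hC, hb⟩ := this one_pos le_rfl
    exact ⟨C, hC, fun s h1 h2 => hb s (by linarith) h2⟩
  obtain ⟨C₁, hC₁, hZ⟩ := norm_riemannZeta₁_le
  set A : ℝ := 2 + (|Real.log (4 * C₁)| + 2 * Real.log 6) / Real.log 2 with hA
  have hl2 : 0 < Real.log 2 := Real.log_pos one_lt_two
  have hl6 : 0 < Real.log 6 := Real.log_pos (by norm_num)
  have hA0 : 0 < A := by positivity
  set R : ℝ := 3 / 2 - ε / 2
  set r : ℝ := 3 / 2 - ε
  refine ⟨8 * A * R / (R - r) ^ 2, ?_, fun s hs1 hs2 => ?_⟩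
  · have : 0 < R := by simp only [R]; linarith
    have : 0 < R - r := by simp only [R, r]; linarith
    positivity
  set t := s.im
  have hlt : Real.log 2 ≤ Real.log (2 + |t|) :=
    Real.log_le_log two_pos (by linarith [abs_nonneg t])
  have hlt0 : 0 < Real.log (2 + |t|) := hl2.trans_le hlt
  set M : ℝ := A * Real.log (2 + |t|) with hM
  have key := norm_logDeriv_le_of_ball (Z := riemannZeta₁) (c := 2 + t * I) (R := R) (r := r) (M := M)
    (z := s) (by simp only [r]; linarith) (by simp only [r, R]; linarith) (by positivity)
    differentiable_riemannZeta₁.differentiableOn ?_ ?_ ?_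
  · rw [zetaReg, norm_neg]
    refine key.trans (le_of_eq ?_)
    rw [hM]; ring
  · intro z hz
    apply riemannZeta₁_ne_zero h
    have h1 := (abs_re_le_norm (z - (2 + t * I))).trans_lt (mem_ball_iff_norm.1 hz)
    simp [abs_lt] at h1
    simp only [R] at h1; linarith [h1.1]
  · intro z hz
    have hzn := mem_ball_iff_norm.1 hz
    have h1 := (abs_re_le_norm (z - (2 + t * I))).trans_lt hzn
    simp [abs_lt] at h1
    have h2 : 1 / 2 < z.re := by simp only [R] at h1; linarith [h1.1]
    have h3 : ‖z‖ + 1 ≤ 6 * (2 + |t|) := by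
      have h4 : ‖z‖ ≤ ‖z - (2 + t * I)‖ + ‖(2 : ℂ) + t * I‖ := by
        simpa using norm_add_le (z - (2 + t * I)) (2 + t * I)
      have h5 : ‖(2 : ℂ) + t * I‖ ≤ 2 + |t| := by
        refine (norm_add_le _ _).trans ?_
        simp
      simp only [R] at hzn
      linarith [abs_nonneg t]
    have h6 : ‖riemannZeta₁ z‖ ≤ C₁ * (6 * (2 + |t|)) ^ 2 := (hZ z h2).trans (by gcongr)
    have h7 : C₁ * (6 * (2 + |t|)) ^ 2 ≤ Real.exp M * (1 / 4) := by
      have h8 : 4 * C₁ * (6 * (2 + |t|)) ^ 2 ≤ Real.exp M := by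
        rw [← Real.log_le_iff_le_exp (by positivity), Real.log_mul (by positivity) (by positivity),
          Real.log_pow, Real.log_mul (x := 6) (y := 2 + |t|) (by positivity) (by positivity), hM, hA]
        push_cast
        have h9 : |Real.log (4 * C₁)| + 2 * Real.log 6 ≤
            (|Real.log (4 * C₁)| + 2 * Real.log 6) / Real.log 2 * Real.log (2 + |t|) := by
          rw [div_mul_eq_mul_div, le_div_iff₀ hl2]
          gcongr
        have := le_abs_self (Real.log (4 * C₁))
        linarith
      linarith
    refine h6.trans (h7.trans ?_)
    gcongr
    exact norm_riemannZeta₁_two_add t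
  · have : s - (2 + t * I) = ((s.re - 2 : ℝ) : ℂ) := by
      apply Complex.ext <;> simp [t]
    rw [this, norm_real, Real.norm_eq_abs, abs_of_nonpos (by linarith)]
    simp only [r]; linarith

lemma zetaReg_eq {s : ℂ} (hs : 1 < s.re) : zetaReg s =
    LSeries (fun n => (ArithmeticFunction.vonMangoldt n : ℂ)) s - 1 / (s - 1) := by
  have h1 : s ≠ 1 := by rintro rfl; simp at hs
  have h2 : s - 1 ≠ 0 := sub_ne_zero.2 h1
  have hz : riemannZeta s ≠ 0 := riemannZeta_ne_zero_of_one_le_re hs.le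
  have e : ∀ z : ℂ, z ≠ 1 → riemannZeta₁ z = (z - 1) * riemannZeta z := by
    intro z hz
    rw [riemannZeta_eq_inv_sub_mul hz]
    have : z - 1 ≠ 0 := sub_ne_zero.2 hz
    field_simp
  have ev : riemannZeta₁ =ᶠ[nhds s] fun z => (z - 1) * riemannZeta z := by
    filter_upwards [isOpen_ne.mem_nhds h1] with z hz using e z hz
  have hd : deriv riemannZeta₁ s = riemannZeta s + (s - 1) * deriv riemannZeta s := by
    rw [ev.deriv_eq]
    have := ((hasDerivAt_id s).sub_const 1).mul (differentiableAt_riemannZeta h1).hasDerivAt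
    refine this.deriv.trans ?_
    simp
  rw [ArithmeticFunction.LSeries_vonMangoldt_eq_deriv_riemannZeta_div hs, zetaReg, hd, e s h1]
  field_simp
  ring

end

section
open Complex MeasureTheory Set Filter Topology Asymptotics
open scoped ContDiff

/-- Smooth functions vanishing on a neighbourhood of `+∞`. -/
structure Cut (F : ℝ → ℂ) : Prop where
  smooth : ContDiff ℝ ∞ F
  top : ∃ B > 0, ∀ w, B ≤ w → F w = 0

/-- Smooth functions with compact support in `(0, ∞)` (extended by zero to the negative axis). -/
structure Adm (F : ℝ → ℂ) : Prop extends Cut F where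
  bot : ∃ A > 0, ∀ w, w ≤ A → F w = 0

namespace Cut
variable {F : ℝ → ℂ} {s : ℂ}

lemma continuous (hF : Cut F) : Continuous F := hF.smooth.continuous

lemma isBigO_top (hF : Cut F) (a : ℝ) : F =O[atTop] (fun w => w ^ (-a)) := by
  obtain ⟨B, hB, h⟩ := hF.top
  refine IsBigO.of_bound 0 ?_
  filter_upwards [eventually_ge_atTop B] with w hw
  simp [h w hw]

lemma isBigO_zero (hF : Cut F) (h : 0 < s.re ∨ Adm F) : ∃ b < s.re, F =O[𝓝[>] 0] (fun w => w ^ (-b)) := by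
  rcases h with h | h
  · refine ⟨0, h, ?_⟩
    simp only [neg_zero, Real.rpow_zero]
    exact (hF.continuous.continuousAt.tendsto.mono_left nhdsWithin_le_nhds).isBigO_one ℝ
  · obtain ⟨A, hA, h⟩ := h.bot
    refine ⟨s.re - 1, by linarith, IsBigO.of_bound 0 ?_⟩
    filter_upwards [mem_nhdsWithin_of_mem_nhds (Iio_mem_nhds hA)] with w hw
    simp [h w (le_of_lt hw)]

lemma mellinConvergent (hF : Cut F) (h : 0 < s.re ∨ Adm F) : MellinConvergent F s := by
  obtain ⟨b, hb, h2⟩ := hF.isBigO_zero h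
  exact mellinConvergent_of_isBigO_rpow (hF.continuous.locallyIntegrable.locallyIntegrableOn _)
    (hF.isBigO_top (s.re + 1)) (by linarith) h2 hb

lemma hasDerivAt_mellin (hF : Cut F) (h : 0 < s.re ∨ Adm F) :
    HasDerivAt (mellin F) (mellin (fun t => Real.log t • F t) s) s := by
  obtain ⟨b, hb, h2⟩ := hF.isBigO_zero h
  exact (mellin_hasDerivAt_of_isBigO_rpow (hF.continuous.locallyIntegrable.locallyIntegrableOn _)
    (hF.isBigO_top (s.re + 1)) (by linarith) h2 hb).2

lemma hasDerivAt (hF : Cut F) (w : ℝ) : HasDerivAt F (deriv F w) w :=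
  (hF.smooth.differentiable (by simp) w).hasDerivAt

lemma deriv (hF : Cut F) : Cut (deriv F) := by
  refine ⟨(contDiff_infty_iff_deriv.1 hF.smooth).2, ?_⟩
  obtain ⟨B, hB, h⟩ := hF.top
  refine ⟨B + 1, by linarith, fun w hw => ?_⟩
  have : F =ᶠ[𝓝 w] fun _ => 0 := by
    filter_upwards [Ioi_mem_nhds (show B < w by linarith)] with v hv using h v (le_of_lt hv)
  rw [this.deriv_eq]; simp

end Cut

namespace Adm
variable {F : ℝ → ℂ} {s : ℂ}

lemma deriv (hF : Adm F) : Adm (deriv F) := by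
  refine ⟨hF.toCut.deriv, ?_⟩
  obtain ⟨A, hA, h⟩ := hF.bot
  refine ⟨A / 2, by linarith, fun w hw => ?_⟩
  have : F =ᶠ[𝓝 w] fun _ => 0 := by
    filter_upwards [Iio_mem_nhds (show w < A by linarith)] with v hv using h v (le_of_lt hv)
  rw [this.deriv_eq]; simp

lemma mul_smooth (hF : Adm F) {g : ℝ → ℂ} (hg : ContDiff ℝ ∞ g) : Adm (fun w => F w * g w) := by
  refine ⟨⟨hF.smooth.mul hg, ?_⟩, ?_⟩
  · obtain ⟨B, hB, h⟩ := hF.top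
    exact ⟨B, hB, fun w hw => by simp [h w hw]⟩
  · obtain ⟨B, hB, h⟩ := hF.bot
    exact ⟨B, hB, fun w hw => by simp [h w hw]⟩

lemma log_smul (hF : Adm F) : Adm (fun w => Real.log w • F w) := by
  obtain ⟨A, hA, h⟩ := hF.bot
  obtain ⟨B, hB, h'⟩ := hF.top
  refine ⟨⟨?_, B, hB, fun w hw => by simp [h' w hw]⟩, A, hA, fun w hw => by simp [h w hw]⟩
  rw [contDiff_iff_contDiffAt]
  intro w
  rcases lt_or_ge 0 w with hw | hw
  · exact (Real.contDiffAt_log.2 hw.ne').smul hF.smooth.contDiffAt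
  · have : (fun w => Real.log w • F w) =ᶠ[𝓝 w] fun _ => 0 := by
      filter_upwards [Iio_mem_nhds (show w < A by linarith)] with v hv
      simp [h v (le_of_lt hv)]
    exact contDiffAt_const.congr_of_eventuallyEq this

end Adm

lemma Cut.mul_mellin {F : ℝ → ℂ} {s : ℂ} (hF : Cut F) (h : 0 < s.re ∨ Adm F) :
    s * mellin F s = -mellin (_root_.deriv F) (s + 1) := by
  have hc := hF.mellinConvergent h
  have hc' : MellinConvergent (_root_.deriv F) (s + 1) := by
    refine hF.deriv.mellinConvergent ?_
    rcases h with h | h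
    · left; simp; linarith
    · exact Or.inr h.deriv
  rcases eq_or_ne s 0 with rfl | hs
  · have hA : Adm F := by simpa using h
    simp only [mellin, zero_add, sub_self, cpow_zero, one_smul, zero_mul]
    have := integral_Ioi_of_hasDerivAt_of_tendsto' (a := (0 : ℝ)) (m := 0) (fun x _ => hF.hasDerivAt x)
      (by simpa [MellinConvergent] using hc') ?_
    · obtain ⟨A, hA, h⟩ := hA.bot
      rw [this, h 0 hA.le]; simp
    · obtain ⟨B, hB, h⟩ := hF.top
      refine tendsto_const_nhds.congr' ?_
      filter_upwards [eventually_ge_atTop B] with w hw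
      simp [h w hw]
  have key := integral_Ioi_mul_deriv_eq_deriv_mul (a := (0 : ℝ)) (u := fun w : ℝ => (w : ℂ) ^ s)
    (u' := fun w : ℝ => s * (w : ℂ) ^ (s - 1)) (v := F) (v' := _root_.deriv F) (a' := 0) (b' := 0)
    ?_ (fun x _ => hF.hasDerivAt x) ?_ ?_ ?_ ?_
  · simp only [mellin, add_sub_cancel_right, smul_eq_mul]
    rw [key, ← integral_const_mul]
    simp [mul_assoc]
  · intro x hx
    have hx' : (0 : ℝ) < x := hx
    have := ((hasDerivAt_id (x : ℂ)).cpow_const (c := s) (Or.inl (by simpa using hx'))).comp_ofReal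
    simpa using this
  · simpa [MellinConvergent, Pi.mul_def] using hc'
  · have := hc.const_mul s
    simpa [Pi.mul_def, mul_assoc, IntegrableOn] using this
  · rcases h with h | h
    · have h1 : Tendsto (fun w : ℝ => (w : ℂ) ^ s) (𝓝[>] 0) (𝓝 0) := by
        rw [tendsto_zero_iff_norm_tendsto_zero]
        have : Tendsto (fun w : ℝ => w ^ s.re) (𝓝[>] 0) (𝓝 0) := by
          have := (Real.continuousAt_rpow_const 0 s.re (Or.inr h.le)).tendsto
          rw [Real.zero_rpow h.ne'] at this
          exact this.mono_left nhdsWithin_le_nhds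
        refine this.congr' ?_
        filter_upwards [self_mem_nhdsWithin] with w hw
        rw [norm_cpow_eq_rpow_re_of_pos hw]
      have h2 := h1.mul (hF.continuous.continuousAt.tendsto.mono_left (nhdsWithin_le_nhds (s := Ioi 0)))
      simpa [Pi.mul_def] using h2
    · obtain ⟨A, hA, h⟩ := h.bot
      refine tendsto_const_nhds.congr' ?_
      filter_upwards [mem_nhdsWithin_of_mem_nhds (Iio_mem_nhds hA)] with w hw
      simp [h w (le_of_lt hw)]
  · obtain ⟨B, hB, h⟩ := hF.top
    refine tendsto_const_nhds.congr' ?_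
    filter_upwards [eventually_ge_atTop B] with w hw
    simp [h w hw]

lemma norm_mellin_le {F : ℝ → ℂ} (s : ℂ) :
    ‖mellin F s‖ ≤ ∫ w in Ioi (0 : ℝ), w ^ (s.re - 1) * ‖F w‖ := by
  refine (norm_integral_le_integral_norm _).trans (le_of_eq ?_)
  refine setIntegral_congr_fun measurableSet_Ioi fun w hw => ?_
  simp only [norm_smul]
  rw [norm_cpow_eq_rpow_re_of_pos hw]; simp

lemma Cut.integrableOn_norm {F : ℝ → ℂ} {σ : ℝ} (hF : Cut F) (h : 0 < σ ∨ Adm F) :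
    IntegrableOn (fun w => w ^ (σ - 1) * ‖F w‖) (Ioi (0 : ℝ)) := by
  have := (hF.mellinConvergent (s := σ) (by simpa using h)).norm
  refine IntegrableOn.congr_fun this (fun w hw => ?_) measurableSet_Ioi
  simp only [norm_smul]
  rw [norm_cpow_eq_rpow_re_of_pos hw]; simp

lemma Cut.continuous_vertical {F : ℝ → ℂ} {σ : ℝ} (hF : Cut F) (h : 0 < σ ∨ Adm F) :
    Continuous fun t : ℝ => mellin F (σ + t * I) := by
  rw [continuous_iff_continuousAt]
  intro t
  have h1 := (hF.hasDerivAt_mellin (s := σ + t * I) (by simpa using h)).continuousAt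
  exact ContinuousAt.comp (f := fun t : ℝ => (σ : ℂ) + t * I) h1 (by fun_prop)

lemma integrable_one_add_abs_rpow {p : ℝ} (hp : 1 < p) : Integrable fun t : ℝ => (1 + |t|) ^ (-p) := by
  simpa using integrable_one_add_norm (E := ℝ) (μ := volume) (r := p) (by simpa using hp)

lemma vertical_integral_eq_of_strip {f : ℂ → ℂ} {a b C p : ℝ} (hab : a ≤ b) (hp : 1 < p)
    (hf : ∀ z : ℂ, a ≤ z.re → z.re ≤ b → DifferentiableAt ℂ f z)
    (hb : ∀ z : ℂ, a ≤ z.re → z.re ≤ b → ‖f z‖ ≤ C * (1 + |z.im|) ^ (-p)) :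
    ∫ t : ℝ, f (a + t * I) = ∫ t : ℝ, f (b + t * I) := by
  have hInt : ∀ c : ℝ, a ≤ c → c ≤ b → Integrable fun t : ℝ => f (c + t * I) := by
    intro c h1 h2
    refine Integrable.mono' ((integrable_one_add_abs_rpow hp).const_mul C) ?_ ?_
    · refine Continuous.aestronglyMeasurable ?_
      rw [continuous_iff_continuousAt]
      intro t
      exact ContinuousAt.comp (f := fun t : ℝ => (c : ℂ) + t * I)
        (hf (c + t * I) (by simpa using h1) (by simpa using h2)).continuousAt (by fun_prop)
    · filter_upwards with t
      simpa using hb (c + t * I) (by simpa using h1) (by simpa using h2)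
  have hrect : ∀ T : ℝ, (∫ t in -T..T, f (b + t * I)) - (∫ t in -T..T, f (a + t * I)) =
      I * ((∫ x in a..b, f (x + (-T : ℝ) * I)) - ∫ x in a..b, f (x + T * I)) := by
    intro T
    have h := integral_boundary_rect_eq_zero_of_differentiableOn f (a + (-T : ℝ) * I) (b + T * I) ?_
    · simp only [add_re, ofReal_re, mul_re, I_re, I_im, ofReal_im, add_im, mul_im, mul_zero,
        mul_one, add_zero, zero_add, smul_eq_mul, sub_self] at h
      have hI : I * I = -1 := I_mul_I
      linear_combination (-I) * h + ((∫ t in -T..T, f (b + t * I)) - (∫ t in -T..T, f (a + t * I))) * hI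
    · intro z hz
      have h1 := hz.1
      simp only [mem_preimage, add_re, ofReal_re, mul_re, I_re, I_im, ofReal_im, mul_zero, mul_one,
        sub_self, add_zero, uIcc_of_le hab] at h1
      exact (hf z h1.1 h1.2).differentiableWithinAt
  have hlim : ∀ c : ℝ, a ≤ c → c ≤ b →
      Tendsto (fun T : ℝ => ∫ t in -T..T, f (c + t * I)) atTop (𝓝 (∫ t : ℝ, f (c + t * I))) :=
    fun c h1 h2 => intervalIntegral_tendsto_integral (hInt c h1 h2) tendsto_neg_atTop_atBot tendsto_id
  have hz : Tendsto (fun T : ℝ => (∫ t in -T..T, f (b + t * I)) - (∫ t in -T..T, f (a + t * I)))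
      atTop (𝓝 0) := by
    simp_rw [hrect]
    have hdec : Tendsto (fun T : ℝ => 2 * (C * (1 + |T|) ^ (-p) * |b - a|)) atTop (𝓝 0) := by
      have : Tendsto (fun T : ℝ => (1 + |T|) ^ (-p)) atTop (𝓝 0) :=
        (tendsto_rpow_neg_atTop (by linarith)).comp (tendsto_atTop_add_const_left _ _ tendsto_abs_atTop_atTop)
      simpa using ((this.const_mul C).mul_const |b - a|).const_mul 2
    refine squeeze_zero_norm (fun T => ?_) hdec
    have hh : ∀ U : ℝ, ‖∫ x in a..b, f (x + U * I)‖ ≤ C * (1 + |U|) ^ (-p) * |b - a| := by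
      intro U
      refine intervalIntegral.norm_integral_le_of_norm_le_const fun x hx => ?_
      rw [uIoc_of_le hab] at hx
      simpa using hb (x + U * I) (by simpa using hx.1.le) (by simpa using hx.2)
    rw [norm_mul, norm_I, one_mul]
    have h1 := hh (-T)
    have h2 := hh T
    rw [abs_neg] at h1
    exact (norm_sub_le _ _).trans (by linarith)
  have h3 := (hlim b hab le_rfl).sub (hlim a le_rfl hab)
  have := tendsto_nhds_unique h3 hz
  linear_combination -this

namespace Cut
variable {F : ℝ → ℂ}

lemma mul_mul_mellin (hF : Cut F) {s : ℂ} (h : 0 < s.re ∨ Adm F) :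
    s * (s + 1) * mellin F s = mellin (_root_.deriv (_root_.deriv F)) (s + 2) := by
  have h1 := hF.mul_mellin h
  have h2 := hF.deriv.mul_mellin (s := s + 1) (by
    rcases h with h | h
    · left; simp; linarith
    · exact Or.inr h.deriv)
  rw [show s + 2 = s + 1 + 1 by ring]
  linear_combination (s + 1) * h1 - h2

lemma norm_mellin_le_inv (hF : Cut F) {s : ℂ} (h : 0 < s.re ∨ Adm F) :
    ‖mellin F s‖ ≤ ((∫ w in Ioi (0 : ℝ), w ^ (s.re - 1) * ‖F w‖) +
      ∫ w in Ioi (0 : ℝ), w ^ (s.re + 1) * ‖_root_.deriv (_root_.deriv F) w‖) * (1 + s.im ^ 2)⁻¹ := by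
  have h0 := norm_mellin_le (F := F) s
  have h1 := norm_mellin_le (F := _root_.deriv (_root_.deriv F)) (s + 2)
  rw [← hF.mul_mul_mellin h, norm_mul, norm_mul, add_re, show ((2 : ℂ).re) = 2 by simp,
    show s.re + 2 - 1 = s.re + 1 by ring] at h1
  have h2 := abs_im_le_norm s
  have h3 : |s.im| ≤ ‖s + 1‖ := by simpa using abs_im_le_norm (s + 1)
  have h4 : s.im ^ 2 ≤ ‖s‖ * ‖s + 1‖ := by
    rw [← sq_abs, sq]; gcongr
  rw [← div_eq_mul_inv, le_div_iff₀ (by positivity)]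
  nlinarith [norm_nonneg (mellin F s)]

lemma integrable_vertical (hF : Cut F) {σ : ℝ} (h : 0 < σ ∨ Adm F) :
    Integrable fun t : ℝ => mellin F (σ + t * I) := by
  refine Integrable.mono' (integrable_inv_one_add_sq.const_mul
    ((∫ w in Ioi (0 : ℝ), w ^ (σ - 1) * ‖F w‖) +
      ∫ w in Ioi (0 : ℝ), w ^ (σ + 1) * ‖_root_.deriv (_root_.deriv F) w‖))
    (hF.continuous_vertical h).aestronglyMeasurable (.of_forall fun t => ?_)
  have := hF.norm_mellin_le_inv (s := σ + t * I) (by simpa using h)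
  simpa using this

lemma mellin_inversion (hF : Cut F) {σ : ℝ} (h : 0 < σ ∨ Adm F) {w : ℝ} (hw : 0 < w) :
    (1 / (2 * Real.pi) : ℂ) * ∫ t : ℝ, (w : ℂ) ^ (-(σ + t * I) : ℂ) * mellin F (σ + t * I) = F w := by
  have := mellinInv_mellin_eq σ F hw (hF.mellinConvergent (by simpa using h))
    (hF.integrable_vertical h) hF.continuous.continuousAt
  rw [← this, mellinInv]
  simp only [smul_eq_mul, real_smul]
  push_cast
  rfl

end Cut

lemma explicit_sum {F : ℝ → ℂ} (hF : Adm F) {s : ℂ} {b : ℝ} (hb : s.re + b = 2) :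
    HasSum (fun n : ℕ => (ArithmeticFunction.vonMangoldt n : ℂ) * (n : ℂ) ^ (-s) * F n)
      ((1 / (2 * Real.pi) : ℂ) * ∫ t : ℝ, mellin F (b + t * I) *
        LSeries (fun n => (ArithmeticFunction.vonMangoldt n : ℂ)) (s + (b + t * I))) := by
  set L : ℕ → ℂ := fun n => (ArithmeticFunction.vonMangoldt n : ℂ)
  have hInt := hF.toCut.integrable_vertical (σ := b) (Or.inr hF)
  have hterm : ∀ (n : ℕ) (t : ℝ), LSeries.term L (s + (b + t * I)) n =
      L n * (n : ℂ) ^ (-s) * (n : ℂ) ^ (-(b + t * I) : ℂ) := by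
    intro n t
    rcases eq_or_ne n 0 with rfl | hn
    · simp [L]
    · rw [LSeries.term_of_ne_zero hn, cpow_neg, cpow_neg, cpow_add _ _ (by exact_mod_cast hn)]
      field_simp
  have hnorm : ∀ (n : ℕ) (t : ℝ), ‖LSeries.term L (s + (b + t * I)) n‖ = ‖LSeries.term L 2 n‖ := by
    intro n t
    rw [LSeries.norm_term_eq, LSeries.norm_term_eq]
    simp [← hb]
  have hsum2 : Summable fun n => ‖LSeries.term L 2 n‖ :=
    (ArithmeticFunction.LSeriesSummable_vonMangoldt (s := 2) (by norm_num)).norm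
  have hcont : ∀ n : ℕ, Continuous fun t : ℝ => LSeries.term L (s + (b + t * I)) n := by
    intro n
    rcases eq_or_ne n 0 with rfl | hn
    · simpa using continuous_const
    · simp only [LSeries.term_of_ne_zero hn]
      refine continuous_const.div ?_ fun t => ?_
      · exact Continuous.const_cpow (by fun_prop) (Or.inl (by exact_mod_cast hn))
      · simp [cpow_eq_zero_iff, hn]
  have hI : ∀ n : ℕ, Integrable fun t : ℝ => mellin F (b + t * I) * LSeries.term L (s + (b + t * I)) n := by
    intro n
    refine hInt.mul_bdd (c := ‖LSeries.term L 2 n‖) (hcont n).aestronglyMeasurable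
      (.of_forall fun t => (hnorm n t).le)
  have key := hasSum_integral_of_summable_integral_norm hI ?_
  · have k2 := key.mul_left (1 / (2 * Real.pi) : ℂ)
    simp only [tsum_mul_left] at k2
    simp only [LSeries]
    refine k2.congr_fun ?_ |> fun h => h
    intro n
    rcases eq_or_ne n 0 with rfl | hn
    · simp [L]
    · have hn' : (0 : ℝ) < n := by exact_mod_cast Nat.pos_of_ne_zero hn
      have h3 := hF.toCut.mellin_inversion (σ := b) (Or.inr hF) hn'
      rw [← h3]
      simp only [hterm]
      rw [← mul_assoc, mul_comm _ (1 / (2 * Real.pi) : ℂ), mul_assoc, ← integral_const_mul]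
      congr 2
      ext t
      simp only [L, ofReal_natCast]; ring
  · refine (hsum2.mul_left (∫ t : ℝ, ‖mellin F (b + t * I)‖)).congr fun n => ?_
    rw [← integral_mul_const]
    refine integral_congr_ae (.of_forall fun t => ?_)
    simp only [norm_mul, hnorm]

lemma explicit_integral {F : ℝ → ℂ} (hF : Adm F) {s : ℂ} {b : ℝ} (hb : s.re + b = 2) :
    ∫ v in Ioi (1 : ℝ), (v : ℂ) ^ (-s) * F v =
      (1 / (2 * Real.pi) : ℂ) * ∫ t : ℝ, mellin F (b + t * I) * (1 / (s + (b + t * I) - 1)) := by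
  have hInt := hF.toCut.integrable_vertical (σ := b) (Or.inr hF)
  have h1 : ∀ t : ℝ, 1 / (s + (b + t * I) - 1) = ∫ v in Ioi (1 : ℝ), (v : ℂ) ^ (-(s + (b + t * I))) := by
    intro t
    rw [integral_Ioi_cpow_of_lt (by simp; linarith) one_pos]
    rw [ofReal_one, one_cpow, ← neg_div_neg_eq]
    congr 1; ring
  have h2 : ∀ v ∈ Ioi (1 : ℝ), (v : ℂ) ^ (-s) * F v = (1 / (2 * Real.pi) : ℂ) *
      ∫ t : ℝ, mellin F (b + t * I) * (v : ℂ) ^ (-(s + (b + t * I))) := by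
    intro v hv
    have hv0 : (0 : ℝ) < v := lt_trans one_pos hv
    rw [← hF.toCut.mellin_inversion (σ := b) (Or.inr hF) hv0, ← mul_assoc,
      mul_comm _ (1 / (2 * Real.pi) : ℂ), mul_assoc, ← integral_const_mul]
    congr 2
    ext t
    rw [neg_add s, cpow_add (-s) _ (by exact_mod_cast hv0.ne')]
    ring
  rw [setIntegral_congr_fun measurableSet_Ioi h2, integral_const_mul]
  congr 1
  simp_rw [h1, ← integral_const_mul]
  rw [integral_integral_swap]
  have hdom : Integrable (fun p : ℝ × ℝ => (p.1 ^ (-2 : ℝ)) * ‖mellin F (b + p.2 * I)‖)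
      ((volume.restrict (Ioi 1)).prod volume) :=
    (integrableOn_Ioi_rpow_of_lt (by norm_num) one_pos).mul_prod hInt.norm
  refine hdom.mono' ?_ ?_
  · refine AEStronglyMeasurable.mul ?_ ?_
    · exact ((hF.toCut.continuous_vertical (Or.inr hF)).comp continuous_snd).aestronglyMeasurable
    · refine Measurable.aestronglyMeasurable ?_
      fun_prop
  · have : ∀ᵐ p : ℝ × ℝ ∂((volume.restrict (Ioi 1)).prod volume), p.1 ∈ Ioi (1 : ℝ) := by
      exact Measure.quasiMeasurePreserving_fst.ae (ae_restrict_mem measurableSet_Ioi)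
    filter_upwards [this] with p hp
    have hp0 : 0 < p.1 := lt_trans one_pos hp
    simp only [Function.uncurry, norm_mul]
    have hre : (-(s + (b + p.2 * I))).re = -2 := by simp; linarith
    rw [norm_cpow_eq_rpow_re_of_pos hp0, mul_comm, hre]

lemma Adm.norm_mellin_le_strip {F : ℝ → ℂ} (hF : Adm F) (a b : ℝ) : ∃ K ≥ 0, ∀ z : ℂ, a ≤ z.re → z.re ≤ b →
    ‖mellin F z‖ ≤ K * (1 + z.im ^ 2)⁻¹ := by
  have aux : ∀ G : ℝ → ℂ, Adm G → ∀ a b : ℝ, ∀ σ : ℝ, a ≤ σ → σ ≤ b →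
      ∫ w in Ioi (0 : ℝ), w ^ (σ - 1) * ‖G w‖ ≤
        (∫ w in Ioi (0 : ℝ), w ^ (a - 1) * ‖G w‖) + ∫ w in Ioi (0 : ℝ), w ^ (b - 1) * ‖G w‖ := by
    intro G hG a b σ h1 h2
    have hi := fun σ : ℝ => hG.toCut.integrableOn_norm (σ := σ) (Or.inr hG)
    rw [← integral_add (hi a) (hi b)]
    refine setIntegral_mono_on (hi σ) ((hi a).add (hi b)) measurableSet_Ioi fun w hw => ?_
    have hw0 : (0 : ℝ) < w := hw
    rw [← add_mul]
    gcongr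
    rcases le_total 1 w with h | h
    · have := Real.rpow_le_rpow_of_exponent_le h (show σ - 1 ≤ b - 1 by linarith)
      have := Real.rpow_nonneg hw0.le (a - 1)
      linarith
    · have := Real.rpow_le_rpow_of_exponent_ge hw0 h (show a - 1 ≤ σ - 1 by linarith)
      have := Real.rpow_nonneg hw0.le (b - 1)
      linarith
  have hnn : ∀ (G : ℝ → ℂ) (c : ℝ), 0 ≤ ∫ w in Ioi (0 : ℝ), w ^ (c - 1) * ‖G w‖ := fun G c =>
    setIntegral_nonneg measurableSet_Ioi fun w hw => mul_nonneg (Real.rpow_nonneg (le_of_lt hw) _) (norm_nonneg _)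
  set J : (ℝ → ℂ) → ℝ → ℝ := fun G c => ∫ w in Ioi (0 : ℝ), w ^ (c - 1) * ‖G w‖ with hJ
  refine ⟨(J F a + J F b) + (J (_root_.deriv (_root_.deriv F)) (a + 2) + J (_root_.deriv (_root_.deriv F)) (b + 2)), ?_,
    fun z h1 h2 => (hF.toCut.norm_mellin_le_inv (s := z) (Or.inr hF)).trans
    (mul_le_mul_of_nonneg_right (add_le_add (aux F hF a b z.re h1 h2) ?_) (by positivity))⟩
  · have := hnn F a
    have := hnn F b
    have := hnn (_root_.deriv (_root_.deriv F)) (a + 2)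
    have := hnn (_root_.deriv (_root_.deriv F)) (b + 2)
    simp only [hJ]
    linarith
  · have := aux _ hF.deriv.deriv (a + 2) (b + 2) (z.re + 2) (by linarith) (by linarith)
    rw [show z.re + 2 - 1 = z.re + 1 by ring] at this
    exact this

lemma log_two_add_le (u t : ℝ) : Real.log (2 + |u + t|) ≤ 2 * (2 + |u|) ^ (1 / 2 : ℝ) * (1 + |t|) ^ (1 / 2 : ℝ) := by
  have h1 : 2 + |u + t| ≤ (2 + |u|) * (1 + |t|) := by
    nlinarith [abs_add_le u t, abs_nonneg u, abs_nonneg t]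
  have h2 := Real.log_le_rpow_div (x := 2 + |u + t|) (by positivity) (show (0 : ℝ) < 1 / 2 by norm_num)
  have h3 : (2 + |u + t|) ^ (1 / 2 : ℝ) ≤ ((2 + |u|) * (1 + |t|)) ^ (1 / 2 : ℝ) :=
    Real.rpow_le_rpow (by positivity) h1 (by norm_num)
  rw [Real.mul_rpow (by positivity) (by positivity)] at h3
  linarith

lemma explicit_formula (h : RHzeta) {F : ℝ → ℂ} (hF : Adm F) {ε : ℝ} (hε : 0 < ε) {s : ℂ}
    (hs1 : 1 / 2 + ε ≤ s.re) (hs2 : s.re ≤ 2) :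
    HasSum (fun n : ℕ => (ArithmeticFunction.vonMangoldt n : ℂ) * (n : ℂ) ^ (-s) * F n)
      ((∫ v in Ioi (1 : ℝ), (v : ℂ) ^ (-s) * F v) + (1 / (2 * Real.pi) : ℂ) *
        ∫ t : ℝ, mellin F ((-(ε / 2) : ℝ) + t * I) * zetaReg (s + ((-(ε / 2) : ℝ) + t * I))) := by
  obtain ⟨b, hb⟩ : ∃ b, s.re + b = 2 := ⟨2 - s.re, by ring⟩
  obtain ⟨C, hC, hz⟩ := norm_zetaReg_le h (half_pos hε)
  obtain ⟨K, hK, hm⟩ := hF.norm_mellin_le_strip (-(ε / 2)) b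
  have hdiff : ∀ z : ℂ, -(ε / 2) ≤ z.re → z.re ≤ b →
      DifferentiableAt ℂ (fun z => mellin F z * zetaReg (s + z)) z := by
    intro z h1 h2
    refine (hF.toCut.hasDerivAt_mellin (Or.inr hF)).differentiableAt.mul ?_
    have := differentiableAt_zetaReg h (s := s + z) (by simp; linarith)
    exact this.comp z (by fun_prop)
  have hbd : ∀ z : ℂ, -(ε / 2) ≤ z.re → z.re ≤ b → ‖mellin F z * zetaReg (s + z)‖ ≤
      (4 * K * C * (2 + |s.im|) ^ (1 / 2 : ℝ)) * (1 + |z.im|) ^ (-(3 / 2) : ℝ) := by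
    intro z h1 h2
    have e1 := hm z h1 h2
    have e2 := hz (s + z) (by simp; linarith) (by simp; linarith)
    have e3 := log_two_add_le s.im z.im
    have e4 : (1 + z.im ^ 2)⁻¹ ≤ 2 * (1 + |z.im|) ^ (-2 : ℝ) := by
      rw [Real.rpow_neg (by positivity), Real.rpow_two, ← div_eq_mul_inv, le_div_iff₀ (by positivity),
        inv_mul_le_iff₀ (by positivity), ← sq_abs z.im]
      nlinarith [sq_nonneg (1 - |z.im|)]
    have e5 : (1 + |z.im|) ^ (-2 : ℝ) * (1 + |z.im|) ^ (1 / 2 : ℝ) = (1 + |z.im|) ^ (-(3 / 2) : ℝ) := by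
      rw [← Real.rpow_add (by positivity)]; norm_num
    rw [norm_mul]
    calc ‖mellin F z‖ * ‖zetaReg (s + z)‖ ≤ (K * (2 * (1 + |z.im|) ^ (-2 : ℝ))) *
          (C * (2 * (2 + |s.im|) ^ (1 / 2 : ℝ) * (1 + |z.im|) ^ (1 / 2 : ℝ))) := by
          gcongr
          · exact e1.trans (by gcongr)
          · exact e2.trans (by rw [add_im]; gcongr)
      _ = (4 * K * C * (2 + |s.im|) ^ (1 / 2 : ℝ)) *
          ((1 + |z.im|) ^ (-2 : ℝ) * (1 + |z.im|) ^ (1 / 2 : ℝ)) := by ring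
      _ = _ := by rw [e5]
  have hshift := vertical_integral_eq_of_strip (by linarith) (by norm_num) hdiff hbd
  have hcontb : Continuous fun t : ℝ => mellin F (b + t * I) := hF.toCut.continuous_vertical (Or.inr hF)
  have hIntb := hF.toCut.integrable_vertical (σ := b) (Or.inr hF)
  have hre : ∀ t : ℝ, (s + (b + t * I)).re = 2 := by intro t; simp [hb]
  have hInt1 : Integrable fun t : ℝ => mellin F (b + t * I) * zetaReg (s + (b + t * I)) := by
    refine Integrable.mono' ((integrable_one_add_abs_rpow (show (1 : ℝ) < 3 / 2 by norm_num)).const_mul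
      (4 * K * C * (2 + |s.im|) ^ (1 / 2 : ℝ))) ?_ (.of_forall fun t => ?_)
    · refine Continuous.aestronglyMeasurable ?_
      rw [continuous_iff_continuousAt]
      intro t
      exact ContinuousAt.comp (f := fun t : ℝ => (b : ℂ) + t * I)
        (hdiff (b + t * I) (by simp; linarith) (by simp)).continuousAt (by fun_prop)
    · simpa using hbd (b + t * I) (by simp; linarith) (by simp)
  have hInt2 : Integrable fun t : ℝ => mellin F (b + t * I) * (1 / (s + (b + t * I) - 1)) := by
    refine hIntb.mul_bdd (c := 1) ?_ (.of_forall fun t => ?_)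
    · refine (continuous_const.div (by fun_prop) fun t h0 => ?_).aestronglyMeasurable
      have := congrArg re h0
      rw [sub_re, hre] at this; norm_num at this
    · have := abs_re_le_norm (s + (b + t * I) - 1)
      rw [sub_re, hre] at this
      norm_num at this
      rw [norm_div, norm_one, div_le_one (by linarith)]
      exact this
  have key := explicit_sum hF hb
  rw [hshift, explicit_integral hF hb, ← mul_add, ← integral_add hInt2 hInt1]
  convert key using 3
  funext t
  rw [zetaReg_eq (by rw [hre]; norm_num)]
  ring

/-- The smooth step from `0` at `A` to `1` at `A + H`. -/
def step (A H : ℝ) (v : ℝ) : ℂ := ((Real.smoothTransition ((v - A) / H) : ℝ) : ℂ)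

lemma step_of_le {A H v : ℝ} (hH : 0 < H) (h : v ≤ A) : step A H v = 0 := by
  rw [step, Real.smoothTransition.zero_of_nonpos (div_nonpos_of_nonpos_of_nonneg (by linarith) hH.le)]
  simp

lemma step_of_ge {A H v : ℝ} (hH : 0 < H) (h : A + H ≤ v) : step A H v = 1 := by
  rw [step, Real.smoothTransition.one_of_one_le (by rw [le_div_iff₀ hH]; linarith)]
  simp

lemma contDiff_step (A H : ℝ) : ContDiff ℝ ∞ (step A H) := by
  unfold step
  refine ofRealCLM.contDiff.comp ?_
  refine Real.smoothTransition.contDiff.comp ?_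
  exact (contDiff_id.sub contDiff_const).div_const _

lemma adm_deriv_step {A H : ℝ} (hA : 0 < A) (hH : 0 < H) : Adm (deriv (step A H)) := by
  refine ⟨⟨(contDiff_infty_iff_deriv.1 (contDiff_step A H)).2, A + H + 1, by linarith, fun w hw => ?_⟩,
    A / 2, by linarith, fun w hw => ?_⟩
  · have : step A H =ᶠ[𝓝 w] fun _ => 1 := by
      filter_upwards [Ioi_mem_nhds (show A + H < w by linarith)] with v hv using step_of_ge hH (le_of_lt hv)
    rw [this.deriv_eq]; simp
  · have : step A H =ᶠ[𝓝 w] fun _ => 0 := by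
      filter_upwards [Iio_mem_nhds (show w < A by linarith)] with v hv using step_of_le hH (le_of_lt hv)
    rw [this.deriv_eq]; simp

lemma deriv_step_eq (A H v : ℝ) : deriv (step A H) v = H⁻¹ * deriv (step 0 1) ((v - A) / H) := by
  have h1 : step A H = fun v => step 0 1 (H⁻¹ * v - H⁻¹ * A) := by
    ext v; simp only [step]; congr 2; ring
  have h2 : HasDerivAt (fun v => step 0 1 (H⁻¹ * v - H⁻¹ * A))
      (H⁻¹ • deriv (step 0 1) (H⁻¹ * v - H⁻¹ * A)) v := by
    have h3 := ((contDiff_step 0 1).differentiable (by simp) (H⁻¹ * v - H⁻¹ * A)).hasDerivAt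
    have h4 : HasDerivAt (fun v : ℝ => H⁻¹ * v - H⁻¹ * A) H⁻¹ v := by
      simpa using ((hasDerivAt_id v).const_mul H⁻¹).sub_const (H⁻¹ * A)
    exact HasDerivAt.scomp (g₁ := step 0 1) (h := fun v : ℝ => H⁻¹ * v - H⁻¹ * A) v h3 h4
  rw [h1, h2.deriv, show H⁻¹ * v - H⁻¹ * A = (v - A) / H by ring]
  simp

lemma deriv_deriv_step_eq (A H v : ℝ) :
    deriv (deriv (step A H)) v = H⁻¹ * (H⁻¹ * deriv (deriv (step 0 1)) ((v - A) / H)) := by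
  have h1 : deriv (step A H) = fun v => ((H⁻¹ : ℝ) : ℂ) * deriv (step 0 1) (H⁻¹ * v - H⁻¹ * A) := by
    ext v; rw [deriv_step_eq, show (v - A) / H = H⁻¹ * v - H⁻¹ * A by ring]
  have hd : ContDiff ℝ ∞ (deriv (step 0 1)) := (contDiff_infty_iff_deriv.1 (contDiff_step 0 1)).2
  have h2 : HasDerivAt (fun v => ((H⁻¹ : ℝ) : ℂ) * deriv (step 0 1) (H⁻¹ * v - H⁻¹ * A))
      (((H⁻¹ : ℝ) : ℂ) * (H⁻¹ • deriv (deriv (step 0 1)) (H⁻¹ * v - H⁻¹ * A))) v := by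
    have h3 := (hd.differentiable (by simp) (H⁻¹ * v - H⁻¹ * A)).hasDerivAt
    have h4 : HasDerivAt (fun v : ℝ => H⁻¹ * v - H⁻¹ * A) H⁻¹ v := by
      simpa using ((hasDerivAt_id v).const_mul H⁻¹).sub_const (H⁻¹ * A)
    exact (HasDerivAt.scomp (g₁ := deriv (step 0 1)) (h := fun v : ℝ => H⁻¹ * v - H⁻¹ * A) v h3 h4).const_mul _
  rw [h1, h2.deriv, show H⁻¹ * v - H⁻¹ * A = (v - A) / H by ring]
  simp

lemma exists_bound_deriv_step : ∃ K > 0, ∀ v, ‖deriv (step 0 1) v‖ ≤ K ∧ ‖deriv (deriv (step 0 1)) v‖ ≤ K := by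
  have hz : ∀ v, v ∉ Icc (0 : ℝ) 1 → deriv (step 0 1) v = 0 ∧ deriv (deriv (step 0 1)) v = 0 := by
    intro v hv
    have : (step 0 1 =ᶠ[𝓝 v] fun _ => 0) ∨ (step 0 1 =ᶠ[𝓝 v] fun _ => 1) := by
      rcases lt_or_ge v 0 with h | h
      · left
        filter_upwards [Iio_mem_nhds h] with u hu using step_of_le one_pos (le_of_lt hu)
      · right
        have : 0 + 1 < v := by
          by_contra h2; exact hv ⟨h, by linarith⟩
        filter_upwards [Ioi_mem_nhds this] with u hu using step_of_ge one_pos (le_of_lt hu)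
    rcases this with h | h <;>
    · refine ⟨by rw [h.deriv_eq]; simp, ?_⟩
      rw [h.deriv.deriv_eq]; simp
  have hd : ContDiff ℝ ∞ (deriv (step 0 1)) := (contDiff_infty_iff_deriv.1 (contDiff_step 0 1)).2
  have hd2 : ContDiff ℝ ∞ (deriv (deriv (step 0 1))) := (contDiff_infty_iff_deriv.1 hd).2
  obtain ⟨K1, h1⟩ := isCompact_Icc.exists_bound_of_continuousOn (s := Icc (0 : ℝ) 1) hd.continuous.continuousOn
  obtain ⟨K2, h2⟩ := isCompact_Icc.exists_bound_of_continuousOn (s := Icc (0 : ℝ) 1) hd2.continuous.continuousOn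
  refine ⟨max (max K1 K2) 1, by positivity, fun v => ?_⟩
  by_cases hv : v ∈ Icc (0 : ℝ) 1
  · exact ⟨(h1 v hv).trans (by simp), (h2 v hv).trans (by simp)⟩
  · rw [(hz v hv).1, (hz v hv).2, norm_zero]
    exact ⟨by positivity, by positivity⟩

lemma deriv_step_eq_zero {A H v : ℝ} (hH : 0 < H) (h : v ∉ Icc A (A + H)) :
    deriv (step A H) v = 0 ∧ deriv (deriv (step A H)) v = 0 := by
  have : (step A H =ᶠ[𝓝 v] fun _ => 0) ∨ (step A H =ᶠ[𝓝 v] fun _ => 1) := by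
    rcases lt_or_ge v A with h' | h'
    · left
      filter_upwards [Iio_mem_nhds h'] with u hu using step_of_le hH (le_of_lt hu)
    · right
      have : A + H < v := by
        by_contra h2; exact h ⟨h', by linarith⟩
      filter_upwards [Ioi_mem_nhds this] with u hu using step_of_ge hH (le_of_lt hu)
  rcases this with h | h <;>
  · refine ⟨by rw [h.deriv_eq]; simp, ?_⟩
    rw [h.deriv.deriv_eq]; simp

/-- A pointwise bound on `[A, A + H]` bounds a Mellin transform of a function supported there. -/
lemma norm_mellin_le_of_support {G : ℝ → ℂ} {A H D : ℝ} {s : ℂ} (hA : 0 < A) (hH : 0 ≤ H)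
    (hsupp : ∀ v, v ∉ Icc A (A + H) → G v = 0)
    (hb : ∀ v ∈ Icc A (A + H), v ^ (s.re - 1) * ‖G v‖ ≤ D) : ‖mellin G s‖ ≤ D * H := by
  have h1 : mellin G s = ∫ v in Icc A (A + H), (v : ℂ) ^ (s - 1) • G v := by
    rw [mellin]
    refine setIntegral_eq_of_subset_of_forall_sdiff_eq_zero measurableSet_Ioi
      (fun v hv => lt_of_lt_of_le hA hv.1) fun v hv => ?_
    rw [hsupp v hv.2, smul_zero]
  rw [h1]
  have := norm_setIntegral_le_of_norm_le_const (μ := volume) (s := Icc A (A + H)) (C := D)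
    (f := fun v : ℝ => (v : ℂ) ^ (s - 1) • G v) (by simp) (fun v hv => by
      have hv0 : 0 < v := lt_of_lt_of_le hA hv.1
      rw [norm_smul, norm_cpow_eq_rpow_re_of_pos hv0]
      simpa using hb v hv)
  refine this.trans (le_of_eq ?_)
  simp [Measure.real, hH]

lemma exists_norm_mellin_deriv_step_le {θ : ℝ} (hθ : 0 < θ) (hθ1 : θ < 1) : ∃ K > 0, ∀ P A H : ℝ, 1 ≤ P →
    P / 2 ≤ A → A + H ≤ 2 * P → Real.sqrt P / 2 ≤ H → ∀ z : ℂ, z.re = 1 - θ →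
    ‖mellin (deriv (step A H)) z‖ ≤ K * P ^ (-(θ / 2)) * ‖z‖ ^ (-θ) := by
  obtain ⟨K, hK, hb⟩ := exists_bound_deriv_step
  refine ⟨4 * K, by positivity, fun P A H hP hA hAH hH z hz => ?_⟩
  have hP0 : 0 < P := by linarith
  have hsq : 0 < Real.sqrt P := Real.sqrt_pos.2 hP0
  have hH0 : 0 < H := by linarith
  have hA0 : 0 < A := by linarith
  have hz0 : 0 < ‖z‖ := by
    rw [norm_pos_iff]; rintro rfl; simp at hz; linarith
  have b1 : ‖mellin (deriv (step A H)) z‖ ≤ 4 * K * P ^ (-θ) := by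
    have := norm_mellin_le_of_support (G := deriv (step A H)) (A := A) (H := H) (D := 2 * P ^ (-θ) * (H⁻¹ * K))
      (s := z) hA0 hH0.le (fun v hv => (deriv_step_eq_zero hH0 hv).1) (fun v hv => by
        have hv0 : 0 < v := lt_of_lt_of_le hA0 hv.1
        rw [deriv_step_eq, norm_mul, hz, show 1 - θ - 1 = -θ by ring, norm_real, Real.norm_eq_abs,
          abs_of_pos (inv_pos.2 hH0)]
        gcongr
        · calc v ^ (-θ) ≤ (P / 2) ^ (-θ) :=
                Real.rpow_le_rpow_of_nonpos (by positivity) (hA.trans hv.1) (by linarith)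
            _ = 2 ^ θ * P ^ (-θ) := by
                rw [div_eq_inv_mul, Real.mul_rpow (by positivity) (by positivity), Real.inv_rpow (by positivity),
                  ← Real.rpow_neg (by positivity), neg_neg]
            _ ≤ 2 * P ^ (-θ) := by
                gcongr
                calc (2 : ℝ) ^ θ ≤ 2 ^ (1 : ℝ) := Real.rpow_le_rpow_of_exponent_le (by norm_num) hθ1.le
                  _ = 2 := by simp
        · exact (hb _).1)
    refine this.trans ?_
    rw [show 2 * P ^ (-θ) * (H⁻¹ * K) * H = 2 * K * P ^ (-θ) * (H⁻¹ * H) by ring, inv_mul_cancel₀ hH0.ne']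
    nlinarith [Real.rpow_pos_of_pos hP0 (-θ), mul_pos hK (Real.rpow_pos_of_pos hP0 (-θ))]
  have b2 : ‖z‖ * ‖mellin (deriv (step A H)) z‖ ≤ 4 * K * P ^ (-θ) * Real.sqrt P := by
    have h0 := (adm_deriv_step hA0 hH0).toCut.mul_mellin (s := z) (Or.inr (adm_deriv_step hA0 hH0))
    rw [← norm_mul, h0, norm_neg]
    have := norm_mellin_le_of_support (G := deriv (deriv (step A H))) (A := A) (H := H)
      (D := 2 * P ^ (1 - θ) * (H⁻¹ * (H⁻¹ * K)))
      (s := z + 1) hA0 hH0.le (fun v hv => (deriv_step_eq_zero hH0 hv).2) (fun v hv => by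
        have hv0 : 0 < v := lt_of_lt_of_le hA0 hv.1
        rw [deriv_deriv_step_eq, norm_mul, norm_mul, add_re, hz, one_re, show 1 - θ + 1 - 1 = 1 - θ by ring,
          norm_real, Real.norm_eq_abs, abs_of_pos (inv_pos.2 hH0)]
        gcongr
        · calc v ^ (1 - θ) ≤ (2 * P) ^ (1 - θ) :=
                Real.rpow_le_rpow hv0.le (hv.2.trans hAH) (by linarith)
            _ = 2 ^ (1 - θ) * P ^ (1 - θ) := by
                rw [Real.mul_rpow (by positivity) (by positivity)]
            _ ≤ 2 * P ^ (1 - θ) := by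
                gcongr
                calc (2 : ℝ) ^ (1 - θ) ≤ 2 ^ (1 : ℝ) :=
                      Real.rpow_le_rpow_of_exponent_le (by norm_num) (by linarith)
                  _ = 2 := by simp
        · exact (hb _).2)
    refine this.trans ?_
    have e1 : P ^ (1 - θ) = P ^ (-θ) * (Real.sqrt P * Real.sqrt P) := by
      rw [Real.mul_self_sqrt hP0.le, sub_eq_add_neg, add_comm, Real.rpow_add hP0, Real.rpow_one]
    rw [show 2 * P ^ (1 - θ) * (H⁻¹ * (H⁻¹ * K)) * H = 2 * K * P ^ (1 - θ) * H⁻¹ * (H⁻¹ * H) by ring,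
      inv_mul_cancel₀ hH0.ne', mul_one, e1]
    have e2 : Real.sqrt P * H⁻¹ ≤ 2 := by
      rw [← div_eq_mul_inv, div_le_iff₀ hH0]; linarith
    calc 2 * K * (P ^ (-θ) * (Real.sqrt P * Real.sqrt P)) * H⁻¹
        = 2 * K * P ^ (-θ) * Real.sqrt P * (Real.sqrt P * H⁻¹) := by ring
      _ ≤ 2 * K * P ^ (-θ) * Real.sqrt P * 2 := by gcongr
      _ = _ := by ring
  set E := ‖mellin (deriv (step A H)) z‖
  have hE : 0 ≤ E := norm_nonneg _
  have hE1 : E ≤ 4 * K * P ^ (-θ) * (Real.sqrt P / ‖z‖) := by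
    rw [← mul_div_assoc, le_div_iff₀ hz0]; linarith
  have hmin : (1 : ℝ) ≤ (Real.sqrt P / ‖z‖) ^ θ ∨ Real.sqrt P / ‖z‖ ≤ (Real.sqrt P / ‖z‖) ^ θ := by
    rcases le_total 1 (Real.sqrt P / ‖z‖) with h | h
    · exact Or.inl (Real.one_le_rpow h hθ.le)
    · right
      have := Real.rpow_le_rpow_of_exponent_ge (by positivity) h hθ1.le
      simpa using this
  have hfin : E ≤ 4 * K * P ^ (-θ) * (Real.sqrt P / ‖z‖) ^ θ := by
    rcases hmin with h | h
    · calc E ≤ 4 * K * P ^ (-θ) * 1 := by linarith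
        _ ≤ _ := by gcongr
    · exact hE1.trans (by gcongr)
  refine hfin.trans (le_of_eq ?_)
  rw [Real.div_rpow hsq.le hz0.le, Real.sqrt_eq_rpow, ← Real.rpow_mul hP0.le, Real.rpow_neg hz0.le,
    show P ^ (-(θ / 2)) = P ^ (-θ) * P ^ (1 / 2 * θ) by rw [← Real.rpow_add hP0]; ring_nf]
  ring

lemma norm_step_le (A H v : ℝ) : ‖step A H v‖ ≤ 1 := by
  rw [step, norm_real, Real.norm_eq_abs, abs_of_nonneg (Real.smoothTransition.nonneg _)]
  exact Real.smoothTransition.le_one _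

/-- A smooth majorant of the indicator of `[N, M]` with edges of width `H₁` and `H₂`. -/
def plateau (N H₁ M H₂ : ℝ) (v : ℝ) : ℂ := step (N - H₁) H₁ v - step M H₂ v

lemma adm_plateau {N H₁ M H₂ : ℝ} (h1 : 0 < H₁) (h2 : 0 < H₂) (hN : 0 < N - H₁) (hNM : N ≤ M) :
    Adm (plateau N H₁ M H₂) := by
  refine ⟨⟨(contDiff_step _ _).sub (contDiff_step _ _), M + H₂, by linarith, fun w hw => ?_⟩,
    N - H₁, hN, fun w hw => ?_⟩
  · rw [plateau, step_of_ge h1 (by linarith), step_of_ge h2 hw, sub_self]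
  · rw [plateau, step_of_le h1 hw, step_of_le h2 (by linarith), sub_self]

lemma plateau_eq_one {N H₁ M H₂ v : ℝ} (h1 : 0 < H₁) (h2 : 0 < H₂) (hv : v ∈ Icc N M) :
    plateau N H₁ M H₂ v = 1 := by
  rw [plateau, step_of_ge h1 (by linarith [hv.1]), step_of_le h2 hv.2, sub_zero]

lemma norm_plateau_le (N H₁ M H₂ v : ℝ) : ‖plateau N H₁ M H₂ v‖ ≤ 2 :=
  (norm_sub_le _ _).trans (by linarith [norm_step_le (N - H₁) H₁ v, norm_step_le M H₂ v])

lemma deriv_plateau (N H₁ M H₂ : ℝ) :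
    deriv (plateau N H₁ M H₂) = deriv (step (N - H₁) H₁) - deriv (step M H₂) := by
  ext v
  rw [show plateau N H₁ M H₂ = fun v => step (N - H₁) H₁ v - step M H₂ v from rfl,
    deriv_fun_sub ((contDiff_step _ _).differentiable (by simp) v) ((contDiff_step _ _).differentiable (by simp) v)]
  rfl

lemma exists_norm_mellin_plateau_le {θ : ℝ} (hθ : 0 < θ) (hθ1 : θ ≤ 1 / 2) : ∃ K > 0, ∀ N H₁ M H₂ : ℝ, 1 ≤ N →
    N ≤ M → N / 2 ≤ N - H₁ → Real.sqrt N / 2 ≤ H₁ → H₂ ≤ M → Real.sqrt M / 2 ≤ H₂ → ∀ τ : ℝ,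
    ‖mellin (plateau N H₁ M H₂) ((-θ : ℝ) + τ * I)‖ ≤ K * N ^ (-(θ / 2)) * (1 + |τ|) ^ (-(1 + θ)) := by
  obtain ⟨K, hK, hb⟩ := exists_norm_mellin_deriv_step_le hθ (by linarith)
  refine ⟨2 * K * (2 / θ) * 3, by positivity, fun N H₁ M H₂ hN hNM hN2 hH1 hM2 hH2 τ => ?_⟩
  have hs1 : 0 < Real.sqrt N := Real.sqrt_pos.2 (by linarith)
  have hs2 : 0 < Real.sqrt M := Real.sqrt_pos.2 (by linarith)
  have h1 : 0 < H₁ := by linarith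
  have h2 : 0 < H₂ := by linarith
  set w : ℂ := (-θ : ℝ) + τ * I with hw
  have hwre : w.re = -θ := by simp [hw]
  have hwim : w.im = τ := by simp [hw]
  have ha := adm_plateau h1 h2 (by linarith : 0 < N - H₁) hNM
  have he1 := adm_deriv_step (by linarith : 0 < N - H₁) h1
  have he2 := adm_deriv_step (by linarith : 0 < M) h2
  have hmul := ha.toCut.mul_mellin (s := w) (Or.inr ha)
  have hsub : mellin (deriv (plateau N H₁ M H₂)) (w + 1) =
      mellin (deriv (step (N - H₁) H₁)) (w + 1) - mellin (deriv (step M H₂)) (w + 1) := by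
    rw [deriv_plateau]
    have := hasMellin_sub (he1.toCut.mellinConvergent (s := w + 1) (Or.inr he1))
      (he2.toCut.mellinConvergent (s := w + 1) (Or.inr he2))
    exact this.2
  have hre1 : (w + 1).re = 1 - θ := by simp [hwre]; ring
  have hb1 := hb N (N - H₁) H₁ hN hN2 (by linarith) hH1 (w + 1) hre1
  have hb2 := hb M M H₂ (by linarith) (by linarith) (by linarith) hH2 (w + 1) hre1
  have hnw : θ / 2 * (1 + |τ|) ≤ ‖w‖ := by
    have e1 := abs_re_le_norm w
    have e2 := abs_im_le_norm w
    rw [hwre, abs_neg, abs_of_pos hθ] at e1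
    rw [hwim] at e2
    nlinarith [abs_nonneg τ]
  have hnw1 : (1 + |τ|) / 3 ≤ ‖w + 1‖ := by
    have e1 := abs_re_le_norm (w + 1)
    have e2 := abs_im_le_norm (w + 1)
    rw [hre1, abs_of_pos (by linarith)] at e1
    simp only [add_im, hwim, one_im, add_zero] at e2
    linarith
  have hτ : 0 < 1 + |τ| := by positivity
  have hw0 : 0 < ‖w‖ := lt_of_lt_of_le (by positivity) hnw
  have hp : ‖w + 1‖ ^ (-θ) ≤ 3 * (1 + |τ|) ^ (-θ) := by
    calc ‖w + 1‖ ^ (-θ) ≤ ((1 + |τ|) / 3) ^ (-θ) :=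
          Real.rpow_le_rpow_of_nonpos (by positivity) hnw1 (by linarith)
      _ = 3 ^ θ * (1 + |τ|) ^ (-θ) := by
          rw [div_eq_inv_mul, Real.mul_rpow (by positivity) (by positivity), Real.inv_rpow (by positivity),
            ← Real.rpow_neg (by positivity), neg_neg]
      _ ≤ 3 ^ (1 : ℝ) * (1 + |τ|) ^ (-θ) := by
          gcongr
          · norm_num
          · linarith
      _ = _ := by simp
  have hMN : M ^ (-(θ / 2)) ≤ N ^ (-(θ / 2)) :=
    Real.rpow_le_rpow_of_nonpos (by linarith) hNM (by linarith)
  have hmain : ‖w‖ * ‖mellin (plateau N H₁ M H₂) w‖ ≤ 2 * K * N ^ (-(θ / 2)) * (3 * (1 + |τ|) ^ (-θ)) := by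
    rw [← norm_mul, hmul, norm_neg, hsub]
    refine (norm_sub_le _ _).trans ?_
    calc _ ≤ K * N ^ (-(θ / 2)) * ‖w + 1‖ ^ (-θ) + K * M ^ (-(θ / 2)) * ‖w + 1‖ ^ (-θ) := add_le_add hb1 hb2
      _ ≤ K * N ^ (-(θ / 2)) * ‖w + 1‖ ^ (-θ) + K * N ^ (-(θ / 2)) * ‖w + 1‖ ^ (-θ) := by gcongr
      _ = 2 * K * N ^ (-(θ / 2)) * ‖w + 1‖ ^ (-θ) := by ring
      _ ≤ _ := by
        have : 0 < N ^ (-(θ / 2)) := Real.rpow_pos_of_pos (by linarith) _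
        gcongr
  have hN0 : 0 < N ^ (-(θ / 2)) := Real.rpow_pos_of_pos (by linarith) _
  calc ‖mellin (plateau N H₁ M H₂) w‖ ≤ 2 * K * N ^ (-(θ / 2)) * (3 * (1 + |τ|) ^ (-θ)) / ‖w‖ := by
        rw [le_div_iff₀ hw0]; linarith
    _ ≤ 2 * K * N ^ (-(θ / 2)) * (3 * (1 + |τ|) ^ (-θ)) / (θ / 2 * (1 + |τ|)) := by gcongr
    _ = _ := by
        rw [neg_add, Real.rpow_add hτ, Real.rpow_neg_one]
        field_simp

lemma log_two_add_le_mul {κ : ℝ} (hκ : 0 < κ) (t τ : ℝ) :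
    Real.log (2 + |t + τ|) ≤ (1 + 2 / κ) * Real.log (2 + |t|) * (1 + |τ|) ^ κ := by
  have h1 : Real.log (2 + |t + τ|) ≤ Real.log (2 + |t|) + Real.log (1 + |τ|) := by
    rw [← Real.log_mul (by positivity) (by positivity)]
    refine Real.log_le_log (by positivity) ?_
    nlinarith [abs_add_le t τ, abs_nonneg t, abs_nonneg τ, mul_nonneg (abs_nonneg t) (abs_nonneg τ)]
  have h2 : 1 / 2 ≤ Real.log (2 + |t|) := by
    have := Real.log_two_gt_d9
    have h3 : Real.log 2 ≤ Real.log (2 + |t|) := Real.log_le_log (by norm_num) (by linarith [abs_nonneg t])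
    linarith
  have h3 := Real.log_le_rpow_div (x := 1 + |τ|) (by positivity) hκ
  have h4 : 1 ≤ (1 + |τ|) ^ κ := Real.one_le_rpow (by linarith [abs_nonneg τ]) hκ.le
  have h5 : (1 + |τ|) ^ κ / κ ≤ 2 / κ * Real.log (2 + |t|) * (1 + |τ|) ^ κ := by
    rw [div_eq_inv_mul, show 2 / κ * Real.log (2 + |t|) * (1 + |τ|) ^ κ =
      κ⁻¹ * (2 * Real.log (2 + |t|) * (1 + |τ|) ^ κ) by ring]
    have : 0 < κ⁻¹ := by positivity
    gcongr
    nlinarith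
  have h6 : Real.log (2 + |t|) ≤ Real.log (2 + |t|) * (1 + |τ|) ^ κ := by nlinarith
  calc _ ≤ Real.log (2 + |t|) * (1 + |τ|) ^ κ + 2 / κ * Real.log (2 + |t|) * (1 + |τ|) ^ κ := by linarith
    _ = _ := by ring

/-- The zero-free half plane bounds the contribution of the nontrivial zeros to a smoothed prime sum. -/
lemma exists_norm_plateau_zero_term_le (h : RHzeta) {ε : ℝ} (hε : 0 < ε) (hε1 : ε ≤ 1) : ∃ C > 0,
    ∀ N H₁ M H₂ : ℝ, 1 ≤ N →
    N ≤ M → N / 2 ≤ N - H₁ → Real.sqrt N / 2 ≤ H₁ → H₂ ≤ M → Real.sqrt M / 2 ≤ H₂ → ∀ s : ℂ, 1 / 2 + ε ≤ s.re →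
    s.re ≤ 2 →
    ‖∫ t : ℝ, mellin (plateau N H₁ M H₂) ((-(ε / 2) : ℝ) + t * I) * zetaReg (s + ((-(ε / 2) : ℝ) + t * I))‖ ≤
      C * N ^ (-(ε / 4)) * Real.log (2 + |s.im|) := by
  obtain ⟨K, hK, hb⟩ := exists_norm_mellin_plateau_le (θ := ε / 2) (by positivity) (by linarith)
  obtain ⟨D, hD, hd⟩ := norm_zetaReg_le h (ε := ε / 2) (by positivity)
  have hInt : Integrable fun τ : ℝ => (1 + |τ|) ^ (-(1 + ε / 4)) := integrable_one_add_abs_rpow (by linarith)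
  set J := ∫ τ : ℝ, (1 + |τ|) ^ (-(1 + ε / 4))
  have hJ : 0 ≤ J := integral_nonneg fun τ => by positivity
  refine ⟨K * D * (1 + 2 / (ε / 4)) * (J + 1), by positivity, fun N H₁ M H₂ hN hNM hN2 hH1 hM2 hH2 s hs1 hs2 => ?_⟩
  have hN0 : 0 < N ^ (-(ε / 4)) := Real.rpow_pos_of_pos (by linarith) _
  have hlog : 0 < Real.log (2 + |s.im|) := Real.log_pos (by linarith [abs_nonneg s.im])
  have hpt : ∀ τ : ℝ, ‖mellin (plateau N H₁ M H₂) ((-(ε / 2) : ℝ) + τ * I) *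
      zetaReg (s + ((-(ε / 2) : ℝ) + τ * I))‖ ≤
      K * D * (1 + 2 / (ε / 4)) * N ^ (-(ε / 4)) * Real.log (2 + |s.im|) * (1 + |τ|) ^ (-(1 + ε / 4)) := by
    intro τ
    have e1 := hb N H₁ M H₂ hN hNM hN2 hH1 hM2 hH2 τ
    have e2 := hd (s + ((-(ε / 2) : ℝ) + τ * I)) (by simp; linarith) (by simp; linarith)
    have e3 : (s + ((-(ε / 2) : ℝ) + τ * I)).im = s.im + τ := by simp
    rw [e3] at e2
    have e4 := log_two_add_le_mul (κ := ε / 4) (by positivity) s.im τ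
    have hτ : 0 < 1 + |τ| := by positivity
    rw [norm_mul]
    calc _ ≤ (K * N ^ (-(ε / 2 / 2)) * (1 + |τ|) ^ (-(1 + ε / 2))) *
          (D * ((1 + 2 / (ε / 4)) * Real.log (2 + |s.im|) * (1 + |τ|) ^ (ε / 4))) := by
          gcongr
          exact e2.trans (by gcongr)
      _ = _ := by
          rw [show -(ε / 2 / 2) = -(ε / 4) by ring, show -(1 + ε / 4) = -(1 + ε / 2) + ε / 4 by ring,
            Real.rpow_add hτ]
          ring
  have hfin := norm_integral_le_of_norm_le (hInt.const_mul
    (K * D * (1 + 2 / (ε / 4)) * N ^ (-(ε / 4)) * Real.log (2 + |s.im|))) (ae_of_all _ hpt)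
  refine hfin.trans ?_
  rw [integral_const_mul]
  have : 0 < K * D * (1 + 2 / (ε / 4)) * N ^ (-(ε / 4)) * Real.log (2 + |s.im|) := by positivity
  calc _ ≤ K * D * (1 + 2 / (ε / 4)) * N ^ (-(ε / 4)) * Real.log (2 + |s.im|) * (J + 1) := by gcongr; linarith
    _ = _ := by ring

lemma rpow_neg_le_of_half_le {P v σ ε : ℝ} (hP : 4 ≤ P) (hv : P / 2 ≤ v) (hε1 : ε ≤ 1)
    (hε : 0 < ε) (hσ : 1 / 2 + ε ≤ σ) : v ^ (-σ) ≤ 4 * P ^ (-(1 / 2 + ε)) := by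
  calc v ^ (-σ) ≤ v ^ (-(1 / 2 + ε)) := Real.rpow_le_rpow_of_exponent_le (by linarith) (by linarith)
    _ ≤ (P / 2) ^ (-(1 / 2 + ε)) := Real.rpow_le_rpow_of_nonpos (by positivity) hv (by linarith)
    _ = 2 ^ (1 / 2 + ε) * P ^ (-(1 / 2 + ε)) := by
        rw [div_eq_inv_mul, Real.mul_rpow (by positivity) (by positivity), Real.inv_rpow (by positivity),
          ← Real.rpow_neg (by positivity), neg_neg]
    _ ≤ 2 ^ (2 : ℝ) * P ^ (-(1 / 2 + ε)) := by
        gcongr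
        · norm_num
        · linarith
    _ = _ := by norm_num

lemma sum_vonMangoldt_short_le {ε σ : ℝ} (hε : 0 < ε) (hε1 : ε ≤ 1) (hσ : 1 / 2 + ε ≤ σ) {P : ℝ} {A B : ℕ}
    (hP : 4 ≤ P) (hA : P / 2 ≤ A) (hB : (B : ℝ) ≤ 2 * P) (hAB : (B : ℝ) ≤ A + Real.sqrt P) (hAB0 : A ≤ B) :
    ∑ n ∈ Finset.Icc A B, ArithmeticFunction.vonMangoldt n * (n : ℝ) ^ (-σ) ≤ 32 / ε * P ^ (-(ε / 4)) := by
  have hP0 : 0 < P := by linarith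
  have hs2 : 2 ≤ Real.sqrt P := by
    rw [show (2 : ℝ) = Real.sqrt 4 by rw [show (4 : ℝ) = 2 ^ 2 by norm_num]; simp]
    exact Real.sqrt_le_sqrt hP
  have hterm : ∀ n ∈ Finset.Icc A B, ArithmeticFunction.vonMangoldt n * (n : ℝ) ^ (-σ) ≤
      (4 / ε * P ^ (ε / 2)) * (4 * P ^ (-(1 / 2 + ε))) := by
    intro n hn
    rw [Finset.mem_Icc] at hn
    have hnA : P / 2 ≤ n := hA.trans (by exact_mod_cast hn.1)
    have hnB : (n : ℝ) ≤ 2 * P := le_trans (by exact_mod_cast hn.2) hB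
    have h1 := rpow_neg_le_of_half_le hP hnA hε1 hε hσ
    have h2 : ArithmeticFunction.vonMangoldt n ≤ 4 / ε * P ^ (ε / 2) := by
      calc ArithmeticFunction.vonMangoldt n ≤ Real.log n := ArithmeticFunction.vonMangoldt_le_log
        _ ≤ Real.log (2 * P) := Real.log_le_log (by linarith) hnB
        _ ≤ (2 * P) ^ (ε / 2) / (ε / 2) := Real.log_le_rpow_div (by linarith) (by linarith)
        _ = 2 ^ (ε / 2) * P ^ (ε / 2) / (ε / 2) := by rw [Real.mul_rpow (by positivity) hP0.le]
        _ ≤ 2 ^ (1 : ℝ) * P ^ (ε / 2) / (ε / 2) := by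
            gcongr
            · norm_num
            · linarith
        _ = _ := by rw [Real.rpow_one]; field_simp; norm_num
    have : 0 ≤ ArithmeticFunction.vonMangoldt n := ArithmeticFunction.vonMangoldt_nonneg
    gcongr
  refine (Finset.sum_le_card_nsmul _ _ _ hterm).trans ?_
  have hcard : ((Finset.Icc A B).card : ℝ) ≤ 2 * Real.sqrt P := by
    rw [Nat.card_Icc, Nat.cast_sub (by omega)]; push_cast; linarith
  rw [nsmul_eq_mul]
  have hp1 : 0 < P ^ (ε / 2) := Real.rpow_pos_of_pos hP0 _
  have hp2 : 0 < P ^ (-(1 / 2 + ε)) := Real.rpow_pos_of_pos hP0 _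
  calc _ ≤ 2 * Real.sqrt P * ((4 / ε * P ^ (ε / 2)) * (4 * P ^ (-(1 / 2 + ε)))) := by gcongr
    _ = 32 / ε * (Real.sqrt P * P ^ (ε / 2) * P ^ (-(1 / 2 + ε))) := by ring
    _ = 32 / ε * P ^ (-(ε / 2)) := by
        rw [Real.sqrt_eq_rpow, ← Real.rpow_add hP0, ← Real.rpow_add hP0]; congr 2; ring
    _ ≤ _ := by
        gcongr
        · linarith
        · linarith

lemma norm_natCast_cpow_neg {n : ℕ} {s : ℂ} (hs : 0 < s.re) : ‖(n : ℂ) ^ (-s)‖ = (n : ℝ) ^ (-s.re) := by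
  rw [norm_natCast_cpow_of_re_ne_zero _ (by simpa using hs.ne'), neg_re]

/-- Under the Riemann hypothesis for `ζ`, the prime powers in an interval are regular in the half plane
`Re s > 1/2`. -/
lemma exists_norm_sum_vonMangoldt_sub_integral_le (h : RHzeta) {ε : ℝ} (hε : 0 < ε) (hε1 : ε ≤ 1) : ∃ C > 0,
    ∀ s : ℂ, 1 / 2 + ε ≤ s.re → s.re ≤ 2 → ∀ N M : ℕ, 4 ≤ N → N ≤ M →
    ‖∑ n ∈ Finset.Ioc N M, (ArithmeticFunction.vonMangoldt n : ℂ) * (n : ℂ) ^ (-s) -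
      ∫ v in (N : ℝ)..M, (v : ℂ) ^ (-s)‖ ≤ C * (N : ℝ) ^ (-(ε / 4)) * Real.log (2 + |s.im|) := by
  obtain ⟨C, hC, hz⟩ := exists_norm_plateau_zero_term_le h hε hε1
  refine ⟨C + 2 * (3 * (32 / ε) * 2) + 2 * (8 * 2), by positivity, fun s hs1 hs2 N M hN hNM => ?_⟩
  have hN4 : (4 : ℝ) ≤ N := by exact_mod_cast hN
  have hNM' : (N : ℝ) ≤ M := by exact_mod_cast hNM
  have hsqrt : ∀ P : ℕ, 4 ≤ P → Real.sqrt P / 2 ≤ (P.sqrt : ℝ) ∧ (P.sqrt : ℝ) ≤ Real.sqrt P ∧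
      (P.sqrt : ℝ) ≤ P / 2 ∧ 0 < (P.sqrt : ℝ) := by
    intro P hP
    have hP4 : (4 : ℝ) ≤ P := by exact_mod_cast hP
    have h2 : 2 ≤ Real.sqrt P := by
      rw [show (2 : ℝ) = Real.sqrt 4 by rw [show (4 : ℝ) = 2 ^ 2 by norm_num]; simp]
      exact Real.sqrt_le_sqrt hP4
    have h3 := Real.nat_sqrt_le_real_sqrt (a := P)
    have h4 := Real.real_sqrt_lt_nat_sqrt_succ (a := P)
    have h5 := Real.mul_self_sqrt (show (0 : ℝ) ≤ P by positivity)
    refine ⟨by linarith, h3, by nlinarith, by linarith⟩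
  obtain ⟨n1, n2, n3, n4⟩ := hsqrt N hN
  obtain ⟨m1, m2, m3, m4⟩ := hsqrt M (hN.trans hNM)
  set F := plateau N N.sqrt M M.sqrt with hF
  have hAdm : Adm F := adm_plateau n4 m4 (by linarith) hNM'
  have hexp := explicit_formula h hAdm hε hs1 hs2
  have hzt := hz N N.sqrt M M.sqrt (by linarith) hNM' (by linarith) n1 (by linarith) m1 s hs1 hs2
  rw [← hF] at hzt
  have hσ : 0 < s.re := by linarith
  have hNs : N.sqrt ≤ N := Nat.sqrt_le_self N
  have hFz : ∀ v : ℝ, v ∉ Icc ((N : ℝ) - N.sqrt) (M + M.sqrt) → F v = 0 := by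
    intro v hv
    rw [hF, plateau]
    rcases lt_or_ge v ((N : ℝ) - N.sqrt) with h1 | h1
    · rw [step_of_le n4 h1.le, step_of_le m4 (by linarith), sub_self]
    · have h2 : M + M.sqrt < v := by
        by_contra h3; exact hv ⟨h1, by linarith⟩
      rw [step_of_ge n4 (by linarith), step_of_ge m4 h2.le, sub_self]
  have hF1 : ∀ v : ℝ, v ∈ Icc (N : ℝ) M → F v = 1 := fun v hv => plateau_eq_one n4 m4 hv
  have hN0 : 0 < (N : ℝ) ^ (-(ε / 4)) := Real.rpow_pos_of_pos (by linarith) _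
  have hMN : (M : ℝ) ^ (-(ε / 4)) ≤ (N : ℝ) ^ (-(ε / 4)) :=
    Real.rpow_le_rpow_of_nonpos (by linarith) hNM' (by linarith)
  have hlog : 1 / 2 ≤ Real.log (2 + |s.im|) := by
    have := Real.log_two_gt_d9
    have h3 : Real.log 2 ≤ Real.log (2 + |s.im|) :=
      Real.log_le_log (by norm_num) (by linarith [abs_nonneg s.im])
    linarith
  set T := Finset.Icc (N - N.sqrt) (M + M.sqrt) with hT
  have hsum := (hasSum_sum_of_ne_finset_zero (s := T) (f := fun n : ℕ =>
      (ArithmeticFunction.vonMangoldt n : ℂ) * (n : ℂ) ^ (-s) * F n) (by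
      intro n hn
      rw [hFz n, mul_zero]
      intro hn2
      refine hn (Finset.mem_Icc.2 ⟨?_, by exact_mod_cast hn2.2⟩)
      have := hn2.1
      rw [← Nat.cast_sub hNs] at this
      exact_mod_cast this)).unique hexp
  have hsub : Finset.Ioc N M ⊆ T := by
    intro n hn
    rw [Finset.mem_Ioc] at hn
    rw [hT, Finset.mem_Icc]; omega
  have hS : ‖∑ n ∈ Finset.Ioc N M, (ArithmeticFunction.vonMangoldt n : ℂ) * (n : ℂ) ^ (-s) -
      ∑ n ∈ T, (ArithmeticFunction.vonMangoldt n : ℂ) * (n : ℂ) ^ (-s) * F n‖ ≤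
      2 * (3 * (32 / ε)) * (N : ℝ) ^ (-(ε / 4)) := by
    set g : ℕ → ℝ := fun n => ArithmeticFunction.vonMangoldt n * (n : ℝ) ^ (-s.re) with hg
    have hg0 : ∀ n, 0 ≤ g n := fun n =>
      mul_nonneg ArithmeticFunction.vonMangoldt_nonneg (by positivity)
    have hext : ∑ n ∈ Finset.Ioc N M, (ArithmeticFunction.vonMangoldt n : ℂ) * (n : ℂ) ^ (-s) =
        ∑ n ∈ T, if n ∈ Finset.Ioc N M then (ArithmeticFunction.vonMangoldt n : ℂ) * (n : ℂ) ^ (-s) else 0 := by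
      rw [← Finset.sum_filter, Finset.filter_mem_eq_inter, Finset.inter_eq_right.2 hsub]
    rw [hext, ← Finset.sum_sub_distrib]
    have hpt : ∀ n ∈ T, ‖(if n ∈ Finset.Ioc N M then
        (ArithmeticFunction.vonMangoldt n : ℂ) * (n : ℂ) ^ (-s) else 0) -
        (ArithmeticFunction.vonMangoldt n : ℂ) * (n : ℂ) ^ (-s) * F n‖ ≤
        (if n ∈ Finset.Icc (N - N.sqrt) N then 3 * g n else 0) +
        (if n ∈ Finset.Icc M (M + M.sqrt) then 3 * g n else 0) := by
      intro n hn
      have hgn : ‖(ArithmeticFunction.vonMangoldt n : ℂ) * (n : ℂ) ^ (-s)‖ = g n := by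
        rw [norm_mul, norm_natCast_cpow_neg hσ, norm_real, Real.norm_eq_abs,
          abs_of_nonneg ArithmeticFunction.vonMangoldt_nonneg]
      by_cases hmid : n ∈ Finset.Ioc N M
      · have := Finset.mem_Ioc.1 hmid
        rw [if_pos hmid, hF1 n ⟨by exact_mod_cast this.1.le, by exact_mod_cast this.2⟩, mul_one, sub_self,
          norm_zero]
        have := hg0 n
        split_ifs <;> linarith
      · rw [if_neg hmid, zero_sub, norm_neg, norm_mul, hgn]
        have e1 : ‖F n‖ ≤ 2 := norm_plateau_le _ _ _ _ _
        have e2 := hg0 n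
        have e3 : g n * ‖F n‖ ≤ 3 * g n := by nlinarith
        rw [hT, Finset.mem_Icc] at hn
        rw [Finset.mem_Ioc] at hmid
        have : n ∈ Finset.Icc (N - N.sqrt) N ∨ n ∈ Finset.Icc M (M + M.sqrt) := by
          simp only [Finset.mem_Icc]; omega
        rcases this with h' | h'
        · rw [if_pos h']; split_ifs <;> linarith
        · rw [if_pos h']; split_ifs <;> linarith
    refine (norm_sum_le_of_le _ hpt).trans ?_
    rw [Finset.sum_add_distrib]
    have hle : ∀ U : Finset ℕ, ∑ n ∈ T, (if n ∈ U then 3 * g n else 0) ≤ 3 * ∑ n ∈ U, g n := by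
      intro U
      rw [← Finset.sum_filter, Finset.mul_sum]
      refine Finset.sum_le_sum_of_subset_of_nonneg (fun n hn => (Finset.mem_filter.1 hn).2) fun n _ _ => ?_
      linarith [hg0 n]
    have f1 := sum_vonMangoldt_short_le (A := N - N.sqrt) (B := N) hε hε1 hs1 hN4
      (by rw [Nat.cast_sub hNs]; linarith) (by linarith) (by rw [Nat.cast_sub hNs]; linarith) (by omega)
    have f2 := sum_vonMangoldt_short_le (A := M) (B := M + M.sqrt) hε hε1 hs1 (hN4.trans hNM')
      (by linarith) (by push_cast; linarith) (by push_cast; linarith) (by omega)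
    have := hle (Finset.Icc (N - N.sqrt) N)
    have := hle (Finset.Icc M (M + M.sqrt))
    have f3 : 32 / ε * (M : ℝ) ^ (-(ε / 4)) ≤ 32 / ε * (N : ℝ) ^ (-(ε / 4)) := by gcongr
    linarith
  have hcont : ContinuousOn (fun v : ℝ => (v : ℂ) ^ (-s) * F v) (Icc ((N : ℝ) - N.sqrt) (M + M.sqrt)) := by
    refine ContinuousOn.mul ?_ hAdm.toCut.continuous.continuousOn
    intro v hv
    have : 0 < v := by linarith [hv.1]
    exact (continuousAt_ofReal_cpow_const _ _ (Or.inr this.ne')).continuousWithinAt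
  have hii : ∀ p q : ℝ, (N : ℝ) - N.sqrt ≤ p → p ≤ q → q ≤ M + M.sqrt →
      IntervalIntegrable (fun v : ℝ => (v : ℂ) ^ (-s) * F v) volume p q := by
    intro p q h1 h2 h3
    refine ContinuousOn.intervalIntegrable ?_
    rw [uIcc_of_le h2]
    exact hcont.mono (Icc_subset_Icc h1 h3)
  have hI0 : ∫ v in Ioi (1 : ℝ), (v : ℂ) ^ (-s) * F v =
      ∫ v in ((N : ℝ) - N.sqrt)..(M + M.sqrt), (v : ℂ) ^ (-s) * F v := by
    rw [intervalIntegral.integral_of_le (by linarith), ← integral_Icc_eq_integral_Ioc]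
    symm
    refine (setIntegral_eq_of_subset_of_forall_sdiff_eq_zero measurableSet_Ioi
      (fun v hv => ?_) fun v hv => ?_).symm
    · show 1 < v
      linarith [hv.1]
    · rw [hFz v hv.2, mul_zero]
  have hI1 : ∫ v in ((N : ℝ) - N.sqrt)..(M + M.sqrt), (v : ℂ) ^ (-s) * F v =
      (∫ v in ((N : ℝ) - N.sqrt)..N, (v : ℂ) ^ (-s) * F v) + (∫ v in (N : ℝ)..M, (v : ℂ) ^ (-s)) +
      ∫ v in (M : ℝ)..(M + M.sqrt), (v : ℂ) ^ (-s) * F v := by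
    rw [← intervalIntegral.integral_add_adjacent_intervals (hii _ M (by linarith) (by linarith) (by linarith))
        (hii M _ (by linarith) (by linarith) (by linarith)),
      ← intervalIntegral.integral_add_adjacent_intervals (hii _ N (by linarith) (by linarith) (by linarith))
        (hii N M (by linarith) (by linarith) (by linarith))]
    congr 2
    refine intervalIntegral.integral_congr fun v hv => ?_
    rw [uIcc_of_le hNM'] at hv
    simp only [hF1 v hv, mul_one]
  have hedge : ∀ P p q : ℝ, 4 ≤ P → P / 2 ≤ p → p ≤ q → q ≤ p + Real.sqrt P →
      ‖∫ v in p..q, (v : ℂ) ^ (-s) * F v‖ ≤ 8 * P ^ (-(ε / 4)) := by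
    intro P p q hP hp hpq hq
    have hP0 : 0 < P := by linarith
    have hP2 : 0 < P ^ (-(1 / 2 + ε)) := Real.rpow_pos_of_pos hP0 _
    have := intervalIntegral.norm_integral_le_of_norm_le_const (a := p) (b := q)
      (C := 4 * P ^ (-(1 / 2 + ε)) * 2) (f := fun v : ℝ => (v : ℂ) ^ (-s) * F v) (by
        intro v hv
        rw [uIoc_of_le hpq] at hv
        have hv0 : 0 < v := by linarith [hv.1]
        rw [norm_mul, norm_cpow_eq_rpow_re_of_pos hv0, neg_re]
        have e1 := rpow_neg_le_of_half_le hP (by linarith [hv.1] : P / 2 ≤ v) hε1 hε hs1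
        have e2 : ‖F v‖ ≤ 2 := norm_plateau_le _ _ _ _ _
        gcongr)
    refine this.trans ?_
    rw [abs_of_nonneg (by linarith)]
    calc _ ≤ 4 * P ^ (-(1 / 2 + ε)) * 2 * Real.sqrt P := by gcongr; linarith
      _ = 8 * (P ^ (-(1 / 2 + ε)) * P ^ (1 / 2 : ℝ)) := by rw [Real.sqrt_eq_rpow]; ring
      _ = 8 * P ^ (-ε) := by rw [← Real.rpow_add hP0]; congr 2; ring
      _ ≤ _ := by
          gcongr
          · linarith
          · linarith
  have g1 := hedge N (N - N.sqrt) N hN4 (by linarith) (by linarith) (by linarith)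
  have g2 := hedge M M (M + M.sqrt) (hN4.trans hNM') (by linarith) (by linarith) (by linarith)
  have hZ : ‖(1 / (2 * Real.pi) : ℂ) * ∫ t : ℝ, mellin F ((-(ε / 2) : ℝ) + t * I) *
      zetaReg (s + ((-(ε / 2) : ℝ) + t * I))‖ ≤ C * (N : ℝ) ^ (-(ε / 4)) * Real.log (2 + |s.im|) := by
    rw [norm_mul]
    have : ‖(1 / (2 * Real.pi) : ℂ)‖ ≤ 1 := by
      rw [show (1 / (2 * Real.pi) : ℂ) = ((1 / (2 * Real.pi) : ℝ) : ℂ) by push_cast; ring, norm_real,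
        Real.norm_eq_abs, abs_of_nonneg (by positivity), div_le_one (by positivity)]
      linarith [Real.pi_gt_three]
    exact (mul_le_mul this hzt (norm_nonneg _) zero_le_one).trans (one_mul _).le
  rw [hI0, hI1] at hsum
  rw [hsum] at hS
  set Z := (1 / (2 * Real.pi) : ℂ) * ∫ t : ℝ, mellin F ((-(ε / 2) : ℝ) + t * I) *
      zetaReg (s + ((-(ε / 2) : ℝ) + t * I))
  set S := ∑ n ∈ Finset.Ioc N M, (ArithmeticFunction.vonMangoldt n : ℂ) * (n : ℂ) ^ (-s)
  set E1 := ∫ v in ((N : ℝ) - N.sqrt)..N, (v : ℂ) ^ (-s) * F v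
  set E2 := ∫ v in (M : ℝ)..(M + M.sqrt), (v : ℂ) ^ (-s) * F v
  set J := ∫ v in (N : ℝ)..M, (v : ℂ) ^ (-s)
  have htri : ‖S - J‖ ≤ ‖S - (E1 + J + E2 + Z)‖ + ‖E1‖ + ‖E2‖ + ‖Z‖ := by
    calc ‖S - J‖ = ‖(S - (E1 + J + E2 + Z)) + E1 + E2 + Z‖ := by congr 1; ring
      _ ≤ _ := (norm_add_le _ _).trans (by gcongr; exact (norm_add_le _ _).trans (by gcongr; exact norm_add_le _ _))
  have hn1 : (N : ℝ) ^ (-(ε / 4)) ≤ 2 * ((N : ℝ) ^ (-(ε / 4)) * Real.log (2 + |s.im|)) := by nlinarith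
  have h32 : 2 * (3 * (32 / ε)) * (N : ℝ) ^ (-(ε / 4)) ≤
      2 * (3 * (32 / ε)) * (2 * ((N : ℝ) ^ (-(ε / 4)) * Real.log (2 + |s.im|))) := by gcongr
  calc ‖S - J‖ ≤ 2 * (3 * (32 / ε)) * (2 * ((N : ℝ) ^ (-(ε / 4)) * Real.log (2 + |s.im|))) +
      8 * (2 * ((N : ℝ) ^ (-(ε / 4)) * Real.log (2 + |s.im|))) +
      8 * (2 * ((N : ℝ) ^ (-(ε / 4)) * Real.log (2 + |s.im|))) +
      C * (N : ℝ) ^ (-(ε / 4)) * Real.log (2 + |s.im|) := by linarith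
    _ = _ := by ring

lemma sum_rpow_Icc_two_le {r : ℝ} (hr : 0 ≤ r) (hr1 : r ≤ 3 / 4) (M : ℕ) :
    ∑ k ∈ Finset.Icc 2 M, r ^ k ≤ 4 * r ^ 2 := by
  have h1 : ∑ k ∈ Finset.Icc 2 M, r ^ k ≤ ∑ k ∈ Finset.range M, r ^ (k + 2) := by
    rw [← Finset.sum_image (s := Finset.range M) (g := fun k => k + 2) (f := fun k => r ^ k) (by simp)]
    refine Finset.sum_le_sum_of_subset_of_nonneg (fun k hk => ?_) fun k _ _ => by positivity
    rw [Finset.mem_Icc] at hk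
    exact Finset.mem_image.2 ⟨k - 2, Finset.mem_range.2 (by omega), by omega⟩
  refine h1.trans ?_
  simp_rw [pow_add]
  rw [← Finset.sum_mul]
  have h2 : ∑ k ∈ Finset.range M, r ^ k ≤ 4 := by
    have := (summable_geometric_of_lt_one hr (by linarith)).sum_le_tsum (Finset.range M) (fun k _ => by positivity)
    rw [tsum_geometric_of_lt_one hr (by linarith)] at this
    refine this.trans ?_
    rw [inv_le_comm₀ (by linarith) (by norm_num)]; linarith
  gcongr

lemma two_rpow_neg_half_le {p : ℕ} (hp : p.Prime) {σ : ℝ} (hσ : 1 / 2 ≤ σ) : (p : ℝ) ^ (-σ) ≤ 3 / 4 := by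
  have h2 : (2 : ℝ) ≤ p := by exact_mod_cast hp.two_le
  calc (p : ℝ) ^ (-σ) ≤ (2 : ℝ) ^ (-σ) := Real.rpow_le_rpow_of_nonpos (by norm_num) h2 (by linarith)
    _ ≤ (2 : ℝ) ^ (-(1 / 2) : ℝ) := Real.rpow_le_rpow_of_exponent_le (by norm_num) (by linarith)
    _ = (Real.sqrt 2)⁻¹ := by rw [Real.rpow_neg (by norm_num), Real.sqrt_eq_rpow]
    _ ≤ 3 / 4 := by
        rw [inv_le_comm₀ (by positivity) (by norm_num)]
        exact Real.le_sqrt_of_sq_le (by norm_num)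

lemma exists_sum_log_mul_rpow_le {ε : ℝ} (hε : 0 < ε) : ∃ C > 0, ∀ S : Finset ℕ,
    ∑ n ∈ S, (1 + Real.log n) * (n : ℝ) ^ (-(1 + ε)) ≤ C := by
  have hs : Summable fun n : ℕ => (n : ℝ) ^ (-(1 + ε / 2)) := Real.summable_nat_rpow.2 (by linarith)
  have hpt : ∀ n : ℕ, (1 + Real.log n) * (n : ℝ) ^ (-(1 + ε)) ≤ (1 + 2 / ε) * (n : ℝ) ^ (-(1 + ε / 2)) := by
    intro n
    rcases Nat.eq_zero_or_pos n with rfl | hn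
    · rw [Nat.cast_zero, Real.zero_rpow (by linarith), Real.zero_rpow (by linarith)]; simp
    · have hn1 : (1 : ℝ) ≤ n := by exact_mod_cast hn
      have h1 := Real.log_le_rpow_div (x := n) (by linarith) (half_pos hε)
      have h2 : 1 ≤ (n : ℝ) ^ (ε / 2) := Real.one_le_rpow hn1 (by linarith)
      have h3 : 1 + Real.log n ≤ (1 + 2 / ε) * (n : ℝ) ^ (ε / 2) := by
        rw [div_div_eq_mul_div, mul_div_assoc, mul_comm] at h1
        linarith [show (1 + 2 / ε) * (n : ℝ) ^ (ε / 2) = (n : ℝ) ^ (ε / 2) + 2 / ε * (n : ℝ) ^ (ε / 2) by ring]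
      calc _ ≤ (1 + 2 / ε) * (n : ℝ) ^ (ε / 2) * (n : ℝ) ^ (-(1 + ε)) := by gcongr
        _ = _ := by rw [mul_assoc, ← Real.rpow_add (by linarith)]; congr 2; ring
  refine ⟨(1 + 2 / ε) * (∑' n : ℕ, (n : ℝ) ^ (-(1 + ε / 2))) + 1, ?_, fun S => ?_⟩
  · have : 0 ≤ ∑' n : ℕ, (n : ℝ) ^ (-(1 + ε / 2)) := tsum_nonneg fun n => by positivity
    positivity
  · calc _ ≤ ∑ n ∈ S, (1 + 2 / ε) * (n : ℝ) ^ (-(1 + ε / 2)) := Finset.sum_le_sum fun n _ => hpt n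
      _ = (1 + 2 / ε) * ∑ n ∈ S, (n : ℝ) ^ (-(1 + ε / 2)) := by rw [Finset.mul_sum]
      _ ≤ (1 + 2 / ε) * (∑' n : ℕ, (n : ℝ) ^ (-(1 + ε / 2))) := by
          gcongr
          exact hs.sum_le_tsum S fun n _ => by positivity
      _ ≤ _ := by linarith

/-- Proper prime powers contribute a bounded amount to the right of `1/2`. -/
lemma exists_sum_not_prime_vonMangoldt_le {ε : ℝ} (hε : 0 < ε) : ∃ C > 0, ∀ σ, 1 / 2 + ε ≤ σ → ∀ N M : ℕ,
    ∑ n ∈ (Finset.Ioc N M).filter (fun n => ¬ n.Prime), ArithmeticFunction.vonMangoldt n * (n : ℝ) ^ (-σ) ≤ C := by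
  obtain ⟨C, hC, hb⟩ := exists_sum_log_mul_rpow_le (ε := 2 * ε) (by positivity)
  refine ⟨4 * C, by positivity, fun σ hσ N M => ?_⟩
  set f : ℕ → ℝ := fun n => ArithmeticFunction.vonMangoldt n * (n : ℝ) ^ (-σ) with hf
  have hf0 : ∀ n, 0 ≤ f n := fun n => mul_nonneg ArithmeticFunction.vonMangoldt_nonneg (by positivity)
  set S := ((Finset.range (M + 1)).filter Nat.Prime) ×ˢ Finset.Icc 2 M with hS
  have h1 : ∑ n ∈ (Finset.Ioc N M).filter (fun n => ¬ n.Prime), f n ≤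
      ∑ n ∈ S.image (fun q : ℕ × ℕ => q.1 ^ q.2), f n := by
    rw [← Finset.sum_filter_ne_zero]
    refine Finset.sum_le_sum_of_subset_of_nonneg (fun n hn => ?_) fun n _ _ => hf0 n
    simp only [Finset.mem_filter, Finset.mem_Ioc] at hn
    obtain ⟨⟨⟨_, hnM⟩, hnp⟩, hn0⟩ := hn
    have hL : ArithmeticFunction.vonMangoldt n ≠ 0 := fun h0 => hn0 (by rw [hf]; simp [h0])
    rw [ArithmeticFunction.vonMangoldt_ne_zero_iff, isPrimePow_nat_iff] at hL
    obtain ⟨p, k, hp, hk, rfl⟩ := hL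
    refine Finset.mem_image.2 ⟨(p, k), ?_, rfl⟩
    have hk2 : 2 ≤ k := by
      rcases Nat.lt_or_ge k 2 with h | h
      · exfalso; apply hnp
        have : k = 1 := by omega
        rwa [this, pow_one]
      · exact h
    simp only [hS, Finset.mem_product, Finset.mem_filter, Finset.mem_range, Finset.mem_Icc]
    refine ⟨⟨?_, hp⟩, hk2, ?_⟩
    · have := Nat.le_self_pow hk.ne' p; omega
    · have := (Nat.lt_pow_self hp.one_lt (n := k)); omega
  have h2 : ∑ n ∈ S.image (fun q : ℕ × ℕ => q.1 ^ q.2), f n ≤ ∑ q ∈ S, f (q.1 ^ q.2) :=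
    Finset.sum_image_le_of_nonneg (fun q _ => hf0 _)
  refine h1.trans (h2.trans ?_)
  rw [hS, Finset.sum_product]
  have h3 : ∀ p ∈ (Finset.range (M + 1)).filter Nat.Prime, ∑ k ∈ Finset.Icc 2 M, f (p ^ k) ≤
      4 * ((1 + Real.log p) * (p : ℝ) ^ (-(1 + 2 * ε))) := by
    intro p hp
    have hp' := (Finset.mem_filter.1 hp).2
    have hp1 : (1 : ℝ) ≤ p := by exact_mod_cast hp'.one_lt.le
    have hlog : 0 ≤ Real.log p := Real.log_nonneg hp1
    have e1 : ∀ k ∈ Finset.Icc 2 M, f (p ^ k) = Real.log p * ((p : ℝ) ^ (-σ)) ^ k := by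
      intro k hk
      have hk0 : k ≠ 0 := by have := (Finset.mem_Icc.1 hk).1; omega
      rw [hf]
      simp only [Nat.cast_pow]
      rw [ArithmeticFunction.vonMangoldt_apply_pow hk0, ArithmeticFunction.vonMangoldt_apply_prime hp',
        ← Real.rpow_natCast, ← Real.rpow_mul (by linarith), ← Real.rpow_natCast, ← Real.rpow_mul (by linarith)]
      congr 2; ring
    rw [Finset.sum_congr rfl e1, ← Finset.mul_sum]
    have e2 := sum_rpow_Icc_two_le (r := (p : ℝ) ^ (-σ)) (by positivity)
      (two_rpow_neg_half_le hp' (by linarith)) M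
    have e3 : ((p : ℝ) ^ (-σ)) ^ 2 ≤ (p : ℝ) ^ (-(1 + 2 * ε)) := by
      rw [← Real.rpow_natCast, ← Real.rpow_mul (by linarith)]
      exact Real.rpow_le_rpow_of_exponent_le hp1 (by push_cast; linarith)
    have e4 : 0 < (p : ℝ) ^ (-(1 + 2 * ε)) := by positivity
    calc _ ≤ Real.log p * (4 * (p : ℝ) ^ (-(1 + 2 * ε))) := by gcongr; exact e2.trans (by linarith)
      _ ≤ _ := by nlinarith
  refine (Finset.sum_le_sum h3).trans ?_
  rw [← Finset.mul_sum]
  gcongr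
  exact hb _

/-- Under the Riemann hypothesis for `ζ`, the primes in an interval are regular to the right of `1/2`. -/
lemma exists_norm_sum_prime_sub_integral_le (h : RHzeta) {ε : ℝ} (hε : 0 < ε) (hε1 : ε ≤ 1) : ∃ C > 0,
    ∀ s : ℂ, 1 / 2 + ε ≤ s.re → s.re ≤ 2 → ∀ N M : ℕ, 4 ≤ N → N ≤ M →
    ‖∑ n ∈ (Finset.Ioc N M).filter Nat.Prime, (Real.log n : ℂ) * (n : ℂ) ^ (-s) -
      ∫ v in (N : ℝ)..M, (v : ℂ) ^ (-s)‖ ≤ C * Real.log (2 + |s.im|) := by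
  obtain ⟨C1, hC1, h1⟩ := exists_norm_sum_vonMangoldt_sub_integral_le h hε hε1
  obtain ⟨C2, hC2, h2⟩ := exists_sum_not_prime_vonMangoldt_le hε
  refine ⟨C1 + 2 * C2, by positivity, fun s hs1 hs2 N M hN hNM => ?_⟩
  have e1 := h1 s hs1 hs2 N M hN hNM
  have e2 := h2 s.re hs1 N M
  have hN4 : (4 : ℝ) ≤ N := by exact_mod_cast hN
  have hlog : 1 / 2 ≤ Real.log (2 + |s.im|) := by
    have := Real.log_two_gt_d9
    have h3 : Real.log 2 ≤ Real.log (2 + |s.im|) :=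
      Real.log_le_log (by norm_num) (by linarith [abs_nonneg s.im])
    linarith
  have hsplit : ∑ n ∈ Finset.Ioc N M, (ArithmeticFunction.vonMangoldt n : ℂ) * (n : ℂ) ^ (-s) =
      ∑ n ∈ (Finset.Ioc N M).filter Nat.Prime, (Real.log n : ℂ) * (n : ℂ) ^ (-s) +
      ∑ n ∈ (Finset.Ioc N M).filter (fun n => ¬ n.Prime), (ArithmeticFunction.vonMangoldt n : ℂ) * (n : ℂ) ^ (-s) := by
    rw [← Finset.sum_filter_add_sum_filter_not (Finset.Ioc N M) Nat.Prime]
    congr 1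
    refine Finset.sum_congr rfl fun n hn => ?_
    rw [ArithmeticFunction.vonMangoldt_apply_prime (Finset.mem_filter.1 hn).2]
  have e3 : ‖∑ n ∈ (Finset.Ioc N M).filter (fun n => ¬ n.Prime),
      (ArithmeticFunction.vonMangoldt n : ℂ) * (n : ℂ) ^ (-s)‖ ≤ C2 := by
    refine (norm_sum_le _ _).trans (le_trans (le_of_eq (Finset.sum_congr rfl fun n hn => ?_)) e2)
    rw [norm_mul, norm_natCast_cpow_neg (by linarith), norm_real, Real.norm_eq_abs,
      abs_of_nonneg ArithmeticFunction.vonMangoldt_nonneg]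
  rw [hsplit] at e1
  have e4 : C1 * (N : ℝ) ^ (-(ε / 4)) * Real.log (2 + |s.im|) ≤ C1 * Real.log (2 + |s.im|) := by
    have : (N : ℝ) ^ (-(ε / 4)) ≤ 1 := Real.rpow_le_one_of_one_le_of_nonpos (by linarith) (by linarith)
    gcongr
    nlinarith
  set A := ∑ n ∈ (Finset.Ioc N M).filter Nat.Prime, (Real.log n : ℂ) * (n : ℂ) ^ (-s)
  set B := ∑ n ∈ (Finset.Ioc N M).filter (fun n => ¬ n.Prime), (ArithmeticFunction.vonMangoldt n : ℂ) * (n : ℂ) ^ (-s)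
  calc ‖A - ∫ v in (N : ℝ)..M, (v : ℂ) ^ (-s)‖ = ‖(A + B - ∫ v in (N : ℝ)..M, (v : ℂ) ^ (-s)) - B‖ := by
        congr 1; ring
    _ ≤ C1 * Real.log (2 + |s.im|) + C2 := (norm_sub_le _ _).trans (by linarith)
    _ ≤ _ := by nlinarith

/-- Abel's inequality. -/
lemma norm_sum_Ioc_mul_le_of_antitone {a : ℕ → ℂ} {w : ℕ → ℝ} {K : ℕ} {A : ℝ}
    (hw : ∀ n, K ≤ n → w (n + 1) ≤ w n) (hw0 : ∀ n, K ≤ n → 0 ≤ w n) {M : ℕ} (hKM : K ≤ M)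
    (hA : ∀ n, K ≤ n → n ≤ M → ‖∑ k ∈ Finset.Ioc K n, a k‖ ≤ A) :
    ‖∑ k ∈ Finset.Ioc K M, (w k : ℂ) * a k‖ ≤ A * w K := by
  have key : ∀ n, K ≤ n → n ≤ M → ‖∑ k ∈ Finset.Ioc K n, (w k : ℂ) * a k - w n * ∑ k ∈ Finset.Ioc K n, a k‖ ≤
      A * (w K - w n) := by
    intro n hn
    induction n, hn using Nat.le_induction with
    | base => intro _; simp
    | succ n hn ih =>
      intro hM
      have e1 := ih (by omega)
      have e2 := hA n hn (by omega)
      rw [Finset.sum_Ioc_succ_top hn, Finset.sum_Ioc_succ_top hn]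
      set S := ∑ k ∈ Finset.Ioc K n, a k
      set T := ∑ k ∈ Finset.Ioc K n, (w k : ℂ) * a k
      calc _ = ‖(T - w n * S) + ((w n - w (n + 1) : ℝ) : ℂ) * S‖ := by congr 1; push_cast; ring
        _ ≤ A * (w K - w n) + (w n - w (n + 1)) * A := by
            refine (norm_add_le _ _).trans (add_le_add e1 ?_)
            rw [norm_mul, norm_real, Real.norm_eq_abs, abs_of_nonneg (by linarith [hw n hn])]
            exact mul_le_mul_of_nonneg_left e2 (by linarith [hw n hn])
        _ = _ := by ring
  have h1 := key M hKM le_rfl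
  have h2 := hA M hKM le_rfl
  have h3 := hw0 M hKM
  calc _ = ‖(∑ k ∈ Finset.Ioc K M, (w k : ℂ) * a k - w M * ∑ k ∈ Finset.Ioc K M, a k) +
        w M * ∑ k ∈ Finset.Ioc K M, a k‖ := by congr 1; ring
    _ ≤ A * (w K - w M) + w M * A := by
        refine (norm_add_le _ _).trans (add_le_add h1 ?_)
        rw [norm_mul, norm_real, Real.norm_eq_abs, abs_of_nonneg h3]
        gcongr
    _ = _ := by ring

/-- The partial Euler product of `ζ` over the primes `p ≤ N`. -/
def smoothZeta (N : ℕ) (s : ℂ) : ℂ := ∏ p ∈ Nat.primesBelow (N + 1), (1 - (p : ℂ) ^ (-s))⁻¹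

lemma norm_one_sub_inv_le {z : ℂ} (hz : ‖z‖ ≤ 3 / 4) : ‖(1 - z)⁻¹‖ ≤ Real.exp (z.re + 2 * ‖z‖ ^ 2) := by
  have hne : 1 - z ≠ 0 := by
    intro h0
    have : z = 1 := by linear_combination -h0
    rw [this] at hz; norm_num at hz
  have h1 := Complex.norm_log_one_add_sub_self_le (z := -z) (by rw [norm_neg]; linarith)
  rw [norm_neg, ← sub_eq_add_neg] at h1
  have h2 : (1 - ‖z‖)⁻¹ ≤ 4 := by
    rw [inv_le_comm₀ (by linarith) (by norm_num)]; linarith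
  have h3 : ‖Complex.log (1 - z) - -z‖ ≤ 2 * ‖z‖ ^ 2 := by
    refine h1.trans ?_
    nlinarith [sq_nonneg ‖z‖]
  have h4 := (Complex.abs_re_le_norm (Complex.log (1 - z) - -z)).trans h3
  rw [abs_le] at h4
  simp only [sub_re, neg_re] at h4
  rw [← Complex.exp_log (inv_ne_zero hne), Complex.norm_exp]
  rw [Real.exp_le_exp, Complex.log_re, norm_inv, Real.log_inv]
  rw [Complex.log_re] at h4
  linarith [h4.1]

lemma norm_prime_cpow_neg_le {p : ℕ} (hp : p.Prime) {s : ℂ} (hs : 1 / 2 ≤ s.re) : ‖(p : ℂ) ^ (-s)‖ ≤ 3 / 4 := by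
  rw [norm_natCast_cpow_neg (by linarith)]
  exact two_rpow_neg_half_le hp hs

lemma norm_integral_cpow_le {s : ℂ} (hs1 : 1 / 2 ≤ s.re) {K M : ℝ} (hK : 1 ≤ K) (hKM : K ≤ M)
    (ht : Real.sqrt M ≤ |s.im|) : ‖∫ v in K..M, (v : ℂ) ^ (-s)‖ ≤ 2 := by
  have hM : 1 ≤ Real.sqrt M := Real.one_le_sqrt.2 (hK.trans hKM)
  have him : 0 < |s.im| := by linarith
  rw [integral_cpow (Or.inr ⟨?_, ?_⟩)]
  · have hden : |s.im| ≤ ‖-s + 1‖ := by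
      have := abs_im_le_norm (-s + 1)
      simpa using this
    have hpow : ∀ v : ℝ, 1 ≤ v → v ≤ M → ‖(v : ℂ) ^ (-s + 1)‖ ≤ |s.im| := by
      intro v hv hvM
      rw [norm_cpow_eq_rpow_re_of_pos (by linarith)]
      calc v ^ (-s + 1).re ≤ v ^ (1 / 2 : ℝ) := Real.rpow_le_rpow_of_exponent_le hv (by simp; linarith)
        _ = Real.sqrt v := by rw [Real.sqrt_eq_rpow]
        _ ≤ Real.sqrt M := Real.sqrt_le_sqrt hvM
        _ ≤ _ := ht
    rw [norm_div, div_le_iff₀ (by linarith)]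
    calc _ ≤ |s.im| + |s.im| := (norm_sub_le _ _).trans
          (add_le_add (hpow M (hK.trans hKM) le_rfl) (hpow K hK hKM))
      _ ≤ _ := by linarith
  · intro h0
    have := congrArg Complex.im h0
    simp at this
    rw [this] at him; simp at him
  · rw [uIcc_of_le hKM]; intro h0; linarith [h0.1]

/-- Under the Riemann hypothesis for `ζ`, the partial Euler products have subpolynomial growth
in the half plane `Re s > 1/2`, once the height exceeds the square root of the length. -/
lemma exists_norm_smoothZeta_le (h : RHzeta) {ε η : ℝ} (hε : 0 < ε) (hε1 : ε ≤ 1) (hη : 0 < η) : ∃ C > 0,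
    ∀ (N : ℕ) (s : ℂ), 1 / 2 + ε ≤ s.re → s.re ≤ 1 → Real.sqrt N ≤ |s.im| → 1 ≤ |s.im| →
    ‖smoothZeta N s‖ ≤ C * |s.im| ^ η := by
  obtain ⟨D, hD, hblock⟩ := exists_norm_sum_prime_sub_integral_le h hε hε1
  obtain ⟨E, hE, hsq⟩ := exists_sum_log_mul_rpow_le (ε := 2 * ε) (by positivity)
  set K : ℕ := ⌈Real.exp (D / η)⌉₊ + 4 with hK
  have hK4 : 4 ≤ K := by omega
  have hKr : (4 : ℝ) ≤ K := by exact_mod_cast hK4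
  have hlogK : D / η ≤ Real.log K := by
    rw [Real.le_log_iff_exp_le (by linarith)]
    have := Nat.le_ceil (Real.exp (D / η))
    rw [hK]; push_cast; linarith
  have hlogK1 : 1 ≤ Real.log K := by
    rw [Real.le_log_iff_exp_le (by linarith)]
    linarith [Real.exp_one_lt_d9]
  refine ⟨Real.exp ((K + 1) + (η * Real.log 3 + 2) + 2 * E), by positivity, fun N s hs1 hs2 hN ht => ?_⟩
  have hσ : 1 / 2 ≤ s.re := by linarith
  have hprod : ‖smoothZeta N s‖ ≤ Real.exp (∑ p ∈ Nat.primesBelow (N + 1),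
      (((p : ℂ) ^ (-s)).re + 2 * ‖(p : ℂ) ^ (-s)‖ ^ 2)) := by
    rw [smoothZeta, norm_prod, Real.exp_sum]
    exact Finset.prod_le_prod (fun _ _ => norm_nonneg _) fun p hp =>
      norm_one_sub_inv_le (norm_prime_cpow_neg_le (Nat.prime_of_mem_primesBelow hp) hσ)
  refine hprod.trans ?_
  have hQ : ∑ p ∈ Nat.primesBelow (N + 1), ‖(p : ℂ) ^ (-s)‖ ^ 2 ≤ E := by
    refine (Finset.sum_le_sum fun p hp => ?_).trans (hsq (Nat.primesBelow (N + 1)))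
    have hp1 : (1 : ℝ) ≤ p := by exact_mod_cast (Nat.prime_of_mem_primesBelow hp).one_lt.le
    rw [norm_natCast_cpow_neg (by linarith), ← Real.rpow_natCast, ← Real.rpow_mul (by linarith)]
    have e1 : (p : ℝ) ^ (-s.re * (2 : ℕ)) ≤ (p : ℝ) ^ (-(1 + 2 * ε)) :=
      Real.rpow_le_rpow_of_exponent_le hp1 (by push_cast; linarith)
    have e2 : 0 < (p : ℝ) ^ (-(1 + 2 * ε)) := by positivity
    nlinarith [Real.log_nonneg hp1]
  have hsum : ‖∑ p ∈ Nat.primesBelow (N + 1), (p : ℂ) ^ (-s)‖ ≤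
      (K + 1) + (η * Real.log 3 + 2 + η * Real.log |s.im|) := by
    rw [← Finset.sum_filter_add_sum_filter_not (Nat.primesBelow (N + 1)) (fun p => p ≤ K)]
    refine (norm_add_le _ _).trans (add_le_add ?_ ?_)
    · refine (norm_sum_le_of_le (n := fun _ => (1 : ℝ)) _ fun p hp => ?_).trans ?_
      · have := norm_prime_cpow_neg_le (Nat.prime_of_mem_primesBelow (Finset.mem_filter.1 hp).1) hσ
        linarith
      · rw [Finset.sum_const, nsmul_eq_mul, mul_one]
        have : ((Nat.primesBelow (N + 1)).filter fun p => p ≤ K).card ≤ (Finset.range (K + 1)).card :=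
          Finset.card_le_card fun p hp => Finset.mem_range.2 (by have := (Finset.mem_filter.1 hp).2; omega)
        rw [Finset.card_range] at this
        exact_mod_cast this
    · have hset : (Nat.primesBelow (N + 1)).filter (fun p => ¬ p ≤ K) = (Finset.Ioc K N).filter Nat.Prime := by
        ext p
        simp only [Nat.primesBelow, Finset.mem_filter, Finset.mem_range, Finset.mem_Ioc]
        constructor
        · rintro ⟨⟨h1, h2⟩, h3⟩; exact ⟨⟨by omega, by omega⟩, h2⟩
        · rintro ⟨⟨h1, h2⟩, h3⟩; exact ⟨⟨by omega, h3⟩, by omega⟩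
      rw [hset]
      have hlt : 0 ≤ Real.log |s.im| := Real.log_nonneg ht
      have hl3 : 0 ≤ Real.log 3 := Real.log_nonneg (by norm_num)
      rcases Nat.lt_or_ge N K with hNK | hKN
      · rw [Finset.Ioc_eq_empty (by omega), Finset.filter_empty, Finset.sum_empty, norm_zero]
        have := mul_nonneg hη.le hl3
        have := mul_nonneg hη.le hlt
        linarith
      have habel := norm_sum_Ioc_mul_le_of_antitone (K := K) (M := N) (w := fun n => (Real.log n)⁻¹)
        (a := fun n => if n.Prime then (Real.log n : ℂ) * (n : ℂ) ^ (-s) else 0)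
        (A := D * Real.log (2 + |s.im|) + 2) (fun n hn => by
          have hn4 : (4 : ℝ) ≤ n := by exact_mod_cast hK4.trans hn
          have : 0 < Real.log n := Real.log_pos (by linarith)
          exact inv_anti₀ this (Real.log_le_log (by linarith) (by push_cast; linarith)))
        (fun n hn => inv_nonneg.2 (Real.log_natCast_nonneg n)) hKN (fun n hn hnN => by
          rw [← Finset.sum_filter]
          have e1 := hblock s hs1 (by linarith) K n hK4 hn
          have e2 := norm_integral_cpow_le hσ (K := K) (M := n) (by linarith) (by exact_mod_cast hn)
            ((Real.sqrt_le_sqrt (by exact_mod_cast hnN)).trans hN)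
          calc _ = ‖(∑ n ∈ (Finset.Ioc K n).filter Nat.Prime, (Real.log n : ℂ) * (n : ℂ) ^ (-s) -
                ∫ v in (K : ℝ)..n, (v : ℂ) ^ (-s)) + ∫ v in (K : ℝ)..n, (v : ℂ) ^ (-s)‖ := by congr 1; ring
            _ ≤ _ := (norm_add_le _ _).trans (add_le_add e1 e2))
      have hcong : ∑ p ∈ (Finset.Ioc K N).filter Nat.Prime, (p : ℂ) ^ (-s) = ∑ k ∈ Finset.Ioc K N,
          (((Real.log k)⁻¹ : ℝ) : ℂ) * (if k.Prime then (Real.log k : ℂ) * (k : ℂ) ^ (-s) else 0) := by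
        rw [Finset.sum_filter]
        refine Finset.sum_congr rfl fun k hk => ?_
        have hk4 : (4 : ℝ) ≤ k := by exact_mod_cast hK4.trans (Finset.mem_Ioc.1 hk).1.le
        have hne : (Real.log k : ℂ) ≠ 0 := by exact_mod_cast (Real.log_pos (by linarith)).ne'
        split_ifs
        · rw [ofReal_inv, ← mul_assoc, inv_mul_cancel₀ hne, one_mul]
        · simp
      rw [hcong]
      refine habel.trans ?_
      rw [← div_eq_mul_inv, div_le_iff₀ (by linarith)]
      have hl : Real.log (2 + |s.im|) ≤ Real.log 3 + Real.log |s.im| := by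
        rw [← Real.log_mul (by norm_num) (by linarith)]
        exact Real.log_le_log (by linarith) (by linarith)
      have hDη : D ≤ η * Real.log K := by rw [div_le_iff₀ hη] at hlogK; linarith
      calc D * Real.log (2 + |s.im|) + 2 ≤ D * (Real.log 3 + Real.log |s.im|) + 2 := by gcongr
        _ ≤ (η * Real.log K) * (Real.log 3 + Real.log |s.im|) + 2 * Real.log K := by
            gcongr; linarith
        _ = _ := by ring
  rw [Real.rpow_def_of_pos (by linarith), ← Real.exp_add, Real.exp_le_exp, Finset.sum_add_distrib, ← Finset.mul_sum,
    ← Complex.re_sum]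
  have := (Complex.re_le_norm (∑ p ∈ Nat.primesBelow (N + 1), (p : ℂ) ^ (-s))).trans hsum
  linarith

/-- Sum over the primes `p ≤ N`, split at `4`. -/
lemma sum_primesBelow_eq {E : Type*} [AddCommGroup E] (f : ℕ → E) {N : ℕ} (hN : 4 ≤ N) :
    ∑ p ∈ Nat.primesBelow (N + 1), f p = f 2 + f 3 + ∑ p ∈ (Finset.Ioc 4 N).filter Nat.Prime, f p := by
  have hset : Nat.primesBelow (N + 1) = insert 2 (insert 3 ((Finset.Ioc 4 N).filter Nat.Prime)) := by
    ext p
    simp only [Nat.primesBelow, Finset.mem_filter, Finset.mem_range, Finset.mem_Ioc, Finset.mem_insert]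
    constructor
    · rintro ⟨h1, h2⟩
      by_cases h4 : 4 < p
      · exact Or.inr (Or.inr ⟨⟨h4, by omega⟩, h2⟩)
      · have : p ≤ 4 := by omega
        interval_cases p <;> revert h2 <;> norm_num
    · rintro (rfl | rfl | ⟨⟨h1, h2⟩, h3⟩)
      · exact ⟨by omega, by norm_num⟩
      · exact ⟨by omega, by norm_num⟩
      · exact ⟨by omega, h3⟩
  rw [hset, Finset.sum_insert (by simp), Finset.sum_insert (by simp), add_assoc]

/-- The prime number theorem on vertical lines to the right of `1/2`, under the Riemann hypothesis. -/
lemma exists_norm_sum_prime_sub_cpow_le (h : RHzeta) {ε : ℝ} (hε : 0 < ε) (hε1 : ε ≤ 1) : ∃ C > 0,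
    ∀ s : ℂ, 1 / 2 + ε ≤ s.re → s.re < 1 → ∀ K N : ℕ, 4 ≤ K → K ≤ N →
    ‖∑ n ∈ (Finset.Ioc K N).filter Nat.Prime, (Real.log n : ℂ) * (n : ℂ) ^ (-s) -
      ((N : ℂ) ^ (1 - s) - (K : ℂ) ^ (1 - s)) / (1 - s)‖ ≤ C * Real.log (2 + |s.im|) := by
  obtain ⟨C, hC, hb⟩ := exists_norm_sum_prime_sub_integral_le h hε hε1
  refine ⟨C, hC, fun s h1 h2 K N hK hKN => ?_⟩
  have := hb s h1 (by linarith) K N hK hKN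
  have hK' : (4 : ℝ) ≤ K := by exact_mod_cast hK
  rw [integral_cpow (Or.inr ⟨?_, ?_⟩)] at this
  · simpa [sub_eq_add_neg, add_comm] using this
  · intro h0
    have := congrArg Complex.re h0
    simp at this; linarith
  · rw [uIcc_of_le (by exact_mod_cast hKN)]; intro h0; linarith [h0.1]

lemma exists_abs_sum_prime_sub_rpow_le (h : RHzeta) {ε : ℝ} (hε : 0 < ε) (hε1 : ε ≤ 1) : ∃ C > 0,
    ∀ σ : ℝ, 1 / 2 + ε ≤ σ → σ < 1 → ∀ K N : ℕ, 4 ≤ K → K ≤ N →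
    |∑ n ∈ (Finset.Ioc K N).filter Nat.Prime, Real.log n * (n : ℝ) ^ (-σ) -
      ((N : ℝ) ^ (1 - σ) - (K : ℝ) ^ (1 - σ)) / (1 - σ)| ≤ C := by
  obtain ⟨C, hC, hb⟩ := exists_norm_sum_prime_sub_cpow_le h hε hε1
  refine ⟨C * Real.log 2, by positivity, fun σ h1 h2 K N hK hKN => ?_⟩
  have := hb (σ : ℂ) (by simpa using h1) (by simpa using h2) K N hK hKN
  simp only [ofReal_im, abs_zero, add_zero] at this
  refine le_trans (le_of_eq ?_) this
  rw [← Real.norm_eq_abs, ← Complex.norm_real]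
  congr 1
  have hp : ∀ (n : ℕ) (τ : ℝ), (((n : ℝ) ^ τ : ℝ) : ℂ) = (n : ℂ) ^ (τ : ℂ) := fun n τ => by
    rw [ofReal_cpow (by positivity)]; simp
  simp only [ofReal_sub, ofReal_sum, ofReal_mul, ofReal_div, hp, ofReal_one, ofReal_neg]

/-- The saddle point equation, in the range of parameters considered. -/
structure Saddle (δ ℓ : ℝ) (N : ℕ) (c : ℝ) : Prop where
  le : ℓ ^ (2 + δ) ≤ N
  log_le : Real.log N ≤ ℓ ^ ((1 : ℝ) / 2 - δ)
  pos : 0 < c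
  eq : ∑ p ∈ Nat.primesBelow (N + 1), Real.log p / ((p : ℝ) ^ c - 1) = ℓ

lemma Saddle.exists_bounds {δ : ℝ} (hδ : 0 < δ) (B : ℝ) : ∃ ℓ₀, ∀ ℓ ≥ ℓ₀, ∀ N c, Saddle δ ℓ N c →
    1 ≤ ℓ ∧ B ≤ Real.log ℓ ∧ Real.log ℓ ≤ Real.log N ∧ B * (Real.log N) ^ 2 * (Real.log ℓ) ^ 2 ≤ ℓ ∧
    B * ℓ ≤ ℓ ^ (1 + δ / 4) := by
  have h1 : ∀ᶠ ℓ : ℝ in atTop, B ≤ Real.log ℓ := Real.tendsto_log_atTop.eventually_ge_atTop B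
  have h2 : ∀ᶠ ℓ : ℝ in atTop, B ≤ ℓ ^ (δ / 4) := (tendsto_rpow_atTop (by positivity)).eventually_ge_atTop B
  have h3 := ((isLittleO_log_rpow_atTop hδ).def (c := (1 + |B|)⁻¹) (by positivity))
  obtain ⟨ℓ₀, hℓ₀⟩ := eventually_atTop.1 (((h1.and h2).and h3).and (eventually_ge_atTop 1))
  refine ⟨ℓ₀, fun ℓ hℓ N c hs => ?_⟩
  obtain ⟨⟨⟨h1, h2⟩, h3⟩, h4⟩ := hℓ₀ ℓ hℓ
  have hℓ0 : 0 < ℓ := by linarith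
  have hlog : 0 ≤ Real.log ℓ := Real.log_nonneg h4
  rw [Real.norm_of_nonneg hlog, Real.norm_of_nonneg (by positivity)] at h3
  have hL : Real.log ℓ ≤ Real.log N := by
    have := Real.log_le_log (by positivity) hs.le
    rw [Real.log_rpow hℓ0] at this
    nlinarith
  refine ⟨h4, h1, hL, ?_, ?_⟩
  · have hL0 : 0 ≤ Real.log N := Real.log_natCast_nonneg N
    have e1 : (Real.log N) ^ 2 ≤ (ℓ ^ ((1 : ℝ) / 2 - δ)) ^ 2 := by gcongr; exact hs.log_le
    have e2 : (Real.log ℓ) ^ 2 ≤ ((1 + |B|)⁻¹ * ℓ ^ δ) ^ 2 := by gcongr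
    have e3 : (ℓ ^ ((1 : ℝ) / 2 - δ)) ^ 2 * (ℓ ^ δ) ^ 2 = ℓ := by
      rw [← mul_pow, ← Real.rpow_add hℓ0, ← Real.rpow_natCast, ← Real.rpow_mul hℓ0.le]
      norm_num
    have hB := le_abs_self B
    have hB0 := abs_nonneg B
    have e4 : |B| * ((1 + |B|)⁻¹) ^ 2 ≤ 1 := by
      rw [inv_pow, ← div_eq_mul_inv, div_le_one (by positivity)]
      nlinarith
    calc B * (Real.log N) ^ 2 * (Real.log ℓ) ^ 2 ≤ |B| * (Real.log N) ^ 2 * (Real.log ℓ) ^ 2 := by gcongr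
      _ ≤ |B| * (ℓ ^ ((1 : ℝ) / 2 - δ)) ^ 2 * ((1 + |B|)⁻¹ * ℓ ^ δ) ^ 2 := by gcongr
      _ = (|B| * ((1 + |B|)⁻¹) ^ 2) * ((ℓ ^ ((1 : ℝ) / 2 - δ)) ^ 2 * (ℓ ^ δ) ^ 2) := by ring
      _ ≤ ℓ := by rw [e3]; nlinarith
  · rw [Real.rpow_add hℓ0, Real.rpow_one, mul_comm]
    gcongr

lemma one_sub_inv_sqrt_ge {u : ℝ} (hu : 1 ≤ u) : 1 / (4 * u ^ 2) ≤ 1 - 1 / Real.sqrt (1 + 1 / u ^ 2) := by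
  set v := 1 / u ^ 2 with hv
  have hu2 : (1 : ℝ) ≤ u ^ 2 := by nlinarith
  have hv1 : v ≤ 1 := by rw [hv, div_le_one (by linarith)]; exact hu2
  have hv0 : 0 < v := by positivity
  have e : 1 / (4 * u ^ 2) = v / 4 := by rw [hv]; field_simp
  rw [e]
  have hs : 0 < Real.sqrt (1 + v) := Real.sqrt_pos.2 (by linarith)
  rw [le_sub_comm, div_le_iff₀ hs]
  have hs2 : (1 - v / 4)⁻¹ ≤ Real.sqrt (1 + v) := by
    apply Real.le_sqrt_of_sq_le
    rw [inv_pow, inv_le_comm₀ (by nlinarith) (by linarith), inv_le_iff_one_le_mul₀ (by linarith)]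
    nlinarith [mul_nonneg hv0.le (sub_nonneg.2 hv1)]
  rw [inv_le_iff_one_le_mul₀ (by linarith)] at hs2
  linarith

lemma exp_le_one_add {w : ℝ} (h0 : 0 ≤ w) (h4 : w ≤ 4) : Real.exp (w / 5) ≤ 1 + w := by
  have h1 : 1 - w / 5 ≤ Real.exp (-(w / 5)) := by linarith [Real.add_one_le_exp (-(w / 5))]
  rw [Real.exp_neg] at h1
  have h2 := Real.exp_pos (w / 5)
  have h3 : (1 - w / 5) * Real.exp (w / 5) ≤ 1 := by
    calc _ ≤ (Real.exp (w / 5))⁻¹ * Real.exp (w / 5) := by gcongr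
      _ = 1 := inv_mul_cancel₀ h2.ne'
  have h5 : 1 ≤ (1 + w) * (1 - w / 5) := by nlinarith
  nlinarith

lemma norm_natCast_cpow_mul_I {n : ℕ} (hn : 0 < n) (c t : ℝ) :
    (n : ℂ) ^ (-(c + t * I : ℂ)) = (((n : ℝ) ^ (-c) : ℝ) : ℂ) * Complex.exp (-((t * Real.log n : ℝ) : ℂ) * I) := by
  have hn' : (n : ℂ) ≠ 0 := by exact_mod_cast hn.ne'
  have hn0 : (0 : ℝ) ≤ n := by positivity
  rw [ofReal_cpow hn0, ofReal_natCast, neg_add, cpow_add _ _ hn', ofReal_neg]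
  congr 1
  rw [cpow_def_of_ne_zero hn', ← natCast_log]
  push_cast; ring_nf

lemma re_natCast_cpow {n : ℕ} (hn : 0 < n) (c t : ℝ) :
    ((n : ℂ) ^ (-(c + t * I : ℂ))).re = (n : ℝ) ^ (-c) * Real.cos (t * Real.log n) := by
  rw [norm_natCast_cpow_mul_I hn, re_ofReal_mul, ← ofReal_neg, Complex.exp_ofReal_mul_I_re, Real.cos_neg]

/-- One Euler factor at a point of the vertical line `Re s = c`, compared with that at `c`. -/
lemma norm_euler_factor_le {p : ℕ} (hp : p.Prime) {c : ℝ} (hc : 1 / 2 ≤ c) (t : ℝ) :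
    ‖(1 - (p : ℂ) ^ (-(c + t * I : ℂ)))⁻¹‖ ≤ ‖(1 - (p : ℂ) ^ (-(c : ℂ)))⁻¹‖ *
      Real.exp (-((p : ℝ) ^ (-c) * (1 - Real.cos (t * Real.log p)) / 5)) := by
  set q := (p : ℝ) ^ (-c) with hq
  have hq0 : 0 < q := by have := hp.pos; positivity
  have hq1 : q ≤ 3 / 4 := two_rpow_neg_half_le hp hc
  set θ := t * Real.log p
  have hz := norm_natCast_cpow_mul_I hp.pos c t
  set z := (p : ℂ) ^ (-(c + t * I : ℂ))
  have hqc : (p : ℂ) ^ (-(c : ℂ)) = (q : ℂ) := by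
    rw [hq, ofReal_cpow (by positivity)]; simp
  have hn : ‖1 - z‖ ^ 2 = (1 - q) ^ 2 + 2 * q * (1 - Real.cos θ) := by
    rw [hz, ← ofReal_neg, Complex.exp_mul_I, ← ofReal_cos, ← ofReal_sin, Complex.sq_norm, Complex.normSq_apply]
    simp only [sub_re, one_re, sub_im, one_im, mul_re, mul_im, add_re, add_im, ofReal_re, ofReal_im, I_re, I_im]
    rw [Real.cos_neg, Real.sin_neg]
    nlinarith [Real.sin_sq_add_cos_sq θ]
  have hcos := Real.cos_le_one θ
  have hcos' := Real.neg_one_le_cos θ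
  have hw := exp_le_one_add (w := 2 * (q * (1 - Real.cos θ))) (by nlinarith) (by nlinarith)
  rw [hqc, norm_inv, norm_inv, show (1 : ℂ) - q = ((1 - q : ℝ) : ℂ) by push_cast; ring, norm_real,
    Real.norm_of_nonneg (by linarith), Real.exp_neg, ← mul_inv]
  apply inv_anti₀ (by have := Real.exp_pos (q * (1 - Real.cos θ) / 5); nlinarith)
  apply le_of_sq_le_sq _ (norm_nonneg _)
  rw [hn, mul_pow, ← Real.exp_nat_mul]
  have e : ((2 : ℕ) : ℝ) * (q * (1 - Real.cos θ) / 5) = 2 * (q * (1 - Real.cos θ)) / 5 := by push_cast; ring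
  rw [e]
  have hsq : (1 - q) ^ 2 ≤ 1 := by nlinarith
  have h0 : 0 ≤ q * (1 - Real.cos θ) := by nlinarith
  nlinarith [sq_nonneg (1 - q)]

lemma norm_smoothZeta_vertical_le {c : ℝ} (hc : 1 / 2 ≤ c) (N : ℕ) (t : ℝ) :
    ‖smoothZeta N (c + t * I)‖ ≤ ‖smoothZeta N c‖ * Real.exp (-(1 / 5) *
      ∑ p ∈ Nat.primesBelow (N + 1), (p : ℝ) ^ (-c) * (1 - Real.cos (t * Real.log p))) := by
  rw [smoothZeta, smoothZeta, norm_prod, norm_prod, Finset.mul_sum, Real.exp_sum, ← Finset.prod_mul_distrib]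
  refine Finset.prod_le_prod (fun _ _ => norm_nonneg _) fun p hp => ?_
  refine (norm_euler_factor_le (Nat.prime_of_mem_primesBelow hp) hc t).trans (le_of_eq ?_)
  congr 2; ring

lemma log_div_rpow_sub_one {p : ℕ} (hp : p.Prime) {c : ℝ} (hc : 0 < c) :
    Real.log p * (p : ℝ) ^ (-c) ≤ Real.log p / ((p : ℝ) ^ c - 1) := by
  have hp1 : (1 : ℝ) < p := by exact_mod_cast hp.one_lt
  have := Real.one_lt_rpow hp1 hc
  rw [Real.rpow_neg (by linarith), ← div_eq_mul_inv]
  exact div_le_div_of_nonneg_left (Real.log_nonneg hp1.le) (by linarith) (by linarith)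

lemma log_div_rpow_sub_one_le {p : ℕ} (hp : p.Prime) {c : ℝ} (hc : 1 / 2 ≤ c) :
    Real.log p / ((p : ℝ) ^ c - 1) ≤ Real.log p * (p : ℝ) ^ (-c) + 4 * (Real.log p * (p : ℝ) ^ (-(2 * c))) := by
  have hp1 : (1 : ℝ) < p := by exact_mod_cast hp.one_lt
  have h1 := Real.one_lt_rpow hp1 (show 0 < c by linarith)
  have hl := Real.log_nonneg hp1.le
  have hq := two_rpow_neg_half_le hp hc
  have e : (p : ℝ) ^ (-(2 * c)) = ((p : ℝ) ^ (-c)) ^ 2 := by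
    rw [← Real.rpow_natCast, ← Real.rpow_mul (by linarith)]; congr 1; push_cast; ring
  rw [e]
  have hpc : (p : ℝ) ^ c = ((p : ℝ) ^ (-c))⁻¹ := by rw [Real.rpow_neg (by linarith), inv_inv]
  rw [hpc] at h1 ⊢
  set q := (p : ℝ) ^ (-c)
  have hq0 : 0 < q := by positivity
  have e2 : Real.log p / (q⁻¹ - 1) = Real.log p * (q / (1 - q)) := by
    have : 1 - q ≠ 0 := by linarith
    have : q⁻¹ - 1 ≠ 0 := by linarith
    field_simp
  rw [e2]
  have : q / (1 - q) ≤ q + 4 * q ^ 2 := by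
    rw [div_le_iff₀ (by linarith)]; nlinarith [sq_nonneg q, mul_pos hq0 hq0]
  nlinarith

lemma sum_log_div_rpow_anti {N : ℕ} {c σ : ℝ} (hc : 0 < c) (h : c ≤ σ) :
    ∑ p ∈ Nat.primesBelow (N + 1), Real.log p / ((p : ℝ) ^ σ - 1) ≤
      ∑ p ∈ Nat.primesBelow (N + 1), Real.log p / ((p : ℝ) ^ c - 1) := by
  refine Finset.sum_le_sum fun p hp => ?_
  have hp1 : (1 : ℝ) < p := by exact_mod_cast (Nat.prime_of_mem_primesBelow hp).one_lt
  have h1 := Real.one_lt_rpow hp1 hc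
  exact div_le_div_of_nonneg_left (Real.log_nonneg hp1.le) (by linarith)
    (by linarith [Real.rpow_le_rpow_of_exponent_le hp1.le h])

lemma log_two_mul_rpow_le {c : ℝ} (hc : 0 ≤ c) : ∀ k : ℕ, 1 ≤ k → k ≤ 3 → Real.log k * (k : ℝ) ^ (-c) ≤ 2 := by
  intro k hk hk3
  have hk1 : (1 : ℝ) ≤ k := by exact_mod_cast hk
  have hk3' : (k : ℝ) ≤ 3 := by exact_mod_cast hk3
  have h1 : Real.log k ≤ 2 := by linarith [Real.log_le_sub_one_of_pos (show (0 : ℝ) < k by linarith)]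
  have h2 : (k : ℝ) ^ (-c) ≤ 1 := Real.rpow_le_one_of_one_le_of_nonpos hk1 (by linarith)
  have h3 : 0 ≤ (k : ℝ) ^ (-c) := by positivity
  nlinarith [Real.log_nonneg hk1]

/-- The saddle point sum is asymptotic to `N ^ (1 - σ) / (1 - σ)`. -/
lemma exists_abs_saddle_sum_le (h : RHzeta) {ε : ℝ} (hε : 0 < ε) (hε1 : ε ≤ 1) : ∃ C > 0,
    ∀ σ : ℝ, 1 / 2 + ε ≤ σ → σ < 1 → ∀ N : ℕ, 4 ≤ N →
    |∑ p ∈ Nat.primesBelow (N + 1), Real.log p / ((p : ℝ) ^ σ - 1) -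
      ((N : ℝ) ^ (1 - σ) - (4 : ℝ) ^ (1 - σ)) / (1 - σ)| ≤ C := by
  obtain ⟨C, hC, hb⟩ := exists_abs_sum_prime_sub_rpow_le h hε hε1
  obtain ⟨E, hE, hsq⟩ := exists_sum_log_mul_rpow_le (ε := 2 * ε) (by positivity)
  refine ⟨C + 4 * E + 4, by positivity, fun σ h1 h2 N hN => ?_⟩
  have hb' := hb σ h1 h2 4 N le_rfl hN
  have hlow : ∑ p ∈ Nat.primesBelow (N + 1), Real.log p * (p : ℝ) ^ (-σ) ≤
      ∑ p ∈ Nat.primesBelow (N + 1), Real.log p / ((p : ℝ) ^ σ - 1) :=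
    Finset.sum_le_sum fun p hp => log_div_rpow_sub_one (Nat.prime_of_mem_primesBelow hp) (by linarith)
  have hup : ∑ p ∈ Nat.primesBelow (N + 1), Real.log p / ((p : ℝ) ^ σ - 1) ≤
      ∑ p ∈ Nat.primesBelow (N + 1), Real.log p * (p : ℝ) ^ (-σ) + 4 * E := by
    refine (Finset.sum_le_sum fun p hp => log_div_rpow_sub_one_le (Nat.prime_of_mem_primesBelow hp)
      (by linarith)).trans ?_
    rw [Finset.sum_add_distrib, ← Finset.mul_sum]
    gcongr
    refine (Finset.sum_le_sum fun p hp => ?_).trans (hsq (Nat.primesBelow (N + 1)))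
    have hp1 : (1 : ℝ) < p := by exact_mod_cast (Nat.prime_of_mem_primesBelow hp).one_lt
    have := Real.log_nonneg hp1.le
    gcongr
    · linarith
    · exact hp1.le
    · linarith
  rw [sum_primesBelow_eq (fun p : ℕ => Real.log p * (p : ℝ) ^ (-σ)) hN] at hlow hup
  have a2 := log_two_mul_rpow_le (c := σ) (by linarith) 2 (by norm_num) (by norm_num)
  have a3 := log_two_mul_rpow_le (c := σ) (by linarith) 3 (by norm_num) (by norm_num)
  have b2 : 0 ≤ Real.log (2 : ℕ) * ((2 : ℕ) : ℝ) ^ (-σ) :=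
    mul_nonneg (Real.log_natCast_nonneg _) (by positivity)
  have b3 : 0 ≤ Real.log (3 : ℕ) * ((3 : ℕ) : ℝ) ^ (-σ) :=
    mul_nonneg (Real.log_natCast_nonneg _) (by positivity)
  rw [Nat.cast_ofNat] at hb'
  rw [abs_le] at hb' ⊢
  generalize ∑ n ∈ (Finset.Ioc 4 N).filter Nat.Prime, Real.log n * (n : ℝ) ^ (-σ) = T1 at hb' hlow hup
  generalize ∑ p ∈ Nat.primesBelow (N + 1), Real.log p / ((p : ℝ) ^ σ - 1) = T2 at hlow hup ⊢
  generalize ((N : ℝ) ^ (1 - σ) - (4 : ℝ) ^ (1 - σ)) / (1 - σ) = T3 at hb' ⊢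
  generalize Real.log (2 : ℕ) * ((2 : ℕ) : ℝ) ^ (-σ) = T4 at *
  generalize Real.log (3 : ℕ) * ((3 : ℕ) : ℝ) ^ (-σ) = T5 at *
  obtain ⟨u1, u2⟩ := hb'
  constructor <;> linarith

lemma rpow_four_le {a : ℝ} (ha : a ≤ 1 / 2) : (4 : ℝ) ^ a ≤ 2 := by
  calc (4 : ℝ) ^ a ≤ (4 : ℝ) ^ (1 / 2 : ℝ) := Real.rpow_le_rpow_of_exponent_le (by norm_num) ha
    _ = 2 := by rw [← Real.sqrt_eq_rpow, show (4 : ℝ) = 2 ^ 2 by norm_num]; exact Real.sqrt_sq (by norm_num)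

/-- Location of the saddle point. -/
lemma Saddle.exists_mem (h : RHzeta) {δ : ℝ} (hδ : 0 < δ) : ∃ ε₀ > 0, ε₀ ≤ 1 / 4 ∧ ∃ ℓ₀, ∀ ℓ ≥ ℓ₀, ∀ N c,
    Saddle δ ℓ N c → 1 / 2 + ε₀ ≤ c ∧ c ≤ 1 - 2 / Real.log N := by
  set ε₀ := δ / (4 * (2 + δ)) with hε₀
  have hpos : 0 < ε₀ := by positivity
  have hle : ε₀ ≤ 1 / 4 := by rw [hε₀, div_le_div_iff₀ (by positivity) (by norm_num)]; linarith
  obtain ⟨C, hC, hb⟩ := exists_abs_saddle_sum_le h hpos (by linarith)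
  obtain ⟨ℓ₀, hℓ₀⟩ := Saddle.exists_bounds hδ (C + 20)
  refine ⟨ε₀, hpos, hle, ℓ₀, fun ℓ hℓ N c hs => ?_⟩
  obtain ⟨h1, h2, h3, h4, h5⟩ := hℓ₀ ℓ hℓ N c hs
  have hL : 20 ≤ Real.log N := by linarith
  have hN1 : (1 : ℝ) ≤ N := by
    by_contra hcon
    have : N = 0 := by
      have : (N : ℝ) < 1 := by linarith
      have : N < 1 := by exact_mod_cast this
      omega
    rw [this] at hL; norm_num at hL
  have hN4 : 4 ≤ N := by
    have := Real.log_le_sub_one_of_pos (show (0 : ℝ) < N by linarith)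
    have : (4 : ℝ) ≤ N := by linarith
    exact_mod_cast this
  have hcl : 1 / 2 + ε₀ ≤ c := by
    by_contra hcon
    have hcon : c ≤ 1 / 2 + ε₀ := by linarith
    have e1 := sum_log_div_rpow_anti (N := N) hs.pos hcon
    rw [hs.eq] at e1
    have e2 := hb (1 / 2 + ε₀) le_rfl (by linarith) N hN4
    set a := 1 - (1 / 2 + ε₀) with ha
    have ha4 : 1 / 4 ≤ a := by rw [ha]; linarith
    have ha2 : a ≤ 1 / 2 := by rw [ha]; linarith
    have e3 : (4 : ℝ) ^ a / a ≤ 8 := by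
      rw [div_le_iff₀ (by linarith)]; linarith [rpow_four_le ha2]
    have e4 : (N : ℝ) ^ a ≤ (N : ℝ) ^ a / a := by
      rw [le_div_iff₀ (by linarith)]
      have : 0 ≤ (N : ℝ) ^ a := by positivity
      nlinarith
    have e5 : ℓ ^ (1 + δ / 4) ≤ (N : ℝ) ^ a := by
      calc ℓ ^ (1 + δ / 4) = (ℓ ^ (2 + δ)) ^ a := by
            rw [← Real.rpow_mul (by linarith)]; congr 1; rw [ha, hε₀]; field_simp; ring
        _ ≤ _ := Real.rpow_le_rpow (by positivity) hs.le (by linarith)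
    rw [abs_le, sub_div] at e2
    nlinarith [e2.1]
  refine ⟨hcl, ?_⟩
  by_contra hcon
  have hcon : 1 - 2 / Real.log N ≤ c := by linarith
  have hsm : 2 / Real.log N ≤ 1 / 10 := by rw [div_le_iff₀ (by linarith)]; linarith
  have hsm0 : 0 < 2 / Real.log N := by positivity
  have e1 := sum_log_div_rpow_anti (N := N) (by linarith) hcon
  rw [hs.eq] at e1
  have e2 := hb (1 - 2 / Real.log N) (by linarith) (by linarith) N hN4
  rw [sub_sub_cancel, sub_div] at e2
  have e3 : (N : ℝ) ^ (2 / Real.log N) / (2 / Real.log N) ≤ 5 * Real.log N := by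
    rw [Real.rpow_def_of_pos (by linarith), mul_div_cancel₀ _ (by linarith : Real.log N ≠ 0), div_div_eq_mul_div,
      div_le_iff₀ (by norm_num)]
    have : Real.exp 2 ≤ 10 := by
      rw [show (2 : ℝ) = 1 + 1 by norm_num, Real.exp_add]
      nlinarith [Real.exp_one_lt_d9, Real.exp_pos 1]
    nlinarith
  have e4 : 0 ≤ (4 : ℝ) ^ (2 / Real.log N) / (2 / Real.log N) := by positivity
  rw [abs_le] at e2
  have e5 : 1 ≤ Real.log ℓ := by linarith
  have e6 : (C + 20) * Real.log N ≤ ℓ := by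
    refine le_trans ?_ h4
    have h1l : 1 ≤ (Real.log ℓ) ^ 2 := by nlinarith
    have : Real.log N ≤ (Real.log N) ^ 2 := by nlinarith
    calc (C + 20) * Real.log N ≤ (C + 20) * (Real.log N) ^ 2 := by gcongr
      _ ≤ (C + 20) * (Real.log N) ^ 2 * (Real.log ℓ) ^ 2 := le_mul_of_one_le_right (by positivity) h1l
  have e7 := mul_le_mul_of_nonneg_left (show 1 ≤ Real.log N by linarith) hC.le
  linarith [e2.2]

/-- What the saddle point method needs to know about the saddle point `c`. -/
structure SaddleFacts (ε₀ B ℓ : ℝ) (N : ℕ) (c : ℝ) : Prop where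
  lower : 1 / 2 + ε₀ ≤ c
  upper : c ≤ 1 - 2 / Real.log N
  B_le : B ≤ Real.log N
  log_sq_le : B * (Real.log N) ^ 2 ≤ ℓ
  le_sqrt : ℓ ≤ Real.sqrt N
  sum_le : ∑ p ∈ Nat.primesBelow (N + 1), Real.log p * (p : ℝ) ^ (-c) ≤ ℓ
  decay_small : ∀ t : ℝ, |t| ≤ 1 / Real.log N →
    ‖smoothZeta N (c + t * I)‖ ≤ ‖smoothZeta N c‖ * Real.exp (-(1 / 200 * t ^ 2 * (Real.log N * ℓ)))
  decay_large : ∀ t : ℝ, 1 / Real.log N ≤ |t| → |t| ≤ (N : ℝ) ^ 50 →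
    ‖smoothZeta N (c + t * I)‖ ≤ ‖smoothZeta N c‖ * Real.exp (-(B * Real.log N))

lemma sum_filter_Ioc_le_sum_primesBelow {f : ℕ → ℝ} {K N : ℕ} (hf : ∀ p, p.Prime → 0 ≤ f p) :
    ∑ p ∈ (Finset.Ioc K N).filter Nat.Prime, f p ≤ ∑ p ∈ Nat.primesBelow (N + 1), f p := by
  refine Finset.sum_le_sum_of_subset_of_nonneg (fun p hp => ?_)
    fun p hp _ => hf p (Nat.prime_of_mem_primesBelow hp)
  simp only [Finset.mem_filter, Finset.mem_Ioc, Nat.primesBelow, Finset.mem_range] at hp ⊢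
  exact ⟨by omega, hp.2⟩

lemma one_sub_cos_ge {x : ℝ} (hx : |x| ≤ 1) : 1 / 5 * x ^ 2 ≤ 1 - Real.cos x := by
  have h1 := Real.cos_le_one_sub_mul_cos_sq (x := x) (by linarith [Real.pi_gt_three])
  have hpi : Real.pi ^ 2 ≤ 10 := by nlinarith [Real.pi_lt_d2, Real.pi_pos]
  have : 1 / 5 ≤ 2 / Real.pi ^ 2 := by
    rw [div_le_div_iff₀ (by norm_num) (by positivity)]; linarith
  nlinarith [sq_nonneg x]

lemma sum_one_sub_cos_ge (h : RHzeta) {ε : ℝ} (hε : 0 < ε) (hε1 : ε ≤ 1) : ∃ C > 0,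
    ∀ c : ℝ, 1 / 2 + ε ≤ c → ∀ N : ℕ, 4 ≤ N → 2 / Real.log N ≤ 1 - c → ∀ t : ℝ, 1 / Real.log N ≤ |t| →
    (N : ℝ) ^ (1 - c) / (1 - c) / (4 * ((1 - c) * Real.log N) ^ 2) - C * (Real.log N + Real.log (2 + |t|)) ≤
      ∑ p ∈ (Finset.Ioc 4 N).filter Nat.Prime, Real.log p * ((p : ℝ) ^ (-c) * (1 - Real.cos (t * Real.log p))) := by
  obtain ⟨C₁, hC₁, hr⟩ := exists_abs_sum_prime_sub_rpow_le h hε hε1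
  obtain ⟨C₂, hC₂, hc⟩ := exists_norm_sum_prime_sub_cpow_le h hε hε1
  refine ⟨2 + C₁ + C₂, by positivity, fun c hcl N hN ha t ht => ?_⟩
  have hN4 : (4 : ℝ) ≤ N := by exact_mod_cast hN
  have hL : 1 ≤ Real.log N := by
    rw [Real.le_log_iff_exp_le (by linarith)]; linarith [Real.exp_one_lt_d9]
  have ha0 : 0 < 1 - c := lt_of_lt_of_le (by positivity) ha
  have e1 := hr c hcl (by linarith) 4 N le_rfl hN
  have e2 := hc (c + t * I) (by simpa using hcl) (by simp; linarith) 4 N le_rfl hN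
  have him : (c + t * I : ℂ).im = t := by simp
  rw [him] at e2
  set a := 1 - c with hadef
  have h4a : (4 : ℝ) ^ a / a ≤ Real.log N := by
    rw [div_le_iff₀ ha0]
    rw [div_le_iff₀ (by linarith)] at ha
    linarith [rpow_four_le (show a ≤ 1 / 2 by linarith)]
  have hs : (1 : ℂ) - (c + t * I) = (a : ℂ) - t * I := by rw [hadef]; push_cast; ring
  have hnorm : ‖(1 : ℂ) - (c + t * I)‖ = a * Real.sqrt (1 + (t / a) ^ 2) := by
    rw [hs, Complex.norm_def, Complex.normSq_apply]
    have : a * Real.sqrt (1 + (t / a) ^ 2) = Real.sqrt (a ^ 2 * (1 + (t / a) ^ 2)) := by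
      rw [Real.sqrt_mul (by positivity), Real.sqrt_sq ha0.le]
    rw [this]; congr 1
    simp; field_simp
  have hre : ((1 : ℂ) - (c + t * I)).re = a := by rw [hs]; simp
  set u := a * Real.log N with hu
  have hu1 : 1 ≤ u := by rw [div_le_iff₀ (by linarith)] at ha; linarith
  have htu : 1 / u ^ 2 ≤ (t / a) ^ 2 := by
    rw [hu, mul_pow, ← sq_abs (t / a), abs_div, abs_of_pos ha0, div_pow, div_mul_eq_div_div_swap]
    gcongr
    rw [← one_div_pow]
    gcongr
  have hsq := one_sub_inv_sqrt_ge hu1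
  have hsq2 : 1 / Real.sqrt (1 + (t / a) ^ 2) ≤ 1 / Real.sqrt (1 + 1 / u ^ 2) := by
    apply one_div_le_one_div_of_le (Real.sqrt_pos.2 (by positivity))
    apply Real.sqrt_le_sqrt; linarith
  have hsq3 : 1 ≤ Real.sqrt (1 + (t / a) ^ 2) := Real.one_le_sqrt.2 (by nlinarith [sq_nonneg (t / a)])
  have e3 : ‖((N : ℂ) ^ (1 - (c + t * I) : ℂ) - ((4 : ℕ) : ℂ) ^ (1 - (c + t * I) : ℂ)) / (1 - (c + t * I))‖ ≤
      (N : ℝ) ^ a / a * (1 - 1 / (4 * u ^ 2)) + Real.log N := by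
    rw [norm_div, hnorm]
    calc _ ≤ ((N : ℝ) ^ a + (4 : ℝ) ^ a) / (a * Real.sqrt (1 + (t / a) ^ 2)) := by
          gcongr
          refine (norm_sub_le _ _).trans (le_of_eq ?_)
          rw [norm_natCast_cpow_of_pos (by omega), norm_natCast_cpow_of_pos (by omega), hre]; norm_num
      _ = (N : ℝ) ^ a / a * (1 / Real.sqrt (1 + (t / a) ^ 2)) + (4 : ℝ) ^ a / a * (1 / Real.sqrt (1 + (t / a) ^ 2)) := by
          field_simp
      _ ≤ (N : ℝ) ^ a / a * (1 - 1 / (4 * u ^ 2)) + (4 : ℝ) ^ a / a * 1 := by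
          gcongr
          · linarith
          · rw [div_le_one (by linarith)]; exact hsq3
      _ ≤ _ := by linarith
  have e4 := (Complex.re_le_norm _).trans ((norm_le_norm_sub_add _ _).trans (add_le_add e2 e3))
  have e5 : (∑ n ∈ (Finset.Ioc 4 N).filter Nat.Prime, (Real.log n : ℂ) * (n : ℂ) ^ (-(c + t * I) : ℂ)).re =
      ∑ n ∈ (Finset.Ioc 4 N).filter Nat.Prime, Real.log n * ((n : ℝ) ^ (-c) * Real.cos (t * Real.log n)) := by
    rw [Complex.re_sum]
    refine Finset.sum_congr rfl fun n hn => ?_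
    rw [re_ofReal_mul, re_natCast_cpow (Finset.mem_filter.1 hn).2.pos]
  rw [e5] at e4
  have e6 : ∑ p ∈ (Finset.Ioc 4 N).filter Nat.Prime, Real.log p * ((p : ℝ) ^ (-c) * (1 - Real.cos (t * Real.log p))) =
      ∑ p ∈ (Finset.Ioc 4 N).filter Nat.Prime, Real.log p * (p : ℝ) ^ (-c) -
      ∑ n ∈ (Finset.Ioc 4 N).filter Nat.Prime, Real.log n * ((n : ℝ) ^ (-c) * Real.cos (t * Real.log n)) := by
    rw [← Finset.sum_sub_distrib]
    exact Finset.sum_congr rfl fun n _ => by ring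
  rw [e6]
  have e7 := (abs_le.1 e1).1
  rw [sub_div, Nat.cast_ofNat] at e7
  have hlt : 0 ≤ Real.log (2 + |t|) := Real.log_nonneg (by linarith [abs_nonneg t])
  have e8 : (N : ℝ) ^ a / a / (4 * u ^ 2) = (N : ℝ) ^ a / a * (1 / (4 * u ^ 2)) := by rw [mul_one_div]
  rw [e8]
  nlinarith [mul_nonneg hC₁.le hlt, mul_nonneg hC₂.le (show 0 ≤ Real.log N by linarith),
    mul_le_mul_of_nonneg_left hL hC₁.le]

set_option maxHeartbeats 1000000 in
/-- The saddle point facts, for all large `ℓ`. -/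
theorem exists_saddleFacts (h : RHzeta) {δ : ℝ} (hδ : 0 < δ) : ∃ ε₀ > 0, ε₀ ≤ 1 / 4 ∧ ∀ B : ℝ, 0 ≤ B → ∃ ℓ₀,
    ∀ ℓ ≥ ℓ₀, ∀ N c, Saddle δ ℓ N c → SaddleFacts ε₀ B ℓ N c := by
  obtain ⟨ε₀, hε₀, hε₀1, ℓ₁, hmem⟩ := Saddle.exists_mem h hδ
  obtain ⟨C₀, hC₀, hsum⟩ := exists_abs_saddle_sum_le h hε₀ (by linarith)
  obtain ⟨C₁, hC₁, hr⟩ := exists_abs_sum_prime_sub_rpow_le h hε₀ (by linarith)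
  obtain ⟨C₂, hC₂, hcos⟩ := sum_one_sub_cos_ge h hε₀ (by linarith)
  refine ⟨ε₀, hε₀, hε₀1, fun B hB => ?_⟩
  set D := 8 * (5 * B + 52 * C₂ + C₀ + C₁ + 20) with hD
  obtain ⟨ℓ₂, hbd⟩ := Saddle.exists_bounds hδ D
  refine ⟨max ℓ₁ ℓ₂, fun ℓ hℓ N c hs => ?_⟩
  obtain ⟨hcl, hcu⟩ := hmem ℓ ((le_max_left _ _).trans hℓ) N c hs
  obtain ⟨hℓ1, hDl, hlL, hDL, -⟩ := hbd ℓ ((le_max_right _ _).trans hℓ) N c hs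
  set L := Real.log N with hL
  have hD0 : 8 * 20 ≤ D := by linarith
  have hl1 : 1 ≤ Real.log ℓ := by linarith
  have hL20 : 20 ≤ L := by linarith
  have hDL1 : D * L ^ 2 ≤ ℓ := by
    refine le_trans ?_ hDL
    exact le_mul_of_one_le_right (by positivity) (by nlinarith only [hl1])
  have hLL : L ≤ L ^ 2 := by nlinarith only [hL20]
  have hDL2 : D * L ≤ ℓ := by
    refine le_trans ?_ hDL1
    gcongr
  have hN1 : (1 : ℝ) ≤ N := by
    by_contra hcon
    have : N = 0 := by
      have : (N : ℝ) < 1 := by linarith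
      have : N < 1 := by exact_mod_cast this
      omega
    rw [hL, this] at hL20; norm_num at hL20
  have hN16 : 16 ≤ N := by
    have := Real.log_le_sub_one_of_pos (show (0 : ℝ) < N by linarith)
    have : (16 : ℝ) ≤ N := by linarith
    exact_mod_cast this
  have ha0 : 2 / L ≤ 1 - c := by linarith
  have hapos : 0 < 1 - c := lt_of_lt_of_le (by positivity) ha0
  have hsumc := hsum c hcl (by linarith) N (by omega)
  rw [hs.eq, sub_div] at hsumc
  set a := 1 - c with ha
  have ha2 : a ≤ 1 / 2 := by rw [ha]; linarith
  have h4a : (4 : ℝ) ^ a / a ≤ L := by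
    rw [div_le_iff₀ hapos]
    rw [div_le_iff₀ (by linarith)] at ha0
    linarith [rpow_four_le ha2]
  have h4a0 : 0 ≤ (4 : ℝ) ^ a / a := by positivity
  set Q := (N : ℝ) ^ a / a with hQ
  have hQ1 : ℓ - C₀ ≤ Q := by have := (abs_le.1 hsumc).2; linarith
  have hQ2 : Q ≤ ℓ + C₀ + L := by have := (abs_le.1 hsumc).1; linarith
  have hBL0 : 0 ≤ B * L := by positivity
  have hC₀L : C₀ ≤ C₀ * L := le_mul_of_one_le_right hC₀.le (by linarith)
  have hC₁L : C₁ ≤ C₁ * L := le_mul_of_one_le_right hC₁.le (by linarith)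
  have hC₂L : 0 ≤ C₂ * L := by positivity
  have hDLe : D * L = 8 * (5 * (B * L) + 52 * (C₂ * L) + C₀ * L + C₁ * L + 20 * L) := by rw [hD]; ring
  have hCℓ : 8 * C₀ ≤ ℓ ∧ 8 * C₁ ≤ ℓ ∧ 8 * L ≤ ℓ := by
    refine ⟨?_, ?_, ?_⟩ <;> linarith
  have hBD : B ≤ D := by linarith
  have hNa : (N : ℝ) ^ a = Real.exp (a * L) := by
    rw [Real.rpow_def_of_pos (by linarith), mul_comm]
  have hu2 : 2 ≤ a * L := by rwa [div_le_iff₀ (by linarith)] at ha0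
  have hQa : (N : ℝ) ^ a = a * Q := by rw [hQ]; field_simp
  have hul : a * L ≤ Real.log ℓ := by
    rw [Real.le_log_iff_exp_le (by linarith), ← hNa, hQa]
    have : a * Q ≤ 1 / 2 * (ℓ + C₀ + L) := by
      have : 0 ≤ Q := by positivity
      nlinarith only [this, hQ2, ha2]
    linarith [hCℓ.1, hCℓ.2.2]
  have hsumsq : 1 / 8 * (L * ℓ) ≤ ∑ p ∈ Nat.primesBelow (N + 1), (p : ℝ) ^ (-c) * (Real.log p) ^ 2 := by
    set M := Nat.sqrt N with hM
    have hM4 : 4 ≤ M := Nat.le_sqrt.2 (by omega)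
    have e1 := (abs_le.1 (hr c hcl (by linarith) M N hM4 (Nat.sqrt_le_self N))).1
    rw [← ha, sub_div] at e1
    have hMa : (M : ℝ) ^ a ≤ (N : ℝ) ^ a / 2 := by
      have hMs : (M : ℝ) ≤ Real.sqrt N := Real.nat_sqrt_le_real_sqrt
      have hexp : 2 ≤ Real.exp (a * L / 2) := by
        linarith [Real.add_one_le_exp (a * L / 2)]
      have hsq : (Real.sqrt N) ^ a = Real.exp (a * L / 2) := by
        rw [Real.sqrt_eq_rpow, ← Real.rpow_mul (by linarith), Real.rpow_def_of_pos (by linarith)]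
        congr 1; ring
      have hN' : (N : ℝ) ^ a = Real.exp (a * L / 2) * Real.exp (a * L / 2) := by
        rw [hNa, ← Real.exp_add]; congr 1; ring
      have := Real.rpow_le_rpow (by positivity) hMs hapos.le
      rw [hsq] at this
      rw [hN']
      nlinarith only [this, hexp]
    have hMQ : (M : ℝ) ^ a / a ≤ Q / 2 := by
      rw [hQ, div_right_comm]; gcongr
    have e2 : ℓ / 4 ≤ ∑ n ∈ (Finset.Ioc M N).filter Nat.Prime, Real.log n * (n : ℝ) ^ (-c) := by
      linarith [hCℓ.1, hCℓ.2.1]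
    calc 1 / 8 * (L * ℓ) = L / 2 * (ℓ / 4) := by ring
      _ ≤ L / 2 * ∑ n ∈ (Finset.Ioc M N).filter Nat.Prime, Real.log n * (n : ℝ) ^ (-c) := by gcongr
      _ ≤ ∑ n ∈ (Finset.Ioc M N).filter Nat.Prime, (n : ℝ) ^ (-c) * (Real.log n) ^ 2 := by
          rw [Finset.mul_sum]
          refine Finset.sum_le_sum fun p hp => ?_
          have hpM := (Finset.mem_Ioc.1 (Finset.mem_filter.1 hp).1).1
          have hNp : (N : ℝ) ≤ (p : ℝ) ^ 2 := by
            have h1 : N < (M + 1) * (M + 1) := Nat.lt_succ_sqrt N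
            have h2 : N ≤ p ^ 2 := by nlinarith only [h1, hpM]
            exact_mod_cast h2
          have hlog := Real.log_le_log (by linarith) hNp
          rw [Real.log_pow] at hlog
          push_cast at hlog
          have hp0 : 0 ≤ Real.log p := Real.log_natCast_nonneg p
          have : L / 2 ≤ Real.log p := by linarith
          calc L / 2 * (Real.log p * (p : ℝ) ^ (-c)) ≤ Real.log p * (Real.log p * (p : ℝ) ^ (-c)) := by gcongr
            _ = _ := by ring
      _ ≤ _ := sum_filter_Ioc_le_sum_primesBelow fun p _ => by positivity
  refine ⟨hcl, hcu, ?_, ?_, ?_, ?_, fun t ht => ?_, fun t ht ht2 => ?_⟩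
  · linarith
  · refine le_trans ?_ hDL1
    gcongr
  · apply Real.le_sqrt_of_sq_le
    refine le_trans ?_ hs.le
    rw [← Real.rpow_natCast]
    exact Real.rpow_le_rpow_of_exponent_le hℓ1 (by push_cast; linarith)
  · rw [← hs.eq]
    exact Finset.sum_le_sum fun p hp => log_div_rpow_sub_one (Nat.prime_of_mem_primesBelow hp) hs.pos
  · refine (norm_smoothZeta_vertical_le (by linarith) N t).trans ?_
    gcongr
    rw [neg_mul, neg_le_neg_iff]
    have e1 : 1 / 5 * t ^ 2 * ∑ p ∈ Nat.primesBelow (N + 1), (p : ℝ) ^ (-c) * (Real.log p) ^ 2 ≤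
        ∑ p ∈ Nat.primesBelow (N + 1), (p : ℝ) ^ (-c) * (1 - Real.cos (t * Real.log p)) := by
      rw [Finset.mul_sum]
      refine Finset.sum_le_sum fun p hp => ?_
      have hpp := Nat.prime_of_mem_primesBelow hp
      have hpN : (p : ℝ) ≤ N := by
        have := Nat.lt_of_mem_primesBelow hp
        exact_mod_cast Nat.lt_succ_iff.1 this
      have hlp : Real.log p ≤ L := Real.log_le_log (by exact_mod_cast hpp.pos) hpN
      have hp0 : 0 ≤ Real.log p := Real.log_natCast_nonneg p
      have hx : |t * Real.log p| ≤ 1 := by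
        rw [abs_mul, abs_of_nonneg hp0]
        calc |t| * Real.log p ≤ 1 / L * L := by gcongr
          _ = 1 := by field_simp
      have := one_sub_cos_ge hx
      calc _ = (p : ℝ) ^ (-c) * (1 / 5 * (t * Real.log p) ^ 2) := by ring
        _ ≤ _ := by gcongr
    have e2 : 1 / 5 * t ^ 2 * (1 / 8 * (L * ℓ)) ≤
        1 / 5 * t ^ 2 * ∑ p ∈ Nat.primesBelow (N + 1), (p : ℝ) ^ (-c) * (Real.log p) ^ 2 := by gcongr
    linarith
  · refine (norm_smoothZeta_vertical_le (by linarith) N t).trans ?_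
    gcongr
    rw [neg_mul, neg_le_neg_iff]
    have e1 := hcos c hcl N (by omega) (by linarith) t ht
    rw [← ha, ← hQ] at e1
    have hlt : Real.log (2 + |t|) ≤ 51 * L := by
      have hN2 : (2 : ℝ) ≤ N := by exact_mod_cast (by omega : 2 ≤ N)
      have : 2 + |t| ≤ (N : ℝ) ^ 51 := by
        have : (1 : ℝ) ≤ (N : ℝ) ^ 49 := one_le_pow₀ hN1
        calc 2 + |t| ≤ (N : ℝ) ^ 50 + (N : ℝ) ^ 50 := by
              gcongr
              rw [pow_succ]; nlinarith only [this, hN2]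
          _ ≤ (N : ℝ) ^ 51 := by rw [pow_succ _ 50]; nlinarith only [one_le_pow₀ hN1 (n := 50), hN2]
      have := Real.log_le_log (by positivity) this
      rwa [Real.log_pow] at this
    have e2 : D * L ^ 2 / 8 - C₀ ≤ Q / (4 * (a * L) ^ 2) * 1 := by
      have h1 : (a * L) ^ 2 ≤ (Real.log ℓ) ^ 2 := by gcongr
      have h2 : ℓ / 2 ≤ Q := by linarith [hCℓ.1]
      rw [mul_one]
      calc D * L ^ 2 / 8 - C₀ ≤ D * L ^ 2 / 8 := by linarith
        _ ≤ ℓ / 2 / (4 * (a * L) ^ 2) := by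
            rw [le_div_iff₀ (by positivity)]
            calc D * L ^ 2 / 8 * (4 * (a * L) ^ 2) ≤ D * L ^ 2 / 8 * (4 * (Real.log ℓ) ^ 2) := by gcongr
              _ = D * L ^ 2 * (Real.log ℓ) ^ 2 / 2 := by ring
              _ ≤ ℓ / 2 := by linarith
        _ ≤ _ := by gcongr
    rw [mul_one] at e2
    set S := ∑ p ∈ (Finset.Ioc 4 N).filter Nat.Prime, Real.log p * ((p : ℝ) ^ (-c) * (1 - Real.cos (t * Real.log p)))
      with hS
    have e3 : 5 * B * L ^ 2 ≤ S := by
      have h1 : C₂ * (L + Real.log (2 + |t|)) ≤ C₂ * (52 * L) := by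
        gcongr; linarith
      have h2 : D * L ^ 2 / 8 = 5 * B * L ^ 2 + 52 * (C₂ * L ^ 2) + (C₀ + C₁ + 20) * L ^ 2 := by rw [hD]; ring
      have h3 : C₂ * L ≤ C₂ * L ^ 2 := by gcongr
      have h4 : C₀ * 1 ≤ C₀ * L ^ 2 := by gcongr; linarith
      have h5 : 0 ≤ (C₁ + 20) * L ^ 2 := by positivity
      linarith
    have e4 : S ≤ L * ∑ p ∈ Nat.primesBelow (N + 1), (p : ℝ) ^ (-c) * (1 - Real.cos (t * Real.log p)) := by
      have hnn : ∀ p : ℕ, 0 ≤ (p : ℝ) ^ (-c) * (1 - Real.cos (t * Real.log p)) := fun p =>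
        mul_nonneg (by positivity) (by linarith [Real.cos_le_one (t * Real.log p)])
      rw [Finset.mul_sum]
      refine le_trans ?_ (sum_filter_Ioc_le_sum_primesBelow (K := 4) fun p _ =>
        mul_nonneg (by linarith) (hnn p))
      refine Finset.sum_le_sum fun p hp => ?_
      have hpI := Finset.mem_Ioc.1 (Finset.mem_filter.1 hp).1
      have hlp : Real.log p ≤ L := Real.log_le_log (by exact_mod_cast (by omega : 0 < p)) (by exact_mod_cast hpI.2)
      exact mul_le_mul_of_nonneg_right hlp (hnn p)
    have e5 : L * (5 * B * L) ≤
        L * ∑ p ∈ Nat.primesBelow (N + 1), (p : ℝ) ^ (-c) * (1 - Real.cos (t * Real.log p)) := by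
      linarith [show L * (5 * B * L) = 5 * B * L ^ 2 by ring]
    have e6 := le_of_mul_le_mul_left e5 (by linarith)
    linarith

/-- The completely multiplicative function `n ↦ n ^ (-s)`. -/
def natCpowHom (s : ℂ) : ℕ →* ℂ where
  toFun n := (n : ℂ) ^ (-s)
  map_one' := by simp
  map_mul' m n := by push_cast; exact natCast_mul_natCast_cpow m n (-s)

lemma hasSum_smoothZeta {s : ℂ} (hs : 0 < s.re) (N : ℕ) :
    Summable (fun m : (N + 1).smoothNumbers => ‖((m : ℕ) : ℂ) ^ (-s)‖) ∧
      HasSum (fun m : (N + 1).smoothNumbers => ((m : ℕ) : ℂ) ^ (-s)) (smoothZeta N s) := by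
  refine EulerProduct.summable_and_hasSum_smoothNumbers_prod_primesBelow_geometric (f := natCpowHom s)
    (fun {p} hp => ?_) (N + 1)
  change ‖(p : ℂ) ^ (-s)‖ < 1
  rw [norm_natCast_cpow_neg hs]
  exact Real.rpow_lt_one_of_one_lt_of_neg (by exact_mod_cast hp.one_lt) (by linarith)

lemma norm_smoothZeta_le {s : ℂ} (hs : 0 < s.re) (N : ℕ) : ‖smoothZeta N s‖ ≤ ‖smoothZeta N s.re‖ := by
  rw [smoothZeta, smoothZeta, norm_prod, norm_prod]
  refine Finset.prod_le_prod (fun _ _ => norm_nonneg _) fun p hp => ?_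
  have hpp := Nat.prime_of_mem_primesBelow hp
  have hlt : (p : ℝ) ^ (-s.re) < 1 :=
    Real.rpow_lt_one_of_one_lt_of_neg (by exact_mod_cast hpp.one_lt) (by linarith)
  have e : (p : ℂ) ^ (-(s.re : ℂ)) = (((p : ℝ) ^ (-s.re) : ℝ) : ℂ) := by
    rw [ofReal_cpow (by positivity)]; simp
  rw [norm_inv, norm_inv, e, show (1 : ℂ) - (((p : ℝ) ^ (-s.re) : ℝ) : ℂ) = ((1 - (p : ℝ) ^ (-s.re) : ℝ) : ℂ) by
    push_cast; ring, norm_real, Real.norm_of_nonneg (by linarith)]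
  apply inv_anti₀ (by linarith)
  have := norm_sub_norm_le (1 : ℂ) ((p : ℂ) ^ (-s))
  rw [norm_natCast_cpow_neg hs, norm_one] at this
  exact this

lemma differentiableAt_smoothZeta {s : ℂ} (hs : 0 < s.re) (N : ℕ) : DifferentiableAt ℂ (smoothZeta N) s := by
  unfold smoothZeta
  refine DifferentiableAt.fun_finsetProd fun p hp => ?_
  have hpp := Nat.prime_of_mem_primesBelow hp
  have hp0 : (p : ℂ) ≠ 0 := by exact_mod_cast hpp.ne_zero
  refine DifferentiableAt.inv ?_ ?_
  · exact (differentiableAt_const _).sub (DifferentiableAt.const_cpow (by fun_prop) (Or.inl hp0))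
  · intro h0
    have h1 : (p : ℂ) ^ (-s) = 1 := by linear_combination -h0
    have h2 := congrArg norm h1
    rw [norm_natCast_cpow_neg hs, norm_one] at h2
    have : (p : ℝ) ^ (-s.re) < 1 :=
      Real.rpow_lt_one_of_one_lt_of_neg (by exact_mod_cast hpp.one_lt) (by linarith)
    linarith

lemma continuous_smoothZeta_vertical {σ : ℝ} (hσ : 0 < σ) (N : ℕ) :
    Continuous fun t : ℝ => smoothZeta N (σ + t * I) := by
  rw [continuous_iff_continuousAt]
  intro t
  have h1 := (differentiableAt_smoothZeta (s := σ + t * I) (by simpa using hσ) N).continuousAt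
  exact ContinuousAt.comp (f := fun t : ℝ => (σ : ℂ) + t * I) h1 (by fun_prop)

lemma Cut.integrable_mul_smoothZeta {F : ℝ → ℂ} (hF : Cut F) {σ X : ℝ} (hσ : 0 < σ) (hX : 0 < X) (N : ℕ) :
    Integrable fun t : ℝ => mellin F (σ + t * I) * ((X : ℂ) ^ (σ + t * I : ℂ) * smoothZeta N (σ + t * I)) := by
  have hX' : (X : ℂ) ≠ 0 := by exact_mod_cast hX.ne'
  refine (hF.integrable_vertical (Or.inl hσ)).mul_bdd (c := X ^ σ * ‖smoothZeta N σ‖) ?_ (.of_forall fun t => ?_)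
  · exact ((Continuous.const_cpow (by fun_prop) (Or.inl hX')).mul
      (continuous_smoothZeta_vertical hσ N)).aestronglyMeasurable
  · rw [norm_mul, norm_cpow_eq_rpow_re_of_pos hX]
    have := norm_smoothZeta_le (s := σ + t * I) (by simpa using hσ) N
    simp only [add_re, ofReal_re, mul_re, I_re, mul_zero, ofReal_im, I_im, mul_one, sub_self, add_zero] at this ⊢
    gcongr

/-- Smooth weighted sums over smooth numbers, as Mellin integrals. -/
lemma Cut.hasSum_smoothNumbers {F : ℝ → ℂ} (hF : Cut F) {σ X : ℝ} (hσ : 0 < σ) (hX : 0 < X) (N : ℕ) :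
    HasSum (fun m : (N + 1).smoothNumbers => F ((m : ℕ) / X)) ((1 / (2 * Real.pi) : ℂ) *
      ∫ t : ℝ, mellin F (σ + t * I) * ((X : ℂ) ^ (σ + t * I : ℂ) * smoothZeta N (σ + t * I))) := by
  have hX' : (X : ℂ) ≠ 0 := by exact_mod_cast hX.ne'
  have hInt := hF.integrable_vertical (σ := σ) (Or.inl hσ)
  have hre : ∀ t : ℝ, (σ + t * I : ℂ).re = σ := fun t => by simp
  have hsum := (hasSum_smoothZeta (s := σ) (by simpa using hσ) N).1
  have hnorm : ∀ (m : (N + 1).smoothNumbers) (t : ℝ), ‖(X : ℂ) ^ (σ + t * I : ℂ) * ((m : ℕ) : ℂ) ^ (-(σ + t * I : ℂ))‖ =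
      X ^ σ * ‖((m : ℕ) : ℂ) ^ (-(σ : ℂ))‖ := by
    intro m t
    rw [norm_mul, norm_cpow_eq_rpow_re_of_pos hX, norm_natCast_cpow_neg (by rw [hre]; exact hσ),
      norm_natCast_cpow_neg (by simpa using hσ), hre, ofReal_re]
  have hne : ∀ m : (N + 1).smoothNumbers, ((m : ℕ) : ℂ) ≠ 0 := fun m => by
    exact_mod_cast Nat.ne_zero_of_mem_smoothNumbers m.2
  have hI : ∀ m : (N + 1).smoothNumbers, Integrable fun t : ℝ =>
      mellin F (σ + t * I) * ((X : ℂ) ^ (σ + t * I : ℂ) * ((m : ℕ) : ℂ) ^ (-(σ + t * I : ℂ))) := by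
    intro m
    refine hInt.mul_bdd (c := X ^ σ * ‖((m : ℕ) : ℂ) ^ (-(σ : ℂ))‖) ?_ (.of_forall fun t => (hnorm m t).le)
    exact ((Continuous.const_cpow (by fun_prop) (Or.inl hX')).mul
      (Continuous.const_cpow (by fun_prop) (Or.inl (hne m)))).aestronglyMeasurable
  have key := hasSum_integral_of_summable_integral_norm hI ?_
  · have k2 := key.mul_left (1 / (2 * Real.pi) : ℂ)
    have htsum : ∀ t : ℝ, ∑' m : (N + 1).smoothNumbers,
        mellin F (σ + t * I) * ((X : ℂ) ^ (σ + t * I : ℂ) * ((m : ℕ) : ℂ) ^ (-(σ + t * I : ℂ))) =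
        mellin F (σ + t * I) * ((X : ℂ) ^ (σ + t * I : ℂ) * smoothZeta N (σ + t * I)) := fun t => by
      rw [tsum_mul_left, tsum_mul_left, (hasSum_smoothZeta (by rw [hre]; exact hσ) N).2.tsum_eq]
    simp only [htsum] at k2
    refine k2.congr_fun ?_ |> fun h => h
    intro m
    have hm : (0 : ℝ) < (m : ℕ) := by exact_mod_cast Nat.pos_of_ne_zero (Nat.ne_zero_of_mem_smoothNumbers m.2)
    rw [← hF.mellin_inversion (σ := σ) (Or.inl hσ) (div_pos hm hX)]
    congr 2
    ext t
    rw [ofReal_div, div_cpow_ofReal_nonneg hm.le hX.le, cpow_neg (X : ℂ), ofReal_natCast, div_inv_eq_mul]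
    ring
  · refine ((hsum.mul_left (X ^ σ)).mul_left (∫ t : ℝ, ‖mellin F (σ + t * I)‖)).congr fun m => ?_
    rw [← integral_mul_const]
    refine integral_congr_ae (.of_forall fun t => ?_)
    simp only [norm_mul] at hnorm ⊢
    rw [hnorm]

lemma Cut.tsum_smoothNumbers {F : ℝ → ℂ} (hF : Cut F) {σ X : ℝ} (hσ : 0 < σ) (hX : 0 < X) (N : ℕ) :
    ∑' m : (N + 1).smoothNumbers, F ((m : ℕ) / X) = (1 / (2 * Real.pi) : ℂ) *
      ∫ t : ℝ, mellin F (σ + t * I) * ((X : ℂ) ^ (σ + t * I : ℂ) * smoothZeta N (σ + t * I)) :=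
  (hF.hasSum_smoothNumbers hσ hX N).tsum_eq

lemma integral_abs_mul_exp_neg_mul_sq {b : ℝ} (hb : 0 < b) :
    ∫ t : ℝ, |t| * Real.exp (-b * t ^ 2) = 1 / b := by
  have h1 := integral_comp_abs (f := fun x => x * Real.exp (-b * x ^ 2))
  simp only [sq_abs] at h1
  rw [h1]
  have h2 := _root_.integral_rpow_mul_exp_neg_mul_rpow (p := 2) (q := 1) (b := b) (by norm_num) (by norm_num) hb
  simp only [Real.rpow_one, Real.rpow_two] at h2
  rw [h2, show (-(1 + 1) / 2 : ℝ) = -1 by norm_num, show ((1 + 1) / 2 : ℝ) = 1 by norm_num,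
    Real.rpow_neg_one, Real.Gamma_one]
  ring

lemma integrable_abs_mul_exp_neg_mul_sq {b : ℝ} (hb : 0 < b) :
    Integrable fun t : ℝ => |t| * Real.exp (-b * t ^ 2) := by
  refine ((integrable_mul_exp_neg_mul_sq hb).norm).congr (.of_forall fun t => ?_)
  simp [norm_mul, abs_of_pos (Real.exp_pos _)]

lemma integral_inv_one_add_div_sq {T : ℝ} (hT : 0 < T) :
    ∫ t : ℝ, (1 + (t / T) ^ 2)⁻¹ = T * Real.pi := by
  have := Measure.integral_comp_div (fun t : ℝ => (1 + t ^ 2)⁻¹) T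
  rw [this, integral_univ_inv_one_add_sq, abs_of_pos hT, smul_eq_mul]

lemma integrable_inv_one_add_div_sq {T : ℝ} (hT : 0 < T) :
    Integrable fun t : ℝ => (1 + (t / T) ^ 2)⁻¹ :=
  integrable_inv_one_add_sq.comp_div hT.ne'

/-- The central part of the saddle point integral. -/
def saddleIntegral (ℓ : ℝ) (N : ℕ) (c : ℝ) : ℂ :=
  (1 / (2 * Real.pi) : ℂ) * ∫ t in Icc (-(1 / Real.log N)) (1 / Real.log N),
    cexp (I * ((t * ℓ : ℝ) : ℂ)) * smoothZeta N (c + t * I)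

lemma cpow_add_mul_I_eq {X : ℝ} (hX : 0 < X) (c t : ℝ) :
    (X : ℂ) ^ (c + t * I : ℂ) = ((X ^ c : ℝ) : ℂ) * cexp (I * ((t * Real.log X : ℝ) : ℂ)) := by
  have hX' : (X : ℂ) ≠ 0 := by exact_mod_cast hX.ne'
  rw [cpow_add _ _ hX', ofReal_cpow hX.le, cpow_def_of_ne_zero hX' (t * I), ← ofReal_log hX.le]
  congr 2
  rw [ofReal_mul]; ring

lemma norm_mul_exp_sub_le {a b : ℂ} {t u D : ℝ} (h : ‖a - b‖ ≤ D * |t|) :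
    ‖a * cexp (I * ((t * u : ℝ) : ℂ)) - b‖ ≤ (D + ‖b‖ * |u|) * |t| := by
  have e : a * cexp (I * ((t * u : ℝ) : ℂ)) - b =
      (a - b) * cexp (I * ((t * u : ℝ) : ℂ)) + b * (cexp (I * ((t * u : ℝ) : ℂ)) - 1) := by ring
  rw [e]
  refine (norm_add_le _ _).trans ?_
  have h1 : ‖cexp (I * ((t * u : ℝ) : ℂ))‖ = 1 := by
    rw [mul_comm]; exact norm_exp_ofReal_mul_I _
  have h2 := Real.norm_exp_I_mul_ofReal_sub_one_le (x := t * u)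
  rw [norm_mul, norm_mul, h1, mul_one]
  rw [Real.norm_eq_abs, abs_mul] at h2
  have := mul_le_mul_of_nonneg_left h2 (norm_nonneg b)
  linarith

section
variable {ε₀ B ℓ : ℝ} {N : ℕ} {c : ℝ}

lemma SaddleFacts.log_pos (hs : SaddleFacts ε₀ B ℓ N c) (hB : 100 ≤ B) : 100 ≤ Real.log N :=
  hB.trans hs.B_le

lemma SaddleFacts.two_le (hs : SaddleFacts ε₀ B ℓ N c) (hB : 100 ≤ B) : 2 ≤ N := by
  have h := hs.log_pos hB
  by_contra hN
  have : (N : ℝ) ≤ 1 := by exact_mod_cast (by omega : N ≤ 1)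
  have := Real.log_nonpos (Nat.cast_nonneg N) this
  linarith

lemma SaddleFacts.pos (hs : SaddleFacts ε₀ B ℓ N c) (hB : 100 ≤ B) : 0 < ℓ := by
  have h := hs.log_pos hB
  have := hs.log_sq_le
  nlinarith [sq_nonneg (Real.log N)]

/-- Local limit theorem for smooth weights on smooth numbers. -/
theorem SaddleFacts.norm_tsum_sub_le (hs : SaddleFacts ε₀ B ℓ N c) (hB : 100 ≤ B) (hε₀ : 0 < ε₀)
    {G : ℝ → ℂ} (hG : Cut G) {r D₀ D₁ D₂ : ℝ} (hr : 0 < r)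
    (h0 : ∀ t : ℝ, ‖mellin G (c + t * I)‖ ≤ D₀) 
    (h1 : ∀ t : ℝ, |t| ≤ 1 / Real.log N → ‖mellin G (c + t * I) - mellin G c‖ ≤ D₁ * |t|)
    (h2 : ∀ t : ℝ, ‖mellin G (c + t * I)‖ * t ^ 2 ≤ D₂) :
    ‖∑' m : (N + 1).smoothNumbers, G ((m : ℕ) / (Real.exp ℓ * r)) -
        (((Real.exp ℓ * r) ^ c : ℝ) : ℂ) * (mellin G c * saddleIntegral ℓ N c)‖ ≤
      (Real.exp ℓ * r) ^ c * ‖smoothZeta N c‖ *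
        (40 * (D₁ + ‖mellin G c‖ * |Real.log r|) / (Real.log N * ℓ) + (D₀ + D₂) / (N : ℝ) ^ 50) := by
  have hL := hs.log_pos hB
  have hN := hs.two_le hB
  have hℓ := hs.pos hB
  have hc : 0 < c := by linarith [hs.lower]
  set L := Real.log N with hLdef
  set X := Real.exp ℓ * r with hXdef
  have hX : 0 < X := by positivity
  set Z := ‖smoothZeta N c‖ with hZ
  set T : ℝ := (N : ℝ) ^ 50 with hT
  have hN0 : (0 : ℝ) < N := by exact_mod_cast (by omega : 0 < N)
  have hT0 : 0 < T := by positivity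
  have hlogX : Real.log X = ℓ + Real.log r := by
    rw [hXdef, Real.log_mul (Real.exp_pos _).ne' hr.ne', Real.log_exp]
  have hD0 : 0 ≤ D₀ := (norm_nonneg _).trans (h0 0)
  have hD2 : 0 ≤ D₂ := (mul_nonneg (norm_nonneg _) (sq_nonneg 0)).trans (h2 0)
  have hLi : 0 < 1 / L := by positivity
  have hD1 : 0 ≤ D₁ := by
    have := (norm_nonneg _).trans (h1 (1 / L) (by rw [abs_of_pos hLi]))
    rw [abs_of_pos hLi] at this
    exact nonneg_of_mul_nonneg_left this hLi
  have hV : 0 < 1 / 200 * (L * ℓ) := by positivity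
  set J : Set ℝ := Icc (-(1 / L)) (1 / L) with hJ
  set E := D₁ + ‖mellin G c‖ * |Real.log r| with hE
  have hE0 : 0 ≤ E := by positivity
  rw [hG.tsum_smoothNumbers hc hX N, saddleIntegral]
  have e1 : (((X) ^ c : ℝ) : ℂ) * (mellin G c * ((1 / (2 * Real.pi) : ℂ) * ∫ t in J,
      cexp (I * ((t * ℓ : ℝ) : ℂ)) * smoothZeta N (c + t * I))) =
      (1 / (2 * Real.pi) : ℂ) * ∫ t : ℝ, J.indicator (fun t : ℝ => (((X) ^ c : ℝ) : ℂ) * mellin G c *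
      (cexp (I * ((t * ℓ : ℝ) : ℂ)) * smoothZeta N (c + t * I))) t := by
    rw [integral_indicator measurableSet_Icc, integral_const_mul]; ring
  have hcontZ := continuous_smoothZeta_vertical hc N
  have hInt2 : Integrable (J.indicator (fun t : ℝ => (((X) ^ c : ℝ) : ℂ) * mellin G c *
      (cexp (I * ((t * ℓ : ℝ) : ℂ)) * smoothZeta N (c + t * I)))) := by
    rw [integrable_indicator_iff measurableSet_Icc]
    refine ContinuousOn.integrableOn_Icc (Continuous.continuousOn ?_)
    exact continuous_const.mul (Continuous.mul (by fun_prop) hcontZ)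
  rw [e1, ← mul_sub, ← integral_sub (hG.integrable_mul_smoothZeta hc hX N) hInt2, norm_mul]
  have hbound : ∀ t : ℝ, ‖mellin G (c + t * I) * ((X : ℂ) ^ (c + t * I : ℂ) * smoothZeta N (c + t * I)) -
      J.indicator (fun t : ℝ => (((X) ^ c : ℝ) : ℂ) * mellin G c *
      (cexp (I * ((t * ℓ : ℝ) : ℂ)) * smoothZeta N (c + t * I))) t‖ ≤
      X ^ c * Z * (E * (|t| * Real.exp (-(1 / 200 * (L * ℓ)) * t ^ 2)) +
        2 * (D₀ + D₂) / T ^ 2 * (1 + (t / T) ^ 2)⁻¹) := by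
    intro t
    have hX0 : 0 < X ^ c := by positivity
    have hZ0 : 0 ≤ Z := norm_nonneg _
    have hinv : 0 < (1 + (t / T) ^ 2)⁻¹ := by positivity
    by_cases ht : t ∈ J
    · have htL : |t| ≤ 1 / L := abs_le.mpr ht
      rw [indicator_of_mem ht, cpow_add_mul_I_eq hX, hlogX]
      have e2 : mellin G (c + t * I) * (((X ^ c : ℝ) : ℂ) * cexp (I * ((t * (ℓ + Real.log r) : ℝ) : ℂ)) *
          smoothZeta N (c + t * I)) - ((X ^ c : ℝ) : ℂ) * mellin G c *
          (cexp (I * ((t * ℓ : ℝ) : ℂ)) * smoothZeta N (c + t * I)) =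
          ((X ^ c : ℝ) : ℂ) * (cexp (I * ((t * ℓ : ℝ) : ℂ)) * smoothZeta N (c + t * I)) *
          (mellin G (c + t * I) * cexp (I * ((t * Real.log r : ℝ) : ℂ)) - mellin G c) := by
        have : cexp (I * ((t * (ℓ + Real.log r) : ℝ) : ℂ)) =
            cexp (I * ((t * ℓ : ℝ) : ℂ)) * cexp (I * ((t * Real.log r : ℝ) : ℂ)) := by
          rw [← Complex.exp_add]; congr 1; rw [mul_add, ofReal_add]; ring
        rw [this]; ring
      have h3 : ‖cexp (I * ((t * ℓ : ℝ) : ℂ))‖ = 1 := by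
        rw [mul_comm]; exact norm_exp_ofReal_mul_I _
      rw [e2, norm_mul, norm_mul, norm_mul, h3, one_mul, norm_real, Real.norm_of_nonneg hX0.le]
      have h4 := hs.decay_small t htL
      have h5 := norm_mul_exp_sub_le (u := Real.log r) (h1 t htL)
      have h6 := mul_le_mul (mul_le_mul_of_nonneg_left h4 hX0.le) h5 (norm_nonneg _) (by positivity)
      refine h6.trans ?_
      have e3 : -(1 / 200 * t ^ 2 * (L * ℓ)) = -(1 / 200 * (L * ℓ)) * t ^ 2 := by ring
      rw [← hLdef, e3]
      have : 0 ≤ X ^ c * Z * (2 * (D₀ + D₂) / T ^ 2 * (1 + (t / T) ^ 2)⁻¹) := by positivity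
      linarith
    · have htL : 1 / L ≤ |t| := by
        by_contra h; push Not at h; exact ht (abs_le.mp h.le)
      rw [indicator_of_notMem ht, sub_zero, norm_mul, norm_mul, cpow_add_mul_I_eq hX]
      have h3 : ‖cexp (I * ((t * Real.log X : ℝ) : ℂ))‖ = 1 := by
        rw [mul_comm]; exact norm_exp_ofReal_mul_I _
      rw [norm_mul, h3, mul_one, norm_real, Real.norm_of_nonneg hX0.le]
      have hmain : ‖mellin G (c + t * I)‖ * ‖smoothZeta N (c + t * I)‖ ≤
          Z * (2 * (D₀ + D₂) / T ^ 2 * (1 + (t / T) ^ 2)⁻¹) := by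
        by_cases htT : |t| ≤ T
        · have h4 := hs.decay_large t htL htT
          have h5 : Real.exp (-(B * L)) ≤ 1 / T ^ 2 := by
            have : T ^ 2 = Real.exp (100 * L) := by
              rw [hT, ← pow_mul, hLdef, mul_comm (100 : ℝ), Real.exp_mul, Real.exp_log hN0]
              norm_cast
            rw [this, one_div, ← Real.exp_neg]
            apply Real.exp_le_exp.mpr; nlinarith only [hB, hL]
          have h6 : (1 / 2 : ℝ) ≤ (1 + (t / T) ^ 2)⁻¹ := by
            rw [one_div]; apply inv_anti₀ (by positivity)
            have : (t / T) ^ 2 ≤ 1 := by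
              rw [div_pow, div_le_one (by positivity), ← sq_abs]
              exact pow_le_pow_left₀ (abs_nonneg _) htT 2
            linarith only [this]
          calc ‖mellin G (c + t * I)‖ * ‖smoothZeta N (c + t * I)‖
              ≤ D₀ * (Z * (1 / T ^ 2)) := by
                refine mul_le_mul (h0 t) (h4.trans (by gcongr)) (norm_nonneg _) hD0
            _ = Z * (2 * D₀ / T ^ 2 * (1 / 2)) := by ring
            _ ≤ _ := by gcongr; linarith only [hD2]
        · push Not at htT
          have ht2 : T ^ 2 ≤ t ^ 2 := by
            rw [← sq_abs t]; exact pow_le_pow_left₀ hT0.le htT.le 2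
          have h4 : ‖smoothZeta N (c + t * I)‖ ≤ Z := by
            have := norm_smoothZeta_le (s := c + t * I) (by simpa using hc) N
            simpa using this
          have h5 : ‖mellin G (c + t * I)‖ ≤ 2 * D₂ / T ^ 2 * (1 + (t / T) ^ 2)⁻¹ := by
            have e : 2 * D₂ / T ^ 2 * (1 + (t / T) ^ 2)⁻¹ = 2 * D₂ / (T ^ 2 + t ^ 2) := by
              field_simp
            rw [e, le_div_iff₀ (by positivity)]
            have := h2 t
            nlinarith only [this, norm_nonneg (mellin G (c + t * I)), ht2]
          calc ‖mellin G (c + t * I)‖ * ‖smoothZeta N (c + t * I)‖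
              ≤ (2 * D₂ / T ^ 2 * (1 + (t / T) ^ 2)⁻¹) * Z := by gcongr
            _ = Z * (2 * D₂ / T ^ 2 * (1 + (t / T) ^ 2)⁻¹) := by ring
            _ ≤ _ := by gcongr; linarith only [hD0]
      have : 0 ≤ X ^ c * Z * (E * (|t| * Real.exp (-(1 / 200 * (L * ℓ)) * t ^ 2))) := by positivity
      have h8 := mul_le_mul_of_nonneg_left hmain hX0.le
      nlinarith only [this, h8]
  have hi1 := integrable_abs_mul_exp_neg_mul_sq hV
  have hi2 := integrable_inv_one_add_div_sq hT0
  have h3 := norm_integral_le_of_norm_le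
    (((hi1.const_mul E).add (hi2.const_mul (2 * (D₀ + D₂) / T ^ 2))).const_mul (X ^ c * Z))
    (.of_forall hbound)
  rw [integral_const_mul] at h3
  simp only [Pi.add_apply] at h3
  rw [integral_add (hi1.const_mul E) (hi2.const_mul _), integral_const_mul, integral_const_mul,
    integral_abs_mul_exp_neg_mul_sq hV, integral_inv_one_add_div_sq hT0] at h3
  have hpi : ‖(1 / (2 * Real.pi) : ℂ)‖ = 1 / (2 * Real.pi) := by
    rw [show (1 / (2 * Real.pi) : ℂ) = ((1 / (2 * Real.pi) : ℝ) : ℂ) by simp, norm_real,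
      Real.norm_of_nonneg (by positivity)]
  rw [hpi]
  refine (mul_le_mul_of_nonneg_left h3 (by positivity)).trans ?_
  have e4 : 1 / (2 * Real.pi) * (X ^ c * Z * (E * (1 / (1 / 200 * (L * ℓ))) +
      2 * (D₀ + D₂) / T ^ 2 * (T * Real.pi))) =
      X ^ c * Z * ((100 / Real.pi) * E / (L * ℓ) + (D₀ + D₂) / T) := by
    have := Real.pi_pos
    field_simp
    ring
  rw [e4]
  have : 100 / Real.pi ≤ 40 := by
    rw [div_le_iff₀ Real.pi_pos]; linarith [Real.pi_gt_three]
  have hZ0 : 0 ≤ Z := norm_nonneg _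
  gcongr

end

lemma norm_exp_sub_quadratic_le (z : ℂ) : ‖cexp z - (1 + z + z ^ 2 / 2)‖ ≤ ‖z‖ ^ 3 * Real.exp ‖z‖ := by
  have h := Complex.norm_exp_sub_sum_le_norm_mul_exp z 3
  simpa [Finset.sum_range_succ, Nat.factorial] using h

/-- Second order expansion of a normalised Euler factor. -/
lemma norm_exp_mul_euler_factor_sub_one_le {q θ : ℝ} (hq0 : 0 < q) (hq : q ≤ 3 / 4) (hθ : |θ| ≤ 1) :
    ‖cexp (((θ * (q / (1 - q)) : ℝ) : ℂ) * I + ((θ ^ 2 * (q / (1 - q) ^ 2) / 2 : ℝ) : ℂ)) *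
      ((1 - q) / (1 - q * cexp (-(θ : ℂ) * I))) - 1‖ ≤ 10 ^ 8 * q * |θ| ^ 3 := by
  have h1q : 0 < 1 - q := by linarith
  set a := q / (1 - q) with ha
  set v := q / (1 - q) ^ 2 with hv
  have ha0 : 0 ≤ a := by positivity
  have hv0 : 0 ≤ v := by positivity
  have ha4 : a ≤ 4 * q := by rw [ha, div_le_iff₀ h1q]; nlinarith
  have hv16 : v ≤ 16 * q := by
    rw [hv, div_le_iff₀ (by positivity)]
    have : 1 / 16 ≤ (1 - q) ^ 2 := by nlinarith
    nlinarith
  have hva : v = a ^ 2 + a := by rw [hv, ha]; field_simp; ring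
  have hq1 : a * (1 - q) = q := by rw [ha]; field_simp
  clear_value a v
  set u := |θ| with hu
  have hu0 : 0 ≤ u := abs_nonneg _
  set w : ℂ := ((θ * a : ℝ) : ℂ) * I + ((θ ^ 2 * v / 2 : ℝ) : ℂ) with hw
  have hwn : ‖w‖ ≤ 12 * q * u := by
    rw [hw]
    refine (norm_add_le _ _).trans ?_
    rw [norm_mul, norm_I, mul_one, norm_real, norm_real, Real.norm_eq_abs, Real.norm_eq_abs, abs_mul,
      abs_of_nonneg ha0, abs_of_nonneg (show 0 ≤ θ ^ 2 * v / 2 by positivity), ← sq_abs θ, ← hu]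
    have h1 : u * a ≤ u * (4 * q) := mul_le_mul_of_nonneg_left ha4 hu0
    have h2 : u ^ 2 ≤ u := by nlinarith
    have h3 : u ^ 2 * v ≤ u * (16 * q) := mul_le_mul h2 hv16 hv0 hu0
    linarith
  have hw9 : ‖w‖ ≤ 9 := hwn.trans (by nlinarith)
  have hR1 : ‖cexp w - (1 + w + w ^ 2 / 2)‖ ≤ (12 * q * u) ^ 3 * 8200 := by
    refine (norm_exp_sub_quadratic_le w).trans ?_
    have : Real.exp ‖w‖ ≤ 8200 := by
      refine (Real.exp_le_exp.mpr hw9).trans ?_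
      have h1 : Real.exp 9 = Real.exp 1 ^ 9 := by rw [← Real.exp_nat_mul]; norm_num
      rw [h1]
      calc Real.exp 1 ^ 9 ≤ (2.7182818286 : ℝ) ^ 9 :=
            pow_le_pow_left₀ (Real.exp_pos _).le Real.exp_one_lt_d9.le 9
        _ ≤ 8200 := by norm_num
    gcongr
  have hR2 : ‖cexp (-(θ : ℂ) * I) - (1 + -(θ : ℂ) * I + (-(θ : ℂ) * I) ^ 2 / 2)‖ ≤ u ^ 3 * 3 := by
    refine (norm_exp_sub_quadratic_le _).trans ?_
    have e : ‖-(θ : ℂ) * I‖ = u := by rw [norm_mul, norm_I, mul_one, norm_neg, norm_real, Real.norm_eq_abs]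
    rw [e]
    have : Real.exp u ≤ 3 := (Real.exp_le_exp.mpr hθ).trans (by linarith [Real.exp_one_lt_d9])
    gcongr
  have hden : 1 / 4 ≤ ‖1 - q * cexp (-(θ : ℂ) * I)‖ := by
    have := norm_sub_norm_le (1 : ℂ) (q * cexp (-(θ : ℂ) * I))
    rw [norm_mul, ← ofReal_neg, norm_exp_ofReal_mul_I, norm_real, Real.norm_of_nonneg hq0.le, norm_one] at this
    rw [← ofReal_neg]; linarith
  have hden0 : (1 : ℂ) - q * cexp (-(θ : ℂ) * I) ≠ 0 := by
    rw [← norm_pos_iff]; linarith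
  have key : (1 - q : ℂ) * cexp w - (1 - q * cexp (-(θ : ℂ) * I)) =
      (1 - q : ℂ) * (cexp w - (1 + w + w ^ 2 / 2)) +
      q * (cexp (-(θ : ℂ) * I) - (1 + -(θ : ℂ) * I + (-(θ : ℂ) * I) ^ 2 / 2)) +
      (1 - q : ℂ) * (((θ ^ 3 * a * v / 2 : ℝ) : ℂ) * I + ((θ ^ 4 * v ^ 2 / 8 : ℝ) : ℂ)) := by
    have hq1' : (a : ℂ) * (1 - q) = q := by exact_mod_cast hq1
    have hva' : (v : ℂ) = a ^ 2 + a := by exact_mod_cast hva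
    rw [hw]
    push_cast
    linear_combination (θ * I + θ ^ 2 / 2) * hq1' + (1 - q : ℂ) * (θ ^ 2 / 2) * hva' + ((1 - q : ℂ) * (θ ^ 2 * a ^ 2 / 2) + q * θ ^ 2 / 2) * I_sq
  have hR3 : ‖((θ ^ 3 * a * v / 2 : ℝ) : ℂ) * I + ((θ ^ 4 * v ^ 2 / 8 : ℝ) : ℂ)‖ ≤ 64 * q * u ^ 3 := by
    refine (norm_add_le _ _).trans ?_
    rw [norm_mul, norm_I, mul_one, norm_real, norm_real, Real.norm_eq_abs, Real.norm_eq_abs]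
    have e1 : |θ ^ 3 * a * v / 2| = u ^ 3 * (a * v) / 2 := by
      rw [abs_div, abs_mul, abs_mul, abs_of_nonneg ha0, abs_of_nonneg hv0, abs_pow]; norm_num; ring
    have e2 : |θ ^ 4 * v ^ 2 / 8| = u ^ 4 * (v ^ 2) / 8 := by
      rw [abs_div, abs_mul, abs_of_nonneg (sq_nonneg v), abs_pow, ← hu]; norm_num
    rw [e1, e2]
    have h1 : a * v ≤ 4 * q * (16 * q) := mul_le_mul ha4 hv16 hv0 (by positivity)
    have h2 : v ^ 2 ≤ (16 * q) ^ 2 := pow_le_pow_left₀ hv0 hv16 2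
    have h3 : u ^ 4 ≤ u ^ 3 := pow_le_pow_of_le_one hu0 hθ (by norm_num)
    have h4 : u ^ 4 * v ^ 2 ≤ u ^ 3 * (16 * q) ^ 2 := mul_le_mul h3 h2 (sq_nonneg _) (by positivity)
    have h5 : u ^ 3 * (a * v) ≤ u ^ 3 * (4 * q * (16 * q)) := mul_le_mul_of_nonneg_left h1 (by positivity)
    have h6 : q ^ 2 ≤ q := by nlinarith
    have h7 : u ^ 3 * q ^ 2 ≤ u ^ 3 * q := mul_le_mul_of_nonneg_left h6 (by positivity)
    nlinarith only [h4, h5, h7]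
  have e : cexp w * ((1 - q) / (1 - q * cexp (-(θ : ℂ) * I))) - 1 =
      ((1 - q : ℂ) * cexp w - (1 - q * cexp (-(θ : ℂ) * I))) / (1 - q * cexp (-(θ : ℂ) * I)) := by
    rw [eq_div_iff hden0, sub_mul, mul_assoc, div_mul_cancel₀ _ hden0]; ring
  rw [e, norm_div, div_le_iff₀ (by linarith), key]
  have hn1 : ‖(1 - q : ℂ)‖ ≤ 1 := by
    rw [show (1 - q : ℂ) = ((1 - q : ℝ) : ℂ) by push_cast; rfl, norm_real, Real.norm_of_nonneg h1q.le]; linarith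
  have hnq : ‖(q : ℂ)‖ = q := by rw [norm_real, Real.norm_of_nonneg hq0.le]
  have hu3 : 0 ≤ u ^ 3 := by positivity
  calc _ ≤ 1 * ((12 * q * u) ^ 3 * 8200) + q * (u ^ 3 * 3) + 1 * (64 * q * u ^ 3) := by
        refine (norm_add_le _ _).trans (add_le_add ((norm_add_le _ _).trans (add_le_add ?_ ?_)) ?_)
        · rw [norm_mul]; exact mul_le_mul hn1 hR1 (norm_nonneg _) zero_le_one
        · rw [norm_mul, hnq]; exact mul_le_mul_of_nonneg_left hR2 hq0.le
        · rw [norm_mul]; exact mul_le_mul hn1 hR3 (norm_nonneg _) zero_le_one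
    _ ≤ 10 ^ 8 * q * u ^ 3 * (1 / 4) := by
        have h6 : q ^ 2 ≤ 1 := by nlinarith
        have h7 : q * u ^ 3 * q ^ 2 ≤ q * u ^ 3 * 1 := mul_le_mul_of_nonneg_left h6 (by positivity)
        have h8 : 0 ≤ q * u ^ 3 := by positivity
        nlinarith only [h7, h8]
    _ ≤ _ := by gcongr

section
variable {ε₀ B ℓ : ℝ} {N : ℕ} {c : ℝ}

lemma prime_cpow_neg_eq {p : ℕ} (c : ℝ) : (p : ℂ) ^ (-(c : ℂ)) = (((p : ℝ) ^ (-c) : ℝ) : ℂ) := by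
  rw [ofReal_cpow (by positivity)]; simp

lemma SaddleFacts.exists_gaussian (hs : SaddleFacts ε₀ B ℓ N c) (hB : 100 ≤ B) (hε₀ : 0 < ε₀)
    (heq : ∑ p ∈ Nat.primesBelow (N + 1), Real.log p / ((p : ℝ) ^ c - 1) = ℓ) :
    ∃ W, 0 ≤ W ∧ W ≤ 16 * (Real.log N * ℓ) ∧ ∀ t : ℝ, |t| ≤ 1 / Real.log N →
      ‖cexp (I * ((t * ℓ : ℝ) : ℂ)) * smoothZeta N (c + t * I) -
        smoothZeta N c * ((Real.exp (-(t ^ 2 * W / 2)) : ℝ) : ℂ)‖ ≤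
      ‖smoothZeta N c‖ * (Real.exp (-(t ^ 2 * W / 2)) *
        (Real.exp (10 ^ 8 * |t| ^ 3 * ((Real.log N) ^ 2 * ℓ)) - 1)) := by
  have hL := hs.log_pos hB
  have hN := hs.two_le hB
  have hℓ := hs.pos hB
  have hc2 : 1 / 2 ≤ c := by linarith [hs.lower]
  have hc : 0 < c := by linarith
  set L := Real.log N with hLdef
  set S := Nat.primesBelow (N + 1) with hS
  have hpr : ∀ p ∈ S, p.Prime := fun p hp => Nat.prime_of_mem_primesBelow hp
  set q : ℕ → ℝ := fun p => (p : ℝ) ^ (-c) with hq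
  have hq0 : ∀ p ∈ S, 0 < q p := fun p hp => by
    have := (hpr p hp).pos
    simp only [hq]; positivity
  have hq1 : ∀ p ∈ S, q p ≤ 3 / 4 := fun p hp => two_rpow_neg_half_le (hpr p hp) hc2
  have hlog0 : ∀ p ∈ S, 0 ≤ Real.log p := fun p _ => Real.log_natCast_nonneg p
  have hlogL : ∀ p ∈ S, Real.log p ≤ L := fun p hp => by
    have h1 := (hpr p hp).pos
    have h2 : p ≤ N := by have := Nat.lt_of_mem_primesBelow hp; omega
    exact Real.log_le_log (by exact_mod_cast h1) (by exact_mod_cast h2)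
  have hsum : ∑ p ∈ S, q p * Real.log p ≤ ℓ := by
    refine le_trans (le_of_eq ?_) hs.sum_le
    exact Finset.sum_congr rfl fun p _ => mul_comm _ _
  set v : ℕ → ℝ := fun p => q p / (1 - q p) ^ 2 with hv
  set W := ∑ p ∈ S, (Real.log p) ^ 2 * v p with hW
  have hv0 : ∀ p ∈ S, 0 ≤ v p := fun p hp => by
    have := hq0 p hp
    simp only [hv]; positivity
  have hv16 : ∀ p ∈ S, v p ≤ 16 * q p := fun p hp => by
    have h0 := hq0 p hp
    have h1 := hq1 p hp
    simp only [hv]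
    rw [div_le_iff₀ (by nlinarith)]
    have : 1 / 16 ≤ (1 - q p) ^ 2 := by nlinarith
    nlinarith
  refine ⟨W, Finset.sum_nonneg fun p hp => mul_nonneg (sq_nonneg _) (hv0 p hp), ?_, fun t ht => ?_⟩
  · calc W ≤ ∑ p ∈ S, 16 * L * (q p * Real.log p) := by
          refine Finset.sum_le_sum fun p hp => ?_
          have h1 := mul_le_mul (mul_le_mul_of_nonneg_left (hlogL p hp) (hlog0 p hp)) (hv16 p hp) (hv0 p hp)
            (mul_nonneg (hlog0 p hp) (by linarith))
          nlinarith only [h1]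
      _ = 16 * L * ∑ p ∈ S, q p * Real.log p := by rw [Finset.mul_sum]
      _ ≤ 16 * L * ℓ := by gcongr
      _ = _ := by ring
  · set θ : ℕ → ℝ := fun p => t * Real.log p with hθ
    have hθ1 : ∀ p ∈ S, |θ p| ≤ 1 := fun p hp => by
      simp only [hθ]
      rw [abs_mul, abs_of_nonneg (hlog0 p hp)]
      calc |t| * Real.log p ≤ 1 / L * L := mul_le_mul ht (hlogL p hp) (hlog0 p hp) (by positivity)
        _ = 1 := by field_simp
    set f : ℕ → ℂ := fun p => cexp (((θ p * (q p / (1 - q p)) : ℝ) : ℂ) * I +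
      (((θ p) ^ 2 * v p / 2 : ℝ) : ℂ)) *
      ((1 - q p) / (1 - q p * cexp (-(θ p : ℂ) * I))) - 1 with hf
    have hfle : ∀ p ∈ S, ‖f p‖ ≤ 10 ^ 8 * q p * |θ p| ^ 3 := fun p hp =>
      norm_exp_mul_euler_factor_sub_one_le (hq0 p hp) (hq1 p hp) (hθ1 p hp)
    have hsumf : ∑ p ∈ S, ‖f p‖ ≤ 10 ^ 8 * |t| ^ 3 * (L ^ 2 * ℓ) := by
      calc ∑ p ∈ S, ‖f p‖ ≤ ∑ p ∈ S, 10 ^ 8 * |t| ^ 3 * L ^ 2 * (q p * Real.log p) := by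
            refine Finset.sum_le_sum fun p hp => (hfle p hp).trans ?_
            simp only [hθ]
            rw [abs_mul, abs_of_nonneg (hlog0 p hp), mul_pow]
            have h1 : (Real.log p) ^ 2 ≤ L ^ 2 := pow_le_pow_left₀ (hlog0 p hp) (hlogL p hp) 2
            have h2 : 0 ≤ |t| ^ 3 * (q p * Real.log p) :=
              mul_nonneg (by positivity) (mul_nonneg (hq0 p hp).le (hlog0 p hp))
            have h3 := mul_le_mul_of_nonneg_left h1 h2
            nlinarith only [h3]
        _ = 10 ^ 8 * |t| ^ 3 * L ^ 2 * ∑ p ∈ S, q p * Real.log p := by rw [Finset.mul_sum]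
        _ ≤ 10 ^ 8 * |t| ^ 3 * L ^ 2 * ℓ := by gcongr
        _ = _ := by ring
    have hprod : cexp (I * ((t * ℓ : ℝ) : ℂ)) * smoothZeta N (c + t * I) =
        smoothZeta N c * ((Real.exp (-(t ^ 2 * W / 2)) : ℝ) : ℂ) * ∏ p ∈ S, (1 + f p) := by
      have e1 : cexp (I * ((t * ℓ : ℝ) : ℂ)) = ∏ p ∈ S, cexp (((θ p * (q p / (1 - q p)) : ℝ) : ℂ) * I) := by
        rw [← Complex.exp_sum, ← Finset.sum_mul, ← ofReal_sum, mul_comm I]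
        congr 3
        rw [← heq, Finset.mul_sum]
        refine Finset.sum_congr rfl fun p hp => ?_
        have h1 := hq1 p hp
        have h0 := hq0 p hp
        have h2 : (p : ℝ) ^ c = (q p)⁻¹ := by
          simp only [hq]; rw [Real.rpow_neg (by positivity), inv_inv]
        have h3 : (q p)⁻¹ - 1 ≠ 0 := by
          have : (1 : ℝ) < (q p)⁻¹ := (one_lt_inv₀ h0).mpr (by linarith)
          linarith
        rw [h2]
        simp only [hθ]
        have h4 : 1 - q p ≠ 0 := by linarith
        have : (q p)⁻¹ - 1 = (1 - q p) / q p := by field_simp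
        rw [this]
        field_simp
      have e2 : ((Real.exp (-(t ^ 2 * W / 2)) : ℝ) : ℂ) =
          ∏ p ∈ S, (cexp (((θ p) ^ 2 * v p / 2 : ℝ) : ℂ))⁻¹ := by
        have : -(t ^ 2 * W / 2) = ∑ p ∈ S, -((θ p) ^ 2 * v p / 2) := by
          rw [hW, Finset.sum_neg_distrib, Finset.mul_sum, Finset.sum_div]
          congr 1
          refine Finset.sum_congr rfl fun p _ => ?_
          simp only [hθ]; ring
        rw [this, Real.exp_sum, ofReal_prod]
        refine Finset.prod_congr rfl fun p _ => ?_
        rw [Real.exp_neg, ofReal_inv, ofReal_exp]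
      rw [e1, e2, smoothZeta, smoothZeta, ← Finset.prod_mul_distrib, ← Finset.prod_mul_distrib,
        ← Finset.prod_mul_distrib]
      refine Finset.prod_congr rfl fun p hp => ?_
      have h1 := hq1 p hp
      have h0 := hq0 p hp
      have e3 : (p : ℂ) ^ (-(c + t * I : ℂ)) = q p * cexp (-(θ p : ℂ) * I) :=
        norm_natCast_cpow_mul_I (hpr p hp).pos c t
      have h4 : (1 : ℂ) - q p ≠ 0 := by
        rw [← ofReal_one, ← ofReal_sub]; exact_mod_cast (by linarith : (1 : ℝ) - q p ≠ 0)
      rw [e3, prime_cpow_neg_eq]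
      simp only [hf]
      rw [add_sub_cancel, Complex.exp_add, div_eq_mul_inv]
      have h5 := Complex.exp_ne_zero (((θ p) ^ 2 * v p / 2 : ℝ) : ℂ)
      change _ = (1 - (q p : ℂ))⁻¹ * _ * _
      field_simp
    rw [hprod]
    have e4 : smoothZeta N c * ((Real.exp (-(t ^ 2 * W / 2)) : ℝ) : ℂ) * ∏ p ∈ S, (1 + f p) -
        smoothZeta N c * ((Real.exp (-(t ^ 2 * W / 2)) : ℝ) : ℂ) =
        smoothZeta N c * ((Real.exp (-(t ^ 2 * W / 2)) : ℝ) : ℂ) * (∏ p ∈ S, (1 + f p) - 1) := by ring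
    rw [e4, norm_mul, norm_mul, norm_real, Real.norm_of_nonneg (Real.exp_pos _).le, mul_assoc]
    have h6 := Finset.norm_prod_one_add_sub_one_le S f
    have h7 : Real.exp (∑ p ∈ S, ‖f p‖) ≤ Real.exp (10 ^ 8 * |t| ^ 3 * (L ^ 2 * ℓ)) := Real.exp_le_exp.mpr hsumf
    have h8 := (Real.exp_pos (-(t ^ 2 * W / 2))).le
    gcongr
    linarith

end

/-- Lower bound for the central part of the saddle point integral. -/
theorem exists_le_norm_saddleIntegral : ∃ κ > 0, ∃ B₀ : ℝ, 100 ≤ B₀ ∧ ∀ (ε₀ B ℓ : ℝ) (N : ℕ) (c : ℝ),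
    SaddleFacts ε₀ B ℓ N c → B₀ ≤ B → 0 < ε₀ →
    ∑ p ∈ Nat.primesBelow (N + 1), Real.log p / ((p : ℝ) ^ c - 1) = ℓ →
    κ * ‖smoothZeta N c‖ / Real.sqrt (Real.log N * ℓ) ≤ ‖saddleIntegral ℓ N c‖ := by
  set A : ℝ := 400 * Real.exp 8 with hA
  have hA1 : 1 ≤ A := by have := Real.one_le_exp (show (0 : ℝ) ≤ 8 by norm_num); linarith
  set K : ℝ := 4 * 10 ^ 8 * A ^ 3 with hK
  have hKA : A ≤ K := by
    have : A ≤ A ^ 3 := le_self_pow₀ hA1 (by norm_num)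
    have h0 : 0 ≤ A ^ 3 := by positivity
    linarith
  clear_value K
  refine ⟨Real.exp (-8) / (4 * Real.pi), by positivity, max 100 (K ^ 2), le_max_left _ _,
    fun ε₀ B ℓ N c hs hB hε₀ heq => ?_⟩
  have hB1 : 100 ≤ B := (le_max_left _ _).trans hB
  have hBK : K ^ 2 ≤ B := (le_max_right _ _).trans hB
  have hL := hs.log_pos hB1
  have hℓ := hs.pos hB1
  have hc : 0 < c := by linarith [hs.lower]
  have hBL := hs.log_sq_le
  obtain ⟨W, hW0, hW, hg⟩ := hs.exists_gaussian hB1 hε₀ heq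
  have hds := hs.decay_small
  have hcont := continuous_smoothZeta_vertical hc N
  rw [saddleIntegral]
  set L := Real.log N with hLdef
  set V := L * ℓ with hV
  have hV0 : 0 < V := by positivity
  set R := Real.sqrt V with hR
  have hR0 : 0 < R := Real.sqrt_pos.mpr hV0
  have hR2 : R ^ 2 = V := Real.sq_sqrt hV0.le
  have hKL : K * L ≤ R := by
    rw [hR]; apply Real.le_sqrt_of_sq_le
    have h1 : K ^ 2 * L ^ 2 ≤ B * L ^ 2 := mul_le_mul_of_nonneg_right hBK (by positivity)
    have h2 : 1 * ℓ ≤ L * ℓ := mul_le_mul_of_nonneg_right (by linarith) hℓ.le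
    nlinarith only [h1, h2, hBL, hV]
  have hAL : A * L ≤ R := le_trans (by gcongr) hKL
  have hA0 : 0 < A := by linarith
  set z := smoothZeta N c with hz
  by_cases hz0 : z = 0
  · rw [hz0]; simp
  have hzn : 0 < ‖z‖ := norm_pos_iff.mpr hz0
  set J : Set ℝ := Icc (-(1 / L)) (1 / L) with hJ
  set F : ℝ → ℂ := fun t => cexp (I * ((t * ℓ : ℝ) : ℂ)) * smoothZeta N (c + t * I) with hF
  set h : ℝ → ℝ := fun t => (Icc (-(1 / R)) (1 / R)).indicator (fun _ => Real.exp (-8) / 2) t -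
    R / A * (|t| * Real.exp (-(1 / 200 * V) * t ^ 2)) with hh
  have hAR : A / R ≤ 1 / L := by
    rw [div_le_div_iff₀ hR0 (by linarith)]; linarith
  have hR1 : 1 / R ≤ A / R := by gcongr
  have hmain : ∀ t ∈ J, h t ≤ (F t / z).re := by
    intro t ht
    have htL : |t| ≤ 1 / L := abs_le.mpr ht
    have hpos : 0 ≤ R / A * (|t| * Real.exp (-(1 / 200 * V) * t ^ 2)) := by positivity
    by_cases htA : |t| ≤ A / R
    · set E := Real.exp (-(t ^ 2 * W / 2)) with hE
      have hE0 : 0 < E := Real.exp_pos _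
      have h1 : ‖F t / z - (E : ℂ)‖ ≤ E * (1 / 2) := by
        have e : F t / z - (E : ℂ) = (F t - z * E) / z := by field_simp
        rw [e, norm_div, div_le_iff₀ hzn]
        refine (hg t htL).trans ?_
        rw [mul_comm]
        have hu : 10 ^ 8 * |t| ^ 3 * (L ^ 2 * ℓ) ≤ 1 / 4 := by
          have h3 : |t| ^ 3 ≤ (A / R) ^ 3 := pow_le_pow_left₀ (abs_nonneg _) htA 3
          calc 10 ^ 8 * |t| ^ 3 * (L ^ 2 * ℓ) ≤ 10 ^ 8 * (A / R) ^ 3 * (L ^ 2 * ℓ) := by gcongr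
            _ = (K * L) / 4 / R := by
              have : L ^ 2 * ℓ = L * R ^ 2 := by rw [hR2, hV]; ring
              rw [this, hK]; field_simp
            _ ≤ R / 4 / R := by gcongr
            _ = 1 / 4 := by field_simp
        have h4 : Real.exp (10 ^ 8 * |t| ^ 3 * (L ^ 2 * ℓ)) ≤ 4 / 3 := by
          refine (Real.exp_le_exp.mpr hu).trans ?_
          have h5 := Real.one_sub_le_exp_neg (1 / 4)
          rw [Real.exp_neg] at h5
          have := inv_anti₀ (by norm_num) h5
          rw [inv_inv] at this
          refine this.trans (by norm_num)
        have : E * (Real.exp (10 ^ 8 * |t| ^ 3 * (L ^ 2 * ℓ)) - 1) ≤ E * (1 / 2) := by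
          apply mul_le_mul_of_nonneg_left _ hE0.le; linarith
        exact mul_le_mul_of_nonneg_right this hzn.le
      have h2 : E / 2 ≤ (F t / z).re := by
        have := (abs_re_le_norm (F t / z - (E : ℂ))).trans h1
        rw [sub_re, ofReal_re] at this
        linarith [(abs_le.mp this).1]
      by_cases htR : t ∈ Icc (-(1 / R)) (1 / R)
      · simp only [hh]
        rw [indicator_of_mem htR]
        have htR' : |t| ≤ 1 / R := abs_le.mpr htR
        have : Real.exp (-8) ≤ E := by
          apply Real.exp_le_exp.mpr
          have h3 : t ^ 2 ≤ (1 / R) ^ 2 := by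
            rw [← sq_abs]; exact pow_le_pow_left₀ (abs_nonneg _) htR' 2
          have h4 : t ^ 2 * W ≤ (1 / R) ^ 2 * (16 * V) := mul_le_mul h3 hW hW0 (by positivity)
          have h5 : (1 / R) ^ 2 * (16 * V) = 16 := by rw [← hR2]; field_simp
          linarith
        linarith
      · simp only [hh]
        rw [indicator_of_notMem htR]
        linarith
    · push Not at htA
      simp only [hh]
      have htR : t ∉ Icc (-(1 / R)) (1 / R) := by
        intro h'; have := abs_le.mpr h'; linarith
      rw [indicator_of_notMem htR]
      have h1 : ‖F t / z‖ ≤ Real.exp (-(1 / 200 * V) * t ^ 2) := by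
        rw [norm_div, div_le_iff₀ hzn]
        have h3 : ‖cexp (I * ((t * ℓ : ℝ) : ℂ))‖ = 1 := by
          rw [mul_comm]; exact norm_exp_ofReal_mul_I _
        simp only [hF]
        rw [norm_mul, h3, one_mul]
        refine (hds t htL).trans (le_of_eq ?_)
        rw [mul_comm]; congr 2; ring
      have h2 : 1 ≤ R / A * |t| := by
        have := mul_le_mul_of_nonneg_left htA.le (show 0 ≤ R / A by positivity)
        have e : R / A * (A / R) = 1 := by field_simp
        linarith
      have h3 := (abs_le.mp ((abs_re_le_norm (F t / z)).trans h1)).1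
      have h4 := mul_le_mul_of_nonneg_right h2 (Real.exp_pos (-(1 / 200 * V) * t ^ 2)).le
      nlinarith only [h3, h4]
  have hFc : Continuous F := by
    simp only [hF]; exact Continuous.mul (by fun_prop) hcont
  have hb : (0 : ℝ) < 1 / 200 * V := by positivity
  have hi1 := integrable_abs_mul_exp_neg_mul_sq hb
  have hi2 : Integrable ((Icc (-(1 / R)) (1 / R)).indicator (fun _ => Real.exp (-8) / 2)) := by
    rw [integrable_indicator_iff measurableSet_Icc]
    exact continuousOn_const.integrableOn_Icc
  have hInt : ∫ t in J, h t ≤ ∫ t in J, (F t / z).re := by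
    refine setIntegral_mono_on ?_ ?_ measurableSet_Icc hmain
    · exact (hi2.sub (hi1.const_mul _)).integrableOn
    · exact (continuous_re.comp (hFc.div_const z)).continuousOn.integrableOn_Icc
  have hlow : Real.exp (-8) / (2 * R) ≤ ∫ t in J, h t := by
    simp only [hh]
    rw [integral_sub hi2.integrableOn (hi1.const_mul _).integrableOn, integral_const_mul,
      setIntegral_indicator measurableSet_Icc]
    have hsub : Icc (-(1 / R)) (1 / R) ⊆ J := by
      apply Icc_subset_Icc <;> linarith
    rw [inter_eq_right.mpr hsub, setIntegral_const, Real.volume_real_Icc_of_le (by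
      have : 0 < 1 / R := by positivity
      linarith), smul_eq_mul]
    have h5 : ∫ t in J, |t| * Real.exp (-(1 / 200 * V) * t ^ 2) ≤ 1 / (1 / 200 * V) := by
      rw [← integral_abs_mul_exp_neg_mul_sq hb]
      exact setIntegral_le_integral hi1 (.of_forall fun t => by positivity)
    have h6 := mul_le_mul_of_nonneg_left h5 (show 0 ≤ R / A by positivity)
    have h7 : R / A * (1 / (1 / 200 * V)) = Real.exp (-8) / (2 * R) := by
      rw [← hR2, hA, Real.exp_neg]; field_simp; ring
    have h8 : (1 / R - -(1 / R)) * (Real.exp (-8) / 2) = Real.exp (-8) / R := by ring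
    have h9 : Real.exp (-8) / R = 2 * (Real.exp (-8) / (2 * R)) := by field_simp
    rw [h8, h9]
    linarith
  have hre : ∫ t in J, (F t / z).re = (∫ t in J, F t / z).re := by
    have := integral_re (μ := volume.restrict J) (f := fun t => F t / z)
      (hFc.div_const z).continuousOn.integrableOn_Icc
    simpa using this
  have hnorm : Real.exp (-8) / (2 * R) ≤ ‖∫ t in J, F t‖ / ‖z‖ := by
    have h1 := re_le_norm (∫ t in J, F t / z)
    rw [integral_div, norm_div] at h1
    rw [integral_div] at hre
    linarith
  rw [norm_mul]
  have hpi : ‖(1 / (2 * Real.pi) : ℂ)‖ = 1 / (2 * Real.pi) := by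
    rw [show (1 / (2 * Real.pi) : ℂ) = ((1 / (2 * Real.pi) : ℝ) : ℂ) by simp, norm_real,
      Real.norm_of_nonneg (by positivity)]
  rw [hpi]
  rw [le_div_iff₀ hzn] at hnorm
  refine le_trans (le_of_eq ?_) (mul_le_mul_of_nonneg_left hnorm (by positivity))
  field_simp
  ring

lemma Cut.norm_mellin_sub_le {F : ℝ → ℂ} (hF : Cut F) {c t D : ℝ} (hc : 0 < c)
    (h : ∀ u : ℝ, |u| ≤ |t| → ‖mellin (fun w => Real.log w • F w) (c + u * I)‖ ≤ D) :
    ‖mellin F (c + t * I) - mellin F c‖ ≤ D * |t| := by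
  have hd : ∀ u : ℝ, HasDerivAt (fun u : ℝ => mellin F (c + u * I))
      (mellin (fun w => Real.log w • F w) (c + u * I) * I) u := fun u => by
    have h1 := hF.hasDerivAt_mellin (s := c + u * I) (Or.inl (by simpa using hc))
    have h2 : HasDerivAt (fun z : ℂ => (c : ℂ) + z * I) I (u : ℂ) := by
      simpa using ((hasDerivAt_id (u : ℂ)).mul_const I).const_add (c : ℂ)
    exact (HasDerivAt.comp (u : ℂ) (h₂ := mellin F) (h := fun z : ℂ => (c : ℂ) + z * I) h1 h2).comp_ofReal
  have := (convex_Icc (-|t|) |t|).norm_image_sub_le_of_norm_hasDerivWithin_le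
    (f := fun u : ℝ => mellin F (c + u * I)) (x := 0) (y := t) (C := D)
    (fun u _ => (hd u).hasDerivWithinAt) (fun u hu => by
      rw [norm_mul, norm_I, mul_one]; exact h u (abs_le.mpr hu))
    ⟨by simp, abs_nonneg t⟩ ⟨neg_abs_le t, le_abs_self t⟩
  simpa using this

/-- A smooth cutoff, equal to `1` up to `A` and to `0` from `A + H` on. -/
def cutoff (A H v : ℝ) : ℂ := 1 - step A H v

lemma cutoff_eq_ofReal (A H v : ℝ) :
    cutoff A H v = ((1 - Real.smoothTransition ((v - A) / H) : ℝ) : ℂ) := by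
  simp [cutoff, step]

lemma norm_cutoff_le (A H v : ℝ) : ‖cutoff A H v‖ ≤ 1 := by
  rw [cutoff_eq_ofReal, norm_real, Real.norm_eq_abs, abs_le]
  have h1 := Real.smoothTransition.nonneg ((v - A) / H)
  have h2 := Real.smoothTransition.le_one ((v - A) / H)
  constructor <;> linarith

lemma cutoff_of_le {A H v : ℝ} (hH : 0 < H) (h : v ≤ A) : cutoff A H v = 1 := by
  rw [cutoff, step_of_le hH h, sub_zero]

lemma cutoff_of_ge {A H v : ℝ} (hH : 0 < H) (h : A + H ≤ v) : cutoff A H v = 0 := by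
  rw [cutoff, step_of_ge hH h, sub_self]

lemma cut_cutoff {A H : ℝ} (hA : 0 < A) (hH : 0 < H) : Cut (cutoff A H) :=
  ⟨contDiff_const.sub (contDiff_step A H), A + H, by linarith, fun _ hw => cutoff_of_ge hH hw⟩

lemma integrableOn_rpow_Ioc {r : ℝ} (hr : -1 < r) : IntegrableOn (fun v : ℝ => v ^ r) (Ioc 0 2) :=
  (intervalIntegrable_iff_integrableOn_Ioc_of_le (by norm_num)).1
    (intervalIntegral.intervalIntegrable_rpow' hr)

lemma integral_rpow_Ioc {r : ℝ} (hr : -1 < r) : ∫ v in Ioc (0 : ℝ) 2, v ^ r = 2 ^ (r + 1) / (r + 1) := by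
  rw [← intervalIntegral.integral_of_le (by norm_num), integral_rpow (Or.inl hr),
    Real.zero_rpow (by linarith), sub_zero]

/-- Bound for the Mellin transform of a function dominated by a power on `(0,2]`. -/
lemma norm_mellin_le_of_rpow {G : ℝ → ℂ} {s : ℂ} {r K : ℝ} (hr : -1 < r) 
    (h0 : ∀ v, 2 < v → G v = 0) (hb : ∀ v, 0 < v → v ≤ 2 → v ^ (s.re - 1) * ‖G v‖ ≤ K * v ^ r) :
    ‖mellin G s‖ ≤ K * (2 ^ (r + 1) / (r + 1)) := by
  have h1 : mellin G s = ∫ v in Ioc (0 : ℝ) 2, (v : ℂ) ^ (s - 1) • G v := by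
    rw [mellin]
    refine setIntegral_eq_of_subset_of_forall_sdiff_eq_zero measurableSet_Ioi
      (fun v hv => hv.1) fun v hv => ?_
    have : 2 < v := by
      by_contra h; exact hv.2 ⟨hv.1, by linarith⟩
    rw [h0 v this, smul_zero]
  rw [h1, ← integral_rpow_Ioc hr, ← integral_const_mul]
  refine norm_integral_le_of_norm_le ((integrableOn_rpow_Ioc hr).const_mul K) ?_
  filter_upwards [ae_restrict_mem measurableSet_Ioc] with v hv
  rw [norm_smul, norm_cpow_eq_rpow_re_of_pos hv.1]
  simpa using hb v hv.1 hv.2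

lemma rpow_sub_one_le {v c : ℝ} (hv : 0 < v) (hv2 : v ≤ 2) (hc : 1 / 2 ≤ c) (hc1 : c ≤ 1) :
    v ^ (c - 1) ≤ 2 * v ^ (-(1 / 2) : ℝ) := by
  rcases le_total v 1 with h | h
  · have := Real.rpow_le_rpow_of_exponent_ge hv h (show -(1 / 2) ≤ c - 1 by linarith)
    have h2 : 0 < v ^ (-(1 / 2) : ℝ) := by positivity
    linarith
  · have h1 := Real.rpow_le_one_of_one_le_of_nonpos h (show c - 1 ≤ 0 by linarith)
    have h2 : v ^ (-1 : ℝ) ≤ v ^ (-(1 / 2) : ℝ) := Real.rpow_le_rpow_of_exponent_le h (by norm_num)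
    have h3 : 1 / 2 ≤ v ^ (-1 : ℝ) := by
      rw [Real.rpow_neg_one, one_div]; exact inv_anti₀ hv hv2
    linarith

lemma rpow_sub_one_mul_abs_log_le {v c : ℝ} (hv : 0 < v) (hv2 : v ≤ 2) (hc : 1 / 2 ≤ c) (hc1 : c ≤ 1) :
    v ^ (c - 1) * |Real.log v| ≤ 8 * v ^ (-(3 / 4) : ℝ) := by
  have h0 := rpow_sub_one_le hv hv2 hc hc1
  have hl : |Real.log v| ≤ 4 * v ^ (-(1 / 4) : ℝ) := by
    rcases le_total v 1 with h | h
    · rw [abs_of_nonpos (Real.log_nonpos hv.le h), ← Real.log_inv]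
      have := Real.log_le_rpow_div (inv_pos.mpr hv).le (show (0 : ℝ) < 1 / 4 by norm_num)
      rw [Real.inv_rpow hv.le, ← Real.rpow_neg hv.le] at this
      linarith
    · rw [abs_of_nonneg (Real.log_nonneg h)]
      have h1 : Real.log v ≤ 1 := (Real.log_le_sub_one_of_pos hv).trans (by linarith)
      have h2 : v ^ (-1 : ℝ) ≤ v ^ (-(1 / 4) : ℝ) := Real.rpow_le_rpow_of_exponent_le h (by norm_num)
      have h3 : 1 / 2 ≤ v ^ (-1 : ℝ) := by
        rw [Real.rpow_neg_one, one_div]; exact inv_anti₀ hv hv2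
      linarith
  calc v ^ (c - 1) * |Real.log v| ≤ (2 * v ^ (-(1 / 2) : ℝ)) * (4 * v ^ (-(1 / 4) : ℝ)) := by gcongr
    _ = 8 * (v ^ (-(1 / 2) : ℝ) * v ^ (-(1 / 4) : ℝ)) := by ring
    _ = _ := by rw [← Real.rpow_add hv]; norm_num

section
variable {A H c : ℝ}

lemma norm_mellin_cutoff_le (hH : 0 < H) (hA2 : A + H ≤ 2) (hc : 1 / 2 ≤ c) (hc1 : c ≤ 1) (t : ℝ) :
    ‖mellin (cutoff A H) (c + t * I)‖ ≤ 8 := by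
  have := norm_mellin_le_of_rpow (G := cutoff A H) (s := c + t * I) (r := -(1 / 2)) (K := 2) (by norm_num)
    (fun v hv => cutoff_of_ge hH (by linarith)) fun v hv hv2 => by
      have h1 := rpow_sub_one_le hv hv2 hc hc1
      have h2 := mul_le_mul_of_nonneg_left (norm_cutoff_le A H v) (show 0 ≤ v ^ (c - 1) by positivity)
      simp only [add_re, ofReal_re, mul_re, I_re, mul_zero, ofReal_im, I_im, mul_one, sub_self, add_zero]
      linarith
  refine this.trans ?_
  have : (2 : ℝ) ^ (-(1 / 2) + 1 : ℝ) ≤ 2 ^ (1 : ℝ) := Real.rpow_le_rpow_of_exponent_le (by norm_num) (by norm_num)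
  rw [Real.rpow_one] at this
  norm_num at this ⊢
  linarith

lemma norm_mellin_log_cutoff_le (hH : 0 < H) (hA2 : A + H ≤ 2) (hc : 1 / 2 ≤ c) (hc1 : c ≤ 1) (t : ℝ) :
    ‖mellin (fun v => Real.log v • cutoff A H v) (c + t * I)‖ ≤ 64 := by
  have := norm_mellin_le_of_rpow (G := fun v => Real.log v • cutoff A H v) (s := c + t * I)
    (r := -(3 / 4)) (K := 8) (by norm_num)
    (fun v hv => by rw [cutoff_of_ge hH (by linarith), smul_zero]) fun v hv hv2 => by
      have h1 := rpow_sub_one_mul_abs_log_le hv hv2 hc hc1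
      have h2 := mul_le_mul_of_nonneg_left (norm_cutoff_le A H v)
        (show 0 ≤ v ^ (c - 1) * |Real.log v| by positivity)
      simp only [add_re, ofReal_re, mul_re, I_re, mul_zero, ofReal_im, I_im, mul_one, sub_self, add_zero]
      rw [norm_smul, Real.norm_eq_abs, ← mul_assoc]
      linarith
  refine this.trans ?_
  have : (2 : ℝ) ^ (-(3 / 4) + 1 : ℝ) ≤ 2 ^ (1 : ℝ) := Real.rpow_le_rpow_of_exponent_le (by norm_num) (by norm_num)
  rw [Real.rpow_one] at this
  norm_num at this ⊢
  linarith

lemma exists_norm_mellin_cutoff_mul_sq_le : ∃ K > 0, ∀ A H c t : ℝ, 1 / 2 ≤ A → 0 < H → A + H ≤ 2 → 0 < c →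
    c ≤ 1 → ‖mellin (cutoff A H) (c + t * I)‖ * t ^ 2 ≤ K / H := by
  obtain ⟨K, hK, hb⟩ := exists_bound_deriv_step
  refine ⟨4 * K, by positivity, fun A H c t hA hH hA2 hc hc1 => ?_⟩
  have hA0 : 0 < A := by linarith
  have h1 := (cut_cutoff hA0 hH).mul_mul_mellin (s := c + t * I) (Or.inl (by simpa using hc))
  have e1 : deriv (cutoff A H) = fun v => -deriv (step A H) v := by
    ext v; exact deriv_const_sub (f := step A H) (1 : ℂ)
  have e2 : deriv (deriv (cutoff A H)) = fun v => -deriv (deriv (step A H)) v := by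
    rw [e1]; ext v; rw [deriv.fun_neg]
  have h2 : ‖mellin (deriv (deriv (cutoff A H))) (c + t * I + 2)‖ ≤ 4 * K / H ^ 2 * H := by
    refine norm_mellin_le_of_support hA0 hH.le (fun v hv => ?_) fun v hv => ?_
    · rw [e2]; simp only; rw [(deriv_step_eq_zero hH hv).2, neg_zero]
    · rw [e2]; simp only
      rw [norm_neg, deriv_deriv_step_eq, norm_mul, norm_mul, norm_real, Real.norm_of_nonneg (show 0 ≤ H⁻¹ by positivity)]
      have hv0 : 0 < v := by linarith [hv.1]
      have hv2 : v ≤ 2 := by linarith [hv.2]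
      have h3 : v ^ ((c + t * I + 2 : ℂ).re - 1) ≤ 4 := by
        have e : (c + t * I + 2 : ℂ).re - 1 = c + 1 := by simp; ring
        rw [e]
        calc v ^ (c + 1) ≤ 2 ^ (c + 1) := Real.rpow_le_rpow hv0.le hv2 (by linarith)
          _ ≤ 2 ^ (2 : ℝ) := Real.rpow_le_rpow_of_exponent_le (by norm_num) (by linarith)
          _ = 4 := by norm_num
      calc _ ≤ 4 * (H⁻¹ * (H⁻¹ * K)) := by
            gcongr; exact (hb _).2
        _ = _ := by field_simp
  rw [← h1, norm_mul, norm_mul] at h2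
  have h3 : |t| ≤ ‖(c + t * I : ℂ)‖ := by simpa using abs_im_le_norm (c + t * I : ℂ)
  have h4 : |t| ≤ ‖(c + t * I + 1 : ℂ)‖ := by simpa using abs_im_le_norm (c + t * I + 1 : ℂ)
  have h5 : t ^ 2 ≤ ‖(c + t * I : ℂ)‖ * ‖(c + t * I + 1 : ℂ)‖ := by
    rw [← sq_abs, sq]; gcongr
  have h6 := mul_le_mul_of_nonneg_right h5 (norm_nonneg (mellin (cutoff A H) (c + t * I)))
  have h7 : 4 * K / H ^ 2 * H = 4 * K / H := by field_simp
  linarith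

lemma norm_mellin_cutoff_sub_le (hA : 1 / 2 ≤ A) (hH : 0 < H) (hA1 : A ≤ 1) (hAH : 1 ≤ A + H)
    (hc : 0 < c) (hc1 : c ≤ 1) : ‖mellin (cutoff A H) c - 1 / c‖ ≤ 2 * H := by
  have h1 := hasMellin_one_Ioc (s := (c : ℂ)) (by simpa using hc)
  have hA0 : 0 < A := by linarith
  have h2 := hasMellin_sub ((cut_cutoff hA0 hH).mellinConvergent (s := (c : ℂ)) (Or.inl (by simpa using hc))) h1.1
  rw [← h1.2, ← h2.2]
  have h3 : mellin (fun v => cutoff A H v - (Ioc (0 : ℝ) 1).indicator (fun _ => (1 : ℂ)) v) c =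
      mellin ((Ioi (0 : ℝ)).indicator fun v => cutoff A H v - (Ioc (0 : ℝ) 1).indicator (fun _ => (1 : ℂ)) v) c := by
    refine setIntegral_congr_fun measurableSet_Ioi fun v hv => ?_
    simp only
    rw [indicator_of_mem hv]
  rw [h3]
  refine norm_mellin_le_of_support hA0 hH.le (fun v hv => ?_) fun v hv => ?_
  · by_cases h0 : 0 < v
    · rw [indicator_of_mem (show v ∈ Ioi 0 from h0)]
      by_cases hvA : v < A
      · rw [cutoff_of_le hH hvA.le, indicator_of_mem (show v ∈ Ioc 0 1 from ⟨h0, by linarith⟩), sub_self]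
      · have : A + H < v := by
          by_contra h; exact hv ⟨by linarith, by linarith⟩
        rw [cutoff_of_ge hH this.le, indicator_of_notMem (fun h => by linarith [h.2]), sub_zero]
    · exact indicator_of_notMem h0 _
  · have h0 : 0 < v := by linarith [hv.1]
    rw [indicator_of_mem (show v ∈ Ioi 0 from h0), ofReal_re]
    have h4 : v ^ (c - 1) ≤ 2 := by
      have := Real.rpow_le_rpow_of_nonpos (show (0 : ℝ) < 1 / 2 by norm_num) (hA.trans hv.1)
        (show c - 1 ≤ 0 by linarith)
      refine this.trans ?_
      rw [one_div, Real.inv_rpow (by norm_num), ← Real.rpow_neg (by norm_num)]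
      calc (2 : ℝ) ^ (-(c - 1)) ≤ 2 ^ (1 : ℝ) := Real.rpow_le_rpow_of_exponent_le (by norm_num) (by linarith)
        _ = 2 := by norm_num
    have h5 : ‖cutoff A H v - (Ioc (0 : ℝ) 1).indicator (fun _ => (1 : ℂ)) v‖ ≤ 1 := by
      by_cases hm : v ∈ Ioc (0 : ℝ) 1
      · rw [indicator_of_mem hm, cutoff_eq_ofReal, ← ofReal_one, ← ofReal_sub, norm_real, Real.norm_eq_abs, abs_le]
        have h1 := Real.smoothTransition.nonneg ((v - A) / H)
        have h2 := Real.smoothTransition.le_one ((v - A) / H)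
        constructor <;> linarith
      · rw [indicator_of_notMem hm, sub_zero]; exact norm_cutoff_le A H v
    calc v ^ (c - 1) * ‖cutoff A H v - (Ioc (0 : ℝ) 1).indicator (fun _ => (1 : ℂ)) v‖ ≤ 2 * 1 := by gcongr
      _ = 2 := by norm_num

end

/-- The number of `N`-smooth numbers up to `X`. -/
def smoothCount (N : ℕ) (X : ℝ) : ℝ := ∑' m : (N + 1).smoothNumbers, if ((m : ℕ) : ℝ) ≤ X then 1 else 0

lemma summable_of_eq_zero_of_lt {N : ℕ} {f : (N + 1).smoothNumbers → ℝ} {Y : ℝ}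
    (h : ∀ m : (N + 1).smoothNumbers, Y < (m : ℕ) → f m = 0) : Summable f := by
  refine summable_of_hasFiniteSupport (Set.Finite.subset (s := {m : (N + 1).smoothNumbers | (m : ℕ) ≤ ⌊Y⌋₊}) ?_ fun m hm => ?_)
  · exact Set.Finite.preimage (Subtype.val_injective.injOn) (Set.finite_Iic ⌊Y⌋₊)
  · refine Nat.le_floor ?_
    by_contra hlt
    exact hm (h m (not_le.mp hlt))

lemma tsum_cutoff_re {N : ℕ} (A H X : ℝ) :
    ∑' m : (N + 1).smoothNumbers, cutoff A H ((m : ℕ) / X) =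
      ((∑' m : (N + 1).smoothNumbers, (1 - Real.smoothTransition (((m : ℕ) / X - A) / H)) : ℝ) : ℂ) := by
  rw [ofReal_tsum]
  exact tsum_congr fun m => cutoff_eq_ofReal _ _ _

lemma summable_cutoff {N : ℕ} {A H X : ℝ} (hH : 0 < H) (hX : 0 < X) :
    Summable fun m : (N + 1).smoothNumbers => 1 - Real.smoothTransition (((m : ℕ) / X - A) / H) := by
  refine summable_of_eq_zero_of_lt (Y := (A + H) * X) fun m hm => ?_
  rw [Real.smoothTransition.one_of_one_le, sub_self]
  rw [le_div_iff₀ hH]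
  have := (lt_div_iff₀ hX).mpr hm
  linarith

lemma smoothCount_bounds {N : ℕ} {H X : ℝ} (hH : 0 < H) (hX : 0 < X) :
    ∑' m : (N + 1).smoothNumbers, (1 - Real.smoothTransition (((m : ℕ) / X - (1 - H)) / H)) ≤ smoothCount N X ∧
    smoothCount N X ≤ ∑' m : (N + 1).smoothNumbers, (1 - Real.smoothTransition (((m : ℕ) / X - 1) / H)) := by
  have hs : Summable fun m : (N + 1).smoothNumbers => if ((m : ℕ) : ℝ) ≤ X then (1 : ℝ) else 0 :=
    summable_of_eq_zero_of_lt (Y := X) fun m hm => if_neg (not_le.mpr hm)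
  refine ⟨(summable_cutoff hH hX).tsum_le_tsum (fun m => ?_) hs, hs.tsum_le_tsum (fun m => ?_) (summable_cutoff hH hX)⟩
  · split_ifs with h
    · linarith [Real.smoothTransition.nonneg (((m : ℕ) / X - (1 - H)) / H)]
    · rw [Real.smoothTransition.one_of_one_le, sub_self]
      rw [le_div_iff₀ hH]
      have := (one_lt_div hX).mpr (not_le.mp h)
      linarith
  · split_ifs with h
    · rw [Real.smoothTransition.zero_of_nonpos, sub_zero]
      exact div_nonpos_of_nonpos_of_nonneg (by linarith [(div_le_one hX).mpr h]) hH.le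
    · linarith [Real.smoothTransition.le_one (((m : ℕ) / X - 1) / H)]

section
variable {ε₀ B ℓ : ℝ} {N : ℕ} {c : ℝ}

lemma SaddleFacts.sqrt_bounds (hs : SaddleFacts ε₀ B ℓ N c) (hB : 100 ≤ B) :
    Real.log N ≤ Real.sqrt (Real.log N * ℓ) ∧ Real.sqrt (Real.log N * ℓ) ≤ N ∧ Real.log N ≤ N := by
  have hL := hs.log_pos hB
  have hℓ := hs.pos hB
  have h1 := hs.log_sq_le
  have hN : (1 : ℝ) ≤ N := by exact_mod_cast (hs.two_le hB).trans' (by norm_num)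
  have h3 : Real.log N ≤ N := (Real.log_le_sub_one_of_pos (by linarith)).trans (by linarith)
  have h4 : ℓ ≤ N := hs.le_sqrt.trans (by
    rw [Real.sqrt_le_left (by linarith)]; nlinarith)
  refine ⟨Real.le_sqrt_of_sq_le ?_, ?_, h3⟩
  · have h2 : 1 * ℓ ≤ Real.log N * ℓ := mul_le_mul_of_nonneg_right (by linarith) hℓ.le
    have h5 : 1 * (Real.log N) ^ 2 ≤ B * (Real.log N) ^ 2 := mul_le_mul_of_nonneg_right (by linarith) (sq_nonneg _)
    linarith
  · rw [Real.sqrt_le_left (by linarith), sq]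
    exact mul_le_mul h3 h4 hℓ.le (by linarith)

lemma SaddleFacts.norm_saddleIntegral_le (hs : SaddleFacts ε₀ B ℓ N c) (hB : 100 ≤ B) :
    ‖saddleIntegral ℓ N c‖ ≤ 10 * ‖smoothZeta N c‖ / Real.sqrt (Real.log N * ℓ) := by
  have hL := hs.log_pos hB
  have hℓ := hs.pos hB
  have hds := hs.decay_small
  rw [saddleIntegral, norm_mul]
  set L := Real.log N with hLdef
  have hV : 0 < 1 / 200 * (L * ℓ) := by positivity
  have hpi : ‖(1 / (2 * Real.pi) : ℂ)‖ = 1 / (2 * Real.pi) := by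
    rw [show (1 / (2 * Real.pi) : ℂ) = ((1 / (2 * Real.pi) : ℝ) : ℂ) by simp, norm_real,
      Real.norm_of_nonneg (by positivity)]
  have hig := integrable_exp_neg_mul_sq hV
  have h1 : ‖∫ t in Icc (-(1 / L)) (1 / L), cexp (I * ((t * ℓ : ℝ) : ℂ)) * smoothZeta N (c + t * I)‖ ≤
      ‖smoothZeta N c‖ * ∫ t : ℝ, Real.exp (-(1 / 200 * (L * ℓ)) * t ^ 2) := by
    calc _ ≤ ∫ t in Icc (-(1 / L)) (1 / L), ‖smoothZeta N c‖ * Real.exp (-(1 / 200 * (L * ℓ)) * t ^ 2) := by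
          refine norm_integral_le_of_norm_le (hig.const_mul _).integrableOn ?_
          filter_upwards [ae_restrict_mem measurableSet_Icc] with t ht
          have h3 : ‖cexp (I * ((t * ℓ : ℝ) : ℂ))‖ = 1 := by
            rw [mul_comm]; exact norm_exp_ofReal_mul_I _
          rw [norm_mul, h3, one_mul]
          refine (hds t (abs_le.mpr ht)).trans (le_of_eq ?_)
          congr 2; ring
      _ ≤ ∫ t : ℝ, ‖smoothZeta N c‖ * Real.exp (-(1 / 200 * (L * ℓ)) * t ^ 2) :=
          setIntegral_le_integral (hig.const_mul _) (.of_forall fun t => by positivity)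
      _ = _ := integral_const_mul _ _
  rw [integral_gaussian] at h1
  have h2 : Real.sqrt (Real.pi / (1 / 200 * (L * ℓ))) = Real.sqrt (200 * Real.pi) / Real.sqrt (L * ℓ) := by
    rw [← Real.sqrt_div (by positivity)]; congr 1; field_simp
  have h3 : Real.sqrt (200 * Real.pi) ≤ 10 * (2 * Real.pi) := by
    rw [Real.sqrt_le_left (by positivity)]
    nlinarith [Real.pi_gt_three]
  rw [hpi]
  calc _ ≤ 1 / (2 * Real.pi) * (‖smoothZeta N c‖ * Real.sqrt (Real.pi / (1 / 200 * (L * ℓ)))) := by gcongr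
    _ ≤ 1 / (2 * Real.pi) * (‖smoothZeta N c‖ * ((10 * (2 * Real.pi)) / Real.sqrt (L * ℓ))) := by
        rw [h2]; gcongr
    _ = _ := by field_simp

end

/-- The saddle point asymptotics for the number of smooth numbers. -/
theorem exists_smoothCount_asymp : ∃ C > 0, ∃ κ > 0, ∃ B₀ : ℝ, 100 ≤ B₀ ∧ ∀ (ε₀ B ℓ : ℝ) (N : ℕ) (c : ℝ),
    SaddleFacts ε₀ B ℓ N c → B₀ ≤ B → 0 < ε₀ →
    ∑ p ∈ Nat.primesBelow (N + 1), Real.log p / ((p : ℝ) ^ c - 1) = ℓ →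
    ‖(smoothCount N (Real.exp ℓ) : ℂ) - ((Real.exp ℓ ^ c : ℝ) : ℂ) * (1 / c * saddleIntegral ℓ N c)‖ ≤
      C * (Real.exp ℓ ^ c * ‖smoothZeta N c‖) / (Real.sqrt (Real.log N * ℓ) * Real.log N) ∧
    κ * (Real.exp ℓ ^ c * ‖smoothZeta N c‖) / Real.sqrt (Real.log N * ℓ) ≤ smoothCount N (Real.exp ℓ) := by
  obtain ⟨κ, hκ, B₁, hB₁, hlow⟩ := exists_le_norm_saddleIntegral
  obtain ⟨K, hK, hmsq⟩ := exists_norm_mellin_cutoff_mul_sq_le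
  set C₀ : ℝ := 40 * 64 + (8 + K) + 20 with hC₀
  have hC₀p : 0 < C₀ := by positivity
  refine ⟨3 * C₀, by positivity, κ / 2, by positivity, max B₁ (6 * C₀ / κ), hB₁.trans (le_max_left _ _),
    fun ε₀ B ℓ N c hs hB hε₀ heq => ?_⟩
  have hBB : B₁ ≤ B := (le_max_left _ _).trans hB
  have hB1 : 100 ≤ B := hB₁.trans hBB
  have hL := hs.log_pos hB1
  have hℓ := hs.pos hB1
  have hc2 : 1 / 2 ≤ c := by linarith [hs.lower]
  have hc : 0 < c := by linarith
  have hc1 : c ≤ 1 := by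
    have := hs.upper
    have : 0 ≤ 2 / Real.log N := by positivity
    linarith
  have hI := hs.norm_saddleIntegral_le hB1
  have hIl := hlow ε₀ B ℓ N c hs hBB hε₀ heq
  obtain ⟨hLR, hRN, hLN⟩ := hs.sqrt_bounds hB1
  have hLbig : 6 * C₀ / κ ≤ Real.log N := ((le_max_right _ _).trans hB).trans hs.B_le
  have hN2 := hs.two_le hB1
  have hN1 : (1 : ℝ) ≤ N := by exact_mod_cast hN2.trans' (by norm_num)
  have hVR := Real.sq_sqrt (show 0 ≤ Real.log N * ℓ by positivity)
  have hllt := fun A => hs.norm_tsum_sub_le hB1 hε₀ (G := cutoff A (1 / Real.log N)) (r := 1) (D₀ := 8) (D₁ := 64)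
    (D₂ := K / (1 / Real.log N))
  set L := Real.log N with hLdef
  set R := Real.sqrt (L * ℓ) with hR
  set Z := ‖smoothZeta N c‖ with hZ
  set x := Real.exp ℓ with hx
  have hx0 : 0 < x := Real.exp_pos _
  have hZ0 : 0 ≤ Z := norm_nonneg _
  have hR0 : 0 < R := by linarith
  set H := 1 / L with hH
  have hH0 : 0 < H := by positivity
  have hH1 : H ≤ 1 / 100 := by rw [hH]; exact one_div_le_one_div_of_le (by norm_num) hL
  set S := saddleIntegral ℓ N c with hS
  have hxc : 0 < x ^ c := by positivity
  set M : ℂ := ((x ^ c : ℝ) : ℂ) * (1 / c * S) with hM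
  set E := C₀ * (x ^ c * Z) / (R * L) with hE
  have hcore : ∀ A : ℝ, 1 - H ≤ A → A ≤ 1 →
      ‖∑' m : (N + 1).smoothNumbers, cutoff A H ((m : ℕ) / x) - M‖ ≤ E := by
    intro A hA hA1
    have hA2 : 1 / 2 ≤ A := by linarith
    have hAH2 : A + H ≤ 2 := by linarith
    have h1 := hllt A (cut_cutoff (by linarith) hH0) one_pos
      (fun t => norm_mellin_cutoff_le hH0 hAH2 hc2 hc1 t)
      (fun t _ => (cut_cutoff (by linarith) hH0).norm_mellin_sub_le hc
        fun u _ => norm_mellin_log_cutoff_le hH0 hAH2 hc2 hc1 u)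
      (fun t => hmsq A H c t hA2 hH0 hAH2 hc hc1)
    rw [mul_one, Real.log_one, abs_zero, mul_zero, add_zero] at h1
    have h2 := norm_mellin_cutoff_sub_le hA2 hH0 hA1 (by linarith) hc hc1
    have h3 : ‖((x ^ c : ℝ) : ℂ) * (mellin (cutoff A H) c * S) - M‖ ≤ 20 * (x ^ c * Z) / (R * L) := by
      have e : ((x ^ c : ℝ) : ℂ) * (mellin (cutoff A H) c * S) - M =
          ((x ^ c : ℝ) : ℂ) * ((mellin (cutoff A H) c - 1 / c) * S) := by rw [hM]; ring
      rw [e, norm_mul, norm_mul, norm_real, Real.norm_of_nonneg hxc.le]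
      calc _ ≤ x ^ c * (2 * H * (10 * Z / R)) := by gcongr
        _ = _ := by rw [hH]; ring
    have h4 : 40 * 64 / (L * ℓ) + (8 + K / H) / (N : ℝ) ^ 50 ≤ (40 * 64 + (8 + K)) / (R * L) := by
      rw [add_div (40 * 64 : ℝ) (8 + K) (R * L)]
      refine add_le_add ?_ ?_
      · rw [← hVR, sq]; gcongr
      · rw [div_le_div_iff₀ (by positivity) (by positivity)]
        have e : K / H = K * L := by rw [hH]; field_simp
        rw [e]
        have h5 : 8 + K * L ≤ (8 + K) * L := by nlinarith
        calc (8 + K * L) * (R * L) ≤ ((8 + K) * N) * (N * N) := by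
              refine mul_le_mul (h5.trans (by gcongr)) ?_ (by positivity) (by positivity)
              gcongr
          _ = (8 + K) * (N : ℝ) ^ 3 := by ring
          _ ≤ (8 + K) * (N : ℝ) ^ 50 := by gcongr; norm_num
    calc _ ≤ ‖∑' m : (N + 1).smoothNumbers, cutoff A H ((m : ℕ) / x) - ((x ^ c : ℝ) : ℂ) * (mellin (cutoff A H) c * S)‖ +
          ‖((x ^ c : ℝ) : ℂ) * (mellin (cutoff A H) c * S) - M‖ := norm_sub_le_norm_sub_add_norm_sub _ _ _
      _ ≤ x ^ c * Z * ((40 * 64 + (8 + K)) / (R * L)) + 20 * (x ^ c * Z) / (R * L) := by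
          refine add_le_add (h1.trans ?_) h3
          gcongr
      _ = E := by rw [hE, hC₀]; ring
  obtain ⟨hlo, hhi⟩ := smoothCount_bounds (N := N) hH0 hx0
  have ha := hcore (1 - H) le_rfl (by linarith)
  have hb := hcore 1 (by linarith) le_rfl
  rw [tsum_cutoff_re] at ha hb
  set a := ∑' m : (N + 1).smoothNumbers, (1 - Real.smoothTransition (((m : ℕ) / x - (1 - H)) / H))
  set b := ∑' m : (N + 1).smoothNumbers, (1 - Real.smoothTransition (((m : ℕ) / x - 1) / H))
  have hab : |b - a| ≤ 2 * E := by
    have : ‖((b - a : ℝ) : ℂ)‖ ≤ ‖(b : ℂ) - M‖ + ‖(a : ℂ) - M‖ := by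
      rw [ofReal_sub, show (b : ℂ) - a = (b - M) - (a - M) by ring]
      exact norm_sub_le _ _
    rw [norm_real, Real.norm_eq_abs] at this
    linarith
  have hmain : ‖(smoothCount N x : ℂ) - M‖ ≤ 3 * E := by
    have h1 : ‖(smoothCount N x : ℂ) - M‖ ≤ ‖((smoothCount N x - a : ℝ) : ℂ)‖ + ‖(a : ℂ) - M‖ := by
      rw [ofReal_sub]; exact norm_sub_le_norm_sub_add_norm_sub _ _ _
    rw [norm_real, Real.norm_eq_abs, abs_of_nonneg (by linarith)] at h1
    linarith [le_abs_self (b - a)]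
  refine ⟨hmain.trans (le_of_eq (by rw [hE]; ring)), ?_⟩
  have h1 : κ * (x ^ c * Z) / R ≤ ‖M‖ := by
    rw [hM, norm_mul, norm_mul, norm_real, Real.norm_of_nonneg hxc.le, norm_div, norm_one, norm_real,
      Real.norm_of_nonneg hc.le]
    have h2 : 1 ≤ 1 / c := by rw [le_div_iff₀ hc]; linarith
    calc κ * (x ^ c * Z) / R = x ^ c * (1 * (κ * Z / R)) := by ring
      _ ≤ x ^ c * (1 / c * ‖S‖) := by gcongr
  have h2 : 3 * E ≤ κ / 2 * (x ^ c * Z) / R := by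
    rw [hE]
    have h3 : 6 * C₀ ≤ κ * L := by rw [div_le_iff₀ hκ] at hLbig; linarith
    calc 3 * (C₀ * (x ^ c * Z) / (R * L)) = (6 * C₀) * (x ^ c * Z) / (2 * R * L) := by field_simp; ring
      _ ≤ (κ * L) * (x ^ c * Z) / (2 * R * L) := by gcongr
      _ = _ := by field_simp
  have h3 : 0 ≤ smoothCount N x := tsum_nonneg fun m => by split_ifs <;> norm_num
  have h4 : ‖M‖ ≤ ‖(smoothCount N x : ℂ)‖ + ‖(smoothCount N x : ℂ) - M‖ := by
    have := norm_sub_le (smoothCount N x : ℂ) ((smoothCount N x : ℂ) - M)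
    simpa using this
  rw [norm_real, Real.norm_of_nonneg h3] at h4
  have h5 : κ * (x ^ c * Z) / R = 2 * (κ / 2 * (x ^ c * Z) / R) := by ring
  linarith

section
open scoped FourierTransform

/-- The additive character `e(λw)`. -/
def phase (lam w : ℝ) : ℂ := cexp (2 * (Real.pi : ℂ) * I * ((lam * w : ℝ) : ℂ))

lemma norm_phase (lam w : ℝ) : ‖phase lam w‖ = 1 := by
  rw [phase, show (2 * (Real.pi : ℂ) * I * ((lam * w : ℝ) : ℂ)) = ((2 * Real.pi * (lam * w) : ℝ) : ℂ) * I by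
    push_cast; ring]
  exact norm_exp_ofReal_mul_I _

lemma contDiff_phase (lam : ℝ) : ContDiff ℝ ∞ (phase lam) := by
  unfold phase
  have : ContDiff ℝ ∞ fun w : ℝ => ((lam * w : ℝ) : ℂ) := ofRealCLM.contDiff.comp (contDiff_const.mul contDiff_id)
  exact (contDiff_const.mul this).cexp

lemma hasDerivAt_phase (lam w : ℝ) :
    HasDerivAt (phase lam) (2 * (Real.pi : ℂ) * I * lam * phase lam w) w := by
  have h1 : HasDerivAt (fun w : ℝ => ((lam * w : ℝ) : ℂ)) lam w := by
    simpa using ((hasDerivAt_id w).const_mul lam).ofReal_comp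
  refine ((h1.const_mul (2 * (Real.pi : ℂ) * I)).cexp).congr_deriv ?_
  rw [phase]; ring

namespace Adm

variable {F : ℝ → ℂ}

lemma mul_contDiffAt (hF : Adm F) {g : ℝ → ℂ} (hg : ∀ w > 0, ContDiffAt ℝ ∞ g w) : Adm (fun w => F w * g w) := by
  obtain ⟨A, hA, h⟩ := hF.bot
  obtain ⟨B, hB, h'⟩ := hF.top
  refine ⟨⟨?_, B, hB, fun w hw => by simp [h' w hw]⟩, A, hA, fun w hw => by simp [h w hw]⟩
  rw [contDiff_iff_contDiffAt]
  intro w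
  rcases lt_or_ge 0 w with hw | hw
  · exact hF.smooth.contDiffAt.mul (hg w hw)
  · have : (fun w => F w * g w) =ᶠ[𝓝 w] fun _ => 0 := by
      filter_upwards [Iio_mem_nhds (show w < A by linarith)] with v hv
      simp [h v (le_of_lt hv)]
    exact contDiffAt_const.congr_of_eventuallyEq this

lemma mul_ofReal (hF : Adm F) : Adm (fun w => F w * w) := hF.mul_smooth ofRealCLM.contDiff

lemma mul_inv (hF : Adm F) : Adm (fun w => F w * (w : ℂ)⁻¹) :=
  hF.mul_contDiffAt fun w hw => ofRealCLM.contDiff.contDiffAt.inv (by simpa using hw.ne')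

lemma mul_phase (hF : Adm F) (lam : ℝ) : Adm (fun w => F w * phase lam w) := hF.mul_smooth (contDiff_phase lam)

lemma deriv_mul_phase (hF : Adm F) (lam : ℝ) : _root_.deriv (fun w => F w * phase lam w) =
    fun w => _root_.deriv F w * phase lam w + 2 * (Real.pi : ℂ) * I * lam * (F w * phase lam w) := by
  ext w
  refine (((hF.toCut.hasDerivAt w).mul (hasDerivAt_phase lam w)).deriv).trans ?_; ring

lemma mellin_mul_phase_add_one (lam : ℝ) (s : ℂ) :
    mellin (fun w => F w * phase lam w) (s + 1) = mellin (fun w => (F w * w) * phase lam w) s := by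
  rw [← mellin_cpow_smul]
  congr 1; ext w; rw [cpow_one, smul_eq_mul]; ring

/-- Integration by parts. -/
lemma mul_mellin_mul_phase (hF : Adm F) (lam : ℝ) (s : ℂ) : s * mellin (fun w => F w * phase lam w) s =
    -(mellin (fun w => _root_.deriv F w * w * phase lam w) s +
      2 * (Real.pi : ℂ) * I * lam * mellin (fun w => F w * w * phase lam w) s) := by
  rw [(hF.mul_phase lam).toCut.mul_mellin (Or.inr (hF.mul_phase lam)), hF.deriv_mul_phase]
  have h1 := ((hF.deriv.mul_phase lam).toCut.mellinConvergent (s := s + 1) (Or.inr (hF.deriv.mul_phase lam)))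
  have h2 := ((hF.mul_phase lam).toCut.mellinConvergent (s := s + 1) (Or.inr (hF.mul_phase lam))).const_smul
    (2 * (Real.pi : ℂ) * I * lam)
  have h3 := (hasMellin_add h1 h2).2
  simp only [smul_eq_mul] at h3
  rw [h3, mellin_mul_phase_add_one, ← mellin_mul_phase_add_one (F := F)]
  congr 2
  have := mellin_const_smul (fun w => F w * phase lam w) (s + 1) (2 * (Real.pi : ℂ) * I * lam)
  simpa only [smul_eq_mul] using this

lemma exists_norm_mellin_mul_phase_le (hF : Adm F) : ∃ C > 0, ∀ (lam : ℝ) (s : ℂ), 1 / 2 ≤ s.re → s.re ≤ 1 →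
    ‖mellin (fun w => F w * phase lam w) s‖ ≤ C := by
  have hi := fun σ : ℝ => hF.toCut.integrableOn_norm (σ := σ) (Or.inr hF)
  have hp := fun σ : ℝ => setIntegral_nonneg (f := fun w : ℝ => w ^ (σ - 1) * ‖F w‖) (μ := volume) measurableSet_Ioi
    fun w (hw : (0 : ℝ) < w) => by positivity
  refine ⟨(∫ w in Ioi (0 : ℝ), w ^ ((1 / 2 : ℝ) - 1) * ‖F w‖) + (∫ w in Ioi (0 : ℝ), w ^ ((1 : ℝ) - 1) * ‖F w‖) + 1,
    add_pos_of_nonneg_of_pos (add_nonneg (hp _) (hp _)) one_pos, fun lam s h1 h2 => (norm_mellin_le s).trans ?_⟩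
  simp only [norm_mul, norm_phase, mul_one]
  rw [← integral_add (hi _) (hi _)]
  refine le_trans (setIntegral_mono_on (hi _) ((hi _).add (hi _)) measurableSet_Ioi fun w (hw : 0 < w) => ?_)
    (le_add_of_nonneg_right zero_le_one)
  simp only [Pi.add_apply]
  rw [← add_mul]
  refine mul_le_mul_of_nonneg_right ?_ (norm_nonneg _)
  rcases le_total w 1 with h | h
  · have := Real.rpow_le_rpow_of_exponent_ge hw h (show (1 / 2 : ℝ) - 1 ≤ s.re - 1 by linarith)
    exact this.trans (le_add_of_nonneg_right (Real.rpow_nonneg hw.le _))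
  · have := Real.rpow_le_rpow_of_exponent_le h (show s.re - 1 ≤ (1 : ℝ) - 1 by linarith)
    exact this.trans (le_add_of_nonneg_left (Real.rpow_nonneg hw.le _))

lemma exists_norm_mellin_mul_phase_mul_lam_pow_le (k : ℕ) : ∀ F : ℝ → ℂ, Adm F → ∃ C > 0, ∀ (lam : ℝ) (s : ℂ),
    1 / 2 ≤ s.re → s.re ≤ 1 →
    ‖mellin (fun w => F w * phase lam w) s‖ * |lam| ^ k ≤ C * (1 + |s.im|) ^ k := by
  induction k with
  | zero => intro F hF; simpa using hF.exists_norm_mellin_mul_phase_le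
  | succ k ih =>
    intro F hF
    obtain ⟨C₁, hC₁, h₁⟩ := ih _ hF.deriv
    obtain ⟨C₂, hC₂, h₂⟩ := ih _ hF.mul_inv
    refine ⟨C₁ + C₂, by positivity, fun lam s hs hs' => ?_⟩
    have e : 2 * (Real.pi : ℂ) * I * lam * mellin (fun w => F w * phase lam w) s =
        -(mellin (fun w => _root_.deriv F w * phase lam w) s +
          (s - 1) * mellin (fun w => F w * (w : ℂ)⁻¹ * phase lam w) s) := by
      have h0 := hF.mul_mellin_mul_phase lam (s - 1)
      have e1 := mellin_mul_phase_add_one (F := _root_.deriv F) lam (s - 1)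
      have e2 := mellin_mul_phase_add_one (F := F) lam (s - 1)
      have e3 := mellin_mul_phase_add_one (F := fun w => F w * (w : ℂ)⁻¹) lam (s - 1)
      rw [sub_add_cancel] at e1 e2 e3
      rw [← e1, ← e2] at h0
      rw [e3]
      have e4 : mellin (fun w => F w * (w : ℂ)⁻¹ * w * phase lam w) (s - 1) =
          mellin (fun w => F w * phase lam w) (s - 1) := by
        refine setIntegral_congr_fun measurableSet_Ioi fun w (hw : 0 < w) => ?_
        have : (w : ℂ) ≠ 0 := by exact_mod_cast hw.ne'
        simp only [inv_mul_cancel_right₀ this]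
      rw [e4, h0]; ring
    have e' := congrArg (fun z => ‖z‖) e
    simp only [norm_mul, norm_neg, norm_real, norm_I, Complex.norm_ofNat, Real.norm_eq_abs, abs_of_pos Real.pi_pos,
      mul_one] at e'
    have hs1 : ‖s - 1‖ ≤ 1 + |s.im| := by
      refine (norm_le_abs_re_add_abs_im _).trans ?_
      simp only [sub_re, one_re, sub_im, one_im, sub_zero]
      gcongr
      rw [abs_le]; constructor <;> linarith
    have h5 : |lam| * ‖mellin (fun w => F w * phase lam w) s‖ ≤
        ‖mellin (fun w => _root_.deriv F w * phase lam w) s‖ +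
          (1 + |s.im|) * ‖mellin (fun w => F w * (w : ℂ)⁻¹ * phase lam w) s‖ := by
      calc _ ≤ 2 * Real.pi * |lam| * ‖mellin (fun w => F w * phase lam w) s‖ := by
            have : 1 ≤ 2 * Real.pi := by linarith [Real.pi_gt_three]
            have h6 : 0 ≤ |lam| * ‖mellin (fun w => F w * phase lam w) s‖ := by positivity
            nlinarith
        _ ≤ _ := by
            rw [e']
            refine (norm_add_le _ _).trans ?_
            rw [norm_mul]
            gcongr
    have h6 := h₁ lam s hs hs'
    have h7 := h₂ lam s hs hs'
    have hτ : 1 ≤ 1 + |s.im| := by linarith [abs_nonneg s.im]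
    calc _ = (|lam| * ‖mellin (fun w => F w * phase lam w) s‖) * |lam| ^ k := by ring
      _ ≤ (‖mellin (fun w => _root_.deriv F w * phase lam w) s‖ +
          (1 + |s.im|) * ‖mellin (fun w => F w * (w : ℂ)⁻¹ * phase lam w) s‖) * |lam| ^ k := by gcongr
      _ = ‖mellin (fun w => _root_.deriv F w * phase lam w) s‖ * |lam| ^ k +
          (1 + |s.im|) * (‖mellin (fun w => F w * (w : ℂ)⁻¹ * phase lam w) s‖ * |lam| ^ k) := by ring
      _ ≤ C₁ * (1 + |s.im|) ^ k + (1 + |s.im|) * (C₂ * (1 + |s.im|) ^ k) := by gcongr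
      _ ≤ C₁ * (1 + |s.im|) ^ (k + 1) + (1 + |s.im|) * (C₂ * (1 + |s.im|) ^ k) := by gcongr; omega
      _ = _ := by ring

lemma exists_norm_mellin_mul_phase_mul_norm_pow_le (k : ℕ) : ∀ F : ℝ → ℂ, Adm F → ∃ C > 0, ∀ (lam : ℝ) (s : ℂ),
    1 / 2 ≤ s.re → s.re ≤ 1 →
    ‖mellin (fun w => F w * phase lam w) s‖ * ‖s‖ ^ k ≤ C * (1 + |lam|) ^ k := by
  induction k with
  | zero => intro F hF; simpa using hF.exists_norm_mellin_mul_phase_le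
  | succ k ih =>
    intro F hF
    obtain ⟨C₁, hC₁, h₁⟩ := ih _ hF.deriv.mul_ofReal
    obtain ⟨C₂, hC₂, h₂⟩ := ih _ hF.mul_ofReal
    refine ⟨C₁ + 2 * Real.pi * C₂, by positivity, fun lam s hs hs' => ?_⟩
    have e' := congrArg (fun z => ‖z‖) (hF.mul_mellin_mul_phase lam s)
    simp only [norm_mul, norm_neg] at e'
    have h5 : ‖s‖ * ‖mellin (fun w => F w * phase lam w) s‖ ≤
        ‖mellin (fun w => _root_.deriv F w * w * phase lam w) s‖ +
          2 * Real.pi * (1 + |lam|) * ‖mellin (fun w => F w * w * phase lam w) s‖ := by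
      rw [e']
      refine (norm_add_le _ _).trans ?_
      simp only [norm_mul, norm_real, norm_I, Complex.norm_ofNat, Real.norm_eq_abs, abs_of_pos Real.pi_pos, mul_one]
      gcongr
      linarith
    have h6 := h₁ lam s hs hs'
    have h7 := h₂ lam s hs hs'
    have hτ : 1 ≤ 1 + |lam| := by linarith [abs_nonneg lam]
    calc _ = (‖s‖ * ‖mellin (fun w => F w * phase lam w) s‖) * ‖s‖ ^ k := by ring
      _ ≤ (‖mellin (fun w => _root_.deriv F w * w * phase lam w) s‖ +
          2 * Real.pi * (1 + |lam|) * ‖mellin (fun w => F w * w * phase lam w) s‖) * ‖s‖ ^ k := by gcongr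
      _ = ‖mellin (fun w => _root_.deriv F w * w * phase lam w) s‖ * ‖s‖ ^ k +
          2 * Real.pi * (1 + |lam|) * (‖mellin (fun w => F w * w * phase lam w) s‖ * ‖s‖ ^ k) := by ring
      _ ≤ C₁ * (1 + |lam|) ^ k + 2 * Real.pi * (1 + |lam|) * (C₂ * (1 + |lam|) ^ k) := by gcongr
      _ ≤ C₁ * (1 + |lam|) ^ (k + 1) + 2 * Real.pi * (1 + |lam|) * (C₂ * (1 + |lam|) ^ k) := by gcongr; omega
      _ = _ := by ring

lemma one_add_pow_le {a : ℝ} (ha : 0 ≤ a) (k : ℕ) : (1 + a) ^ k ≤ 2 ^ k * (1 + a ^ k) := by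
  rcases le_total a 1 with h | h
  · calc (1 + a) ^ k ≤ 2 ^ k := by gcongr; linarith
      _ ≤ _ := le_mul_of_one_le_right (by positivity) (by linarith [pow_nonneg ha k])
  · calc (1 + a) ^ k ≤ (2 * a) ^ k := by gcongr; linarith
      _ = 2 ^ k * a ^ k := mul_pow _ _ _
      _ ≤ _ := by gcongr; linarith

/-- Decay of the Mellin transform of `F · e(λ·)` in `λ`. -/
theorem exists_norm_mellin_mul_phase_mul_one_add_lam_pow_le (hF : Adm F) (k : ℕ) : ∃ C > 0, ∀ (lam : ℝ) (s : ℂ),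
    1 / 2 ≤ s.re → s.re ≤ 1 →
    ‖mellin (fun w => F w * phase lam w) s‖ * (1 + |lam|) ^ k ≤ C * (1 + |s.im|) ^ k := by
  obtain ⟨C₀, hC₀, h₀⟩ := hF.exists_norm_mellin_mul_phase_le
  obtain ⟨C₁, hC₁, h₁⟩ := exists_norm_mellin_mul_phase_mul_lam_pow_le k F hF
  refine ⟨2 ^ k * (C₀ + C₁), by positivity, fun lam s hs hs' => ?_⟩
  have h2 : 1 ≤ (1 + |s.im|) ^ k := one_le_pow₀ (by linarith [abs_nonneg s.im])
  have h3 := h₀ lam s hs hs'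
  have h4 := h₁ lam s hs hs'
  calc _ ≤ ‖mellin (fun w => F w * phase lam w) s‖ * (2 ^ k * (1 + |lam| ^ k)) := by
        gcongr; exact one_add_pow_le (abs_nonneg _) k
    _ = 2 ^ k * (‖mellin (fun w => F w * phase lam w) s‖ + ‖mellin (fun w => F w * phase lam w) s‖ * |lam| ^ k) := by
        ring
    _ ≤ 2 ^ k * (C₀ * (1 + |s.im|) ^ k + C₁ * (1 + |s.im|) ^ k) := by
        gcongr
        exact h3.trans (le_mul_of_one_le_right hC₀.le h2)
    _ = _ := by ring

/-- Decay of the Mellin transform of `F · e(λ·)` in the vertical direction. -/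
theorem exists_norm_mellin_mul_phase_mul_one_add_im_pow_le (hF : Adm F) (k : ℕ) : ∃ C > 0, ∀ (lam : ℝ) (s : ℂ),
    1 / 2 ≤ s.re → s.re ≤ 1 →
    ‖mellin (fun w => F w * phase lam w) s‖ * (1 + |s.im|) ^ k ≤ C * (1 + |lam|) ^ k := by
  obtain ⟨C₁, hC₁, h₁⟩ := exists_norm_mellin_mul_phase_mul_norm_pow_le k F hF
  refine ⟨3 ^ k * C₁, by positivity, fun lam s hs hs' => ?_⟩
  have h2 : 1 + |s.im| ≤ 3 * ‖s‖ := by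
    have := abs_re_le_norm s
    have := abs_im_le_norm s
    have := le_abs_self s.re
    linarith
  have h4 := h₁ lam s hs hs'
  calc _ ≤ ‖mellin (fun w => F w * phase lam w) s‖ * (3 * ‖s‖) ^ k := by gcongr
    _ = 3 ^ k * (‖mellin (fun w => F w * phase lam w) s‖ * ‖s‖ ^ k) := by ring
    _ ≤ 3 ^ k * (C₁ * (1 + |lam|) ^ k) := by gcongr
    _ = _ := by ring


lemma hasCompactSupport_comp_exp (hF : Adm F) (σ : ℝ) :
    HasCompactSupport fun u : ℝ => Real.exp (-σ * u) • F (Real.exp (-u)) := by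
  obtain ⟨A, hA, h⟩ := hF.bot
  obtain ⟨B, hB, h'⟩ := hF.top
  refine HasCompactSupport.intro (isCompact_Icc (a := -Real.log B) (b := -Real.log A)) fun u hu => ?_
  rw [mem_Icc, not_and_or, not_le, not_le] at hu
  rcases hu with hu | hu
  · rw [h' _ ((Real.log_le_iff_le_exp hB).1 (by linarith)), smul_zero]
  · rw [h _ ((Real.le_log_iff_exp_le hA).1 (by linarith)), smul_zero]

lemma contDiff_comp_exp (hF : Adm F) (σ : ℝ) :
    ContDiff ℝ ∞ fun u : ℝ => Real.exp (-σ * u) • F (Real.exp (-u)) := by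
  have h1 : ContDiff ℝ ∞ fun u : ℝ => Real.exp (-σ * u) := by fun_prop
  have h2 : ContDiff ℝ ∞ fun u : ℝ => Real.exp (-u) := by fun_prop
  exact h1.smul (hF.smooth.comp h2)

lemma integral_norm_mellin_sq (hF : Adm F) (σ : ℝ) : ∫ t : ℝ, ‖mellin F (σ + t * I)‖ ^ 2 =
    2 * Real.pi * ∫ u : ℝ, ‖Real.exp (-σ * u) • F (Real.exp (-u))‖ ^ 2 := by
  have h := SchwartzMap.integral_norm_sq_fourier ((hF.hasCompactSupport_comp_exp σ).toSchwartzMap (hF.contDiff_comp_exp σ))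
  have e : ∀ t : ℝ, mellin F (σ + t * I) = 𝓕 (fun u : ℝ => Real.exp (-σ * u) • F (Real.exp (-u))) (t / (2 * Real.pi)) := by
    intro t; rw [mellin_eq_fourier]; simp
  simp only [e]
  rw [Measure.integral_comp_div (fun t : ℝ => ‖𝓕 (fun u : ℝ => Real.exp (-σ * u) • F (Real.exp (-u))) t‖ ^ 2) (2 * Real.pi),
    abs_of_pos (by positivity), smul_eq_mul]
  congr 1

lemma integrable_norm_mellin_sq (hF : Adm F) (σ : ℝ) : Integrable fun t : ℝ => ‖mellin F (σ + t * I)‖ ^ 2 := by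
  have h1 := hF.toCut.integrable_vertical (σ := σ) (Or.inr hF)
  have h2 : ∀ t : ℝ, ‖(‖mellin F (σ + t * I)‖)‖ ≤ ∫ w in Ioi (0 : ℝ), w ^ (σ - 1) * ‖F w‖ := by
    intro t
    have := norm_mellin_le (F := F) (σ + t * I)
    simpa using this
  have h3 := h1.norm.mul_bdd (c := ∫ w in Ioi (0 : ℝ), w ^ (σ - 1) * ‖F w‖) h1.norm.aestronglyMeasurable
    (Eventually.of_forall h2)
  simpa only [sq] using h3

lemma exists_integral_norm_mellin_mul_phase_sq_le (hF : Adm F) : ∃ C > 0, ∀ lam σ : ℝ, 1 / 2 ≤ σ → σ ≤ 1 →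
    ∫ t : ℝ, ‖mellin (fun w => F w * phase lam w) (σ + t * I)‖ ^ 2 ≤ C := by
  have hi : ∀ σ : ℝ, Integrable fun u : ℝ => ‖Real.exp (-σ * u) • F (Real.exp (-u))‖ ^ 2 := by
    intro σ
    refine ((hF.contDiff_comp_exp σ).continuous.norm.pow 2).integrable_of_hasCompactSupport ?_
    have h : HasCompactSupport fun u : ℝ => ‖Real.exp (-σ * u) • F (Real.exp (-u))‖ :=
      (hF.hasCompactSupport_comp_exp σ).norm
    simp only [sq]
    exact h.mul_right
  have hp : ∀ σ : ℝ, 0 ≤ ∫ u : ℝ, ‖Real.exp (-σ * u) • F (Real.exp (-u))‖ ^ 2 := fun σ =>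
    integral_nonneg fun u => by positivity
  refine ⟨2 * Real.pi * ((∫ u : ℝ, ‖Real.exp (-(1 / 2 : ℝ) * u) • F (Real.exp (-u))‖ ^ 2) +
    ∫ u : ℝ, ‖Real.exp (-(1 : ℝ) * u) • F (Real.exp (-u))‖ ^ 2) + 1,
    add_pos_of_nonneg_of_pos (mul_nonneg (by positivity) (add_nonneg (hp _) (hp _))) one_pos, fun lam σ h1 h2 => ?_⟩
  rw [(hF.mul_phase lam).integral_norm_mellin_sq, ← integral_add (hi _) (hi _)]
  refine le_trans (mul_le_mul_of_nonneg_left ?_ (by positivity)) (le_add_of_nonneg_right zero_le_one)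
  refine integral_mono_of_nonneg (Eventually.of_forall fun u => by positivity) ((hi _).add (hi _))
    (Eventually.of_forall fun u => ?_)
  simp only [norm_smul, norm_mul, norm_phase, mul_one, Real.norm_eq_abs, Real.abs_exp, mul_pow]
  rw [← add_mul]
  refine mul_le_mul_of_nonneg_right ?_ (by positivity)
  rcases le_total u 0 with h | h
  · refine le_trans ?_ (le_add_of_nonneg_left (by positivity))
    exact pow_le_pow_left₀ (Real.exp_pos _).le (Real.exp_le_exp.2 (by nlinarith only [h, h1, h2])) 2
  · refine le_trans ?_ (le_add_of_nonneg_right (by positivity))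
    exact pow_le_pow_left₀ (Real.exp_pos _).le (Real.exp_le_exp.2 (by nlinarith only [h, h1, h2])) 2

/-- A weighted Plancherel bound. -/
lemma exists_integral_norm_mellin_mul_phase_sq_mul_le (hF : Adm F) : ∃ C > 0, ∀ lam σ : ℝ, 1 / 2 ≤ σ → σ ≤ 1 →
    Integrable (fun t : ℝ => ‖mellin (fun w => F w * phase lam w) (σ + t * I)‖ ^ 2 * (1 + (t / (1 + |lam|)) ^ 2)) ∧
    ∫ t : ℝ, ‖mellin (fun w => F w * phase lam w) (σ + t * I)‖ ^ 2 * (1 + (t / (1 + |lam|)) ^ 2) ≤ C := by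
  obtain ⟨C₀, hC₀, h₀⟩ := hF.exists_integral_norm_mellin_mul_phase_sq_le
  obtain ⟨C₁, hC₁, h₁⟩ := hF.deriv.mul_ofReal.exists_integral_norm_mellin_mul_phase_sq_le
  obtain ⟨C₂, hC₂, h₂⟩ := hF.mul_ofReal.exists_integral_norm_mellin_mul_phase_sq_le
  refine ⟨C₀ + 2 * C₁ + 2 * (2 * Real.pi) ^ 2 * C₂, by positivity, fun lam σ hσ hσ' => ?_⟩
  have i0 := (hF.mul_phase lam).integrable_norm_mellin_sq σ
  have i1 := ((hF.deriv.mul_ofReal.mul_phase lam).integrable_norm_mellin_sq σ).const_mul 2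
  have i2 := ((hF.mul_ofReal.mul_phase lam).integrable_norm_mellin_sq σ).const_mul (2 * (2 * Real.pi) ^ 2)
  have hb : ∀ t : ℝ, ‖mellin (fun w => F w * phase lam w) (σ + t * I)‖ ^ 2 * (1 + (t / (1 + |lam|)) ^ 2) ≤
      ‖mellin (fun w => F w * phase lam w) (σ + t * I)‖ ^ 2 +
      2 * ‖mellin (fun w => _root_.deriv F w * w * phase lam w) (σ + t * I)‖ ^ 2 +
      2 * (2 * Real.pi) ^ 2 * ‖mellin (fun w => F w * w * phase lam w) (σ + t * I)‖ ^ 2 := by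
    intro t
    have e' := congrArg (fun z => ‖z‖) (hF.mul_mellin_mul_phase lam (σ + t * I))
    simp only [norm_mul, norm_neg] at e'
    set m := ‖mellin (fun w => F w * phase lam w) (σ + t * I)‖
    set m1 := ‖mellin (fun w => _root_.deriv F w * w * phase lam w) (σ + t * I)‖
    set m2 := ‖mellin (fun w => F w * w * phase lam w) (σ + t * I)‖
    have h3 : |t| * m ≤ m1 + 2 * Real.pi * |lam| * m2 := by
      have h4 : |t| ≤ ‖(σ + t * I : ℂ)‖ := by simpa using abs_im_le_norm (σ + t * I : ℂ)
      calc |t| * m ≤ ‖(σ + t * I : ℂ)‖ * m := by gcongr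
        _ ≤ _ := by
          rw [e']
          refine (norm_add_le _ _).trans (le_of_eq ?_)
          simp only [norm_mul, norm_real, norm_I, Complex.norm_ofNat, Real.norm_eq_abs, abs_of_pos Real.pi_pos, mul_one]
          rfl
    have hl : 0 < 1 + |lam| := by positivity
    have h5 : |t| / (1 + |lam|) * m ≤ m1 + 2 * Real.pi * m2 := by
      rw [div_mul_eq_mul_div, div_le_iff₀ hl]
      have : 0 ≤ m1 * |lam| := by positivity
      have : 0 ≤ 2 * Real.pi * m2 := by positivity
      nlinarith
    have h6 : (|t| / (1 + |lam|) * m) ^ 2 ≤ 2 * m1 ^ 2 + 2 * (2 * Real.pi * m2) ^ 2 := by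
      calc _ ≤ (m1 + 2 * Real.pi * m2) ^ 2 := by gcongr
        _ ≤ _ := by nlinarith [sq_nonneg (m1 - 2 * Real.pi * m2)]
    have h7 : (t / (1 + |lam|)) ^ 2 = (|t| / (1 + |lam|)) ^ 2 := by rw [div_pow, div_pow, sq_abs]
    rw [h7]
    nlinarith
  have hi := (i0.add i1).add i2
  have hm : Integrable fun t : ℝ =>
      ‖mellin (fun w => F w * phase lam w) (σ + t * I)‖ ^ 2 * (1 + (t / (1 + |lam|)) ^ 2) := by
    refine hi.mono' ?_ (Eventually.of_forall fun t => ?_)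
    · exact i0.aestronglyMeasurable.mul (by fun_prop : Continuous fun t : ℝ => 1 + (t / (1 + |lam|)) ^ 2).aestronglyMeasurable
    · rw [Real.norm_of_nonneg (by positivity)]; exact hb t
  refine ⟨hm, (integral_mono hm hi hb).trans ?_⟩
  rw [integral_add' (i0.add i1) i2, integral_add' i0 i1, integral_const_mul, integral_const_mul]
  gcongr
  · exact h₀ lam σ hσ hσ'
  · exact h₁ lam σ hσ hσ'
  · exact h₂ lam σ hσ hσ'

theorem exists_integral_norm_mellin_mul_phase_mul_rpow_le (hF : Adm F) {η : ℝ} (hη : 0 ≤ η) (hη' : η ≤ 1 / 8) :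
    ∃ C > 0, ∀ lam σ : ℝ, 1 / 2 ≤ σ → σ ≤ 1 →
    Integrable (fun t : ℝ => ‖mellin (fun w => F w * phase lam w) (σ + t * I)‖ * (1 + |t|) ^ η) ∧
    ∫ t : ℝ, ‖mellin (fun w => F w * phase lam w) (σ + t * I)‖ * (1 + |t|) ^ η ≤ C * (1 + |lam|) ^ (1 / 2 + η) := by
  obtain ⟨C₀, hC₀, h₀⟩ := hF.exists_integral_norm_mellin_mul_phase_sq_mul_le
  have hK : 0 ≤ ∫ t : ℝ, (1 + |t|) ^ (-(3 / 2) : ℝ) := integral_nonneg fun t => by positivity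
  refine ⟨C₀ + 2 * ∫ t : ℝ, (1 + |t|) ^ (-(3 / 2) : ℝ), by positivity, fun lam σ hσ hσ' => ?_⟩
  obtain ⟨i0, hI⟩ := h₀ lam σ hσ hσ'
  set Λ := 1 + |lam| with hΛ
  have hΛ1 : 1 ≤ Λ := by rw [hΛ]; linarith [abs_nonneg lam]
  have hΛ0 : 0 < Λ := by linarith
  have i1 := ((integrable_one_add_abs_rpow (p := 3 / 2) (by norm_num)).comp_div hΛ0.ne').const_mul (2 * Λ ^ (-(1 / 2) + η))
  have i2 := (i0.const_mul (Λ ^ (1 / 2 + η))).add i1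
  have hb : ∀ t : ℝ, ‖mellin (fun w => F w * phase lam w) (σ + t * I)‖ * (1 + |t|) ^ η ≤
      Λ ^ (1 / 2 + η) * (‖mellin (fun w => F w * phase lam w) (σ + t * I)‖ ^ 2 * (1 + (t / Λ) ^ 2)) +
        2 * Λ ^ (-(1 / 2) + η) * (1 + |t / Λ|) ^ (-(3 / 2) : ℝ) := by
    intro t
    set m := ‖mellin (fun w => F w * phase lam w) (σ + t * I)‖
    set u := t / Λ with hu
    set v := 1 + |u| with hv
    have hv1 : 1 ≤ v := by rw [hv]; linarith [abs_nonneg u]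
    have hv0 : 0 < v := by linarith
    have h1 : 1 + |t| ≤ Λ * v := by
      have : |t| = Λ * |u| := by rw [hu, abs_div, abs_of_pos hΛ0]; field_simp
      rw [this, hv]; nlinarith
    have h2 : (1 + |t|) ^ η ≤ Λ ^ η * v ^ (1 / 8 : ℝ) := by
      calc (1 + |t|) ^ η ≤ (Λ * v) ^ η := by gcongr
        _ = Λ ^ η * v ^ η := Real.mul_rpow hΛ0.le hv0.le
        _ ≤ _ := by gcongr
    have h3 : v ^ 2 ≤ 2 * (1 + u ^ 2) := by
      rw [hv, ← sq_abs u]; nlinarith [sq_nonneg (|u| - 1)]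
    have e1 : Λ ^ (1 / 2 + η) = Λ ^ η * Λ ^ (1 / 2 : ℝ) := by rw [add_comm, Real.rpow_add hΛ0]
    have e2 : Λ ^ (-(1 / 2) + η) = Λ ^ η * (Λ ^ (1 / 2 : ℝ))⁻¹ := by
      rw [add_comm, Real.rpow_add hΛ0, Real.rpow_neg hΛ0.le]
    have e3 : v ^ (-(3 / 2) : ℝ) * v ^ (3 / 2 : ℝ) = 1 := by
      rw [Real.rpow_neg hv0.le, inv_mul_cancel₀]; positivity
    have e4 : v ^ (1 / 8 : ℝ) * v ^ (1 / 8 : ℝ) ≤ v ^ 2 * v ^ (-(3 / 2) : ℝ) := by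
      rw [← Real.rpow_add hv0, ← Real.rpow_natCast v 2, ← Real.rpow_add hv0]
      exact Real.rpow_le_rpow_of_exponent_le hv1 (by norm_num)
    set p := Λ ^ (1 / 2 : ℝ) with hp
    set q := v ^ (1 / 8 : ℝ) with hq
    set w := v ^ (-(3 / 2) : ℝ) with hw
    have hp0 : 0 < p := by positivity
    have hq0 : 0 < q := by positivity
    have hw0 : 0 < w := by positivity
    have hm0 : 0 ≤ m := norm_nonneg _
    have h5 : m * q ≤ p * (m ^ 2 * (1 + u ^ 2)) + 2 * p⁻¹ * w := by
      have h6 : q ^ 2 ≤ 2 * (1 + u ^ 2) * w := by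
        calc q ^ 2 = q * q := sq q
          _ ≤ v ^ 2 * w := e4
          _ ≤ _ := by gcongr
      have h7 : m * q ≤ p * (m ^ 2 * (1 + u ^ 2)) + p⁻¹ * (q ^ 2 / (1 + u ^ 2)) := by
        have hk : 0 < 1 + u ^ 2 := by positivity
        have : p * (m ^ 2 * (1 + u ^ 2)) + p⁻¹ * (q ^ 2 / (1 + u ^ 2)) - m * q =
            ((p * (m * (1 + u ^ 2)) - q) ^ 2 + p * (m * (1 + u ^ 2)) * q) / (p * (1 + u ^ 2)) := by
          field_simp; ring
        have h8 : 0 ≤ ((p * (m * (1 + u ^ 2)) - q) ^ 2 + p * (m * (1 + u ^ 2)) * q) / (p * (1 + u ^ 2)) := by positivity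
        linarith
      refine h7.trans ?_
      rw [mul_comm 2 p⁻¹, mul_assoc]
      gcongr
      rw [div_le_iff₀ (by positivity)]
      linarith
    calc m * (1 + |t|) ^ η ≤ m * (Λ ^ η * q) := by gcongr
      _ = Λ ^ η * (m * q) := by ring
      _ ≤ Λ ^ η * (p * (m ^ 2 * (1 + u ^ 2)) + 2 * p⁻¹ * w) := by gcongr
      _ = _ := by rw [e1, e2]; ring
  have hm : Integrable (fun t : ℝ => ‖mellin (fun w => F w * phase lam w) (σ + t * I)‖ * (1 + |t|) ^ η) := by
    refine i2.mono' ?_ (Eventually.of_forall fun t => ?_)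
    · refine ((hF.mul_phase lam).toCut.continuous_vertical (σ := σ) (Or.inr (hF.mul_phase lam))).norm.aestronglyMeasurable.mul ?_
      have : Continuous fun t : ℝ => (1 + |t|) ^ η :=
        (by fun_prop : Continuous fun t : ℝ => 1 + |t|).rpow_const fun t => Or.inr hη
      exact this.aestronglyMeasurable
    · rw [Real.norm_of_nonneg (by positivity)]; exact hb t
  refine ⟨hm, (integral_mono hm i2 hb).trans ?_⟩
  rw [integral_add' (i0.const_mul _) i1, integral_const_mul, integral_const_mul,
    Measure.integral_comp_div (fun t : ℝ => (1 + |t|) ^ (-(3 / 2) : ℝ)) Λ, abs_of_pos hΛ0, smul_eq_mul]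
  have e : Λ ^ (1 / 2 + η) = Λ ^ (-(1 / 2) + η) * Λ := by
    nth_rw 3 [← Real.rpow_one Λ]
    rw [← Real.rpow_add hΛ0]; congr 1; ring
  calc _ ≤ Λ ^ (1 / 2 + η) * C₀ + 2 * Λ ^ (-(1 / 2) + η) * (Λ * ∫ t : ℝ, (1 + |t|) ^ (-(3 / 2) : ℝ)) := by gcongr
    _ = Λ ^ (1 / 2 + η) * C₀ + 2 * (Λ ^ (-(1 / 2) + η) * Λ) * ∫ t : ℝ, (1 + |t|) ^ (-(3 / 2) : ℝ) := by ring
    _ = _ := by rw [← e]; ring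

end Adm

end

/-- The coefficient `μ(d)/φ(d)`. -/
def moebiusDivTotient (d : ℕ) : ℝ := (ArithmeticFunction.moebius d : ℝ) / (Nat.totient d : ℝ)

lemma moebiusDivTotient_mul {a b : ℕ} (h : Nat.Coprime a b) :
    moebiusDivTotient (a * b) = moebiusDivTotient a * moebiusDivTotient b := by
  simp only [moebiusDivTotient]
  rw [ArithmeticFunction.isMultiplicative_moebius.map_mul_of_coprime h, Nat.totient_mul h]
  push_cast
  rw [mul_div_mul_comm]

lemma moebiusDivTotient_prime_pow {p : ℕ} (hp : p.Prime) (k : ℕ) :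
    moebiusDivTotient (p ^ k) = if k = 0 then 1 else if k = 1 then -1 / ((p : ℝ) - 1) else 0 := by
  rw [moebiusDivTotient]
  split_ifs with h0 h1
  · simp [h0]
  · subst h1
    rw [pow_one, ArithmeticFunction.moebius_apply_prime hp, Nat.totient_prime hp, Nat.cast_sub hp.one_le]
    norm_num
  · rw [ArithmeticFunction.moebius_apply_prime_pow hp h0, if_neg h1]; simp

/-- The coefficients in the expansion of `μ(q/(q,n))/φ(q/(q,n))` into indicators of divisibility. -/
def divCoeff (q : ℕ) (t : Finset ℕ) : ℝ :=
  (∏ p ∈ t, (-1 / ((p : ℝ) - 1))) * ∏ p ∈ q.primeFactors \ t, ((p : ℝ) / ((p : ℝ) - 1))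

lemma factorization_prod_primes {t : Finset ℕ} (ht : ∀ p ∈ t, p.Prime) (p : ℕ) :
    (∏ r ∈ t, r).factorization p = if p ∈ t then 1 else 0 := by
  rw [Nat.factorization_prod_apply fun r hr => (ht r hr).ne_zero]
  rw [Finset.sum_congr rfl fun r hr => by rw [(ht r hr).factorization, Finsupp.single_apply]]
  simp

lemma prod_subset_primeFactors_dvd {q : ℕ} {t : Finset ℕ} (ht : t ⊆ q.primeFactors) : (∏ r ∈ t, r) ∣ q :=
  (Finset.prod_dvd_prod_of_subset _ _ _ ht).trans (Nat.prod_primeFactors_dvd q)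

lemma div_prod_dvd_iff {q n : ℕ} (hq : q ≠ 0) (hn : n ≠ 0) {t : Finset ℕ} (ht : t ⊆ q.primeFactors) :
    q / (∏ r ∈ t, r) ∣ n ↔ (∀ p ∈ t, q.factorization p ≤ n.factorization p + 1) ∧
      ∀ p ∈ q.primeFactors \ t, q.factorization p ≤ n.factorization p := by
  have hd := prod_subset_primeFactors_dvd ht
  have hpr : ∀ p ∈ t, p.Prime := fun p hp => Nat.prime_of_mem_primeFactors (ht hp)
  have h0 : q / (∏ r ∈ t, r) ≠ 0 := (Nat.div_pos (Nat.le_of_dvd (Nat.pos_of_ne_zero hq) hd)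
    (Nat.pos_of_ne_zero fun h => hq (by rw [h] at hd; exact zero_dvd_iff.1 hd))).ne'
  rw [← Nat.factorization_le_iff_dvd h0 hn, Nat.factorization_div hd, Finsupp.le_def]
  simp only [Finsupp.tsub_apply, factorization_prod_primes hpr, Finset.mem_sdiff]
  constructor
  · intro h
    refine ⟨fun p hp => ?_, fun p hp => ?_⟩
    · have := h p; rw [if_pos hp] at this; omega
    · have := h p; rw [if_neg hp.2] at this; omega
  · rintro ⟨h1, h2⟩ p
    by_cases hp : p ∈ t
    · have := h1 p hp; rw [if_pos hp]; omega
    · rw [if_neg hp]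
      by_cases hp' : p ∈ q.primeFactors
      · have := h2 p ⟨hp', hp⟩; omega
      · rw [Finsupp.notMem_support_iff.1 (by rwa [Nat.support_factorization])]; omega

/-- Expansion of `μ(q/(q,n))/φ(q/(q,n))` into indicators of divisibility. -/
theorem moebiusDivTotient_div_gcd {q n : ℕ} (hq : q ≠ 0) (hn : n ≠ 0) :
    moebiusDivTotient (q / Nat.gcd q n) =
      ∑ t ∈ q.primeFactors.powerset, divCoeff q t * if q / (∏ r ∈ t, r) ∣ n then 1 else 0 := by
  have hg := Nat.gcd_dvd_left q n
  have h0 : q / Nat.gcd q n ≠ 0 := (Nat.div_pos (Nat.le_of_dvd (Nat.pos_of_ne_zero hq) hg)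
    (Nat.gcd_pos_of_pos_left _ (Nat.pos_of_ne_zero hq))).ne'
  have hL : moebiusDivTotient (q / Nat.gcd q n) = ∏ p ∈ q.primeFactors,
      moebiusDivTotient (p ^ (q.factorization p - n.factorization p)) := by
    rw [Nat.multiplicative_factorization moebiusDivTotient (fun _ _ h => moebiusDivTotient_mul h)
      (by simp [moebiusDivTotient]) h0, Nat.factorization_div hg, Nat.factorization_gcd hq hn]
    rw [Finsupp.prod_of_support_subset (s := q.primeFactors)]
    · refine Finset.prod_congr rfl fun p _ => ?_
      congr 2
      simp only [Finsupp.tsub_apply, Finsupp.inf_apply]; omega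
    · intro p hp
      rw [← Nat.support_factorization, Finsupp.mem_support_iff]
      rw [Finsupp.mem_support_iff, Finsupp.tsub_apply] at hp
      omega
    · simp [moebiusDivTotient]
  have hR : ∀ p ∈ q.primeFactors, moebiusDivTotient (p ^ (q.factorization p - n.factorization p)) =
      (-1 / ((p : ℝ) - 1)) * (if q.factorization p ≤ n.factorization p + 1 then 1 else 0) +
        (p : ℝ) / ((p : ℝ) - 1) * (if q.factorization p ≤ n.factorization p then 1 else 0) := by
    intro p hp
    have hp' := Nat.prime_of_mem_primeFactors hp
    have h2 : (2 : ℝ) ≤ p := by exact_mod_cast hp'.two_le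
    have h1 : (p : ℝ) - 1 ≠ 0 := by linarith
    rw [moebiusDivTotient_prime_pow hp']
    rcases le_or_gt (q.factorization p) (n.factorization p) with h | h
    · rw [if_pos (by omega), if_pos (by omega), if_pos h]; field_simp; ring
    · rcases eq_or_ne (q.factorization p) (n.factorization p + 1) with h3 | h3
      · rw [if_neg (by omega), if_pos (by omega), if_pos (by omega), if_neg (by omega)]; ring
      · rw [if_neg (by omega), if_neg (by omega), if_neg (by omega), if_neg (by omega)]; ring
  rw [hL, Finset.prod_congr rfl hR, Finset.prod_add]
  refine Finset.sum_congr rfl fun t ht => ?_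
  rw [Finset.mem_powerset] at ht
  rw [Finset.prod_mul_distrib, Finset.prod_mul_distrib, divCoeff]
  rw [Finset.prod_ite_zero, Finset.prod_ite_zero, mul_mul_mul_comm, Finset.prod_const_one, Finset.prod_const_one]
  congr 1
  rw [if_congr (div_prod_dvd_iff hq hn ht) rfl rfl]
  split_ifs <;> simp_all

lemma sum_divCoeff_mul_rpow (q : ℕ) (c : ℝ) :
    ∑ t ∈ q.primeFactors.powerset, divCoeff q t * ((∏ r ∈ t, r : ℕ) : ℝ) ^ c =
      ∏ p ∈ q.primeFactors, (1 - ((p : ℝ) ^ c - 1) / ((p : ℝ) - 1)) := by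
  have h : ∀ p ∈ q.primeFactors, (1 - ((p : ℝ) ^ c - 1) / ((p : ℝ) - 1)) =
      (-1 / ((p : ℝ) - 1)) * (p : ℝ) ^ c + (p : ℝ) / ((p : ℝ) - 1) := by
    intro p hp
    have h2 : (2 : ℝ) ≤ p := by exact_mod_cast (Nat.prime_of_mem_primeFactors hp).two_le
    have h1 : (p : ℝ) - 1 ≠ 0 := by linarith
    field_simp; ring
  rw [Finset.prod_congr rfl h, Finset.prod_add]
  refine Finset.sum_congr rfl fun t _ => ?_
  rw [Finset.prod_mul_distrib, divCoeff, Nat.cast_prod, ← Real.finsetProd_rpow _ _ fun p _ => Nat.cast_nonneg p]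
  ring

lemma sum_abs_divCoeff_mul_rpow_le (q : ℕ) {σ : ℝ} (hσ : σ ≤ 1) :
    ∑ t ∈ q.primeFactors.powerset, |divCoeff q t| * ((∏ r ∈ t, r : ℕ) : ℝ) ^ σ ≤ 4 ^ q.primeFactors.card := by
  have h : ∏ p ∈ q.primeFactors, ((1 / ((p : ℝ) - 1)) * (p : ℝ) ^ σ + (p : ℝ) / ((p : ℝ) - 1)) =
      ∑ t ∈ q.primeFactors.powerset, |divCoeff q t| * ((∏ r ∈ t, r : ℕ) : ℝ) ^ σ := by
    rw [Finset.prod_add]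
    refine Finset.sum_congr rfl fun t ht => ?_
    rw [Finset.mem_powerset] at ht
    rw [Finset.prod_mul_distrib, divCoeff, Nat.cast_prod, ← Real.finsetProd_rpow _ _ fun p _ => Nat.cast_nonneg p,
      abs_mul, Finset.abs_prod, Finset.abs_prod]
    have hp : ∀ p ∈ q.primeFactors, 0 < (p : ℝ) - 1 := fun p hp => by
      have h2 : (2 : ℝ) ≤ p := by exact_mod_cast (Nat.prime_of_mem_primeFactors hp).two_le
      linarith
    rw [Finset.prod_congr rfl (fun p h => by rw [abs_div, abs_neg, abs_one, abs_of_pos (hp p (ht h))] :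
      ∀ p ∈ t, |-1 / ((p : ℝ) - 1)| = 1 / ((p : ℝ) - 1)),
      Finset.prod_congr rfl (fun p h => abs_of_nonneg (div_nonneg (Nat.cast_nonneg p)
        (hp p (Finset.mem_sdiff.1 h).1).le) : ∀ p ∈ q.primeFactors \ t, |(p : ℝ) / ((p : ℝ) - 1)| = p / ((p : ℝ) - 1))]
    ring
  rw [← h]
  have h2 : ∀ p ∈ q.primeFactors, (2 : ℝ) ≤ p := fun p hp => by
    exact_mod_cast (Nat.prime_of_mem_primeFactors hp).two_le
  rw [← Finset.prod_const]
  refine Finset.prod_le_prod (fun p hp => ?_) fun p hp => ?_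
  · have := h2 p hp
    have : 0 < (p : ℝ) - 1 := by linarith
    positivity
  have h2 := h2 p hp
  have h3 : (p : ℝ) ^ σ ≤ p := by
    simpa using Real.rpow_le_rpow_of_exponent_le (show (1 : ℝ) ≤ p by linarith) hσ
  rw [one_div_mul_eq_div, ← add_div, div_le_iff₀ (by linarith)]
  linarith

lemma exists_four_pow_card_primeFactors_le {ε : ℝ} (hε : 0 < ε) :
    ∃ C > 0, ∀ q : ℕ, q ≠ 0 → (4 : ℝ) ^ q.primeFactors.card ≤ C * (q : ℝ) ^ ε := by
  set K : ℕ := ⌈(4 : ℝ) ^ (1 / ε)⌉₊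
  refine ⟨4 ^ K, by positivity, fun q hq => ?_⟩
  have h1 : ∀ p ∈ q.primeFactors, (4 : ℝ) ≤ (if p < K then 4 else 1) * (p : ℝ) ^ ε := by
    intro p hp
    have h2 : (1 : ℝ) ≤ p := by exact_mod_cast (Nat.prime_of_mem_primeFactors hp).one_le
    split_ifs with h
    · exact le_mul_of_one_le_right (by norm_num) (Real.one_le_rpow h2 hε.le)
    · have h3 : (4 : ℝ) ^ (1 / ε) ≤ p := (Nat.le_ceil _).trans (by exact_mod_cast not_lt.1 h)
      calc (4 : ℝ) = ((4 : ℝ) ^ (1 / ε)) ^ ε := by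
            rw [← Real.rpow_mul (by norm_num), one_div_mul_cancel hε.ne', Real.rpow_one]
        _ ≤ (p : ℝ) ^ ε := by gcongr
        _ = _ := (one_mul _).symm
  calc (4 : ℝ) ^ q.primeFactors.card = ∏ p ∈ q.primeFactors, (4 : ℝ) := by rw [Finset.prod_const]
    _ ≤ ∏ p ∈ q.primeFactors, ((if p < K then 4 else 1) * (p : ℝ) ^ ε) :=
        Finset.prod_le_prod (fun _ _ => by norm_num) h1
    _ = (∏ p ∈ q.primeFactors, (if p < K then (4 : ℝ) else 1)) * (∏ p ∈ q.primeFactors, (p : ℝ)) ^ ε := by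
        rw [Finset.prod_mul_distrib, Real.finsetProd_rpow _ _ fun p _ => Nat.cast_nonneg p]
    _ ≤ 4 ^ K * (q : ℝ) ^ ε := by
        gcongr
        · rw [← Finset.prod_filter, Finset.prod_const]
          refine pow_le_pow_right₀ (by norm_num) ?_
          calc _ ≤ (Finset.range K).card := Finset.card_le_card fun p hp => by
                rw [Finset.mem_filter] at hp; exact Finset.mem_range.2 hp.2
            _ = K := Finset.card_range K
        · rw [← Nat.cast_prod]
          exact_mod_cast Nat.le_of_dvd (Nat.pos_of_ne_zero hq) (Nat.prod_primeFactors_dvd q)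

/-- The total weight of the expansion. -/
theorem exists_sum_abs_divCoeff_mul_le {ε : ℝ} (hε : 0 < ε) : ∃ C > 0, ∀ (q : ℕ) (σ : ℝ), q ≠ 0 → σ ≤ 1 →
    ∑ t ∈ q.primeFactors.powerset, |divCoeff q t| * (((∏ r ∈ t, r : ℕ) : ℝ) / q) ^ σ ≤ C * (q : ℝ) ^ (-σ + ε) := by
  obtain ⟨C, hC, h⟩ := exists_four_pow_card_primeFactors_le hε
  refine ⟨C, hC, fun q σ hq hσ => ?_⟩
  have hq0 : (0 : ℝ) < q := by exact_mod_cast Nat.pos_of_ne_zero hq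
  have e : ∀ t ∈ q.primeFactors.powerset, |divCoeff q t| * (((∏ r ∈ t, r : ℕ) : ℝ) / q) ^ σ =
      (q : ℝ) ^ (-σ) * (|divCoeff q t| * ((∏ r ∈ t, r : ℕ) : ℝ) ^ σ) := by
    intro t _
    rw [Real.div_rpow (Nat.cast_nonneg _) hq0.le, Real.rpow_neg hq0.le]; ring
  rw [Finset.sum_congr rfl e, ← Finset.mul_sum, Real.rpow_add hq0]
  calc _ ≤ (q : ℝ) ^ (-σ) * (C * (q : ℝ) ^ ε) := by
        gcongr; exact (sum_abs_divCoeff_mul_rpow_le q hσ).trans (h q hq)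
    _ = _ := by ring

lemma Cut.summable_smoothNumbers {F : ℝ → ℂ} (hF : Cut F) (N : ℕ) {X : ℝ} (hX : 0 < X) (g : ℕ → ℂ) :
    Summable fun m : (N + 1).smoothNumbers => g m * F ((m : ℕ) / X) := by
  obtain ⟨B, hB, h⟩ := hF.top
  refine summable_of_hasFiniteSupport (Set.Finite.subset
    (s := {m : (N + 1).smoothNumbers | (m : ℕ) ≤ ⌊B * X⌋₊}) ?_ fun m hm => ?_)
  · exact Set.Finite.of_finite_image (f := Subtype.val) ((Set.finite_Iic ⌊B * X⌋₊).subset (by rintro _ ⟨m, hm, rfl⟩; exact hm))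
      Subtype.val_injective.injOn
  · by_contra hlt
    refine hm ?_
    have h1 : B * X < (m : ℕ) := Nat.lt_of_floor_lt (not_le.1 hlt)
    simp only [h _ ((le_div_iff₀ hX).2 h1.le), mul_zero]

/-- The local main term as a combination of sums over smooth numbers. -/
theorem Cut.tsum_moebiusDivTotient {F : ℝ → ℂ} (hF : Cut F) {N q : ℕ} (hq : q ≠ 0) (hs : q ∈ (N + 1).smoothNumbers)
    {x : ℝ} (hx : 0 < x) :
    ∑' n : (N + 1).smoothNumbers, ((moebiusDivTotient (q / Nat.gcd q n) : ℝ) : ℂ) * F ((n : ℕ) / x) =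
      ∑ t ∈ q.primeFactors.powerset, (divCoeff q t : ℂ) *
        ∑' m : (N + 1).smoothNumbers, F ((m : ℕ) / (x * (((∏ r ∈ t, r : ℕ) : ℝ) / q))) := by
  have hq0 : (0 : ℝ) < q := by exact_mod_cast Nat.pos_of_ne_zero hq
  have e : ∀ n : (N + 1).smoothNumbers, ((moebiusDivTotient (q / Nat.gcd q n) : ℝ) : ℂ) * F ((n : ℕ) / x) =
      ∑ t ∈ q.primeFactors.powerset, (divCoeff q t : ℂ) *
        ((if q / (∏ r ∈ t, r) ∣ (n : ℕ) then 1 else 0) * F ((n : ℕ) / x)) := by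
    intro n
    rw [moebiusDivTotient_div_gcd hq (Nat.ne_zero_of_mem_smoothNumbers n.2), ofReal_sum, Finset.sum_mul]
    refine Finset.sum_congr rfl fun t _ => ?_
    rw [ofReal_mul, mul_assoc]
    congr 2
    split_ifs <;> simp
  rw [tsum_congr e, Summable.tsum_finsetSum fun t _ =>
    (hF.summable_smoothNumbers N hx fun n => if q / (∏ r ∈ t, r) ∣ n then 1 else 0).mul_left _]
  refine Finset.sum_congr rfl fun t ht => ?_
  rw [tsum_mul_left]
  congr 1
  have hdq := prod_subset_primeFactors_dvd (Finset.mem_powerset.1 ht)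
  set E := ∏ r ∈ t, r
  have hE0 : E ≠ 0 := fun h => hq (by rw [h] at hdq; exact zero_dvd_iff.1 hdq)
  have hE : (0 : ℝ) < E := by exact_mod_cast Nat.pos_of_ne_zero hE0
  have hd0 : q / E ≠ 0 := (Nat.div_pos (Nat.le_of_dvd (Nat.pos_of_ne_zero hq) hdq) (Nat.pos_of_ne_zero hE0)).ne'
  have hds : q / E ∈ (N + 1).smoothNumbers := Nat.mem_smoothNumbers_of_dvd hs (Nat.div_dvd_of_dvd hdq)
  let g : (N + 1).smoothNumbers → (N + 1).smoothNumbers := fun m => ⟨q / E * m, Nat.mul_mem_smoothNumbers hds m.2⟩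
  have hg : Function.Injective g := fun a b hab => by
    have : q / E * (a : ℕ) = q / E * (b : ℕ) := congrArg Subtype.val hab
    exact Subtype.ext (Nat.eq_of_mul_eq_mul_left (Nat.pos_of_ne_zero hd0) this)
  rw [← hg.tsum_eq (f := fun n : (N + 1).smoothNumbers => (if q / E ∣ (n : ℕ) then 1 else 0) * F ((n : ℕ) / x))]
  · refine tsum_congr fun m => ?_
    have e1 : ((g m : ℕ) : ℝ) = q / E * (m : ℕ) := by
      rw [show (g m : ℕ) = q / E * (m : ℕ) from rfl, Nat.cast_mul, Nat.cast_div hdq hE.ne']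
    rw [if_pos (Dvd.intro _ rfl), one_mul, e1]
    congr 1
    field_simp
  · intro n hn
    by_cases hdn : q / E ∣ (n : ℕ)
    · obtain ⟨m, hm⟩ := hdn
      exact ⟨⟨m, Nat.mem_smoothNumbers_of_dvd n.2 ⟨q / E, by rw [hm, mul_comm]⟩⟩, Subtype.ext hm.symm⟩
    · exact absurd (by simp [hdn]) hn

/-- The local factor of the main term. -/
def localFactor (q : ℕ) (c : ℝ) : ℝ :=
  (q : ℝ) ^ (-c) * ∏ p ∈ q.primeFactors, (1 - ((p : ℝ) ^ c - 1) / ((p : ℝ) - 1))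

lemma sum_divCoeff_mul_div_rpow (q : ℕ) (c : ℝ) :
    ∑ t ∈ q.primeFactors.powerset, divCoeff q t * (((∏ r ∈ t, r : ℕ) : ℝ) / q) ^ c = localFactor q c := by
  rw [localFactor, ← sum_divCoeff_mul_rpow, Finset.mul_sum]
  refine Finset.sum_congr rfl fun t _ => ?_
  rw [Real.div_rpow (Nat.cast_nonneg _) (Nat.cast_nonneg q), Real.rpow_neg (Nat.cast_nonneg q)]; ring

lemma abs_localFactor_le (q : ℕ) (c : ℝ) : |localFactor q c| ≤
    ∑ t ∈ q.primeFactors.powerset, |divCoeff q t| * (((∏ r ∈ t, r : ℕ) : ℝ) / q) ^ c := by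
  rw [← sum_divCoeff_mul_div_rpow]
  refine (Finset.abs_sum_le_sum_abs _ _).trans (le_of_eq (Finset.sum_congr rfl fun t _ => ?_))
  rw [abs_mul, abs_of_nonneg (by positivity : 0 ≤ (((∏ r ∈ t, r : ℕ) : ℝ) / q) ^ c)]

lemma prod_div_pos {q : ℕ} (hq : q ≠ 0) {t : Finset ℕ} (ht : t ⊆ q.primeFactors) :
    0 < ((∏ r ∈ t, r : ℕ) : ℝ) / q := by
  have hq0 : (0 : ℝ) < q := by exact_mod_cast Nat.pos_of_ne_zero hq
  have : 0 < ∏ r ∈ t, r := Finset.prod_pos fun r hr => (Nat.prime_of_mem_primeFactors (ht hr)).pos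
  have : (0 : ℝ) < (∏ r ∈ t, r : ℕ) := by exact_mod_cast this
  positivity

lemma one_div_le_prod_div {q : ℕ} (hq : q ≠ 0) {t : Finset ℕ} (ht : t ⊆ q.primeFactors) :
    1 / (q : ℝ) ≤ ((∏ r ∈ t, r : ℕ) : ℝ) / q := by
  have hq0 : (0 : ℝ) < q := by exact_mod_cast Nat.pos_of_ne_zero hq
  have : 0 < ∏ r ∈ t, r := Finset.prod_pos fun r hr => (Nat.prime_of_mem_primeFactors (ht hr)).pos
  gcongr
  exact_mod_cast this

lemma prod_div_le_one {q : ℕ} (hq : q ≠ 0) {t : Finset ℕ} (ht : t ⊆ q.primeFactors) :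
    ((∏ r ∈ t, r : ℕ) : ℝ) / q ≤ 1 := by
  have hq0 : (0 : ℝ) < q := by exact_mod_cast Nat.pos_of_ne_zero hq
  rw [div_le_one hq0]
  exact_mod_cast Nat.le_of_dvd (Nat.pos_of_ne_zero hq) (prod_subset_primeFactors_dvd ht)

lemma abs_log_prod_div_le {q : ℕ} (hq : q ≠ 0) {t : Finset ℕ} (ht : t ⊆ q.primeFactors) :
    |Real.log (((∏ r ∈ t, r : ℕ) : ℝ) / q)| ≤ Real.log q := by
  have hq0 : (0 : ℝ) < q := by exact_mod_cast Nat.pos_of_ne_zero hq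
  rw [abs_of_nonpos (Real.log_nonpos (prod_div_pos hq ht).le (prod_div_le_one hq ht))]
  have := Real.log_le_log (by positivity) (one_div_le_prod_div hq ht)
  rw [one_div, Real.log_inv] at this
  linarith

lemma Adm.exists_norm_mellin_mul_phase_sub_le {F : ℝ → ℂ} (hF : Adm F) : ∃ C > 0, ∀ lam c t : ℝ, 1 / 2 ≤ c → c ≤ 1 →
    |t| ≤ 1 → ‖mellin (fun w => F w * phase lam w) (c + t * I) - mellin (fun w => F w * phase lam w) c‖ ≤
      C / (1 + |lam|) ^ 2 * |t| := by
  obtain ⟨C, hC, h⟩ := hF.log_smul.exists_norm_mellin_mul_phase_mul_one_add_lam_pow_le 2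
  refine ⟨4 * C, by positivity, fun lam c t hc hc' ht => ?_⟩
  refine (hF.mul_phase lam).toCut.norm_mellin_sub_le (by linarith) fun u hu => ?_
  have h1 := h lam (c + u * I) (by simpa using hc) (by simpa using hc')
  have hl : 0 < 1 + |lam| := by positivity
  simp only [smul_mul_assoc] at h1
  rw [le_div_iff₀ (by positivity)]
  refine h1.trans ?_
  simp only [add_im, ofReal_im, mul_im, ofReal_re, I_im, mul_one, I_re, mul_zero, add_zero, zero_add]
  calc C * (1 + |u|) ^ 2 ≤ C * (1 + 1) ^ 2 := by gcongr; linarith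
    _ = 4 * C := by ring

lemma exists_one_add_log_le {ε : ℝ} (hε : 0 < ε) : ∃ C > 0, ∀ q : ℕ, q ≠ 0 → 1 + Real.log q ≤ C * (q : ℝ) ^ ε := by
  refine ⟨1 + 1 / ε, by positivity, fun q hq => ?_⟩
  have h1 := Real.log_le_rpow_div (Nat.cast_nonneg q) hε
  have h2 : (1 : ℝ) ≤ q := by exact_mod_cast Nat.pos_of_ne_zero hq
  have h3 := Real.one_le_rpow h2 hε.le
  calc 1 + Real.log q ≤ (q : ℝ) ^ ε + (q : ℝ) ^ ε / ε := by linarith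
    _ = _ := by ring

/-- The sums over smooth numbers for small frequencies. -/
lemma Adm.exists_norm_tsum_sub_le_of_small {F : ℝ → ℂ} (hF : Adm F) : ∃ C > 0, ∀ (ε₀ B ℓ : ℝ) (N : ℕ) (c lam r : ℝ),
    SaddleFacts ε₀ B ℓ N c → 100 ≤ B → 0 < ε₀ → |lam| ≤ (N : ℝ) ^ 10 → 0 < r →
    ‖∑' m : (N + 1).smoothNumbers, F ((m : ℕ) / (Real.exp ℓ * r)) * phase lam ((m : ℕ) / (Real.exp ℓ * r)) -
      (((Real.exp ℓ * r) ^ c : ℝ) : ℂ) * (mellin (fun w => F w * phase lam w) c * saddleIntegral ℓ N c)‖ ≤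
      C * (Real.exp ℓ ^ c * ‖smoothZeta N c‖ / (Real.sqrt (Real.log N * ℓ) * Real.log N * (1 + |lam|) ^ 2)) *
        (r ^ c * (1 + |Real.log r|)) := by
  obtain ⟨C₀, hC₀, h₀⟩ := hF.exists_norm_mellin_mul_phase_le
  obtain ⟨C₁, hC₁, h₁⟩ := hF.exists_norm_mellin_mul_phase_sub_le
  obtain ⟨C₂, hC₂, h₂⟩ := hF.exists_norm_mellin_mul_phase_mul_one_add_im_pow_le 2
  obtain ⟨C₃, hC₃, h₃⟩ := hF.exists_norm_mellin_mul_phase_mul_one_add_lam_pow_le 2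
  refine ⟨40 * (C₁ + C₃) + 16 * (C₀ + C₂), by positivity, fun ε₀ B ℓ N c lam r hs hB hε₀ hlam hr => ?_⟩
  have hL := hs.log_pos hB
  have hℓ := hs.pos hB
  have hc2 : 1 / 2 ≤ c := by linarith [hs.lower]
  have hc : 0 < c := by linarith
  have hc1 : c ≤ 1 := by
    have := hs.upper
    have : 0 ≤ 2 / Real.log N := by positivity
    linarith
  obtain ⟨hLR, hRN, hLN⟩ := hs.sqrt_bounds hB
  have hN2 := hs.two_le hB
  have hN1 : (1 : ℝ) ≤ N := by exact_mod_cast hN2.trans' (by norm_num)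
  have hVR := Real.sq_sqrt (show 0 ≤ Real.log N * ℓ by positivity)
  have hΛ0 : 0 < 1 + |lam| := by positivity
  have hΛ1 : 1 ≤ 1 + |lam| := by linarith [abs_nonneg lam]
  have hΛN : 1 + |lam| ≤ 2 * (N : ℝ) ^ 10 := by linarith [one_le_pow₀ hN1 (n := 10)]
  have hm : ‖mellin (fun w => F w * phase lam w) c‖ ≤ C₃ / (1 + |lam|) ^ 2 := by
    have := h₃ lam c (by simpa using hc2) (by simpa using hc1)
    rw [le_div_iff₀ (by positivity)]
    simpa using this
  have hllt := hs.norm_tsum_sub_le hB hε₀ (hF.mul_phase lam).toCut (r := r) (D₀ := C₀) (D₁ := C₁ / (1 + |lam|) ^ 2)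
    (D₂ := C₂ * (1 + |lam|) ^ 2) hr (fun t => h₀ lam _ (by simpa using hc2) (by simpa using hc1))
    (fun t ht => h₁ lam c t hc2 hc1 (ht.trans (by rw [div_le_one (by linarith)]; linarith)))
    (fun t => by
      refine le_trans ?_ (h₂ lam (c + t * I) (by simpa using hc2) (by simpa using hc1))
      refine mul_le_mul_of_nonneg_left ?_ (norm_nonneg _)
      have him : ((c : ℂ) + t * I).im = t := by simp
      rw [him, ← sq_abs t]
      exact pow_le_pow_left₀ (abs_nonneg t) (by linarith) 2)
  refine hllt.trans ?_
  set L := Real.log N with hLdef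
  set R := Real.sqrt (L * ℓ) with hR
  set Z := ‖smoothZeta N c‖ with hZ
  set x := Real.exp ℓ with hx
  set Λ := 1 + |lam| with hΛ
  set m := ‖mellin (fun w => F w * phase lam w) c‖
  have hx0 : 0 < x := Real.exp_pos _
  have hZ0 : 0 ≤ Z := norm_nonneg _
  have hR0 : 0 < R := by linarith
  have hL0 : 0 < L := by linarith
  have hlog := abs_nonneg (Real.log r)
  have h4 : 40 * (C₁ / Λ ^ 2 + m * |Real.log r|) / (L * ℓ) ≤ 40 * (C₁ + C₃) * (1 + |Real.log r|) / (R * L * Λ ^ 2) := by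
    rw [← hVR, sq R]
    calc 40 * (C₁ / Λ ^ 2 + m * |Real.log r|) / (R * R)
        ≤ 40 * (C₁ / Λ ^ 2 * (1 + |Real.log r|) + C₃ / Λ ^ 2 * (1 + |Real.log r|)) / (R * L) := by
          gcongr
          · exact le_mul_of_one_le_right (by positivity) (by linarith)
          · linarith
      _ = _ := by field_simp
  have h5 : (C₀ + C₂ * Λ ^ 2) / (N : ℝ) ^ 50 ≤ 16 * (C₀ + C₂) * (1 + |Real.log r|) / (R * L * Λ ^ 2) := by
    have h6 : C₀ + C₂ * Λ ^ 2 ≤ (C₀ + C₂) * Λ ^ 2 := by linarith [le_mul_of_one_le_right hC₀.le (one_le_pow₀ hΛ1 (n := 2))]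
    rw [div_le_div_iff₀ (by positivity) (by positivity)]
    calc (C₀ + C₂ * Λ ^ 2) * (R * L * Λ ^ 2) ≤ ((C₀ + C₂) * Λ ^ 2) * (N * N * Λ ^ 2) := by gcongr
      _ = (C₀ + C₂) * (N : ℝ) ^ 2 * Λ ^ 4 := by ring
      _ ≤ (C₀ + C₂) * (N : ℝ) ^ 2 * (2 * (N : ℝ) ^ 10) ^ 4 := by gcongr
      _ = 16 * (C₀ + C₂) * (N : ℝ) ^ 42 := by ring
      _ ≤ 16 * (C₀ + C₂) * (N : ℝ) ^ 50 := by gcongr; norm_num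
      _ ≤ 16 * (C₀ + C₂) * (1 + |Real.log r|) * (N : ℝ) ^ 50 := by
          refine mul_le_mul_of_nonneg_right ?_ (by positivity)
          exact le_mul_of_one_le_right (by positivity) (by linarith)
  calc (x * r) ^ c * Z * (40 * (C₁ / Λ ^ 2 + m * |Real.log r|) / (L * ℓ) + (C₀ + C₂ * Λ ^ 2) / (N : ℝ) ^ 50)
      ≤ (x * r) ^ c * Z * (40 * (C₁ + C₃) * (1 + |Real.log r|) / (R * L * Λ ^ 2) +
          16 * (C₀ + C₂) * (1 + |Real.log r|) / (R * L * Λ ^ 2)) := by gcongr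
    _ = _ := by rw [Real.mul_rpow hx0.le hr.le]; ring

/-- The local main term for small frequencies. -/
theorem Adm.exists_norm_sum_sub_le_of_small {F : ℝ → ℂ} (hF : Adm F) {ε : ℝ} (hε : 0 < ε) :
    ∃ C > 0, ∃ B₀ : ℝ, 100 ≤ B₀ ∧ ∀ (ε₀ B ℓ : ℝ) (N : ℕ) (c lam : ℝ) (q : ℕ),
    SaddleFacts ε₀ B ℓ N c → B₀ ≤ B → 0 < ε₀ →
    ∑ p ∈ Nat.primesBelow (N + 1), Real.log p / ((p : ℝ) ^ c - 1) = ℓ → q ≠ 0 → |lam| ≤ (N : ℝ) ^ 10 →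
    ‖∑ t ∈ q.primeFactors.powerset, (divCoeff q t : ℂ) * ∑' m : (N + 1).smoothNumbers,
        F ((m : ℕ) / (Real.exp ℓ * (((∏ r ∈ t, r : ℕ) : ℝ) / q))) *
          phase lam ((m : ℕ) / (Real.exp ℓ * (((∏ r ∈ t, r : ℕ) : ℝ) / q))) -
      (localFactor q c : ℂ) * c * mellin (fun w => F w * phase lam w) c * smoothCount N (Real.exp ℓ)‖ ≤
      C * (smoothCount N (Real.exp ℓ) * (q : ℝ) ^ (-c + ε) / (Real.log N * (1 + |lam|) ^ 2)) := by
  obtain ⟨K, hK, κ, hκ, B₀, hB₀, hcount⟩ := exists_smoothCount_asymp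
  obtain ⟨C₁, hC₁, h₁⟩ := hF.exists_norm_tsum_sub_le_of_small
  obtain ⟨C₂, hC₂, h₂⟩ := hF.exists_norm_mellin_mul_phase_mul_one_add_lam_pow_le 2
  obtain ⟨C₃, hC₃, h₃⟩ := exists_sum_abs_divCoeff_mul_le (half_pos hε)
  obtain ⟨C₄, hC₄, h₄⟩ := exists_one_add_log_le (half_pos hε)
  refine ⟨(C₁ * C₃ * C₄ + C₂ * C₃ * K) / κ, by positivity, B₀, hB₀, fun ε₀ B ℓ N c lam q hs hB hε₀ heq hq hlam => ?_⟩
  have hB1 := hB₀.trans hB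
  have hL := hs.log_pos hB1
  have hc2 : 1 / 2 ≤ c := by linarith [hs.lower]
  have hc : 0 < c := by linarith
  have hc1 : c ≤ 1 := by
    have := hs.upper
    have : 0 ≤ 2 / Real.log N := by positivity
    linarith
  obtain ⟨hLR, hRN, hLN⟩ := hs.sqrt_bounds hB1
  have hq1 : (1 : ℝ) ≤ q := by exact_mod_cast Nat.pos_of_ne_zero hq
  have hq0 : (0 : ℝ) < q := by linarith
  have hm : ‖mellin (fun w => F w * phase lam w) c‖ ≤ C₂ / (1 + |lam|) ^ 2 := by
    have := h₂ lam c (by simpa using hc2) (by simpa using hc1)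
    rw [le_div_iff₀ (by positivity)]
    simpa using this
  obtain ⟨hasymp, hlower⟩ := hcount ε₀ B ℓ N c hs hB hε₀ heq
  have hS := fun r => h₁ ε₀ B ℓ N c lam r hs hB1 hε₀ hlam
  have hW := h₃ q c hq hc1
  have hlf := (abs_localFactor_le q c).trans hW
  have hlq := h₄ q hq
  set L := Real.log N with hLdef
  set R := Real.sqrt (L * ℓ) with hR
  set Z := ‖smoothZeta N c‖ with hZ
  set x := Real.exp ℓ with hx
  set Λ := 1 + |lam| with hΛ
  set m := mellin (fun w => F w * phase lam w) c
  set S := saddleIntegral ℓ N c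
  set P := smoothCount N x
  have hx0 : 0 < x := Real.exp_pos _
  have hZ0 : 0 ≤ Z := norm_nonneg _
  have hR0 : 0 < R := by linarith
  have hL0 : 0 < L := by linarith
  have hΛ0 : 0 < Λ := by positivity
  set E := x ^ c * Z / (R * L * Λ ^ 2) with hE
  have hE0 : 0 ≤ E := by positivity
  have hq2 : (q : ℝ) ^ (-c + ε / 2) * (q : ℝ) ^ (ε / 2) = (q : ℝ) ^ (-c + ε) := by
    rw [← Real.rpow_add hq0]; congr 1; ring
  have hA : ‖∑ t ∈ q.primeFactors.powerset, (divCoeff q t : ℂ) * ∑' m : (N + 1).smoothNumbers,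
        F ((m : ℕ) / (x * (((∏ r ∈ t, r : ℕ) : ℝ) / q))) * phase lam ((m : ℕ) / (x * (((∏ r ∈ t, r : ℕ) : ℝ) / q))) -
      (localFactor q c : ℂ) * ((x ^ c : ℝ) : ℂ) * (m * S)‖ ≤ C₁ * C₃ * C₄ * E * (q : ℝ) ^ (-c + ε) := by
    rw [← sum_divCoeff_mul_div_rpow, ofReal_sum, Finset.sum_mul, Finset.sum_mul, ← Finset.sum_sub_distrib]
    calc _ ≤ ∑ t ∈ q.primeFactors.powerset, |divCoeff q t| * (C₁ * E * ((((∏ r ∈ t, r : ℕ) : ℝ) / q) ^ c *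
            (C₄ * (q : ℝ) ^ (ε / 2)))) := by
          refine norm_sum_le_of_le _ fun t ht => ?_
          have ht' := Finset.mem_powerset.1 ht
          have hr := prod_div_pos hq ht'
          have h5 := hS _ hr
          have h6 := abs_log_prod_div_le hq ht'
          rw [Real.mul_rpow hx0.le hr.le] at h5
          rw [ofReal_mul, show ∀ a b u v w : ℂ, a * u - a * b * v * w = a * (u - (v * b) * w) by intros; ring,
            norm_mul, norm_real, Real.norm_eq_abs, ← ofReal_mul]
          refine mul_le_mul_of_nonneg_left (h5.trans ?_) (abs_nonneg _)
          gcongr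
          linarith
      _ = C₁ * C₄ * E * (q : ℝ) ^ (ε / 2) *
            ∑ t ∈ q.primeFactors.powerset, |divCoeff q t| * (((∏ r ∈ t, r : ℕ) : ℝ) / q) ^ c := by
          rw [Finset.mul_sum]; exact Finset.sum_congr rfl fun t _ => by ring
      _ ≤ C₁ * C₄ * E * (q : ℝ) ^ (ε / 2) * (C₃ * (q : ℝ) ^ (-c + ε / 2)) := by gcongr
      _ = _ := by rw [← hq2]; ring
  have hBd : ‖(localFactor q c : ℂ) * ((x ^ c : ℝ) : ℂ) * (m * S) - (localFactor q c : ℂ) * c * m * P‖ ≤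
      C₂ * C₃ * K * E * (q : ℝ) ^ (-c + ε) := by
    have e : (localFactor q c : ℂ) * ((x ^ c : ℝ) : ℂ) * (m * S) - (localFactor q c : ℂ) * c * m * P =
        -((localFactor q c : ℂ) * c * m * ((P : ℂ) - ((x ^ c : ℝ) : ℂ) * (1 / c * S))) := by
      have : (c : ℂ) ≠ 0 := by exact_mod_cast hc.ne'
      field_simp; ring
    rw [e, norm_neg, norm_mul, norm_mul, norm_mul, norm_real, norm_real, Real.norm_eq_abs, Real.norm_of_nonneg hc.le]
    calc _ ≤ (C₃ * (q : ℝ) ^ (-c + ε / 2)) * 1 * (C₂ / Λ ^ 2) * (K * (x ^ c * Z) / (R * L)) := by gcongr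
      _ = C₂ * C₃ * K * E * (q : ℝ) ^ (-c + ε / 2) := by rw [hE]; field_simp
      _ ≤ _ := by
          gcongr
          linarith
  have hEP : E ≤ P / (κ * (L * Λ ^ 2)) := by
    rw [le_div_iff₀ (by positivity)]
    calc E * (κ * (L * Λ ^ 2)) = κ * (x ^ c * Z) / R := by rw [hE]; field_simp
      _ ≤ P := hlower
  calc _ ≤ C₁ * C₃ * C₄ * E * (q : ℝ) ^ (-c + ε) + C₂ * C₃ * K * E * (q : ℝ) ^ (-c + ε) :=
        (norm_sub_le_norm_sub_add_norm_sub _ _ _).trans (add_le_add hA hBd)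
    _ = (C₁ * C₃ * C₄ + C₂ * C₃ * K) * (q : ℝ) ^ (-c + ε) * E := by ring
    _ ≤ (C₁ * C₃ * C₄ + C₂ * C₃ * K) * (q : ℝ) ^ (-c + ε) * (P / (κ * (L * Λ ^ 2))) := by gcongr
    _ = _ := by field_simp

lemma one_le_norm_smoothZeta {c : ℝ} (hc : 0 < c) (N : ℕ) : 1 ≤ ‖smoothZeta N c‖ := by
  rw [smoothZeta, norm_prod]
  refine Finset.prod_induction _ (fun u : ℝ => 1 ≤ u) (fun _ _ => one_le_mul_of_one_le_of_one_le) le_rfl fun p hp => ?_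
  have hpp := Nat.prime_of_mem_primesBelow hp
  have hlt : (p : ℝ) ^ (-c) < 1 :=
    Real.rpow_lt_one_of_one_lt_of_neg (by exact_mod_cast hpp.one_lt) (by linarith)
  have hpos : 0 < (p : ℝ) ^ (-c) := Real.rpow_pos_of_pos (by exact_mod_cast hpp.pos) _
  have e : (p : ℂ) ^ (-(c : ℂ)) = (((p : ℝ) ^ (-c) : ℝ) : ℂ) := by
    rw [ofReal_cpow (by positivity)]; simp
  rw [norm_inv, e, show (1 : ℂ) - (((p : ℝ) ^ (-c) : ℝ) : ℂ) = ((1 - (p : ℝ) ^ (-c) : ℝ) : ℂ) by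
    push_cast; ring, norm_real, Real.norm_of_nonneg (by linarith)]
  exact (one_le_inv₀ (by linarith)).2 (by linarith)

/-- Moving the central segment of a vertical line integral to the right. -/
lemma norm_integral_vertical_le_of_shift {f : ℂ → ℂ} {g : ℝ → ℝ} {a b T A A' : ℝ} (hab : a ≤ b) (hT : 0 ≤ T)
    (hf : ∀ z : ℂ, a ≤ z.re → DifferentiableAt ℂ f z) (hfi : Integrable fun t : ℝ => f (a + t * I))
    (hg : Integrable g) (hg0 : ∀ t, 0 ≤ g t) (hfg : ∀ t : ℝ, T ≤ |t| → ‖f (a + t * I)‖ ≤ g t)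
    (hA : ∀ t : ℝ, |t| ≤ T → ‖f (b + t * I)‖ ≤ A)
    (hA' : ∀ u t : ℝ, a ≤ u → u ≤ b → |t| = T → ‖f (u + t * I)‖ ≤ A') :
    ‖∫ t : ℝ, f (a + t * I)‖ ≤ (∫ t, g t) + 2 * (T * A + (b - a) * A') := by
  have hrect : (∫ t in -T..T, f (b + t * I)) - (∫ t in -T..T, f (a + t * I)) =
      I * ((∫ x in a..b, f (x + (-T : ℝ) * I)) - ∫ x in a..b, f (x + T * I)) := by
    have h := integral_boundary_rect_eq_zero_of_differentiableOn f (a + (-T : ℝ) * I) (b + T * I) ?_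
    · simp only [add_re, ofReal_re, mul_re, I_re, I_im, ofReal_im, add_im, mul_im, mul_zero,
        mul_one, add_zero, zero_add, smul_eq_mul, sub_self] at h
      have hI : I * I = -1 := I_mul_I
      linear_combination (-I) * h + ((∫ t in -T..T, f (b + t * I)) - (∫ t in -T..T, f (a + t * I))) * hI
    · intro z hz
      have h1 := hz.1
      simp only [mem_preimage, add_re, ofReal_re, mul_re, I_re, I_im, ofReal_im, mul_zero, mul_one,
        sub_self, add_zero, uIcc_of_le hab] at h1
      exact (hf z h1.1).differentiableWithinAt
  have hvert : ‖∫ t in -T..T, f (b + t * I)‖ ≤ A * |T - -T| := by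
    refine intervalIntegral.norm_integral_le_of_norm_le_const fun t ht => ?_
    rw [uIoc_of_le (by linarith)] at ht
    exact hA t (abs_le.2 ⟨ht.1.le, ht.2⟩)
  have hhor : ∀ U : ℝ, |U| = T → ‖∫ x in a..b, f (x + U * I)‖ ≤ A' * |b - a| := by
    intro U hU
    refine intervalIntegral.norm_integral_le_of_norm_le_const fun x hx => ?_
    rw [uIoc_of_le hab] at hx
    exact hA' x U hx.1.le hx.2 hU
  have hcentral : ‖∫ t in Ioc (-T) T, f (a + t * I)‖ ≤ 2 * (T * A + (b - a) * A') := by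
    rw [← intervalIntegral.integral_of_le (by linarith)]
    have e : (∫ t in -T..T, f (a + t * I)) = (∫ t in -T..T, f (b + t * I)) -
        I * ((∫ x in a..b, f (x + (-T : ℝ) * I)) - ∫ x in a..b, f (x + T * I)) := by
      rw [← hrect]; ring
    rw [e]
    have h1 := hhor (-T) (by rw [abs_neg, abs_of_nonneg hT])
    have h2 := hhor T (abs_of_nonneg hT)
    rw [abs_of_nonneg (by linarith)] at h1 h2 hvert
    refine (norm_sub_le _ _).trans ?_
    rw [norm_mul, norm_I, one_mul]
    have h3 := norm_sub_le (∫ x in a..b, f (x + (-T : ℝ) * I)) (∫ x in a..b, f (x + T * I))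
    linarith
  have htail : ‖∫ t in (Ioc (-T) T)ᶜ, f (a + t * I)‖ ≤ ∫ t, g t := by
    refine (norm_integral_le_of_norm_le hg.integrableOn
      ((ae_restrict_iff' measurableSet_Ioc.compl).2 (.of_forall fun t ht => hfg t ?_))).trans
      (setIntegral_le_integral hg (.of_forall hg0))
    simp only [mem_compl_iff, mem_Ioc, not_and_or, not_lt, not_le] at ht
    rcases ht with ht | ht
    · exact (by linarith : T ≤ -t).trans (neg_le_abs t)
    · exact ht.le.trans (le_abs_self t)
  rw [← integral_add_compl (measurableSet_Ioc (a := -T) (b := T)) hfi]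
  exact (norm_add_le _ _).trans (by linarith)

/-- The sums over smooth numbers for large frequencies. -/
lemma Adm.exists_norm_tsum_le_of_large (h : RHzeta) {F : ℝ → ℂ} (hF : Adm F) {ε₁ η : ℝ} (hε₁ : 0 < ε₁)
    (hε₁' : ε₁ ≤ 1 / 2) (hη : 0 < η) (hη' : η ≤ 1 / 8) : ∃ C > 0, ∀ (ε₀ B ℓ : ℝ) (N : ℕ) (c lam X : ℝ),
    SaddleFacts ε₀ B ℓ N c → 100 ≤ B → ε₁ ≤ ε₀ → (N : ℝ) ^ 10 ≤ |lam| → 1 ≤ X →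
    ‖∑' m : (N + 1).smoothNumbers, F ((m : ℕ) / X) * phase lam ((m : ℕ) / X)‖ ≤
      C * (X ^ (1 / 2 + ε₁) * (1 + |lam|) ^ (1 / 2 + η) +
        X ^ c * ‖smoothZeta N c‖ / (Real.sqrt (Real.log N * ℓ) * Real.log N * (1 + |lam|) ^ 2)) := by
  obtain ⟨C₁, hC₁, h₁⟩ := exists_norm_smoothZeta_le h hε₁ (by linarith) hη
  obtain ⟨C₂, hC₂, h₂⟩ := hF.exists_integral_norm_mellin_mul_phase_mul_rpow_le hη.le hη'
  obtain ⟨C₃, hC₃, h₃⟩ := hF.exists_norm_mellin_mul_phase_mul_one_add_lam_pow_le 3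
  refine ⟨C₁ * C₂ + 16 * C₃ * (1 + C₁), by positivity, fun ε₀ B ℓ N c lam X hs hB hε hlam hX => ?_⟩
  have hL := hs.log_pos hB
  have hc2 : 1 / 2 + ε₁ ≤ c := by linarith [hs.lower]
  have hc : 0 < c := by linarith
  have hc1 : c ≤ 1 := by
    have := hs.upper
    have : 0 ≤ 2 / Real.log N := by positivity
    linarith
  obtain ⟨hLR, hRN, hLN⟩ := hs.sqrt_bounds hB
  have hN1 : (1 : ℝ) ≤ N := by linarith
  have hZ1 := one_le_norm_smoothZeta hc N
  have hX0 : 0 < X := by linarith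
  have hX' : (X : ℂ) ≠ 0 := by exact_mod_cast hX0.ne'
  have hlam1 : 1 ≤ |lam| := (one_le_pow₀ hN1).trans hlam
  set T := |lam| ^ (1 / 20 : ℝ) with hT
  have hT0 : 0 ≤ T := by positivity
  have hT20 : T ^ 20 = |lam| := by
    rw [hT, ← Real.rpow_natCast, ← Real.rpow_mul (abs_nonneg _)]; norm_num
  have hT1 : 1 ≤ T := Real.one_le_rpow hlam1 (by norm_num)
  have hNT : (N : ℝ) ≤ T ^ 2 := by
    refine le_of_pow_le_pow_left₀ (n := 10) (by norm_num) (by positivity) ?_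
    rw [← pow_mul]; norm_num; rw [hT20]; exact hlam
  have hsT : Real.sqrt N ≤ T := Real.sqrt_le_iff.2 ⟨hT0, hNT⟩
  have hΛ0 : 0 < 1 + |lam| := by positivity
  have hG := (hF.mul_phase lam).toCut
  set G : ℝ → ℂ := fun w => F w * phase lam w with hGdef
  set σ : ℝ := 1 / 2 + ε₁ with hσ
  have hσ0 : 0 < σ := by positivity
  have hσ1 : σ ≤ 1 := by linarith
  set Z := ‖smoothZeta N c‖
  set Λ := 1 + |lam| with hΛ
  obtain ⟨hgi, hgI⟩ := h₂ lam σ (by linarith) hσ1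
  have hm : ∀ u t : ℝ, σ ≤ u → u ≤ c → |t| ≤ T → ‖mellin G (u + t * I)‖ ≤ 8 * C₃ * T ^ 3 / Λ ^ 3 := by
    intro u t hu hu' ht
    have := h₃ lam (u + t * I) (by simp; linarith) (by simp; linarith)
    have him : ((u : ℂ) + t * I).im = t := by simp
    rw [him] at this
    rw [le_div_iff₀ (by positivity)]
    calc _ ≤ C₃ * (1 + |t|) ^ 3 := this
      _ ≤ C₃ * (2 * T) ^ 3 := by gcongr; linarith
      _ = _ := by ring
  have hnX : ∀ u t : ℝ, ‖(X : ℂ) ^ (u + t * I : ℂ)‖ = X ^ u := by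
    intro u t
    rw [norm_cpow_eq_rpow_re_of_pos hX0]; simp
  have hkey := norm_integral_vertical_le_of_shift (f := fun s => mellin G s * ((X : ℂ) ^ s * smoothZeta N s))
    (g := fun t => C₁ * X ^ σ * (‖mellin G (σ + t * I)‖ * (1 + |t|) ^ η)) (a := σ) (b := c) (T := T)
    (A := 8 * C₃ * T ^ 3 / Λ ^ 3 * (X ^ c * Z)) (A' := 8 * C₃ * T ^ 3 / Λ ^ 3 * (X ^ c * (C₁ * T))) hc2 hT0
    (fun z hz => (hG.hasDerivAt_mellin (Or.inl (by linarith))).differentiableAt.mul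
      ((DifferentiableAt.const_cpow (by fun_prop) (Or.inl hX')).mul (differentiableAt_smoothZeta (by linarith) N)))
    (hG.integrable_mul_smoothZeta hσ0 hX0 N) (hgi.const_mul _) (fun t => by positivity)
    (fun t ht => by
      have h4 := h₁ N (σ + t * I) (by simp) (by simpa using hσ1) (by simpa using hsT.trans ht)
        (by simpa using hT1.trans ht)
      have him : ((σ : ℂ) + t * I).im = t := by simp
      rw [him] at h4
      rw [norm_mul, norm_mul, hnX]
      calc _ ≤ ‖mellin G (σ + t * I)‖ * (X ^ σ * (C₁ * (1 + |t|) ^ η)) := by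
            gcongr
            refine h4.trans ?_
            gcongr
            linarith
        _ = _ := by ring)
    (fun t ht => by
      have h4 := norm_smoothZeta_le (s := c + t * I) (by simpa using hc) N
      have hre : ((c : ℂ) + t * I).re = c := by simp
      rw [hre] at h4
      have h5 := hm c t hc2 le_rfl ht
      rw [norm_mul, norm_mul, hnX]
      gcongr)
    (fun u t hu hu' ht => by
      have h4 := h₁ N (u + t * I) (by simp; linarith) (by simp; linarith) (by simpa [ht] using hsT)
        (by simpa [ht] using hT1)
      have him : ((u : ℂ) + t * I).im = t := by simp
      rw [him, ht] at h4
      have h6 : T ^ η ≤ T := by simpa using Real.rpow_le_rpow_of_exponent_le hT1 (by linarith : η ≤ 1)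
      have h5 := hm u t hu hu' ht.le
      rw [norm_mul, norm_mul, hnX]
      gcongr
      exact h4.trans (by gcongr))
  rw [integral_const_mul] at hkey
  have hTΛ : T ^ 4 / Λ ^ 3 ≤ 1 / (Real.sqrt (Real.log N * ℓ) * Real.log N * Λ ^ 2) := by
    rw [div_le_div_iff₀ (by positivity) (mul_pos (mul_pos (by linarith) (by linarith)) (by positivity))]
    calc T ^ 4 * (Real.sqrt (Real.log N * ℓ) * Real.log N * Λ ^ 2) ≤ T ^ 4 * (T ^ 2 * T ^ 2 * Λ ^ 2) := by
          gcongr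
          · exact hRN.trans hNT
          · exact hLN.trans hNT
      _ = T ^ 8 * Λ ^ 2 := by ring
      _ ≤ T ^ 20 * Λ ^ 2 := by gcongr; norm_num
      _ ≤ Λ * Λ ^ 2 := by rw [hT20]; gcongr; linarith
      _ = 1 * Λ ^ 3 := by ring
  have hpi : ‖(1 / (2 * Real.pi) : ℂ)‖ ≤ 1 := by
    have : (1 / (2 * Real.pi) : ℂ) = ((1 / (2 * Real.pi) : ℝ) : ℂ) := by push_cast; ring
    rw [this, norm_real, Real.norm_of_nonneg (by positivity), div_le_one (by positivity)]
    linarith [Real.pi_gt_three]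
  have e := hG.tsum_smoothNumbers hσ0 hX0 N
  rw [hGdef] at e
  rw [e, norm_mul]
  refine (mul_le_of_le_one_left (norm_nonneg _) hpi).trans (hkey.trans ?_)
  set E := Real.sqrt (Real.log N * ℓ) * Real.log N * Λ ^ 2 with hE
  have hE0 : 0 < E := mul_pos (mul_pos (by linarith) (by linarith)) (by positivity)
  have hXc : 0 < X ^ c := Real.rpow_pos_of_pos hX0 _
  have hXσ : 0 < X ^ σ := Real.rpow_pos_of_pos hX0 _
  have hmain : 2 * (T * (8 * C₃ * T ^ 3 / Λ ^ 3 * (X ^ c * Z)) + (c - σ) * (8 * C₃ * T ^ 3 / Λ ^ 3 * (X ^ c * (C₁ * T)))) ≤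
      16 * C₃ * (1 + C₁) * (X ^ c * Z / E) := by
    calc _ ≤ 2 * (T * (8 * C₃ * T ^ 3 / Λ ^ 3 * (X ^ c * Z)) + 1 * (8 * C₃ * T ^ 3 / Λ ^ 3 * (X ^ c * (C₁ * (T * Z))))) := by
          gcongr
          · linarith
          · exact le_mul_of_one_le_right hT0 hZ1
      _ = 16 * C₃ * (1 + C₁) * (X ^ c * Z) * (T ^ 4 / Λ ^ 3) := by ring
      _ ≤ 16 * C₃ * (1 + C₁) * (X ^ c * Z) * (1 / E) := by gcongr
      _ = _ := by ring
  have hfirst : C₁ * X ^ σ * ∫ t : ℝ, ‖mellin G (σ + t * I)‖ * (1 + |t|) ^ η ≤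
      C₁ * C₂ * (X ^ σ * Λ ^ (1 / 2 + η)) := by
    calc _ ≤ C₁ * X ^ σ * (C₂ * Λ ^ (1 / 2 + η)) := by gcongr
      _ = _ := by ring
  have hp1 : 0 ≤ 16 * C₃ * (1 + C₁) * (X ^ σ * Λ ^ (1 / 2 + η)) := by positivity
  have hp2 : 0 ≤ C₁ * C₂ * (X ^ c * Z / E) := by positivity
  linarith

/-- The local main term for large frequencies. -/
theorem Adm.exists_norm_sum_sub_le_of_large (h : RHzeta) {F : ℝ → ℂ} (hF : Adm F) {ε ε₁ : ℝ} (hε : 0 < ε)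
    (hε₁ : 0 < ε₁) (hε₁' : ε₁ ≤ 1 / 2) (hε₁ε : ε₁ ≤ ε / 2) :
    ∃ C > 0, ∃ B₀ : ℝ, 100 ≤ B₀ ∧ ∀ (ε₀ B ℓ : ℝ) (N : ℕ) (c lam : ℝ) (q : ℕ),
    SaddleFacts ε₀ B ℓ N c → B₀ ≤ B → ε₁ ≤ ε₀ →
    ∑ p ∈ Nat.primesBelow (N + 1), Real.log p / ((p : ℝ) ^ c - 1) = ℓ → q ≠ 0 → (N : ℝ) ^ 10 ≤ |lam| →
    q * |lam| ≤ Real.sqrt (Real.exp ℓ) →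
    ‖∑ t ∈ q.primeFactors.powerset, (divCoeff q t : ℂ) * ∑' m : (N + 1).smoothNumbers,
        F ((m : ℕ) / (Real.exp ℓ * (((∏ r ∈ t, r : ℕ) : ℝ) / q))) *
          phase lam ((m : ℕ) / (Real.exp ℓ * (((∏ r ∈ t, r : ℕ) : ℝ) / q))) -
      (localFactor q c : ℂ) * c * mellin (fun w => F w * phase lam w) c * smoothCount N (Real.exp ℓ)‖ ≤
      C * (Real.exp ℓ ^ (3 / 4 + ε) * (q : ℝ) ^ (-3 / 4 + ε) +
        smoothCount N (Real.exp ℓ) * (q : ℝ) ^ (-c + ε) / (Real.log N * (1 + |lam|) ^ 2)) := by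
  obtain ⟨K, hK, κ, hκ, B₀, hB₀, hcount⟩ := exists_smoothCount_asymp
  set η := min ε (1 / 8) with hη
  have hη0 : 0 < η := lt_min hε (by norm_num)
  have hηε : η ≤ ε := min_le_left _ _
  have hη8 : η ≤ 1 / 8 := min_le_right _ _
  obtain ⟨C₁, hC₁, h₁⟩ := hF.exists_norm_tsum_le_of_large h hε₁ hε₁' hη0 hη8
  obtain ⟨C₂, hC₂, h₂⟩ := hF.exists_norm_mellin_mul_phase_mul_one_add_lam_pow_le 3
  obtain ⟨C₃, hC₃, h₃⟩ := exists_sum_abs_divCoeff_mul_le hε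
  refine ⟨2 * C₁ * C₃ + C₁ * C₃ / κ + C₂ * C₃, by positivity, B₀, hB₀,
    fun ε₀ B ℓ N c lam q hs hB hε₀ heq hq hlam hqlam => ?_⟩
  have hB1 := hB₀.trans hB
  have hL := hs.log_pos hB1
  have hc2 : 1 / 2 + ε₁ ≤ c := by linarith [hs.lower]
  have hc : 0 < c := by linarith
  have hc1 : c ≤ 1 := by
    have := hs.upper
    have : 0 ≤ 2 / Real.log N := by positivity
    linarith
  obtain ⟨hLR, hRN, hLN⟩ := hs.sqrt_bounds hB1
  have hN1 : (1 : ℝ) ≤ N := by linarith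
  have hq1 : (1 : ℝ) ≤ q := by exact_mod_cast Nat.pos_of_ne_zero hq
  have hq0 : (0 : ℝ) < q := by linarith
  have hlam1 : 1 ≤ |lam| := (one_le_pow₀ hN1).trans hlam
  have hlower := (hcount ε₀ B ℓ N c hs hB (by linarith) heq).2
  have hm : ‖mellin (fun w => F w * phase lam w) c‖ ≤ C₂ / (1 + |lam|) ^ 3 := by
    have := h₂ lam c (by simp; linarith) (by simpa using hc1)
    rw [le_div_iff₀ (by positivity)]
    simpa using this
  have hS := fun X => h₁ ε₀ B ℓ N c lam X hs hB1 hε₀ hlam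
  have hWc := h₃ q c hq hc1
  have hWσ := h₃ q (1 / 2 + ε₁) hq (by linarith)
  have hlf := (abs_localFactor_le q c).trans hWc
  have hLlam : Real.log N ≤ 1 + |lam| := by
    have : (N : ℝ) ≤ N ^ 10 := le_self_pow₀ hN1 (by norm_num)
    linarith
  have hx0 : 0 < Real.exp ℓ := Real.exp_pos _
  have hx1 : 1 ≤ Real.exp ℓ := Real.one_le_exp (hs.pos hB1).le
  have hP0 : 0 ≤ smoothCount N (Real.exp ℓ) := tsum_nonneg fun m => by split_ifs <;> norm_num
  set x := Real.exp ℓ with hx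
  set L := Real.log N with hLdef
  set R := Real.sqrt (L * ℓ) with hR
  set Z := ‖smoothZeta N c‖ with hZ
  set Λ := 1 + |lam| with hΛ
  set m := mellin (fun w => F w * phase lam w) c
  set P := smoothCount N x
  have hZ0 : 0 ≤ Z := norm_nonneg _
  have hR0 : 0 < R := by linarith
  have hL0 : 0 < L := by linarith
  have hΛ0 : 0 < Λ := by positivity
  have hsx : Real.sqrt x ≤ x := Real.sqrt_le_iff.2 ⟨hx0.le, by nlinarith only [hx1]⟩
  have hqx : (q : ℝ) ≤ x := by
    have : (q : ℝ) * 1 ≤ q * |lam| := by gcongr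
    linarith
  have hΛq : Λ ≤ 2 * (Real.sqrt x / q) := by
    have : |lam| ≤ Real.sqrt x / q := by rw [le_div_iff₀ hq0]; linarith
    linarith
  have hΛpow : Λ ^ (1 / 2 + η) ≤ 2 * (x ^ (1 / 4 + η / 2) * (q : ℝ) ^ (-(1 / 2 + η))) := by
    calc Λ ^ (1 / 2 + η) ≤ (2 * (Real.sqrt x / q)) ^ (1 / 2 + η) := by gcongr
      _ = 2 ^ (1 / 2 + η) * (x ^ (1 / 4 + η / 2) * (q : ℝ) ^ (-(1 / 2 + η))) := by
          rw [Real.mul_rpow (by norm_num) (by positivity), Real.div_rpow (by positivity) hq0.le, Real.sqrt_eq_rpow,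
            ← Real.rpow_mul hx0.le, Real.rpow_neg hq0.le, div_eq_mul_inv]
          ring_nf
      _ ≤ _ := by
          gcongr
          simpa using Real.rpow_le_rpow_of_exponent_le (by norm_num : (1 : ℝ) ≤ 2) (by linarith : 1 / 2 + η ≤ 1)
  set E := x ^ c * Z / (R * L * Λ ^ 2) with hE
  have hE0 : 0 ≤ E := by positivity
  have hEP : E ≤ P / (κ * (L * Λ ^ 2)) := by
    rw [le_div_iff₀ (by positivity)]
    calc E * (κ * (L * Λ ^ 2)) = κ * (x ^ c * Z) / R := by rw [hE]; field_simp
      _ ≤ P := hlower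
  have hA : ‖∑ t ∈ q.primeFactors.powerset, (divCoeff q t : ℂ) * ∑' m : (N + 1).smoothNumbers,
        F ((m : ℕ) / (x * (((∏ r ∈ t, r : ℕ) : ℝ) / q))) *
          phase lam ((m : ℕ) / (x * (((∏ r ∈ t, r : ℕ) : ℝ) / q)))‖ ≤
      2 * C₁ * C₃ * (x ^ (3 / 4 + ε) * (q : ℝ) ^ (-3 / 4 + ε)) + C₁ * C₃ * E * (q : ℝ) ^ (-c + ε) := by
    calc _ ≤ ∑ t ∈ q.primeFactors.powerset, |divCoeff q t| *
            (C₁ * (x ^ (1 / 2 + ε₁) * (((∏ r ∈ t, r : ℕ) : ℝ) / q) ^ (1 / 2 + ε₁) * Λ ^ (1 / 2 + η) +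
              E * (((∏ r ∈ t, r : ℕ) : ℝ) / q) ^ c)) := by
          refine norm_sum_le_of_le _ fun t ht => ?_
          have ht' := Finset.mem_powerset.1 ht
          have hr := prod_div_pos hq ht'
          have hX : 1 ≤ x * (((∏ r ∈ t, r : ℕ) : ℝ) / q) := by
            calc (1 : ℝ) ≤ x * (1 / q) := by rw [mul_one_div, le_div_iff₀ hq0]; linarith
              _ ≤ _ := mul_le_mul_of_nonneg_left (one_div_le_prod_div hq ht') hx0.le
          have h5 := hS _ hX
          rw [Real.mul_rpow hx0.le hr.le, Real.mul_rpow hx0.le hr.le] at h5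
          rw [norm_mul, norm_real, Real.norm_eq_abs]
          refine mul_le_mul_of_nonneg_left (h5.trans (le_of_eq ?_)) (abs_nonneg _)
          rw [hE]; ring
      _ = C₁ * x ^ (1 / 2 + ε₁) * Λ ^ (1 / 2 + η) *
            ∑ t ∈ q.primeFactors.powerset, |divCoeff q t| * (((∏ r ∈ t, r : ℕ) : ℝ) / q) ^ (1 / 2 + ε₁) +
          C₁ * E * ∑ t ∈ q.primeFactors.powerset, |divCoeff q t| * (((∏ r ∈ t, r : ℕ) : ℝ) / q) ^ c := by
          rw [Finset.mul_sum, Finset.mul_sum, ← Finset.sum_add_distrib]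
          exact Finset.sum_congr rfl fun t _ => by ring
      _ ≤ C₁ * x ^ (1 / 2 + ε₁) * (2 * (x ^ (1 / 4 + η / 2) * (q : ℝ) ^ (-(1 / 2 + η)))) *
            (C₃ * (q : ℝ) ^ (-(1 / 2 + ε₁) + ε)) + C₁ * E * (C₃ * (q : ℝ) ^ (-c + ε)) := by gcongr
      _ = 2 * C₁ * C₃ * (x ^ (3 / 4 + ε₁ + η / 2) * (q : ℝ) ^ (-1 - ε₁ - η + ε)) +
            C₁ * C₃ * E * (q : ℝ) ^ (-c + ε) := by
          have e1 : x ^ (3 / 4 + ε₁ + η / 2) = x ^ (1 / 2 + ε₁) * x ^ (1 / 4 + η / 2) := by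
            rw [← Real.rpow_add hx0]; congr 1; ring
          have e2 : (q : ℝ) ^ (-1 - ε₁ - η + ε) = (q : ℝ) ^ (-(1 / 2 + η)) * (q : ℝ) ^ (-(1 / 2 + ε₁) + ε) := by
            rw [← Real.rpow_add hq0]; congr 1; ring
          rw [e1, e2]
          ring
      _ ≤ _ := by
          have e1 : x ^ (3 / 4 + ε₁ + η / 2) ≤ x ^ (3 / 4 + ε) := Real.rpow_le_rpow_of_exponent_le hx1 (by linarith)
          have e2 : (q : ℝ) ^ (-1 - ε₁ - η + ε) ≤ (q : ℝ) ^ (-3 / 4 + ε) :=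
            Real.rpow_le_rpow_of_exponent_le hq1 (by linarith)
          gcongr
  have hM : ‖(localFactor q c : ℂ) * c * m * P‖ ≤ C₂ * C₃ * (P * (q : ℝ) ^ (-c + ε) / (L * Λ ^ 2)) := by
    rw [norm_mul, norm_mul, norm_mul, norm_real, norm_real, norm_real, Real.norm_eq_abs, Real.norm_of_nonneg hc.le,
      Real.norm_of_nonneg hP0]
    calc _ ≤ (C₃ * (q : ℝ) ^ (-c + ε)) * 1 * (C₂ / Λ ^ 3) * P := by gcongr
      _ = C₂ * C₃ * (P * (q : ℝ) ^ (-c + ε) / (Λ * Λ ^ 2)) := by rw [pow_succ' Λ 2]; ring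
      _ ≤ _ := by gcongr
  have hY : 0 ≤ x ^ (3 / 4 + ε) * (q : ℝ) ^ (-3 / 4 + ε) := by positivity
  have hEq : C₁ * C₃ * E * (q : ℝ) ^ (-c + ε) ≤ C₁ * C₃ / κ * (P * (q : ℝ) ^ (-c + ε) / (L * Λ ^ 2)) := by
    calc _ ≤ C₁ * C₃ * (P / (κ * (L * Λ ^ 2))) * (q : ℝ) ^ (-c + ε) := by gcongr
      _ = _ := by field_simp
  have hY2 : 0 ≤ P * (q : ℝ) ^ (-c + ε) / (L * Λ ^ 2) := by positivity
  set Y := x ^ (3 / 4 + ε) * (q : ℝ) ^ (-3 / 4 + ε)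
  set W := P * (q : ℝ) ^ (-c + ε) / (L * Λ ^ 2)
  calc _ ≤ (2 * C₁ * C₃ * Y + C₁ * C₃ / κ * W) + C₂ * C₃ * W :=
        (norm_sub_le _ _).trans (add_le_add (hA.trans (by linarith)) hM)
    _ = 2 * C₁ * C₃ * Y + (C₁ * C₃ / κ + C₂ * C₃) * W := by ring
    _ ≤ (2 * C₁ * C₃ + C₁ * C₃ / κ + C₂ * C₃) * Y + (2 * C₁ * C₃ + C₁ * C₃ / κ + C₂ * C₃) * W := by
        have e1 : 0 ≤ C₁ * C₃ / κ := by positivity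
        have e2 : 0 ≤ C₂ * C₃ := by positivity
        have e3 : 0 ≤ C₁ * C₃ := by positivity
        gcongr
        · linarith
        · linarith
    _ = _ := by ring

/-- The asymptotic formula for the local main term, in terms of weighted sums over smooth numbers. -/
theorem Adm.exists_norm_sum_sub_le (h : RHzeta) {F : ℝ → ℂ} (hF : Adm F) {δ ε : ℝ} (hδ : 0 < δ) (hε : 0 < ε) :
    ∃ C > 0, ∃ ℓ₀ : ℝ, ∀ ℓ ≥ ℓ₀, ∀ (N : ℕ) (c lam : ℝ) (q : ℕ), Saddle δ ℓ N c → q ≠ 0 →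
    q * |lam| ≤ Real.sqrt (Real.exp ℓ) →
    2 ≤ N ∧ ‖∑ t ∈ q.primeFactors.powerset, (divCoeff q t : ℂ) * ∑' m : (N + 1).smoothNumbers,
        F ((m : ℕ) / (Real.exp ℓ * (((∏ r ∈ t, r : ℕ) : ℝ) / q))) *
          phase lam ((m : ℕ) / (Real.exp ℓ * (((∏ r ∈ t, r : ℕ) : ℝ) / q))) -
      (localFactor q c : ℂ) * c * mellin (fun w => F w * phase lam w) c * smoothCount N (Real.exp ℓ)‖ ≤
      C * (Real.exp ℓ ^ (3 / 4 + ε) * (q : ℝ) ^ (-3 / 4 + ε) +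
        smoothCount N (Real.exp ℓ) * (q : ℝ) ^ (-c + ε) / (Real.log N * (1 + |lam|) ^ 2)) := by
  obtain ⟨ε₀, hε₀, hε₀1, hfacts⟩ := exists_saddleFacts h hδ
  obtain ⟨C₁, hC₁, B₁, hB₁, h₁⟩ := hF.exists_norm_sum_sub_le_of_small hε
  obtain ⟨C₂, hC₂, B₂, hB₂, h₂⟩ := hF.exists_norm_sum_sub_le_of_large h hε (ε₁ := min ε₀ (ε / 2))
    (lt_min hε₀ (by linarith)) ((min_le_left _ _).trans (by linarith)) (min_le_right _ _)
  obtain ⟨ℓ₀, hℓ₀⟩ := hfacts (max B₁ B₂) (by linarith [le_max_left B₁ B₂])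
  refine ⟨C₁ + C₂, by positivity, ℓ₀, fun ℓ hℓ N c lam q hs hq hlam => ?_⟩
  have hf := hℓ₀ ℓ hℓ N c hs
  have hN := hf.two_le (hB₁.trans (le_max_left _ _))
  have hP0 : 0 ≤ smoothCount N (Real.exp ℓ) := tsum_nonneg fun m => by split_ifs <;> norm_num
  have hL0 : 0 ≤ Real.log N := Real.log_natCast_nonneg N
  have hY : 0 ≤ Real.exp ℓ ^ (3 / 4 + ε) * (q : ℝ) ^ (-3 / 4 + ε) := by positivity
  have hW : 0 ≤ smoothCount N (Real.exp ℓ) * (q : ℝ) ^ (-c + ε) / (Real.log N * (1 + |lam|) ^ 2) := by positivity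
  refine ⟨hN, ?_⟩
  rcases le_total |lam| ((N : ℝ) ^ 10) with hl | hl
  · refine (h₁ ε₀ _ ℓ N c lam q hf (le_max_left _ _) hε₀ hs.eq hq hl).trans ?_
    gcongr
    · linarith
    · linarith
  · refine (h₂ ε₀ _ ℓ N c lam q hf (le_max_right _ _) (min_le_left _ _) hs.eq hq hl hlam).trans ?_
    gcongr
    linarith

lemma adm_ofReal {Φ : ℝ → ℝ} (hsmooth : ContDiff ℝ ∞ Φ) (hcompact : HasCompactSupport Φ)
    (hsupp : tsupport Φ ⊆ Ioi 0) : Adm fun w => (Φ w : ℂ) := by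
  obtain ⟨B, hB⟩ := hcompact.isCompact.bddAbove
  have h0 : ∀ w, w ∉ tsupport Φ → (Φ w : ℂ) = 0 := fun w hw => by
    rw [image_eq_zero_of_notMem_tsupport hw, ofReal_zero]
  refine ⟨⟨ofRealCLM.contDiff.comp hsmooth, max B 0 + 1, by positivity, fun w hw => ?_⟩, ?_⟩
  · refine h0 w fun hm => ?_
    linarith [hB hm, le_max_left B 0]
  · rcases (tsupport Φ).eq_empty_or_nonempty with he | hne
    · exact ⟨1, one_pos, fun w _ => h0 w (by simp [he])⟩
    · obtain ⟨a, ha, hmin⟩ := hcompact.isCompact.exists_isLeast hne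
      have ha0 : 0 < a := hsupp ha
      refine ⟨a / 2, by positivity, fun w hw => h0 w fun hm => ?_⟩
      linarith [hmin hm]

lemma saddle_floor {δ : ℝ} (hδ : 0 < δ) : ∃ ℓ₀ : ℝ, 1 ≤ ℓ₀ ∧ ∀ ℓ ≥ ℓ₀, ∀ y c : ℝ, ℓ ^ (2 + δ) ≤ y →
    y ≤ Real.exp (ℓ ^ ((1 : ℝ) / 2 - δ)) → 0 < c →
    ∑ p ∈ Nat.primesBelow (⌊y⌋₊ + 1), Real.log p / ((p : ℝ) ^ c - 1) = ℓ → Saddle (δ / 2) ℓ ⌊y⌋₊ c := by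
  refine ⟨2 ^ (2 / δ), Real.one_le_rpow (by norm_num) (by positivity), fun ℓ hℓ y c hy hy' hc heq => ⟨?_, ?_, hc, heq⟩⟩
  all_goals
    have hℓ1 : 1 ≤ ℓ := (Real.one_le_rpow (by norm_num) (by positivity)).trans hℓ
    have hℓ0 : 0 < ℓ := by linarith
    have hy1 : 1 ≤ y := (Real.one_le_rpow hℓ1 (by linarith)).trans hy
  · have h1 : 2 ≤ ℓ ^ (δ / 2) := by
      calc (2 : ℝ) = (2 ^ (2 / δ)) ^ (δ / 2) := by
            rw [← Real.rpow_mul (by norm_num), show 2 / δ * (δ / 2) = 1 by field_simp, Real.rpow_one]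
        _ ≤ _ := by gcongr
    have h2 : ℓ ^ (2 + δ / 2) * ℓ ^ (δ / 2) = ℓ ^ (2 + δ) := by
      rw [← Real.rpow_add hℓ0]; congr 1; ring
    have h3 := Nat.lt_floor_add_one y
    have h4 : (1 : ℝ) ≤ ⌊y⌋₊ := by exact_mod_cast Nat.le_floor (by simpa using hy1)
    have h5 : 0 < ℓ ^ (2 + δ / 2) := by positivity
    nlinarith only [h1, h2, h3, h4, h5, hy]
  · have h4 : (1 : ℝ) ≤ ⌊y⌋₊ := by exact_mod_cast Nat.le_floor (by simpa using hy1)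
    calc Real.log ⌊y⌋₊ ≤ Real.log y := Real.log_le_log (by linarith) (Nat.floor_le (by linarith))
      _ ≤ ℓ ^ ((1 : ℝ) / 2 - δ) := by rw [Real.log_le_iff_le_exp (by linarith)]; exact hy'
      _ ≤ _ := Real.rpow_le_rpow_of_exponent_le hℓ1 (by linarith)

lemma mem_smoothNumbers_floor_iff {y : ℝ} (n : ℕ) :
    (0 < n ∧ ∀ p : ℕ, p.Prime → p ∣ n → (p : ℝ) ≤ y) ↔ n ∈ (⌊y⌋₊ + 1).smoothNumbers := by
  rw [Nat.mem_smoothNumbers']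
  constructor
  · intro h p hp hpn
    exact Nat.lt_succ_of_le (Nat.le_floor (h.2 p hp hpn))
  · intro h
    have hn : n ≠ 0 := by
      rintro rfl
      obtain ⟨p, hp, hpp⟩ := Nat.exists_infinite_primes (⌊y⌋₊ + 1)
      exact absurd (h p hpp (dvd_zero p)) (by omega)
    refine ⟨Nat.pos_of_ne_zero hn, fun p hp hpn => ?_⟩
    have h1 : p ≤ ⌊y⌋₊ := Nat.lt_succ_iff.1 (h p hp hpn)
    exact (Nat.le_floor_iff' hp.ne_zero).1 h1

lemma Psi_eq_smoothCount (x y : ℝ) : (Psi x y : ℝ) = smoothCount ⌊y⌋₊ x := by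
  have hfin : Finite {n : ℕ | 0 < n ∧ (n : ℝ) ≤ x ∧ ∀ p : ℕ, p.Prime → p ∣ n → (p : ℝ) ≤ y} :=
    Set.Finite.subset (Set.finite_Iic ⌊x⌋₊) fun n hn => Nat.le_floor hn.2.1
  have e : smoothCount ⌊y⌋₊ x = ∑' n : ℕ,
      Set.indicator {n : ℕ | 0 < n ∧ (n : ℝ) ≤ x ∧ ∀ p : ℕ, p.Prime → p ∣ n → (p : ℝ) ≤ y} (fun _ => (1 : ℝ)) n := by
    rw [smoothCount, tsum_subtype ((⌊y⌋₊ + 1).smoothNumbers) (fun m : ℕ => if (m : ℝ) ≤ x then (1 : ℝ) else 0)]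
    refine tsum_congr fun n => ?_
    have := mem_smoothNumbers_floor_iff (y := y) n
    by_cases h1 : n ∈ (⌊y⌋₊ + 1).smoothNumbers
    · rw [Set.indicator_of_mem h1]
      have h2 := this.2 h1
      by_cases h3 : (n : ℝ) ≤ x
      · rw [if_pos h3, Set.indicator_of_mem (by exact ⟨h2.1, h3, h2.2⟩)]
      · rw [if_neg h3, Set.indicator_of_notMem fun hm => h3 hm.2.1]
    · rw [Set.indicator_of_notMem h1, Set.indicator_of_notMem fun hm => h1 (this.1 ⟨hm.1, hm.2.2⟩)]
  rw [e, ← tsum_subtype, tsum_const, Psi]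
  simp

lemma Mterm_eq_tsum {x y : ℝ} (hx : x ≠ 0) (Φ : ℝ → ℝ) (q : ℕ) (γ : ℝ) : Mterm x y Φ q γ =
    ∑' n : (⌊y⌋₊ + 1).smoothNumbers, ((moebiusDivTotient (q / Nat.gcd q n) : ℝ) : ℂ) *
      ((Φ ((n : ℕ) / x) : ℂ) * phase (γ * x) ((n : ℕ) / x)) := by
  rw [Mterm, ← (Equiv.subtypeEquivRight (mem_smoothNumbers_floor_iff (y := y))).tsum_eq]
  refine tsum_congr fun n => ?_
  rw [phase, moebiusDivTotient, Equiv.subtypeEquivRight_apply_coe, mul_assoc]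
  congr 1
  rw [mul_comm, show γ * x * ((n : ℕ) / x) = (n : ℕ) * γ by field_simp]
  push_cast
  rw [mul_assoc _ _ (γ : ℂ)]

lemma PhiCheck_eq_mellin (Φ : ℝ → ℝ) (s lam : ℝ) :
    PhiCheck Φ s lam = mellin (fun w => (Φ w : ℂ) * phase lam w) s := by
  rw [PhiCheck, mellin]
  refine setIntegral_congr_fun measurableSet_Ioi fun w hw => ?_
  simp only [phase, smul_eq_mul]
  rw [ofReal_cpow (le_of_lt hw)]
  push_cast
  ring
end

theorem local_main_term_major_arc_asymptotic (hGRH : GRH)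
    (Φ : ℝ → ℝ) (hsmooth : ContDiff ℝ (⊤ : ℕ∞) Φ) (hcompact : HasCompactSupport Φ)
    (hsupp : tsupport Φ ⊆ Set.Ioi 0) (δ ε : ℝ) (hδ : 0 < δ) (hε : 0 < ε) :
    ∃ C > (0 : ℝ), ∃ x₀ : ℝ, ∀ x ≥ x₀, ∀ y : ℝ,
      (Real.log x) ^ (2 + δ) ≤ y → y ≤ Real.exp ((Real.log x) ^ ((1 : ℝ) / 2 - δ)) →
      ∀ q₀ : ℕ, 0 < q₀ → (∀ p : ℕ, p.Prime → p ∣ q₀ → (p : ℝ) ≤ y) →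
      ∀ γ : ℝ, |γ| ≤ 1 / ((q₀ : ℝ) * Real.sqrt x) → |γ| ≤ x ^ (δ - 1) →
      ∀ c : ℝ, 0 < c →
        (∑ p ∈ Nat.primesBelow (⌊y⌋₊ + 1), Real.log p / ((p : ℝ) ^ c - 1)) = Real.log x →
        ‖Mterm x y Φ q₀ γ -
          ((((q₀ : ℝ) ^ (-c) * ∏ p ∈ q₀.primeFactors,
              (1 - ((p : ℝ) ^ c - 1) / ((p : ℝ) - 1)) : ℝ)) : ℂ) *
            ((c : ℝ) : ℂ) * PhiCheck Φ c (γ * x) * ((Psi x y : ℝ) : ℂ)‖ ≤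
          C * (x ^ ((3 : ℝ) / 4 + ε) * (q₀ : ℝ) ^ (-(3 : ℝ) / 4 + ε) +
            (Psi x y : ℝ) * (q₀ : ℝ) ^ (-c + ε) /
              (Real.log y * (1 + |γ| * x) ^ 2)) := by
  have hF := adm_ofReal hsmooth hcompact hsupp
  obtain ⟨C, hC, ℓ₀, hmain⟩ := hF.exists_norm_sum_sub_le hGRH.1 (half_pos hδ) hε
  obtain ⟨ℓ₁, hℓ₁, hsaddle⟩ := saddle_floor hδ
  refine ⟨2 * C, by positivity, Real.exp (max ℓ₀ ℓ₁), fun x hx y hy hy' q hq hqy γ hγ _ c hc heq => ?_⟩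
  have hx0 : 0 < x := (Real.exp_pos _).trans_le hx
  have hlog : max ℓ₀ ℓ₁ ≤ Real.log x := (Real.le_log_iff_exp_le hx0).2 hx
  have hs := hsaddle _ ((le_max_right _ _).trans hlog) y c hy hy' hc heq
  have hq0 : (0 : ℝ) < q := by exact_mod_cast hq
  have hsx : 0 < Real.sqrt x := Real.sqrt_pos.2 hx0
  have hlam : q * |γ * x| ≤ Real.sqrt x := by
    rw [abs_mul, abs_of_pos hx0]
    calc q * (|γ| * x) ≤ q * (1 / (q * Real.sqrt x) * x) := by gcongr
      _ = x / Real.sqrt x := by field_simp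
      _ = Real.sqrt x := Real.div_sqrt
  have hqs : q ∈ (⌊y⌋₊ + 1).smoothNumbers := (mem_smoothNumbers_floor_iff q).1 ⟨hq, hqy⟩
  obtain ⟨hN, hbound⟩ := hmain _ ((le_max_left _ _).trans hlog) ⌊y⌋₊ c (γ * x) q hs hq.ne'
    (by rwa [Real.exp_log hx0])
  rw [Real.exp_log hx0] at hbound
  have hsum := (hF.mul_phase (γ * x)).toCut.tsum_moebiusDivTotient hq.ne' hqs hx0
  rw [← hsum] at hbound
  rw [Mterm_eq_tsum hx0.ne', PhiCheck_eq_mellin, Psi_eq_smoothCount]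
  refine hbound.trans ?_
  have hN2 : (2 : ℝ) ≤ ⌊y⌋₊ := by exact_mod_cast hN
  have hLN : 0 < Real.log ⌊y⌋₊ := Real.log_pos (by linarith)
  have hy2 : (2 : ℝ) ≤ y := hN2.trans (Nat.floor_le (by
    by_contra h0
    rw [Nat.floor_of_nonpos (by linarith)] at hN
    omega))
  have hLy : Real.log y ≤ 2 * Real.log ⌊y⌋₊ := by
    rw [← Real.log_rpow (by linarith)]
    apply Real.log_le_log (by linarith)
    have h3 := Nat.lt_floor_add_one y
    norm_num
    nlinarith only [hN2, h3]
  have hLy0 : 0 < Real.log y := Real.log_pos (by linarith)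
  have hP0 : 0 ≤ smoothCount ⌊y⌋₊ x := tsum_nonneg fun m => by split_ifs <;> norm_num
  have hY : 0 ≤ x ^ ((3 : ℝ) / 4 + ε) * (q : ℝ) ^ (-(3 : ℝ) / 4 + ε) := by positivity
  rw [abs_mul, abs_of_pos hx0]
  have hW : smoothCount ⌊y⌋₊ x * (q : ℝ) ^ (-c + ε) / (Real.log ⌊y⌋₊ * (1 + |γ| * x) ^ 2) ≤
      2 * (smoothCount ⌊y⌋₊ x * (q : ℝ) ^ (-c + ε) / (Real.log y * (1 + |γ| * x) ^ 2)) := by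
    calc _ ≤ smoothCount ⌊y⌋₊ x * (q : ℝ) ^ (-c + ε) / (Real.log y / 2 * (1 + |γ| * x) ^ 2) := by
          gcongr
          linarith
      _ = _ := by field_simp
  calc _ ≤ C * (2 * (x ^ ((3 : ℝ) / 4 + ε) * (q : ℝ) ^ (-(3 : ℝ) / 4 + ε)) +
        2 * (smoothCount ⌊y⌋₊ x * (q : ℝ) ^ (-c + ε) / (Real.log y * (1 + |γ| * x) ^ 2))) :=
        mul_le_mul_of_nonneg_left (add_le_add (by linarith) hW) hC.le
    _ = _ := by ring
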